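/- Let f_l(u) = f_r(u) = u²/2, T = 1, and fix L_0 < 0. Set A := 4L_0, B := −4L_0 (so (A,B) is a connection with γ = 8L_0²), and fix p < 12L_0. Define ω_3(x) := −4L_0 for x ≤ L_0, ω_3(x) := 4L_0 for L_0 < x < 0, ω_3(x) := p for x > 0. Define u_{0,1}(x) := −4L_0 for x < L_0, 4L_0 for L_0 < x < 0, −4L_0 for 0 < x < (4L_0−p)/2, and p for x > (4L_0−p)/2; and u_{0,2}(x) := −4L_0 for x < 5L_0, L_0 − x for 5L_0 < x < L_0, −8L_0 for L_0 < x < 0, 8L_0 for 0 < x < −L_0, 4L_0 for −L_0 < x < −4L_0, −x for −4L_0 < x < −p, and p for x > −p. Then ω_3 ∈ A^{[AB]}(1), u_{0,1} and u_{0,2} belong to I_1^{[AB]}(ω_3), but for every λ ∈ (0,1) the convex combination λu_{0,1} + (1−λ)u_{0,2} does not belong to I_1^{[AB]}(ω_3); in particular the set I_1^{[AB]}(ω_3) is not convex. -/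

import Mathlib

open MeasureTheory Set Filter

noncomputable section

/-- The discontinuous flux `f(x,u) = f_l(u)` for `x < 0`, `f_r(u)` for `x > 0`
(the value at the interface is taken to be `f_r(u)`). -/
def dflux (fl fr : ℝ → ℝ) (x u : ℝ) : ℝ := if x < 0 then fl u else fr u

/-- The connection function `c^{AB}`. -/
def cAB (A B : ℝ) (x : ℝ) : ℝ := if x ≤ 0 then A else B

/-- An `AB`-entropy solution of `u_t + f(x,u)_x = 0` on `ℝ × [0,∞)` with
initial datum `u0`, for the flux `f(x,·) = fl` on `x<0` and `fr` on `x>0`,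
relative to the connection `(A,B)`.  The structure bundles the solution `u`
(as a function of `(x,t)`), its one-sided spatial limits `um x t = u(x-,t)` and
`up x t = u(x+,t)` (for `t > 0`), the weak (distributional) formulation, the
Kružkov entropy inequalities away from the interface, the `AB`-interface
entropy inequality, `L¹_loc`-continuity in time and the initial condition. -/
structure ABSol (fl fr : ℝ → ℝ) (A B : ℝ) (u0 : ℝ → ℝ) where
  u : ℝ → ℝ → ℝ
  meas : Measurable (Function.uncurry u)
  bdd : ∃ M : ℝ, ∀ x t, |u x t| ≤ M
  um : ℝ → ℝ → ℝ
  up : ℝ → ℝ → ℝ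
  um_spec : ∀ x t, 0 < t →
    Tendsto (fun y => u y t) (nhdsWithin x (Iio x)) (nhds (um x t))
  up_spec : ∀ x t, 0 < t →
    Tendsto (fun y => u y t) (nhdsWithin x (Ioi x)) (nhds (up x t))
  weak : ∀ φ : ℝ → ℝ → ℝ,
    ContDiff ℝ 1 (fun p : ℝ × ℝ => φ p.1 p.2) →
    HasCompactSupport (fun p : ℝ × ℝ => φ p.1 p.2) →
    (∀ x t, t ≤ 0 → φ x t = 0) →
    (∫ p : ℝ × ℝ, (u p.1 p.2 * deriv (fun s => φ p.1 s) p.2 +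
        dflux fl fr p.1 (u p.1 p.2) * deriv (fun y => φ y p.2) p.1)) = 0
  kruzkov_l : ∀ (k : ℝ) (φ : ℝ → ℝ → ℝ),
    ContDiff ℝ 1 (fun p : ℝ × ℝ => φ p.1 p.2) →
    HasCompactSupport (fun p : ℝ × ℝ => φ p.1 p.2) →
    (∀ x t, 0 ≤ φ x t) →
    (∀ x t, 0 ≤ x ∨ t ≤ 0 → φ x t = 0) →
    0 ≤ ∫ p : ℝ × ℝ, (|u p.1 p.2 - k| * deriv (fun s => φ p.1 s) p.2 +
        Real.sign (u p.1 p.2 - k) * (fl (u p.1 p.2) - fl k) *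
          deriv (fun y => φ y p.2) p.1)
  kruzkov_r : ∀ (k : ℝ) (φ : ℝ → ℝ → ℝ),
    ContDiff ℝ 1 (fun p : ℝ × ℝ => φ p.1 p.2) →
    HasCompactSupport (fun p : ℝ × ℝ => φ p.1 p.2) →
    (∀ x t, 0 ≤ φ x t) →
    (∀ x t, x ≤ 0 ∨ t ≤ 0 → φ x t = 0) →
    0 ≤ ∫ p : ℝ × ℝ, (|u p.1 p.2 - k| * deriv (fun s => φ p.1 s) p.2 +
        Real.sign (u p.1 p.2 - k) * (fr (u p.1 p.2) - fr k) *
          deriv (fun y => φ y p.2) p.1)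
  interfaceEntropy : ∀ φ : ℝ → ℝ → ℝ,
    ContDiff ℝ 1 (fun p : ℝ × ℝ => φ p.1 p.2) →
    HasCompactSupport (fun p : ℝ × ℝ => φ p.1 p.2) →
    (∀ x t, 0 ≤ φ x t) →
    (∀ x t, t ≤ 0 → φ x t = 0) →
    0 ≤ ∫ p : ℝ × ℝ, (|u p.1 p.2 - cAB A B p.1| * deriv (fun s => φ p.1 s) p.2 +
        Real.sign (u p.1 p.2 - cAB A B p.1) *
          (dflux fl fr p.1 (u p.1 p.2) - dflux fl fr p.1 (cAB A B p.1)) *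
          deriv (fun y => φ y p.2) p.1)
  timeCont : ∀ (r t₀ : ℝ), 0 ≤ t₀ →
    Tendsto (fun t => ∫ x in Icc (-r) r, |u x t - u x t₀|)
      (nhdsWithin t₀ (Ici 0)) (nhds 0)
  init : ∀ᵐ x : ℝ ∂volume, u x 0 = u0 x

/-- `AB`-genuine/interface characteristic for the `AB`-entropy solution `sol`,
on the time interval `[0,T]`, where `γ = f_l(A) = f_r(B)`. -/
def IsABgic (T : ℝ) (fl fr : ℝ → ℝ) (γ : ℝ) {A B : ℝ} {u0 : ℝ → ℝ}
    (sol : ABSol fl fr A B u0) (ζ : ℝ → ℝ) : Prop :=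
  (∃ K : NNReal, LipschitzOnWith K ζ (Icc 0 T)) ∧
  (∀ᵐ t ∂(volume.restrict (Icc 0 T)),
    (ζ t < 0 → HasDerivAt ζ (deriv fl (sol.um (ζ t) t)) t ∧
      deriv fl (sol.um (ζ t) t) = deriv fl (sol.up (ζ t) t)) ∧
    (0 < ζ t → HasDerivAt ζ (deriv fr (sol.um (ζ t) t)) t ∧
      deriv fr (sol.um (ζ t) t) = deriv fr (sol.up (ζ t) t)) ∧
    (ζ t = 0 → fl (sol.um 0 t) = γ ∧ fr (sol.up 0 t) = γ))

/-- `C(u,x)`: the set of `AB`-genuine/interface characteristics of `sol`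
reaching `x` at time `T`. -/
def charSet (T : ℝ) (fl fr : ℝ → ℝ) (γ : ℝ) {A B : ℝ} {u0 : ℝ → ℝ}
    (sol : ABSol fl fr A B u0) (x : ℝ) : Set (ℝ → ℝ) :=
  {ζ | IsABgic T fl fr γ sol ζ ∧ ζ T = x}

/-- `C₀(u,x)`: the set of initial positions `ζ(0)` of characteristics in `C(u,x)`. -/
def charSet0 (T : ℝ) (fl fr : ℝ → ℝ) (γ : ℝ) {A B : ℝ} {u0 : ℝ → ℝ}
    (sol : ABSol fl fr A B u0) (x : ℝ) : Set ℝ :=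
  (fun ζ : ℝ → ℝ => ζ 0) '' charSet T fl fr γ sol x

/-- Membership in `L^∞(ℝ)`: measurable and (essentially) bounded. -/
def IsLinf (g : ℝ → ℝ) : Prop :=
  Measurable g ∧ ∃ M : ℝ, ∀ᵐ x : ℝ ∂volume, |g x| ≤ M

/-- `ω ∈ A^{[AB]}(T)`: the profile `ω` is attainable at time `T`. -/
def Attainable (T : ℝ) (fl fr : ℝ → ℝ) (A B : ℝ) (ω : ℝ → ℝ) : Prop :=
  ∃ u0 : ℝ → ℝ, IsLinf u0 ∧
    ∃ sol : ABSol fl fr A B u0, ∀ᵐ x : ℝ ∂volume, sol.u x T = ω x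

/-- `I_T^{[AB]}(ω)`: the set of (bounded) initial data whose `AB`-entropy
solution coincides a.e. with `ω` at time `T`. -/
def InitialSet (T : ℝ) (fl fr : ℝ → ℝ) (A B : ℝ) (ω : ℝ → ℝ) : Set (ℝ → ℝ) :=
  {u0 | IsLinf u0 ∧
    ∃ sol : ABSol fl fr A B u0, ∀ᵐ x : ℝ ∂volume, sol.u x T = ω x}

/-- `x` is a point of continuity of `ω`: the one-sided limits exist and coincide. -/
def ContinuityPt (ω : ℝ → ℝ) (x : ℝ) : Prop :=
  ∃ l : ℝ, Tendsto ω (nhdsWithin x (Iio x)) (nhds l) ∧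
    Tendsto ω (nhdsWithin x (Ioi x)) (nhds l)

/-- Quadratic (Burgers) flux `u²/2`. -/
def fq : ℝ → ℝ := fun u => u ^ 2 / 2

/-- The target profile `ω₃` of the non-convexity example. -/
def omega3 (L0 p : ℝ) : ℝ → ℝ := fun x =>
  if x ≤ L0 then -4 * L0 else if x < 0 then 4 * L0 else p

/-- The first initial datum `u_{0,1}` of the non-convexity example. -/
def udat1 (L0 p : ℝ) : ℝ → ℝ := fun x =>
  if x < L0 then -4 * L0
  else if x < 0 then 4 * L0
  else if x < (4 * L0 - p) / 2 then -4 * L0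
  else p

/-- The second initial datum `u_{0,2}` of the non-convexity example. -/
def udat2 (L0 p : ℝ) : ℝ → ℝ := fun x =>
  if x < 5 * L0 then -4 * L0
  else if x < L0 then L0 - x
  else if x < 0 then -8 * L0
  else if x < -L0 then 8 * L0
  else if x < -4 * L0 then 4 * L0
  else if x < -p then -x
  else p

section
lemma scale_ae {ℓ : ℝ} (hℓ : ℓ ≠ 0) {P : ℝ → Prop} (h : ∀ᵐ x : ℝ, P x) : ∀ᵐ x : ℝ, P (ℓ * x) := by
  have : Measure.QuasiMeasurePreserving (fun x : ℝ => ℓ * x) volume volume := by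
    refine ⟨by fun_prop, ?_⟩
    rw [Real.map_volume_mul_left hℓ]
    exact Measure.smul_absolutelyContinuous
  exact this.ae h
lemma sign_div_pos {a ℓ : ℝ} (h : 0 < ℓ) : Real.sign (a / ℓ) = Real.sign a := by
  rcases lt_trichotomy a 0 with h1 | h1 | h1
  · rw [Real.sign_of_neg h1, Real.sign_of_neg (div_neg_of_neg_of_pos h1 h)]
  · simp [h1]
  · rw [Real.sign_of_pos h1, Real.sign_of_pos (div_pos h1 h)]
lemma int_scale {ℓ : ℝ} (hℓ : 0 < ℓ) (F : ℝ × ℝ → ℝ) :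
    ∫ p : ℝ × ℝ, F (ℓ * p.1, p.2) = ℓ⁻¹ * ∫ p, F p := by
  let e : ℝ × ℝ ≃ᵐ ℝ × ℝ := (Homeomorph.mulLeft₀ ℓ hℓ.ne').toMeasurableEquiv.prodCongr (MeasurableEquiv.refl ℝ)
  have he : Measure.map e volume = ENNReal.ofReal ℓ⁻¹ • (volume : Measure (ℝ × ℝ)) := by
    have h1 : (e : ℝ × ℝ → ℝ × ℝ) = Prod.map (fun x => ℓ * x) id := rfl
    rw [h1, Measure.volume_eq_prod, ← Measure.map_prod_map _ _ (by fun_prop) measurable_id,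
      Real.map_volume_mul_left hℓ.ne', Measure.map_id, abs_of_pos (inv_pos.2 hℓ)]
    exact Measure.prod_smul_left _
  have h2 := integral_map_equiv (μ := volume) e F
  rw [he, integral_smul_measure] at h2
  simp only [ENNReal.toReal_ofReal (inv_pos.2 hℓ).le, smul_eq_mul] at h2
  rw [h2]; rfl
lemma int_scale1 {ℓ : ℝ} (hℓ : 0 < ℓ) (r : ℝ) (g : ℝ → ℝ) :
    ∫ x in Icc (-r) r, g (ℓ * x) = ℓ⁻¹ * ∫ x in Icc (-(ℓ * r)) (ℓ * r), g x := by
  have h1 : ∀ x, (Icc (-r) r).indicator (fun x => g (ℓ * x)) x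
      = (fun y => (Icc (-(ℓ * r)) (ℓ * r)).indicator g y) (ℓ * x) := by
    intro x
    simp only [indicator, mem_Icc, ← mul_neg, mul_le_mul_iff_right₀ hℓ]
  rw [← integral_indicator measurableSet_Icc, ← integral_indicator measurableSet_Icc]
  simp_rw [h1]
  rw [Measure.integral_comp_mul_left, abs_of_pos (inv_pos.2 hℓ), smul_eq_mul]
lemma scale_test {ℓ : ℝ} (hℓ : 0 < ℓ) {φ : ℝ → ℝ → ℝ}
    (h1 : ContDiff ℝ 1 (fun p : ℝ × ℝ => φ p.1 p.2))
    (h2 : HasCompactSupport (fun p : ℝ × ℝ => φ p.1 p.2)) :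
    ContDiff ℝ 1 (fun p : ℝ × ℝ => φ (p.1 / ℓ) p.2) ∧
    HasCompactSupport (fun p : ℝ × ℝ => φ (p.1 / ℓ) p.2) ∧
    (∀ x t, deriv (fun y => φ (y / ℓ) t) (ℓ * x) = deriv (fun y => φ y t) x / ℓ) := by
  refine ⟨h1.comp (f := fun p : ℝ × ℝ => (p.1 / ℓ, p.2)) (by fun_prop), ?_, ?_⟩
  · let e : ℝ × ℝ ≃ₜ ℝ × ℝ := (Homeomorph.mulRight₀ ℓ⁻¹ (inv_ne_zero hℓ.ne')).prodCongr (Homeomorph.refl ℝ)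
    exact h2.comp_homeomorph e
  · intro x t
    have hd : DifferentiableAt ℝ (fun y => φ y t) (ℓ * x / ℓ) :=
      ((h1.comp (f := fun y : ℝ => (y, t)) (by fun_prop)).differentiable one_ne_zero) _
    have := hd.hasDerivAt.scomp (ℓ * x) ((hasDerivAt_id (ℓ * x)).div_const ℓ)
    have e := this.deriv
    simp only [mul_div_cancel_left₀ _ hℓ.ne', smul_eq_mul, Function.comp_def, id] at e
    rw [e]; field_simp
def scaleSol {A B ℓ : ℝ} {u0 : ℝ → ℝ} (hℓ : 0 < ℓ) (s : ABSol fq fq A B u0) :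
    ABSol fq fq (A / ℓ) (B / ℓ) (fun x => u0 (ℓ * x) / ℓ) where
  u := fun x t => s.u (ℓ * x) t / ℓ
  meas := by
    have := s.meas
    exact (this.comp (f := fun p : ℝ × ℝ => (ℓ * p.1, p.2)) (by fun_prop)).div_const ℓ
  bdd := by
    obtain ⟨M, hM⟩ := s.bdd
    refine ⟨M / ℓ, fun x t => ?_⟩
    rw [abs_div, abs_of_pos hℓ]
    exact div_le_div_of_nonneg_right (hM _ _) hℓ.le
  um := fun x t => s.um (ℓ * x) t / ℓ
  up := fun x t => s.up (ℓ * x) t / ℓ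
  um_spec := by
    intro x t ht
    refine ((s.um_spec (ℓ * x) t ht).comp ?_).div_const ℓ
    refine tendsto_nhdsWithin_iff.2 ⟨((continuous_const.mul continuous_id).tendsto x).mono_left nhdsWithin_le_nhds, ?_⟩
    filter_upwards [self_mem_nhdsWithin] with y hy
    exact mul_lt_mul_of_pos_left hy hℓ
  up_spec := by
    intro x t ht
    refine ((s.up_spec (ℓ * x) t ht).comp ?_).div_const ℓ
    refine tendsto_nhdsWithin_iff.2 ⟨((continuous_const.mul continuous_id).tendsto x).mono_left nhdsWithin_le_nhds, ?_⟩
    filter_upwards [self_mem_nhdsWithin] with y hy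
    exact mul_lt_mul_of_pos_left hy hℓ
  weak := by
    intro φ h1 h2 h3
    obtain ⟨g1, g2, g3⟩ := scale_test hℓ h1 h2
    have h := s.weak (fun x t => φ (x / ℓ) t) g1 g2 (fun x t ht => h3 _ _ ht)
    have h5 := int_scale hℓ (fun p : ℝ × ℝ => s.u p.1 p.2 * deriv (fun s => φ (p.1 / ℓ) s) p.2 +
        dflux fq fq p.1 (s.u p.1 p.2) * deriv (fun y => φ (y / ℓ) p.2) p.1)
    rw [h, mul_zero] at h5
    have h6 : (0:ℝ) = ℓ⁻¹ * 0 := by simp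
    rw [h6, ← h5, ← integral_const_mul]
    congr 1; ext p
    simp only [g3, mul_div_cancel_left₀ _ hℓ.ne', dflux, fq]
    simp only [ite_self]; field_simp
  kruzkov_l := by
    intro k φ h1 h2 h3 h4
    obtain ⟨g1, g2, g3⟩ := scale_test hℓ h1 h2
    have h := s.kruzkov_l (ℓ * k) (fun x t => φ (x / ℓ) t) g1 g2 (fun x t => h3 _ _)
      (fun x t ht => h4 _ _ (ht.imp_left fun h => by positivity))
    have h5 := int_scale hℓ (fun p : ℝ × ℝ => |s.u p.1 p.2 - ℓ * k| * deriv (fun s => φ (p.1 / ℓ) s) p.2 + Real.sign (s.u p.1 p.2 - ℓ * k) * (fq (s.u p.1 p.2) - fq (ℓ * k)) * deriv (fun y => φ (y / ℓ) p.2) p.1)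
    have h6 := mul_nonneg (inv_pos.2 hℓ).le (mul_nonneg (inv_pos.2 hℓ).le h)
    rw [← h5, ← integral_const_mul] at h6
    refine h6.trans (le_of_eq ?_)
    congr 1; ext p
    have e1 : s.u (ℓ * p.1) p.2 / ℓ - k = (s.u (ℓ * p.1) p.2 - ℓ * k) / ℓ := by field_simp
    simp only [g3, mul_div_cancel_left₀ _ hℓ.ne', fq, e1, abs_div, abs_of_pos hℓ, sign_div_pos hℓ]
    field_simp
  kruzkov_r := by
    intro k φ h1 h2 h3 h4
    obtain ⟨g1, g2, g3⟩ := scale_test hℓ h1 h2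
    have h := s.kruzkov_r (ℓ * k) (fun x t => φ (x / ℓ) t) g1 g2 (fun x t => h3 _ _)
      (fun x t ht => h4 _ _ (ht.imp_left fun h => div_nonpos_of_nonpos_of_nonneg h hℓ.le))
    have h5 := int_scale hℓ (fun p : ℝ × ℝ => |s.u p.1 p.2 - ℓ * k| * deriv (fun s => φ (p.1 / ℓ) s) p.2 + Real.sign (s.u p.1 p.2 - ℓ * k) * (fq (s.u p.1 p.2) - fq (ℓ * k)) * deriv (fun y => φ (y / ℓ) p.2) p.1)
    have h6 := mul_nonneg (inv_pos.2 hℓ).le (mul_nonneg (inv_pos.2 hℓ).le h)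
    rw [← h5, ← integral_const_mul] at h6
    refine h6.trans (le_of_eq ?_)
    congr 1; ext p
    have e1 : s.u (ℓ * p.1) p.2 / ℓ - k = (s.u (ℓ * p.1) p.2 - ℓ * k) / ℓ := by field_simp
    simp only [g3, mul_div_cancel_left₀ _ hℓ.ne', fq, e1, abs_div, abs_of_pos hℓ, sign_div_pos hℓ]
    field_simp
  interfaceEntropy := by
    intro φ h1 h2 h3 h4
    obtain ⟨g1, g2, g3⟩ := scale_test hℓ h1 h2
    have h := s.interfaceEntropy (fun x t => φ (x / ℓ) t) g1 g2 (fun x t => h3 _ _)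
      (fun x t ht => h4 _ _ ht)
    have h5 := int_scale hℓ (fun p : ℝ × ℝ => |s.u p.1 p.2 - cAB A B p.1| * deriv (fun s => φ (p.1 / ℓ) s) p.2 + Real.sign (s.u p.1 p.2 - cAB A B p.1) * (dflux fq fq p.1 (s.u p.1 p.2) - dflux fq fq p.1 (cAB A B p.1)) * deriv (fun y => φ (y / ℓ) p.2) p.1)
    have h6 := mul_nonneg (inv_pos.2 hℓ).le (mul_nonneg (inv_pos.2 hℓ).le h)
    rw [← h5, ← integral_const_mul] at h6
    refine h6.trans (le_of_eq ?_)
    congr 1; ext p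
    have e0 : cAB (A / ℓ) (B / ℓ) p.1 = cAB A B (ℓ * p.1) / ℓ := by
      simp only [cAB, mul_nonpos_iff_pos_imp_nonpos, mul_nonpos_iff, hℓ, hℓ.le, hℓ.not_ge]
      split_ifs <;> simp_all
    simp only [g3, mul_div_cancel_left₀ _ hℓ.ne', dflux, fq, e0, ite_self, ← sub_div, abs_div, abs_of_pos hℓ, sign_div_pos hℓ]
    field_simp
  timeCont := by
    intro r t0 ht0
    have h := (s.timeCont (ℓ * r) t0 ht0).const_mul (ℓ⁻¹ * ℓ⁻¹)
    rw [mul_zero] at h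
    refine h.congr fun t => ?_
    rw [mul_assoc, ← int_scale1 hℓ r (fun x => |s.u x t - s.u x t0|), ← integral_const_mul]
    congr 1; ext x
    rw [← sub_div, abs_div, abs_of_pos hℓ]; ring
  init := by
    filter_upwards [scale_ae hℓ.ne' s.init] with x hx
    rw [hx]
end

section
section TF
variable {φ : ℝ → ℝ → ℝ}
lemma tf_hasDt (h1 : ContDiff ℝ 1 (fun p : ℝ × ℝ => φ p.1 p.2)) (x t : ℝ) :
    HasDerivAt (fun s => φ x s) (fderiv ℝ (fun p : ℝ × ℝ => φ p.1 p.2) (x, t) (0, 1)) t := by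
  have := (h1.differentiable one_ne_zero (x, t)).hasFDerivAt.comp_hasDerivAt t
    ((hasDerivAt_const t x).prodMk (hasDerivAt_id t))
  exact this
lemma tf_hasDx (h1 : ContDiff ℝ 1 (fun p : ℝ × ℝ => φ p.1 p.2)) (x t : ℝ) :
    HasDerivAt (fun y => φ y t) (fderiv ℝ (fun p : ℝ × ℝ => φ p.1 p.2) (x, t) (1, 0)) x := by
  have := (h1.differentiable one_ne_zero (x, t)).hasFDerivAt.comp_hasDerivAt x
    ((hasDerivAt_id x).prodMk (hasDerivAt_const x t))
  exact this
lemma tf_dt_eq (h1 : ContDiff ℝ 1 (fun p : ℝ × ℝ => φ p.1 p.2)) :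
    (fun p : ℝ × ℝ => deriv (fun s => φ p.1 s) p.2) =
      fun p => fderiv ℝ (fun p : ℝ × ℝ => φ p.1 p.2) p (0, 1) := by
  ext p; exact (tf_hasDt h1 p.1 p.2).deriv
lemma tf_dx_eq (h1 : ContDiff ℝ 1 (fun p : ℝ × ℝ => φ p.1 p.2)) :
    (fun p : ℝ × ℝ => deriv (fun y => φ y p.2) p.1) =
      fun p => fderiv ℝ (fun p : ℝ × ℝ => φ p.1 p.2) p (1, 0) := by
  ext p; exact (tf_hasDx h1 p.1 p.2).deriv
lemma tf_dt_cont (h1 : ContDiff ℝ 1 (fun p : ℝ × ℝ => φ p.1 p.2)) :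
    Continuous (fun p : ℝ × ℝ => deriv (fun s => φ p.1 s) p.2) := by
  rw [tf_dt_eq h1]; exact (h1.continuous_fderiv one_ne_zero).clm_apply continuous_const
lemma tf_dx_cont (h1 : ContDiff ℝ 1 (fun p : ℝ × ℝ => φ p.1 p.2)) :
    Continuous (fun p : ℝ × ℝ => deriv (fun y => φ y p.2) p.1) := by
  rw [tf_dx_eq h1]; exact (h1.continuous_fderiv one_ne_zero).clm_apply continuous_const
lemma tf_dt_supp (h1 : ContDiff ℝ 1 (fun p : ℝ × ℝ => φ p.1 p.2))
    (h2 : HasCompactSupport (fun p : ℝ × ℝ => φ p.1 p.2)) :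
    HasCompactSupport (fun p : ℝ × ℝ => deriv (fun s => φ p.1 s) p.2) := by
  rw [tf_dt_eq h1]; exact h2.fderiv_apply ℝ _
lemma tf_dx_supp (h1 : ContDiff ℝ 1 (fun p : ℝ × ℝ => φ p.1 p.2))
    (h2 : HasCompactSupport (fun p : ℝ × ℝ => φ p.1 p.2)) :
    HasCompactSupport (fun p : ℝ × ℝ => deriv (fun y => φ y p.2) p.1) := by
  rw [tf_dx_eq h1]; exact h2.fderiv_apply ℝ _
end TF
lemma cs_box {g : ℝ × ℝ → ℝ} (h2 : HasCompactSupport g) :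
    ∃ R : ℝ, 0 < R ∧ ∀ x t, (R < |x| ∨ R < |t|) → g (x, t) = 0 := by
  obtain ⟨R, hR⟩ := h2.isCompact.isBounded.subset_closedBall (0 : ℝ × ℝ)
  refine ⟨max R 1, by positivity, fun x t h => ?_⟩
  by_contra hne
  have := hR (subset_tsupport _ hne)
  rw [mem_closedBall_zero_iff, Prod.norm_def] at this
  simp only [Real.norm_eq_abs] at this
  have h1 := le_max_left |x| |t|
  have h2 := le_max_right |x| |t|
  have h3 := le_max_left R 1
  rcases h with h | h <;> linarith
lemma cs_bdd {g : ℝ × ℝ → ℝ} (hc : Continuous g) (h2 : HasCompactSupport g) :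
    ∃ C : ℝ, 0 < C ∧ ∀ p, |g p| ≤ C := by
  obtain ⟨C, hC⟩ := h2.exists_bound_of_continuous hc
  exact ⟨max C 1, by positivity, fun p => (hC p).trans (le_max_left _ _)⟩
def kap (z : ℝ) : ℝ := 6 * max 0 (-(z * (1 + z)))
def Kst (z : ℝ) : ℝ := ∫ s in (-1 : ℝ)..z, kap s
lemma kap_cont : Continuous kap := by unfold kap; fun_prop
lemma kap_nonneg (z : ℝ) : 0 ≤ kap z := by unfold kap; positivity
lemma kap_zero {z : ℝ} (h : z ≤ -1 ∨ 0 ≤ z) : kap z = 0 := by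
  unfold kap
  rw [max_eq_left, mul_zero]
  rcases h with h | h <;> nlinarith
lemma kap_supp : HasCompactSupport kap := by
  refine HasCompactSupport.intro (isCompact_Icc (a := (-1:ℝ)) (b := 0)) fun x hx => ?_
  apply kap_zero
  simp only [mem_Icc, not_and_or, not_le] at hx
  exact hx.imp le_of_lt le_of_lt
lemma kap_le (z : ℝ) : kap z ≤ 6 := by
  unfold kap
  have : max 0 (-(z * (1 + z))) ≤ 1 := max_le zero_le_one (by nlinarith [sq_nonneg (z + 1/2)])
  linarith
lemma kap_integrable : Integrable kap := kap_cont.integrable_of_hasCompactSupport kap_supp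
lemma Kst_deriv (z : ℝ) : HasDerivAt Kst (kap z) z :=
  intervalIntegral.integral_hasDerivAt_right (kap_cont.intervalIntegrable _ _)
    (kap_cont.stronglyMeasurableAtFilter _ _) kap_cont.continuousAt
lemma Kst_contDiff : ContDiff ℝ 1 Kst := by
  rw [contDiff_one_iff_deriv]
  refine ⟨fun z => (Kst_deriv z).differentiableAt, ?_⟩
  have : deriv Kst = kap := by ext z; exact (Kst_deriv z).deriv
  rw [this]; exact kap_cont
lemma Kst_mono : Monotone Kst :=
  monotone_of_deriv_nonneg (fun z => (Kst_deriv z).differentiableAt)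
    (fun z => by rw [(Kst_deriv z).deriv]; exact kap_nonneg z)
lemma Kst_zero {z : ℝ} (h : z ≤ -1) : Kst z = 0 := by
  unfold Kst
  rw [intervalIntegral.integral_congr (g := fun _ => 0)]
  · simp
  · intro s hs
    rw [uIcc_of_ge h] at hs
    exact kap_zero (Or.inl hs.2)
lemma Kst_at0 : Kst 0 = 1 := by
  unfold Kst
  rw [intervalIntegral.integral_congr (g := fun z => 6 * (-z - z^2))]
  · rw [intervalIntegral.integral_const_mul, intervalIntegral.integral_sub
      (Continuous.intervalIntegrable (by fun_prop) _ _) (Continuous.intervalIntegrable (by fun_prop) _ _),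
      intervalIntegral.integral_neg, integral_id, integral_pow]
    norm_num
  · intro s hs
    rw [uIcc_of_le (by norm_num)] at hs
    simp only [kap]
    rw [max_eq_right (by nlinarith [hs.1, hs.2])]; ring
lemma Kst_one {z : ℝ} (h : 0 ≤ z) : Kst z = 1 := by
  rw [← Kst_at0]
  unfold Kst
  rw [← intervalIntegral.integral_add_adjacent_intervals (b := 0)
    (kap_cont.intervalIntegrable _ _) (kap_cont.intervalIntegrable _ _),
    intervalIntegral.integral_congr (a := 0) (b := z) (g := fun _ => 0)]
  · simp
  · intro s hs
    rw [uIcc_of_le h] at hs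
    exact kap_zero (Or.inr hs.1)
lemma Kst_nonneg (z : ℝ) : 0 ≤ Kst z := by
  rcases le_total z (-1) with h | h
  · rw [Kst_zero h]
  · rw [← Kst_zero le_rfl]; exact Kst_mono h
lemma Kst_le (z : ℝ) : Kst z ≤ 1 := by
  rcases le_total 0 z with h | h
  · rw [Kst_one h]
  · rw [← Kst_at0]; exact Kst_mono h
lemma kap_int : ∫ z, kap z = 1 := by
  have h := Kst_at0
  unfold Kst at h
  rw [intervalIntegral.integral_of_le (by norm_num), ← integral_indicator measurableSet_Ioc] at h
  rw [← h]; congr 1; ext z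
  simp only [indicator, mem_Ioc]
  split_ifs with hz
  · rfl
  · apply kap_zero
    by_contra hc; push Not at hc; exact hz ⟨hc.1, hc.2.le⟩
lemma kap_change (G : ℝ × ℝ → ℝ) {n : ℝ} (hn : 0 < n) (a c : ℝ) :
    ∫ p : ℝ × ℝ, G p * (n * kap (n * (p.1 - a) - c))
      = ∫ p : ℝ × ℝ, G (a + (p.1 + c) / n, p.2) * kap p.1 := by
  have h := int_scale hn (fun p : ℝ × ℝ => G (a + (p.1 + c) / n, p.2) * (n * kap p.1))
  have h2 : ∫ p : ℝ × ℝ, G p * (n * kap (n * (p.1 - a) - c)) =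
      ∫ p : ℝ × ℝ, (fun p : ℝ × ℝ => G (a + (n * p.1 + c) / n, p.2) * (n * kap (n * p.1)))
        (p + (-(a + c / n), 0)) := by
    congr 1; ext p
    have e1 : n * (p.1 + -(a + c / n)) = n * (p.1 - a) - c := by field_simp; ring
    have e2 : a + (n * (p.1 - a) - c + c) / n = p.1 := by field_simp; ring
    simp only [Prod.fst_add, Prod.snd_add, e1, e2, add_zero]
  rw [h2, integral_add_right_eq_self
    (fun p : ℝ × ℝ => G (a + (n * p.1 + c) / n, p.2) * (n * kap (n * p.1))), h, ← integral_const_mul]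
  congr 1; ext p; field_simp
lemma trace_lim (G : ℝ × ℝ → ℝ) (Gm : ℝ → ℝ) (a c C T : ℝ) (hG : Measurable G)
    (hC : ∀ p, |G p| ≤ C) (hT : ∀ x t, T < |t| → G (x, t) = 0)
    (hlim : (c = 0 ∧ ∀ᵐ t : ℝ, Tendsto (fun x => G (x, t)) (nhdsWithin a (Iio a)) (nhds (Gm t))) ∨
      (c = 1 ∧ ∀ᵐ t : ℝ, Tendsto (fun x => G (x, t)) (nhdsWithin a (Ioi a)) (nhds (Gm t)))) :
    Tendsto (fun n : ℕ => ∫ p : ℝ × ℝ, G p * (((n:ℝ) + 1) * kap (((n:ℝ) + 1) * (p.1 - a) - c)))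
      atTop (nhds (∫ t, Gm t)) := by
  have hC0 : 0 ≤ C := (abs_nonneg _).trans (hC 0)
  have e1 : ∀ n : ℕ, ∫ p : ℝ × ℝ, G p * (((n:ℝ) + 1) * kap (((n:ℝ) + 1) * (p.1 - a) - c))
      = ∫ p : ℝ × ℝ, G (a + (p.1 + c) / ((n:ℝ) + 1), p.2) * kap p.1 :=
    fun n => kap_change G (by positivity) a c
  simp_rw [e1]
  have e2 : ∫ t, Gm t = ∫ p : ℝ × ℝ, kap p.1 * Gm p.2 := by
    rw [Measure.volume_eq_prod, integral_prod_mul, kap_int, one_mul]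
  rw [e2]
  have hbi : Integrable (fun p : ℝ × ℝ => 6 * C * (Icc (-1 : ℝ) 0 ×ˢ Icc (-T) T).indicator (fun _ => (1:ℝ)) p) := by
    apply Integrable.const_mul
    rw [integrable_indicator_iff (measurableSet_Icc.prod measurableSet_Icc)]
    apply integrableOn_const
    · exact (isCompact_Icc.prod isCompact_Icc).measure_lt_top.ne
    · simp
  refine tendsto_integral_of_dominated_convergence _ ?_ hbi ?_ ?_
  · intro n
    exact ((hG.comp (by fun_prop)).mul (kap_cont.measurable.comp measurable_fst)).aestronglyMeasurable
  · intro n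
    refine Eventually.of_forall fun p => ?_
    by_cases hp : p ∈ (Icc (-1 : ℝ) 0 ×ˢ Icc (-T) T)
    · rw [indicator_of_mem hp, mul_one, norm_mul, Real.norm_eq_abs, Real.norm_eq_abs,
        abs_of_nonneg (kap_nonneg _)]
      nlinarith [hC (a + (p.1 + c) / (n + 1), p.2), kap_le p.1, kap_nonneg p.1, abs_nonneg (G (a + (p.1 + c) / (n + 1), p.2))]
    · rw [indicator_of_notMem hp]
      simp only [mem_prod, mem_Icc, not_and_or, not_le] at hp
      rcases hp with h | h
      · rw [kap_zero (h.imp le_of_lt le_of_lt)]; simp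
      · rw [hT _ _ (by rcases h with h | h; · exact lt_of_lt_of_le (by linarith) (neg_le_abs _)
                       · exact lt_of_lt_of_le h (le_abs_self _))]; simp
  · have hz : ∀ᵐ p : ℝ × ℝ, Tendsto (fun n : ℕ => a + (p.1 + c) / ((n:ℝ) + 1)) atTop (nhds a) := by
      refine Eventually.of_forall fun p => ?_
      have := (tendsto_one_div_add_atTop_nhds_zero_nat (𝕜 := ℝ)).const_mul (p.1 + c)
      simpa [div_eq_mul_inv] using (this.const_add a)
    rcases hlim with ⟨hc, hl⟩ | ⟨hc, hl⟩
    · have hl' : ∀ᵐ p : ℝ × ℝ, Tendsto (fun x => G (x, p.2)) (nhdsWithin a (Iio a)) (nhds (Gm p.2)) :=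
        Measure.quasiMeasurePreserving_snd.ae hl
      filter_upwards [hz, hl'] with p hp1 hp2
      rcases lt_or_ge p.1 0 with h0 | h0
      · rw [mul_comm (kap p.1)]
        refine (hp2.comp (tendsto_nhdsWithin_iff.2 ⟨hp1, Eventually.of_forall fun n => ?_⟩)).mul_const _
        rw [mem_Iio, hc]
        have : (p.1 + 0) / ((n:ℝ) + 1) < 0 := div_neg_of_neg_of_pos (by linarith) (by positivity)
        linarith
      · simp [kap_zero (Or.inr h0)]
    · have hl' : ∀ᵐ p : ℝ × ℝ, Tendsto (fun x => G (x, p.2)) (nhdsWithin a (Ioi a)) (nhds (Gm p.2)) :=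
        Measure.quasiMeasurePreserving_snd.ae hl
      filter_upwards [hz, hl'] with p hp1 hp2
      rcases lt_or_ge (-1) p.1 with h0 | h0
      · rw [mul_comm (kap p.1)]
        refine (hp2.comp (tendsto_nhdsWithin_iff.2 ⟨hp1, Eventually.of_forall fun n => ?_⟩)).mul_const _
        rw [mem_Ioi, hc]
        have : 0 < (p.1 + 1) / ((n:ℝ) + 1) := div_pos (by linarith) (by positivity)
        linarith
      · simp [kap_zero (Or.inl h0)]
end

section
lemma hasLine_t {F : ℝ × ℝ → ℝ} {a : ℝ} {p : ℝ × ℝ} (h : HasDerivAt (fun s => F (p.1, s)) a p.2) :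
    HasLineDerivAt ℝ F a p (0, 1) := by
  have h' : HasDerivAt (fun s => F (p.1, s)) a (p.2 + 0) := by rwa [add_zero]
  have := h'.comp_const_add p.2 0
  simpa [HasLineDerivAt, Prod.add_def] using this
lemma hasLine_x {F : ℝ × ℝ → ℝ} {a : ℝ} {p : ℝ × ℝ} (h : HasDerivAt (fun s => F (s, p.2)) a p.1) :
    HasLineDerivAt ℝ F a p (1, 0) := by
  have h' : HasDerivAt (fun s => F (s, p.2)) a (p.1 + 0) := by rwa [add_zero]
  have := h'.comp_const_add p.1 0
  simpa [HasLineDerivAt, Prod.add_def] using this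
lemma ibp_t {F F' : ℝ × ℝ → ℝ} {C : NNReal} (hF : LipschitzWith C F) {φ : ℝ → ℝ → ℝ}
    (h1 : ContDiff ℝ 1 (fun p : ℝ × ℝ => φ p.1 p.2))
    (h2 : HasCompactSupport (fun p : ℝ × ℝ => φ p.1 p.2))
    (hd : ∀ᵐ p : ℝ × ℝ, φ p.1 p.2 ≠ 0 → HasDerivAt (fun s => F (p.1, s)) (F' p) p.2) :
    ∫ p : ℝ × ℝ, F p * deriv (fun s => φ p.1 s) p.2 = -∫ p : ℝ × ℝ, F' p * φ p.1 p.2 := by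
  obtain ⟨D, hD⟩ := h1.lipschitzWith_of_hasCompactSupport h2 one_ne_zero
  have := hF.integral_lineDeriv_mul_eq (μ := volume) hD h2 (0, 1)
  have e1 : ∫ p : ℝ × ℝ, F' p * φ p.1 p.2 = ∫ x, lineDeriv ℝ F x (0, 1) * φ x.1 x.2 := by
    apply integral_congr_ae
    filter_upwards [hd] with p hp
    by_cases h : φ p.1 p.2 = 0
    · simp [h]
    · rw [(hasLine_t (hp h)).lineDeriv]
  rw [e1, this, ← integral_neg]
  congr 1; ext p
  have h3 := ((h1.differentiable one_ne_zero) p).lineDeriv_eq_fderiv (v := -(0, 1))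
  rw [h3, congrFun (tf_dt_eq h1) p, map_neg]; ring
lemma ibp_x {F F' : ℝ × ℝ → ℝ} {C : NNReal} (hF : LipschitzWith C F) {φ : ℝ → ℝ → ℝ}
    (h1 : ContDiff ℝ 1 (fun p : ℝ × ℝ => φ p.1 p.2))
    (h2 : HasCompactSupport (fun p : ℝ × ℝ => φ p.1 p.2))
    (hd : ∀ᵐ p : ℝ × ℝ, φ p.1 p.2 ≠ 0 → HasDerivAt (fun s => F (s, p.2)) (F' p) p.1) :
    ∫ p : ℝ × ℝ, F p * deriv (fun y => φ y p.2) p.1 = -∫ p : ℝ × ℝ, F' p * φ p.1 p.2 := by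
  obtain ⟨D, hD⟩ := h1.lipschitzWith_of_hasCompactSupport h2 one_ne_zero
  have := hF.integral_lineDeriv_mul_eq (μ := volume) hD h2 (1, 0)
  have e1 : ∫ p : ℝ × ℝ, F' p * φ p.1 p.2 = ∫ x, lineDeriv ℝ F x (1, 0) * φ x.1 x.2 := by
    apply integral_congr_ae
    filter_upwards [hd] with p hp
    by_cases h : φ p.1 p.2 = 0
    · simp [h]
    · rw [(hasLine_x (hp h)).lineDeriv]
  rw [e1, this, ← integral_neg]
  congr 1; ext p
  have h3 := ((h1.differentiable one_ne_zero) p).lineDeriv_eq_fderiv (v := -(1, 0))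
  rw [h3, congrFun (tf_dx_eq h1) p, map_neg]; ring
lemma ibp_1 {R G R' G' : ℝ → ℝ} {C D : NNReal} (hR : LipschitzWith C R) (hG : LipschitzWith D G)
    (hs : HasCompactSupport G) (hR' : ∀ᵐ x, G x ≠ 0 → HasDerivAt R (R' x) x)
    (hG' : ∀ᵐ x, HasDerivAt G (G' x) x) :
    ∫ x, R' x * G x = -∫ x, G' x * R x := by
  have := hR.integral_lineDeriv_mul_eq (μ := volume) hG hs 1
  have e1 : ∫ x, R' x * G x = ∫ x, lineDeriv ℝ R x 1 * G x := by
    apply integral_congr_ae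
    filter_upwards [hR'] with x hx
    by_cases h : G x = 0
    · simp [h]
    · rw [((hx h).hasFDerivAt.hasLineDerivAt 1).lineDeriv]; simp
  rw [e1, this, ← integral_neg]
  apply integral_congr_ae
  filter_upwards [hG'] with x hx
  rw [((hx).hasFDerivAt.hasLineDerivAt (-1)).lineDeriv]; simp
structure Pot (U : ℝ × ℝ → ℝ) (u : ℝ → ℝ → ℝ) : Prop where
  lip : ∃ C : NNReal, LipschitzWith C U
  meas : Measurable (Function.uncurry u)
  bdd : ∃ M : ℝ, ∀ x t, |u x t| ≤ M
  dx : ∀ᵐ p : ℝ × ℝ, 0 < p.2 → HasDerivAt (fun y => U (y, p.2)) (u p.1 p.2) p.1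
  dt : ∀ᵐ p : ℝ × ℝ, 0 < p.2 → HasDerivAt (fun s => U (p.1, s)) (-((u p.1 p.2) ^ 2 / 2)) p.2
lemma cs_integrable {g ψ : ℝ × ℝ → ℝ} {M : ℝ} (hg : Measurable g) (hM : ∀ p, |g p| ≤ M)
    (hc : Continuous ψ) (hs : HasCompactSupport ψ) : Integrable (fun p => g p * ψ p) :=
  (hc.integrable_of_hasCompactSupport hs).bdd_mul hg.aestronglyMeasurable (Eventually.of_forall hM)
lemma tf_zero_dt {φ : ℝ → ℝ → ℝ} (h3 : ∀ x t, t ≤ 0 → φ x t = 0) {p : ℝ × ℝ} (hp : p.2 < 0) :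
    deriv (fun s => φ p.1 s) p.2 = 0 := by
  have : (fun s => φ p.1 s) =ᶠ[nhds p.2] fun _ => 0 := by
    filter_upwards [Iio_mem_nhds hp] with s hs
    exact h3 _ _ (le_of_lt hs)
  rw [this.deriv_eq]; simp
lemma ae_snd_ne (a : ℝ) : ∀ᵐ p : ℝ × ℝ, p.2 ≠ a := by
  have : ∀ᵐ t : ℝ, t ≠ a := by simp [ae_iff, measure_singleton]
  exact Measure.quasiMeasurePreserving_snd.ae this
lemma ae_fst_ne (a : ℝ) : ∀ᵐ p : ℝ × ℝ, p.1 ≠ a := by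
  have : ∀ᵐ t : ℝ, t ≠ a := by simp [ae_iff, measure_singleton]
  exact Measure.quasiMeasurePreserving_fst.ae this
lemma diffquot_tendsto {g : ℝ → ℝ} {a x : ℝ} (h : HasDerivAt g a x) :
    Tendsto (fun n : ℕ => ((n:ℝ) + 1) * (g x - g (x - 1 / ((n:ℝ) + 1)))) atTop (nhds a) := by
  have h0 : Tendsto (fun n : ℕ => -(1 / ((n:ℝ) + 1))) atTop (nhdsWithin 0 {0}ᶜ) := by
    rw [tendsto_nhdsWithin_iff]
    refine ⟨by simpa using (tendsto_one_div_add_atTop_nhds_zero_nat (𝕜 := ℝ)).neg, Eventually.of_forall fun n => ?_⟩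
    have : (0:ℝ) < 1 / ((n:ℝ) + 1) := by positivity
    simp only [mem_compl_iff, mem_singleton_iff]; linarith
  have := (hasDerivAt_iff_tendsto_slope_zero.1 h).comp h0
  refine this.congr fun n => ?_
  have : ((n:ℝ) + 1) ≠ 0 := by positivity
  simp only [Function.comp, smul_eq_mul, ← sub_eq_add_neg]
  field_simp; ring
lemma Pot.weak {U : ℝ × ℝ → ℝ} {u : ℝ → ℝ → ℝ} (P : Pot U u) (φ : ℝ → ℝ → ℝ)
    (h1 : ContDiff ℝ 1 (fun p : ℝ × ℝ => φ p.1 p.2))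
    (h2 : HasCompactSupport (fun p : ℝ × ℝ => φ p.1 p.2))
    (h3 : ∀ x t, t ≤ 0 → φ x t = 0) :
    ∫ p : ℝ × ℝ, (u p.1 p.2 * deriv (fun s => φ p.1 s) p.2 +
      (u p.1 p.2) ^ 2 / 2 * deriv (fun y => φ y p.2) p.1) = 0 := by
  obtain ⟨C, hC⟩ := P.lip
  obtain ⟨M, hM⟩ := P.bdd
  have hmu : Measurable (fun p : ℝ × ℝ => u p.1 p.2) := P.meas
  have hM2 : ∀ p : ℝ × ℝ, |u p.1 p.2 ^ 2 / 2| ≤ M ^ 2 / 2 := fun p => by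
    have := hM p.1 p.2
    rw [abs_of_nonneg (by positivity), ← sq_abs]
    have h0 := abs_nonneg (u p.1 p.2)
    nlinarith
  -- identity at step n
  have key : ∀ n : ℕ, ∫ p : ℝ × ℝ, (((n:ℝ) + 1) * (U p - U (p.1 - 1 / ((n:ℝ) + 1), p.2))) *
      deriv (fun s => φ p.1 s) p.2 =
      ∫ p : ℝ × ℝ, ((n:ℝ) + 1) * ((-(u p.1 p.2 ^ 2 / 2)) * (φ (p.1 + 1 / ((n:ℝ) + 1)) p.2 - φ p.1 p.2)) := by
    intro n
    set h : ℝ := 1 / ((n:ℝ) + 1) with hh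
    have a1 := ibp_t (F' := fun p => -(u p.1 p.2 ^ 2 / 2)) hC h1 h2 (by
      filter_upwards [P.dt] with p hp hne
      exact hp (by by_contra hc; exact hne (h3 _ _ (not_lt.1 hc))))
    have g1 : ContDiff ℝ 1 (fun p : ℝ × ℝ => φ (p.1 + h) p.2) :=
      h1.comp (f := fun p : ℝ × ℝ => (p.1 + h, p.2)) (by fun_prop)
    have g2 : HasCompactSupport (fun p : ℝ × ℝ => φ (p.1 + h) p.2) :=
      h2.comp_homeomorph ((Homeomorph.addRight h).prodCongr (Homeomorph.refl ℝ))
    have a2 := ibp_t (φ := fun x t => φ (x + h) t) (F' := fun p => -(u p.1 p.2 ^ 2 / 2)) hC g1 g2 (by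
      filter_upwards [P.dt] with p hp hne
      exact hp (by by_contra hc; exact hne (h3 _ _ (not_lt.1 hc))))
    have a3 : ∫ p : ℝ × ℝ, U p * deriv (fun s => φ (p.1 + h) s) p.2 =
        ∫ p : ℝ × ℝ, U (p.1 - h, p.2) * deriv (fun s => φ p.1 s) p.2 := by
      have := integral_add_right_eq_self (μ := (volume : Measure (ℝ × ℝ)))
        (fun p : ℝ × ℝ => U (p.1 - h, p.2) * deriv (fun s => φ p.1 s) p.2) (h, 0)
      rw [← this]; congr 1; ext p; simp
    have hUc := hC.continuous
    have i1 : Integrable (fun p : ℝ × ℝ => U p * deriv (fun s => φ p.1 s) p.2) :=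
      (hUc.mul (tf_dt_cont h1)).integrable_of_hasCompactSupport (tf_dt_supp h1 h2).mul_left
    have i2 : Integrable (fun p : ℝ × ℝ => U (p.1 - h, p.2) * deriv (fun s => φ p.1 s) p.2) :=
      ((hUc.comp (by fun_prop)).mul (tf_dt_cont h1)).integrable_of_hasCompactSupport (tf_dt_supp h1 h2).mul_left
    have i3 : Integrable (fun p : ℝ × ℝ => -(u p.1 p.2 ^ 2 / 2) * φ p.1 p.2) :=
      cs_integrable (M := M ^ 2 / 2) (by fun_prop) (fun p => by rw [abs_neg]; exact hM2 p) h1.continuous h2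
    have i4 : Integrable (fun p : ℝ × ℝ => -(u p.1 p.2 ^ 2 / 2) * φ (p.1 + h) p.2) :=
      cs_integrable (M := M ^ 2 / 2) (by fun_prop) (fun p => by rw [abs_neg]; exact hM2 p) g1.continuous g2
    have : ∫ p : ℝ × ℝ, ((n:ℝ) + 1) * ((-(u p.1 p.2 ^ 2 / 2)) * (φ (p.1 + h) p.2 - φ p.1 p.2))
        = ((n:ℝ) + 1) * ((∫ p : ℝ × ℝ, -(u p.1 p.2 ^ 2 / 2) * φ (p.1 + h) p.2)
          - ∫ p : ℝ × ℝ, -(u p.1 p.2 ^ 2 / 2) * φ p.1 p.2) := by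
      rw [integral_const_mul, ← integral_sub i4 i3]; simp_rw [mul_sub]
    rw [this]
    have : ∫ p : ℝ × ℝ, (((n:ℝ) + 1) * (U p - U (p.1 - h, p.2))) * deriv (fun s => φ p.1 s) p.2
        = ((n:ℝ) + 1) * ((∫ p : ℝ × ℝ, U p * deriv (fun s => φ p.1 s) p.2)
          - ∫ p : ℝ × ℝ, U (p.1 - h, p.2) * deriv (fun s => φ p.1 s) p.2) := by
      rw [← integral_sub i1 i2, ← integral_const_mul]; congr 1; ext p; ring
    rw [this, ← a3, a1, a2]; ring
  -- limits
  obtain ⟨D, hD⟩ := h1.lipschitzWith_of_hasCompactSupport h2 one_ne_zero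
  have l1 : Tendsto (fun n : ℕ => ∫ p : ℝ × ℝ, (((n:ℝ) + 1) * (U p - U (p.1 - 1 / ((n:ℝ) + 1), p.2))) *
      deriv (fun s => φ p.1 s) p.2) atTop (nhds (∫ p : ℝ × ℝ, u p.1 p.2 * deriv (fun s => φ p.1 s) p.2)) := by
    refine tendsto_integral_of_dominated_convergence
      (fun p => C * ‖deriv (fun s => φ p.1 s) p.2‖) ?_ ?_ ?_ ?_
    · intro n
      have := hC.continuous
      exact (Continuous.mul (by fun_prop) (tf_dt_cont h1)).aestronglyMeasurable
    · exact ((tf_dt_cont h1).integrable_of_hasCompactSupport (tf_dt_supp h1 h2)).norm.const_mul _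
    · intro n
      refine Eventually.of_forall fun p => ?_
      rw [norm_mul]
      refine mul_le_mul_of_nonneg_right ?_ (norm_nonneg _)
      have := hC.dist_le_mul p (p.1 - 1 / ((n:ℝ) + 1), p.2)
      rw [Real.dist_eq, Prod.dist_eq] at this
      simp only [dist_self, Real.dist_eq, sub_sub_cancel] at this
      rw [abs_of_nonneg (by positivity : (0:ℝ) ≤ 1 / ((n:ℝ) + 1)), max_eq_left (by positivity)] at this
      have hn : (0:ℝ) < (n:ℝ) + 1 := by positivity
      rw [Real.norm_eq_abs, abs_mul, abs_of_pos hn]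
      calc _ ≤ ((n:ℝ) + 1) * (C * (1 / ((n:ℝ) + 1))) := mul_le_mul_of_nonneg_left this hn.le
        _ = C := by field_simp
    · filter_upwards [P.dx, ae_snd_ne 0] with p hp h0
      rcases lt_or_gt_of_ne h0 with h | h
      · simp [tf_zero_dt h3 h]
      · exact (diffquot_tendsto (hp h)).mul_const _
  have l2 : Tendsto (fun n : ℕ => ∫ p : ℝ × ℝ, ((n:ℝ) + 1) * ((-(u p.1 p.2 ^ 2 / 2)) * (φ (p.1 + 1 / ((n:ℝ) + 1)) p.2 - φ p.1 p.2))) atTop (nhds (∫ p : ℝ × ℝ, (-(u p.1 p.2 ^ 2 / 2)) * deriv (fun y => φ y p.2) p.1)) := by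
    obtain ⟨R, hR0, hR⟩ := cs_box h2
    refine tendsto_integral_of_dominated_convergence
      (fun p => M ^ 2 / 2 * D * (Icc (-(R+1)) (R + 1) ×ˢ Icc (-R) R).indicator (fun _ => (1:ℝ)) p) ?_ ?_ ?_ ?_
    · intro n
      have := h1.continuous
      have h' : Continuous (fun p : ℝ × ℝ => φ (p.1 + 1 / ((n:ℝ) + 1)) p.2 - φ p.1 p.2) :=
        (this.comp (f := fun p : ℝ × ℝ => (p.1 + 1 / ((n:ℝ) + 1), p.2)) (by fun_prop)).sub this
      have h'' := h'.measurable
      exact Measurable.aestronglyMeasurable (by fun_prop)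
    · apply Integrable.const_mul
      rw [integrable_indicator_iff (measurableSet_Icc.prod measurableSet_Icc)]
      apply integrableOn_const
      · exact (isCompact_Icc.prod isCompact_Icc).measure_lt_top.ne
      · simp
    · intro n
      refine Eventually.of_forall fun p => ?_
      have hn : (0:ℝ) < (n:ℝ) + 1 := by positivity
      have hn1 : 1 / ((n:ℝ) + 1) ≤ 1 := by rw [div_le_one hn]; linarith [Nat.cast_nonneg (α := ℝ) n]
      have hn2 : 0 < 1 / ((n:ℝ) + 1) := by positivity
      by_cases hp : p ∈ (Icc (-(R+1)) (R + 1) ×ˢ Icc (-R) R)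
      · rw [indicator_of_mem hp, mul_one]
        have := hD.dist_le_mul (p.1 + 1 / ((n:ℝ) + 1), p.2) p
        rw [Real.dist_eq, Prod.dist_eq] at this
        simp only [dist_self, Real.dist_eq, add_sub_cancel_left] at this
        rw [abs_of_nonneg hn2.le, max_eq_left hn2.le] at this
        rw [Real.norm_eq_abs, abs_mul, abs_mul, abs_neg, abs_of_pos hn]
        calc _ ≤ ((n:ℝ) + 1) * ((M ^ 2 / 2) * (D * (1 / ((n:ℝ) + 1)))) := by
              gcongr
              exact hM2 p
          _ = _ := by field_simp
      · rw [indicator_of_notMem hp]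
        simp only [mem_prod, mem_Icc, not_and_or, not_le] at hp
        have e1 : φ (p.1 + 1 / ((n:ℝ) + 1)) p.2 = 0 := by
          apply hR
          rw [lt_abs, lt_abs]
          rcases hp with (h | h) | (h | h)
          · left; right; linarith
          · left; left; linarith
          · right; right; linarith
          · right; left; linarith
        have e2 : φ p.1 p.2 = 0 := by
          apply hR
          rw [lt_abs, lt_abs]
          rcases hp with (h | h) | (h | h)
          · left; right; linarith
          · left; left; linarith
          · right; right; linarith
          · right; left; linarith
        rw [e1, e2]; simp
    · refine Eventually.of_forall fun p => ?_
      have hd := tf_hasDx h1 p.1 p.2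
      rw [← congrFun (tf_dx_eq h1) p] at hd
      have h0 : Tendsto (fun n : ℕ => (1 / ((n:ℝ) + 1))) atTop (nhdsWithin 0 {0}ᶜ) := by
        rw [tendsto_nhdsWithin_iff]
        refine ⟨(tendsto_one_div_add_atTop_nhds_zero_nat (𝕜 := ℝ)), Eventually.of_forall fun n => ?_⟩
        have : (0:ℝ) < 1 / ((n:ℝ) + 1) := by positivity
        exact this.ne'
      have := ((hasDerivAt_iff_tendsto_slope_zero.1 hd).comp h0).const_mul (-(u p.1 p.2 ^ 2 / 2))
      refine this.congr fun n => ?_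
      simp only [Function.comp, smul_eq_mul, one_div, inv_inv]; ring
  have l3 := tendsto_nhds_unique (l1.congr key) l2
  have i1 : Integrable (fun p : ℝ × ℝ => u p.1 p.2 * deriv (fun s => φ p.1 s) p.2) :=
    cs_integrable hmu (fun p => hM p.1 p.2) (tf_dt_cont h1) (tf_dt_supp h1 h2)
  have i2 : Integrable (fun p : ℝ × ℝ => u p.1 p.2 ^ 2 / 2 * deriv (fun y => φ y p.2) p.1) :=
    cs_integrable (by fun_prop) hM2 (tf_dx_cont h1) (tf_dx_supp h1 h2)
  rw [integral_add i1 i2, l3, ← integral_add (by simpa [neg_mul] using i2.neg) i2]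
  simp
end

section
lemma bm_ii {v : ℝ → ℝ} {M : ℝ} (hm : Measurable v) (hM : ∀ x, |v x| ≤ M) (a b : ℝ) :
    IntervalIntegrable v volume a b :=
  (intervalIntegrable_const (c := M)).mono_fun' hm.aestronglyMeasurable (Eventually.of_forall hM)
lemma avg_lip {v : ℝ → ℝ} {M : ℝ} (hm : Measurable v) (hM : ∀ x, |v x| ≤ M) (h : ℝ) :
    ∃ C : NNReal, LipschitzWith C (fun x => (∫ y in (x-h)..x, v y) / h) := by
  have hii := bm_ii hm hM
  refine ⟨Real.toNNReal (2 * M / |h|), LipschitzWith.of_dist_le_mul fun x y => ?_⟩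
  have hM0 : 0 ≤ M := (abs_nonneg _).trans (hM 0)
  rw [Real.coe_toNNReal _ (by positivity), Real.dist_eq, Real.dist_eq, ← sub_div, abs_div]
  have e : (∫ z in (x-h)..x, v z) - ∫ z in (y-h)..y, v z =
      (∫ z in y..x, v z) - ∫ z in (y-h)..(x-h), v z := by
    rw [intervalIntegral.integral_interval_sub_interval_comm' (hii _ _) (hii _ _) (hii _ _)]
    
  rw [e]
  have b1 := intervalIntegral.norm_integral_le_of_norm_le_const (a := y) (b := x) (f := v) (C := M) (fun z _ => hM z)
  have b2 := intervalIntegral.norm_integral_le_of_norm_le_const (a := y-h) (b := x-h) (f := v) (C := M) (fun z _ => hM z)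
  rw [sub_sub_sub_cancel_right] at b2
  simp only [Real.norm_eq_abs] at b1 b2
  rw [div_mul_eq_mul_div]
  apply div_le_div_of_nonneg_right _ (abs_nonneg h)
  exact (abs_sub _ _).trans (by linarith)
lemma avg_deriv {v : ℝ → ℝ} {M : ℝ} (hm : Measurable v) (hM : ∀ x, |v x| ≤ M) (h : ℝ) :
    ∀ᵐ x, HasDerivAt (fun x => (∫ y in (x-h)..x, v y) / h) ((v x - v (x - h)) / h) x := by
  have hii := bm_ii hm hM
  have hli : LocallyIntegrable v volume := by
    rw [MeasureTheory.locallyIntegrable_iff]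
    intro k hk
    refine Measure.integrableOn_of_bounded (M := M) hk.measure_lt_top.ne hm.aestronglyMeasurable ?_
    exact Eventually.of_forall hM
  have a1 := _root_.LocallyIntegrable.ae_hasDerivAt_integral hli
  have a2 : ∀ᵐ x : ℝ, ∀ c, HasDerivAt (fun x => ∫ y in c..x, v y) (v (x - h)) (x - h) :=
    (measurePreserving_sub_right volume h).quasiMeasurePreserving.ae a1
  filter_upwards [a1, a2] with x h1 h2
  have h3 := (h1 0).sub ((h2 0).comp_sub_const x h)
  refine (h3.div_const h).congr_of_eventuallyEq (Eventually.of_forall fun y => ?_)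
  simp only [Pi.sub_apply]
  rw [intervalIntegral.integral_interval_sub_left (hii _ _) (hii _ _)]
lemma avg_jensen {v : ℝ → ℝ} {M : ℝ} (hm : Measurable v) (hM : ∀ x, |v x| ≤ M) {h : ℝ} (hh : 0 < h) (x : ℝ) :
    0 ≤ (∫ y in (x-h)..x, v y ^ 2 / 2) / h - ((∫ y in (x-h)..x, v y) / h) ^ 2 / 2 := by
  have hii := bm_ii hm hM (x - h) x
  have hM2 : ∀ x, |v x ^ 2 / 2| ≤ M ^ 2 / 2 := fun x => by
    have := hM x
    rw [abs_of_nonneg (by positivity), ← sq_abs]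
    have h0 := abs_nonneg (v x)
    nlinarith
  have hii2 := bm_ii (v := fun x => v x ^ 2 / 2) (by fun_prop) hM2 (x - h) x
  set W := (∫ y in (x-h)..x, v y) / h with hW
  have hWh : ∫ y in (x-h)..x, v y = W * h := by rw [hW]; field_simp
  have h0 : 0 ≤ ∫ y in (x-h)..x, (v y - W) ^ 2 / 2 :=
    intervalIntegral.integral_nonneg (by linarith) (fun y _ => by positivity)
  have e : ∫ y in (x-h)..x, (v y - W) ^ 2 / 2 = (∫ y in (x-h)..x, v y ^ 2 / 2) - W ^ 2 / 2 * h := by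
    have : ∀ y, (v y - W) ^ 2 / 2 = v y ^ 2 / 2 - W * v y + W ^ 2 / 2 := fun y => by ring
    simp_rw [this]
    rw [intervalIntegral.integral_add (hii2.sub (hii.const_mul _)) intervalIntegrable_const,
      intervalIntegral.integral_sub hii2 (hii.const_mul _), intervalIntegral.integral_const_mul, hWh]
    simp; ring
  rw [e] at h0
  rw [sub_nonneg, le_div_iff₀ hh]; linarith
lemma core1 {v ψ ψ' g gd : ℝ → ℝ} {M h C1 Kt Gd R t : ℝ} (hm : Measurable v) (hM : ∀ x, |v x| ≤ M)
    (hh : 0 < h) (ht : 0 < t) (hψ : ∀ x, HasDerivAt ψ (ψ' x) x) (hψ'c : Continuous ψ') (hψ0 : ∀ x, 0 ≤ ψ x)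
    (hR : 0 < R) (hψR : ψ (-R) = 0) (hψz : ψ 0 = 0) (hC1 : ∀ x, |ψ' x| ≤ C1) (hb : ∀ x, ψ x ≤ Kt * t)
    (hosl : ∀ x, x < 0 → v x - v (x - h) ≤ h / t)
    (hg : ∀ s, HasDerivAt g (gd s) s) (hgd : ∀ s, 0 ≤ gd s) (hGd : ∀ s, gd s ≤ Gd)
    (hg1 : ∀ s, |g s| ≤ 1) :
    -(C1 + Kt * Gd) * (∫ x in (-R)..0, ((∫ y in (x-h)..x, v y ^ 2 / 2) / h - ((∫ y in (x-h)..x, v y) / h) ^ 2 / 2)) ≤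
    ∫ x in (-R)..0, g ((∫ y in (x-h)..x, v y) / h) * ((v x ^ 2 / 2 - v (x - h) ^ 2 / 2) / h -
        (∫ y in (x-h)..x, v y) / h * ((v x - v (x - h)) / h)) * ψ x := by
  have hM2 : ∀ x, |v x ^ 2 / 2| ≤ M ^ 2 / 2 := fun x => by
    have := hM x
    rw [abs_of_nonneg (by positivity), ← sq_abs]
    have h0 := abs_nonneg (v x)
    nlinarith
  set W : ℝ → ℝ := fun x => (∫ y in (x-h)..x, v y) / h with hW
  set Q : ℝ → ℝ := fun x => (∫ y in (x-h)..x, v y ^ 2 / 2) / h with hQ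
  set r : ℝ → ℝ := fun x => Q x - W x ^ 2 / 2 with hr
  have hr0 : ∀ x, 0 ≤ r x := avg_jensen hm hM hh
  obtain ⟨CW, hCW⟩ := avg_lip hm hM h
  obtain ⟨CQ, hCQ⟩ := avg_lip (v := fun x => v x ^ 2 / 2) (by fun_prop) hM2 h
  have dW := avg_deriv hm hM h
  have dQ := avg_deriv (v := fun x => v x ^ 2 / 2) (by fun_prop) hM2 h
  have acW : AbsolutelyContinuousOnInterval W (-R) 0 := hCW.lipschitzOnWith.absolutelyContinuousOnInterval
  have acQ : AbsolutelyContinuousOnInterval Q (-R) 0 := hCQ.lipschitzOnWith.absolutelyContinuousOnInterval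
  have acr : AbsolutelyContinuousOnInterval r (-R) 0 := by
    have := acQ.sub ((acW.mul acW).const_mul (1/2))
    have e : r = Q - fun x => 1 / 2 * (W * W) x := by
      ext x; simp only [hr, Pi.sub_apply, Pi.mul_apply]; ring
    rw [e]; exact this
  have hglip : LipschitzWith (Real.toNNReal Gd) g := by
    apply lipschitzWith_of_nnnorm_deriv_le (fun s => (hg s).differentiableAt)
    intro s
    rw [(hg s).deriv, ← NNReal.coe_le_coe, Real.coe_toNNReal _ ((hgd 0).trans (hGd 0)), coe_nnnorm,
      Real.norm_eq_abs, abs_of_nonneg (hgd s)]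
    exact hGd s
  have acg : AbsolutelyContinuousOnInterval (fun x => g (W x)) (-R) 0 :=
    (hglip.comp hCW).lipschitzOnWith.absolutelyContinuousOnInterval
  have hψlip : LipschitzWith (Real.toNNReal C1) ψ := by
    apply lipschitzWith_of_nnnorm_deriv_le (fun s => (hψ s).differentiableAt)
    intro s
    rw [(hψ s).deriv, ← NNReal.coe_le_coe, Real.coe_toNNReal _ ((abs_nonneg _).trans (hC1 0)), coe_nnnorm,
      Real.norm_eq_abs]
    exact hC1 s
  have acψ : AbsolutelyContinuousOnInterval ψ (-R) 0 := hψlip.lipschitzOnWith.absolutelyContinuousOnInterval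
  have acG : AbsolutelyContinuousOnInterval (fun x => g (W x) * ψ x) (-R) 0 := acg.mul acψ
  have key := acG.integral_mul_deriv_eq_deriv_mul acr
  simp only [hψR, hψz, mul_zero, zero_mul, sub_zero, zero_sub] at key
  have e1 : ∫ x in (-R)..0, g (W x) * ((v x ^ 2 / 2 - v (x - h) ^ 2 / 2) / h -
        W x * ((v x - v (x - h)) / h)) * ψ x = ∫ x in (-R)..0, g (W x) * ψ x * deriv r x := by
    apply intervalIntegral.integral_congr_ae
    filter_upwards [dW, dQ] with x h1 h2 _
    have h3 : HasDerivAt r ((v x ^ 2 / 2 - v (x - h) ^ 2 / 2) / h - W x * ((v x - v (x - h)) / h)) x := by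
      have h1' : HasDerivAt W ((v x - v (x - h)) / h) x := h1
      have h2' : HasDerivAt Q ((v x ^ 2 / 2 - v (x - h) ^ 2 / 2) / h) x := h2
      have := h2'.sub ((h1'.mul h1').div_const 2)
      have e : r = Q - fun x => (W * W) x / 2 := by
        ext x; simp only [hr, Pi.sub_apply, Pi.mul_apply]; ring
      rw [e]
      refine this.congr_deriv ?_
      ring
    rw [h3.deriv]; ring
  rw [e1, key, neg_mul, neg_le_neg_iff, ← intervalIntegral.integral_const_mul]
  apply intervalIntegral.integral_mono_ae_restrict (by linarith)
  · exact acG.intervalIntegrable_deriv.mul_continuousOn acr.continuousOn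
  · exact (acr.continuousOn.intervalIntegrable).const_mul _
  · rw [EventuallyLE, ae_restrict_iff' measurableSet_Icc]
    filter_upwards [dW, (measure_eq_zero_iff_ae_notMem.1 (measure_singleton (0:ℝ)) : ∀ᵐ x : ℝ, x ∉ ({0}: Set ℝ))] with x h1 h2 h3
    have hx : x < 0 := lt_of_le_of_ne h3.2 h2
    have hd : HasDerivAt (fun x => g (W x) * ψ x) (gd (W x) * ((v x - v (x - h)) / h) * ψ x + g (W x) * ψ' x) x :=
      ((hg (W x)).comp x h1).mul (hψ x)
    rw [hd.deriv]
    apply mul_le_mul_of_nonneg_right _ (hr0 x)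
    have b1 : g (W x) * ψ' x ≤ C1 := by
      refine (le_abs_self _).trans ?_
      rw [abs_mul]
      calc _ ≤ 1 * |ψ' x| := mul_le_mul_of_nonneg_right (hg1 _) (abs_nonneg _)
        _ ≤ C1 := by rw [one_mul]; exact hC1 x
    have b2 : (v x - v (x - h)) / h ≤ 1 / t := by
      rw [div_le_div_iff₀ hh ht]
      have := hosl x hx
      rw [le_div_iff₀ ht] at this; linarith
    have b3 : gd (W x) * ((v x - v (x - h)) / h) * ψ x ≤ Kt * Gd := by
      calc _ ≤ gd (W x) * (1 / t) * ψ x := by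
            apply mul_le_mul_of_nonneg_right _ (hψ0 x)
            exact mul_le_mul_of_nonneg_left b2 (hgd _)
        _ ≤ Gd * (1 / t) * (Kt * t) := by
            apply mul_le_mul _ (hb x) (hψ0 x) (by have := (hgd 0).trans (hGd 0); positivity)
            exact mul_le_mul_of_nonneg_right (hGd _) (by positivity)
        _ = _ := by field_simp
    linarith
end

section
lemma avg_eq (v : ℝ → ℝ) (x : ℝ) {h : ℝ} (hh : 0 < h) :
    (∫ y in (x-h)..x, v y) / h = ∫ z in (0:ℝ)..1, v (x - h * z) := by
  rw [intervalIntegral.integral_comp_sub_mul (f := v) hh.ne']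
  simp [div_eq_inv_mul]
lemma avg_meas {F : ℝ × ℝ → ℝ} (hF : Measurable F) (h : ℝ) :
    Measurable (fun p : ℝ × ℝ => ∫ z in (0:ℝ)..1, F (p.1 - h * z, p.2)) := by
  simp_rw [intervalIntegral.integral_of_le zero_le_one]
  apply StronglyMeasurable.measurable
  apply StronglyMeasurable.integral_prod_right (f := fun (p : ℝ × ℝ) (z : ℝ) => F (p.1 - h * z, p.2))
  apply Measurable.stronglyMeasurable
  exact hF.comp (by fun_prop)
lemma avg_bd {v : ℝ → ℝ} {M : ℝ} (hM : ∀ x, |v x| ≤ M) (x h : ℝ) :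
    |∫ z in (0:ℝ)..1, v (x - h * z)| ≤ M := by
  have := intervalIntegral.norm_integral_le_of_norm_le_const (a := 0) (b := 1) (f := fun z => v (x - h * z))
    (C := M) (fun z _ => hM _)
  simpa using this
lemma avg_tendsto {v : ℝ → ℝ} {M : ℝ} (hm : Measurable v) (hM : ∀ x, |v x| ≤ M) {x l : ℝ}
    (hl : Tendsto v (nhdsWithin x (Iio x)) (nhds l)) :
    Tendsto (fun n : ℕ => ∫ z in (0:ℝ)..1, v (x - 1 / ((n:ℝ) + 1) * z)) atTop (nhds l) := by
  have : l = ∫ z in (0:ℝ)..1, l := by simp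
  rw [this]
  apply intervalIntegral.tendsto_integral_filter_of_dominated_convergence (fun _ => M)
  · exact Eventually.of_forall fun n => (hm.comp (by fun_prop)).aestronglyMeasurable
  · exact Eventually.of_forall fun n => Eventually.of_forall fun z _ => hM _
  · exact intervalIntegrable_const
  · refine Eventually.of_forall fun z hz => ?_
    rw [uIoc_of_le zero_le_one] at hz
    apply hl.comp
    apply tendsto_nhdsWithin_of_tendsto_nhds_of_eventually_within
    · have : Tendsto (fun n : ℕ => x - 1 / ((n:ℝ) + 1) * z) atTop (nhds (x - 0 * z)) :=
        tendsto_const_nhds.sub (tendsto_one_div_add_atTop_nhds_zero_nat.mul_const z)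
      simpa using this
    · refine Eventually.of_forall fun n => ?_
      have : 0 < 1 / ((n:ℝ) + 1) * z := mul_pos (by positivity) hz.1
      show x - _ < x
      linarith
structure LHyp (U : ℝ × ℝ → ℝ) (u : ℝ → ℝ → ℝ) : Prop extends Pot U u where
  ftc : ∀ t, 0 < t → ∀ x y, U (x, t) - U (y, t) = ∫ s in y..x, u s t
  osl : ∀ t, 0 < t → ∀ x y, y < x → x < 0 → u x t - u y t ≤ (x - y) / t
  ll : ∀ t, 0 < t → ∀ x, x < 0 → ∃ l, Tendsto (fun y => u y t) (nhdsWithin x (Iio x)) (nhds l)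
lemma sq2_bd {a M : ℝ} (h : |a| ≤ M) : |a ^ 2 / 2| ≤ M ^ 2 / 2 := by
  rw [abs_of_nonneg (by positivity), ← sq_abs]
  have h0 := abs_nonneg a
  nlinarith
lemma kru_step {U : ℝ × ℝ → ℝ} {u : ℝ → ℝ → ℝ} (P : LHyp U u) {M : ℝ} (hM : ∀ x t, |u x t| ≤ M)
    {g gd η q q' : ℝ → ℝ} {Gd Cq : ℝ}
    (hg : ∀ s, HasDerivAt g (gd s) s) (hgd : ∀ s, 0 ≤ gd s) (hGd : ∀ s, gd s ≤ Gd)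
    (hg1 : ∀ s, |g s| ≤ 1) (hη : ∀ s, HasDerivAt η (g s) s) (hq : ∀ s, HasDerivAt q (q' s) s)
    (hqM : ∀ s, |s| ≤ M → q' s = s * g s) (hqb : ∀ s, |q' s| ≤ Cq)
    {φ : ℝ → ℝ → ℝ} (h1 : ContDiff ℝ 1 (fun p : ℝ × ℝ => φ p.1 p.2))
    (h2 : HasCompactSupport (fun p : ℝ × ℝ => φ p.1 p.2)) (h0 : ∀ x t, 0 ≤ φ x t)
    (h3 : ∀ x t, 0 ≤ x ∨ t ≤ 0 → φ x t = 0) {R C1 : ℝ} (hR : 0 < R)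
    (hbox : ∀ x t, (R ≤ |x| ∨ R < |t|) → φ x t = 0) (hCx : ∀ x t, |deriv (fun y => φ y t) x| ≤ C1)
    (hCt : ∀ x t, |deriv (fun s => φ x s) t| ≤ C1) {h : ℝ} (hh : 0 < h) :
    -(C1 + C1 * Gd) * (∫ p : ℝ × ℝ, (Ioc (-R) 0 ×ˢ Ioc 0 R).indicator (fun p : ℝ × ℝ =>
      (∫ z in (0:ℝ)..1, u (p.1 - h * z) p.2 ^ 2 / 2) - (∫ z in (0:ℝ)..1, u (p.1 - h * z) p.2) ^ 2 / 2) p) ≤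
    ∫ p : ℝ × ℝ, (η ((U p - U (p.1 - h, p.2)) / h) * deriv (fun s => φ p.1 s) p.2 +
      q ((U p - U (p.1 - h, p.2)) / h) * deriv (fun y => φ y p.2) p.1) := by
  obtain ⟨C, hC⟩ := P.lip
  have hmu : Measurable (fun p : ℝ × ℝ => u p.1 p.2) := P.meas
  have hmt : ∀ t, Measurable (fun x => u x t) := fun t => hmu.comp (f := fun x => (x, t)) (by fun_prop)
  have hsh : LipschitzWith 1 (fun p : ℝ × ℝ => (p.1 - h, p.2)) := by
    refine LipschitzWith.of_dist_le_mul fun p p' => ?_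
    rw [Prod.dist_eq, Prod.dist_eq]; simp
  have hlw : ∃ C' : NNReal, LipschitzWith C' (fun p : ℝ × ℝ => (U p - U (p.1 - h, p.2)) / h) := by
    refine ⟨(‖h⁻¹‖₊) * (C + C * 1), ?_⟩
    have := (lipschitzWith_smul (h⁻¹ : ℝ) (β := ℝ)).comp (hC.sub (hC.comp hsh))
    have e : (fun p : ℝ × ℝ => (U p - U (p.1 - h, p.2)) / h) = (fun x => h⁻¹ • x) ∘ (fun p => U p - (U ∘ fun p : ℝ × ℝ => (p.1 - h, p.2)) p) := by
      ext p; simp [div_eq_inv_mul]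
    rw [e]; exact this
  obtain ⟨C', hw⟩ := hlw
  set w : ℝ × ℝ → ℝ := fun p => (U p - U (p.1 - h, p.2)) / h with hwdef
  have hηl : LipschitzWith 1 η := by
    apply lipschitzWith_of_nnnorm_deriv_le (fun s => (hη s).differentiableAt)
    intro s
    rw [(hη s).deriv, ← NNReal.coe_le_coe]; exact hg1 s
  have hql : LipschitzWith (Real.toNNReal Cq) q := by
    apply lipschitzWith_of_nnnorm_deriv_le (fun s => (hq s).differentiableAt)
    intro s
    rw [(hq s).deriv, ← NNReal.coe_le_coe, Real.coe_toNNReal _ ((abs_nonneg _).trans (hqb 0))]; exact hqb s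
  have hqmp : Measure.QuasiMeasurePreserving (fun p : ℝ × ℝ => (p.1 - h, p.2)) volume volume := by
    have := (measurePreserving_sub_right (volume : Measure (ℝ × ℝ)) (h, 0)).quasiMeasurePreserving
    convert this using 2 with p
    ext <;> simp
  have hwe : ∀ p : ℝ × ℝ, 0 < p.2 → w p = ∫ z in (0:ℝ)..1, u (p.1 - h * z) p.2 := by
    intro p hp
    rw [← avg_eq (fun y => u y p.2) p.1 hh, ← P.ftc _ hp]
  have hwM : ∀ p : ℝ × ℝ, 0 < p.2 → |w p| ≤ M := by
    intro p hp
    rw [hwe p hp]; exact avg_bd (fun x => hM x p.2) _ _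
  have hpos : ∀ p : ℝ × ℝ, φ p.1 p.2 ≠ 0 → 0 < p.2 := fun p hne => by
    by_contra hc; exact hne (h3 _ _ (Or.inr (not_lt.1 hc)))
  have a1 := ibp_t (F := fun p => η (w p)) (F' := fun p => g (w p) * ((-(u p.1 p.2 ^ 2 / 2) - -(u (p.1 - h) p.2 ^ 2 / 2)) / h))
    (hηl.comp hw) h1 h2 (by
      filter_upwards [P.dt, hqmp.ae P.dt] with p d1 d2 hne
      have hp := hpos p hne
      exact (hη (w p)).comp p.2 (((d1 hp).sub (d2 hp)).div_const h))
  have a2 := ibp_x (F := fun p => q (w p)) (F' := fun p => q' (w p) * ((u p.1 p.2 - u (p.1 - h) p.2) / h))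
    (hql.comp hw) h1 h2 (by
      filter_upwards [P.dx, hqmp.ae P.dx] with p d1 d2 hne
      have hp := hpos p hne
      have d2' := (d2 hp).comp_sub_const p.1 h
      exact (hq (w p)).comp p.1 (((d1 hp).sub d2').div_const h))
  have i1 : Integrable (fun p : ℝ × ℝ => η (w p) * deriv (fun s => φ p.1 s) p.2) :=
    ((hηl.continuous.comp hw.continuous).mul (tf_dt_cont h1)).integrable_of_hasCompactSupport (tf_dt_supp h1 h2).mul_left
  have i2 : Integrable (fun p : ℝ × ℝ => q (w p) * deriv (fun y => φ y p.2) p.1) :=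
    ((hql.continuous.comp hw.continuous).mul (tf_dx_cont h1)).integrable_of_hasCompactSupport (tf_dx_supp h1 h2).mul_left
  have hgc : Continuous g := continuous_iff_continuousAt.2 fun s => (hg s).continuousAt
  have mq' : Measurable q' := by
    have : q' = deriv q := by ext s; rw [(hq s).deriv]
    rw [this]; exact measurable_deriv q
  have hmus : Measurable (fun p : ℝ × ℝ => u (p.1 - h) p.2) := hmu.comp (f := fun p : ℝ × ℝ => (p.1 - h, p.2)) (by fun_prop)
  have mw : Measurable w := hw.continuous.measurable
  have hC10 : 0 ≤ C1 := (abs_nonneg _).trans (hCx 0 0)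
  have i3 : Integrable (fun p : ℝ × ℝ => g (w p) * ((-(u p.1 p.2 ^ 2 / 2) - -(u (p.1 - h) p.2 ^ 2 / 2)) / h) * φ p.1 p.2) := by
    apply cs_integrable (M := 1 * ((M^2/2 + M^2/2)/h)) _ _ h1.continuous h2
    · exact (hgc.measurable.comp mw).mul (by fun_prop)
    · intro p
      rw [abs_mul, abs_div, abs_of_pos hh]
      gcongr
      · exact hg1 _
      · refine (abs_sub _ _).trans ?_
        rw [abs_neg, abs_neg]
        exact add_le_add (sq2_bd (hM _ _)) (sq2_bd (hM _ _))
  have i4 : Integrable (fun p : ℝ × ℝ => q' (w p) * ((u p.1 p.2 - u (p.1 - h) p.2) / h) * φ p.1 p.2) := by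
    apply cs_integrable (M := Cq * ((M + M)/h)) _ _ h1.continuous h2
    · exact (mq'.comp mw).mul (by fun_prop)
    · intro p
      rw [abs_mul, abs_div, abs_of_pos hh]
      have := (abs_nonneg _).trans (hqb 0)
      gcongr
      · exact hqb _
      · exact (abs_sub _ _).trans (add_le_add (hM _ _) (hM _ _))
  rw [integral_add i1 i2, a1, a2, ← neg_add, ← integral_add i3 i4, ← integral_neg]
  set J : ℝ × ℝ → ℝ := fun p => -(g (w p) * ((-(u p.1 p.2 ^ 2 / 2) - -(u (p.1 - h) p.2 ^ 2 / 2)) / h) * φ p.1 p.2 +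
    q' (w p) * ((u p.1 p.2 - u (p.1 - h) p.2) / h) * φ p.1 p.2) with hJ
  have iJ : Integrable J := (i3.add i4).neg
  set r : ℝ × ℝ → ℝ := fun p : ℝ × ℝ =>
      (∫ z in (0:ℝ)..1, u (p.1 - h * z) p.2 ^ 2 / 2) - (∫ z in (0:ℝ)..1, u (p.1 - h * z) p.2) ^ 2 / 2 with hr
  have mr : Measurable r := by
    apply Measurable.sub
    · exact avg_meas (F := fun p => u p.1 p.2 ^ 2 / 2) (by fun_prop) h
    · exact ((avg_meas (F := fun p => u p.1 p.2) (by fun_prop) h).pow_const 2).div_const 2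
  have br : ∀ p, |r p| ≤ M ^ 2 / 2 + M ^ 2 / 2 := fun p => (abs_sub _ _).trans
    (add_le_add (avg_bd (v := fun y => u y p.2 ^ 2 / 2) (fun x => sq2_bd (hM x p.2)) _ _)
     (sq2_bd (avg_bd (fun x => hM x p.2) _ _)))
  have hbx : MeasurableSet (Ioc (-R) 0 ×ˢ Ioc 0 R : Set (ℝ × ℝ)) := measurableSet_Ioc.prod measurableSet_Ioc
  have ir : Integrable ((Ioc (-R) 0 ×ˢ Ioc 0 R).indicator r) := by
    rw [integrable_indicator_iff hbx]
    refine Measure.integrableOn_of_bounded (M := M ^ 2 / 2 + M ^ 2 / 2) ?_ ?_ ?_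
    · rw [Measure.volume_eq_prod, Measure.prod_prod]
      exact (ENNReal.mul_lt_top measure_Ioc_lt_top measure_Ioc_lt_top).ne
    · exact mr.aestronglyMeasurable
    · exact Eventually.of_forall br
  rw [← integral_const_mul]
  show (∫ p, _ ∂(Measure.prod volume volume)) ≤ ∫ p, J p ∂(Measure.prod volume volume)
  rw [integral_prod_symm _ (ir.const_mul _), integral_prod_symm _ iJ]
  apply integral_mono (ir.const_mul _).integral_prod_right iJ.integral_prod_right
  intro t
  show (∫ x, _) ≤ ∫ x, _
  by_cases ht : t ∈ Ioc 0 R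
  swap
  · have e1 : ∀ x, φ x t = 0 := by
      intro x
      by_cases h4 : t ≤ 0
      · exact h3 _ _ (Or.inr h4)
      · refine hbox x t (Or.inr ?_)
        have : R < t := by by_contra hc; exact ht ⟨not_le.1 h4, not_lt.1 hc⟩
        exact this.trans_le (le_abs_self t)
    have e2 : ∀ x, ((Ioc (-R) 0 ×ˢ Ioc 0 R).indicator r) (x, t) = 0 := fun x =>
      indicator_of_notMem (fun hc => ht hc.2) _
    simp [hJ, e1, e2]
  have hψR : φ (-R) t = 0 := hbox _ _ (Or.inl (by simp [abs_of_pos hR]))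
  have hb : ∀ x, φ x t ≤ C1 * t := by
    intro x
    have hd : ∀ s ∈ (univ : Set ℝ), HasDerivWithinAt (fun s => φ x s) (deriv (fun s => φ x s) s) univ s := fun s _ =>
      ((tf_hasDt h1 x s).differentiableAt.hasDerivAt).hasDerivWithinAt
    have := convex_univ.norm_image_sub_le_of_norm_hasDerivWithin_le hd (fun s _ => hCt x s) (mem_univ 0) (mem_univ t)
    simp only [h3 x 0 (Or.inr le_rfl), sub_zero, Real.norm_eq_abs, abs_of_pos ht.1] at this
    exact (le_abs_self _).trans this
  have key := core1 (v := fun x => u x t) (ψ := fun x => φ x t) (ψ' := fun x => deriv (fun y => φ y t) x)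
    (C1 := C1) (Kt := C1) (Gd := Gd) (hmt t) (fun x => hM x t) hh ht.1
    (fun x => (tf_hasDx h1 x t).differentiableAt.hasDerivAt)
    ((tf_dx_cont h1).comp (f := fun x : ℝ => (x, t)) (by fun_prop)) (fun x => h0 x t) hR
    hψR (h3 _ _ (Or.inl le_rfl)) (fun x => hCx x t) hb
    (fun x hx => by simpa using P.osl t ht.1 x (x - h) (by linarith) hx) hg hgd hGd hg1
  have E1 : ∫ x, -(C1 + C1 * Gd) * ((Ioc (-R) 0 ×ˢ Ioc 0 R).indicator r) (x, t) =
    -(C1 + C1 * Gd) * (∫ x in (-R)..0, ((∫ y in (x-h)..x, u y t ^ 2 / 2) / h - ((∫ y in (x-h)..x, u y t) / h) ^ 2 / 2)) := by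
    rw [integral_const_mul, intervalIntegral.integral_of_le (by linarith), ← integral_indicator measurableSet_Ioc]
    congr 2; ext x
    by_cases hx : x ∈ Ioc (-R) 0
    · rw [indicator_of_mem (show (x, t) ∈ Ioc (-R) 0 ×ˢ Ioc 0 R from ⟨hx, ht⟩), indicator_of_mem hx,
        avg_eq (fun y => u y t) x hh, avg_eq (fun y => u y t ^ 2 / 2) x hh]
    · rw [indicator_of_notMem (fun hc => hx hc.1), indicator_of_notMem hx]
  have E2 : ∫ x, J (x, t) = ∫ x in (-R)..0, g ((∫ y in (x-h)..x, u y t) / h) * ((u x t ^ 2 / 2 - u (x - h) t ^ 2 / 2) / h -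
        (∫ y in (x-h)..x, u y t) / h * ((u x t - u (x - h) t) / h)) * φ x t := by
    rw [intervalIntegral.integral_of_le (by linarith), ← integral_indicator measurableSet_Ioc]
    congr 1; ext x
    by_cases hx : x ∈ Ioc (-R) 0
    · rw [indicator_of_mem hx]
      have e : (∫ y in (x-h)..x, u y t) / h = w (x, t) := by
        rw [hwe _ ht.1, avg_eq (fun y => u y t) x hh]
      rw [e]
      simp only [hJ]
      rw [hqM _ (hwM (x, t) ht.1)]; ring
    · rw [indicator_of_notMem hx]
      have : φ x t = 0 := by
        by_cases h4 : 0 ≤ x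
        · exact h3 _ _ (Or.inl h4)
        · refine hbox _ _ (Or.inl ?_)
          push Not at h4
          rw [abs_of_neg h4]
          by_contra hc
          exact hx ⟨by linarith, h4.le⟩
      simp [hJ, this]
  exact (E1.trans_le key).trans_eq E2.symm
end

section
lemma tf_zero_dx {φ : ℝ → ℝ → ℝ} (h3 : ∀ x t, t ≤ 0 → φ x t = 0) {p : ℝ × ℝ} (hp : p.2 < 0) :
    deriv (fun y => φ y p.2) p.1 = 0 := by
  have : (fun y => φ y p.2) = fun _ => 0 := by
    ext y; exact h3 _ _ hp.le
  rw [this]; simp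
lemma kru_lim {U : ℝ × ℝ → ℝ} {u : ℝ → ℝ → ℝ} (P : LHyp U u) {M : ℝ} (hM : ∀ x t, |u x t| ≤ M)
    {g gd η q q' : ℝ → ℝ} {Gd Cq : ℝ}
    (hg : ∀ s, HasDerivAt g (gd s) s) (hgd : ∀ s, 0 ≤ gd s) (hGd : ∀ s, gd s ≤ Gd)
    (hg1 : ∀ s, |g s| ≤ 1) (hη : ∀ s, HasDerivAt η (g s) s) (hq : ∀ s, HasDerivAt q (q' s) s)
    (hqM : ∀ s, |s| ≤ M → q' s = s * g s) (hqb : ∀ s, |q' s| ≤ Cq)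
    {φ : ℝ → ℝ → ℝ} (h1 : ContDiff ℝ 1 (fun p : ℝ × ℝ => φ p.1 p.2))
    (h2 : HasCompactSupport (fun p : ℝ × ℝ => φ p.1 p.2)) (h0 : ∀ x t, 0 ≤ φ x t)
    (h3 : ∀ x t, 0 ≤ x ∨ t ≤ 0 → φ x t = 0) :
    0 ≤ ∫ p : ℝ × ℝ, (η (u p.1 p.2) * deriv (fun s => φ p.1 s) p.2 +
      q (u p.1 p.2) * deriv (fun y => φ y p.2) p.1) := by
  obtain ⟨R, hR, hbox⟩ := cs_box h2
  obtain ⟨Ca, _, hCa⟩ := cs_bdd (tf_dx_cont h1) (tf_dx_supp h1 h2)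
  obtain ⟨Cb, _, hCb⟩ := cs_bdd (tf_dt_cont h1) (tf_dt_supp h1 h2)
  obtain ⟨C, hC⟩ := P.lip
  have hmu : Measurable (fun p : ℝ × ℝ => u p.1 p.2) := P.meas
  have hηc : Continuous η := continuous_iff_continuousAt.2 fun s => (hη s).continuousAt
  have hqc : Continuous q := continuous_iff_continuousAt.2 fun s => (hq s).continuousAt
  set r : ℕ → ℝ × ℝ → ℝ := fun n p =>
    (∫ z in (0:ℝ)..1, u (p.1 - 1 / ((n:ℝ) + 1) * z) p.2 ^ 2 / 2) - (∫ z in (0:ℝ)..1, u (p.1 - 1 / ((n:ℝ) + 1) * z) p.2) ^ 2 / 2 with hr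
  have step : ∀ n : ℕ, _ := fun n => kru_step P hM hg hgd hGd hg1 hη hq hqM hqb h1 h2 h0 h3 (R := R + 1)
    (C1 := max Ca Cb) (by linarith) (fun x t h => hbox x t (h.imp (fun h => by linarith) (fun h => by linarith)))
    (fun x t => (hCa (x, t)).trans (le_max_left _ _))
    (fun x t => (hCb (x, t)).trans (le_max_right _ _)) (h := 1 / ((n:ℝ) + 1)) (by positivity)
  have hbx : MeasurableSet (Ioc (-(R+1)) 0 ×ˢ Ioc 0 (R+1) : Set (ℝ × ℝ)) := measurableSet_Ioc.prod measurableSet_Ioc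
  have mr : ∀ n, Measurable (r n) := fun n => by
    apply Measurable.sub
    · exact avg_meas (F := fun p => u p.1 p.2 ^ 2 / 2) (by fun_prop) _
    · exact ((avg_meas (F := fun p => u p.1 p.2) (by fun_prop) _).pow_const 2).div_const 2
  have br : ∀ n p, |r n p| ≤ M ^ 2 / 2 + M ^ 2 / 2 := fun n p => (abs_sub _ _).trans
    (add_le_add (avg_bd (v := fun y => u y p.2 ^ 2 / 2) (fun x => sq2_bd (hM x p.2)) _ _)
     (sq2_bd (avg_bd (fun x => hM x p.2) _ _)))
  have lr : Tendsto (fun n => ∫ p, (Ioc (-(R+1)) 0 ×ˢ Ioc 0 (R+1)).indicator (r n) p) atTop (nhds (∫ p : ℝ × ℝ, 0)) := by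
    refine tendsto_integral_of_dominated_convergence
      ((Ioc (-(R+1)) 0 ×ˢ Ioc 0 (R+1)).indicator fun _ => M ^ 2 / 2 + M ^ 2 / 2) ?_ ?_ ?_ ?_
    · exact fun n => ((mr n).indicator hbx).aestronglyMeasurable
    · rw [integrable_indicator_iff hbx]
      refine integrableOn_const ?_
      rw [Measure.volume_eq_prod, Measure.prod_prod]
      exact (ENNReal.mul_lt_top measure_Ioc_lt_top measure_Ioc_lt_top).ne
    · intro n
      refine Eventually.of_forall fun p => ?_
      rw [norm_indicator_eq_indicator_norm]
      exact indicator_le_indicator (br n p)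
    · filter_upwards [ae_fst_ne 0] with p hp
      by_cases hpm : p ∈ (Ioc (-(R+1)) 0 ×ˢ Ioc 0 (R+1))
      · simp_rw [indicator_of_mem hpm]
        have hx : p.1 < 0 := lt_of_le_of_ne hpm.1.2 hp
        obtain ⟨l, hl⟩ := P.ll p.2 hpm.2.1 p.1 hx
        have hmt : Measurable (fun x => u x p.2) := hmu.comp (f := fun x => (x, p.2)) (by fun_prop)
        have t1 := avg_tendsto hmt (fun x => hM x p.2) hl
        have t2 := avg_tendsto (v := fun x => u x p.2 ^ 2 / 2) (by fun_prop) (fun x => sq2_bd (hM x p.2)) ((hl.pow 2).div_const 2)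
        have := t2.sub ((t1.pow 2).div_const 2)
        rwa [sub_self] at this
      · simp_rw [indicator_of_notMem hpm]; exact tendsto_const_nhds
  rw [integral_zero] at lr
  -- bound of the quotient
  have hwb : ∀ (n : ℕ) (p : ℝ × ℝ), |(U p - U (p.1 - 1 / ((n:ℝ) + 1), p.2)) / (1 / ((n:ℝ) + 1))| ≤ C := by
    intro n p
    have hh : 0 < 1 / ((n:ℝ) + 1) := by positivity
    rw [abs_div, abs_of_pos hh, div_le_iff₀ hh]
    have := hC.dist_le_mul p (p.1 - 1 / ((n:ℝ) + 1), p.2)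
    rw [Real.dist_eq] at this
    refine this.trans_eq ?_
    congr 1
    rw [Prod.dist_eq, Real.dist_eq]
    simp only [sub_sub_cancel, dist_self]
    rw [abs_of_pos hh, max_eq_left hh.le]
  obtain ⟨Cη, hCη⟩ := (isCompact_Icc (a := -(C:ℝ)) (b := C)).exists_bound_of_continuousOn hηc.continuousOn
  obtain ⟨Cqq, hCqq⟩ := (isCompact_Icc (a := -(C:ℝ)) (b := C)).exists_bound_of_continuousOn hqc.continuousOn
  have ll : Tendsto (fun n : ℕ => ∫ p : ℝ × ℝ, (η ((U p - U (p.1 - 1 / ((n:ℝ) + 1), p.2)) / (1 / ((n:ℝ) + 1))) * deriv (fun s => φ p.1 s) p.2 +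
      q ((U p - U (p.1 - 1 / ((n:ℝ) + 1), p.2)) / (1 / ((n:ℝ) + 1))) * deriv (fun y => φ y p.2) p.1)) atTop
      (nhds (∫ p : ℝ × ℝ, (η (u p.1 p.2) * deriv (fun s => φ p.1 s) p.2 +
      q (u p.1 p.2) * deriv (fun y => φ y p.2) p.1))) := by
    refine tendsto_integral_of_dominated_convergence
      (fun p => Cη * ‖deriv (fun s => φ p.1 s) p.2‖ + Cqq * ‖deriv (fun y => φ y p.2) p.1‖) ?_ ?_ ?_ ?_
    · intro n
      have hUc := hC.continuous
      have hws : Continuous (fun p : ℝ × ℝ => (U p - U (p.1 - 1 / ((n:ℝ) + 1), p.2)) / (1 / ((n:ℝ) + 1))) := by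
        refine (hUc.sub (hUc.comp (by fun_prop))).div_const _
      exact (((hηc.comp hws).mul (tf_dt_cont h1)).add ((hqc.comp hws).mul (tf_dx_cont h1))).aestronglyMeasurable
    · exact (((tf_dt_cont h1).integrable_of_hasCompactSupport (tf_dt_supp h1 h2)).norm.const_mul _).add
        (((tf_dx_cont h1).integrable_of_hasCompactSupport (tf_dx_supp h1 h2)).norm.const_mul _)
    · intro n
      refine Eventually.of_forall fun p => ?_
      refine (norm_add_le _ _).trans ?_
      rw [norm_mul, norm_mul]
      have := hwb n p
      rw [abs_le] at this
      gcongr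
      · exact hCη _ this
      · exact hCqq _ this
    · filter_upwards [P.dx, ae_snd_ne 0] with p hd hne
      rcases lt_or_gt_of_ne hne with hp | hp
      · rw [tf_zero_dt (fun x t h => h3 x t (Or.inr h)) hp, tf_zero_dx (fun x t h => h3 x t (Or.inr h)) hp]
        simp
      · have := diffquot_tendsto (hd hp)
        have t1 : Tendsto (fun n : ℕ => (U p - U (p.1 - 1 / ((n:ℝ) + 1), p.2)) / (1 / ((n:ℝ) + 1))) atTop (nhds (u p.1 p.2)) := by
          refine this.congr fun n => ?_
          rw [div_div_eq_mul_div, div_one, mul_comm]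
        exact (((hηc.tendsto _).comp t1).mul_const _).add (((hqc.tendsto _).comp t1).mul_const _)
  have := le_of_tendsto_of_tendsto (lr.const_mul (-(max Ca Cb + max Ca Cb * Gd))) ll (Eventually.of_forall step)
  simpa using this
lemma sgnapprox_tendsto (s : ℝ) : Tendsto (fun n : ℕ => Kst (((n:ℝ)+1) * s) - Kst (-(((n:ℝ)+1) * s))) atTop (nhds (Real.sign s)) := by
  have hlim : s ≠ 0 → Tendsto (fun n : ℕ => ((n:ℝ)+1) * |s|) atTop atTop := fun h =>
    (tendsto_natCast_atTop_atTop.atTop_add tendsto_const_nhds).atTop_mul_const (abs_pos.2 h)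
  rcases lt_trichotomy s 0 with h | h | h
  · rw [Real.sign_of_neg h]
    apply tendsto_const_nhds.congr'
    filter_upwards [(hlim h.ne).eventually_ge_atTop 1] with n hn
    rw [abs_of_neg h] at hn
    rw [Kst_zero (by linarith), Kst_one (by linarith)]; norm_num
  · simp [h]
  · rw [Real.sign_of_pos h]
    apply tendsto_const_nhds.congr'
    filter_upwards [(hlim h.ne').eventually_ge_atTop 1] with n hn
    rw [abs_of_pos h] at hn
    rw [Kst_one (by linarith), Kst_zero (by linarith)]; norm_num
lemma sgn_int (k b : ℝ) : ∫ s in k..b, Real.sign (s - k) = |b - k| := by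
  rcases le_total k b with h | h
  · rw [abs_of_nonneg (by linarith), intervalIntegral.integral_congr_ae (g := fun _ => 1)]
    · simp
    · refine Eventually.of_forall fun s hs => ?_
      rw [uIoc_of_le h] at hs
      exact Real.sign_of_pos (by linarith [hs.1])
  · rw [abs_of_nonpos (by linarith), intervalIntegral.integral_symm, intervalIntegral.integral_congr_ae (g := fun _ => -1)]
    · simp
    · filter_upwards [measure_eq_zero_iff_ae_notMem.1 (measure_singleton (k:ℝ))] with s hne hs
      rw [uIoc_of_le h] at hs
      exact Real.sign_of_neg (sub_neg.2 (lt_of_le_of_ne hs.2 hne))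
lemma sgn_int2 (k b : ℝ) : ∫ s in k..b, s * Real.sign (s - k) = Real.sign (b - k) * (b ^ 2 / 2 - k ^ 2 / 2) := by
  rcases lt_trichotomy k b with h | h | h
  · rw [Real.sign_of_pos (by linarith), intervalIntegral.integral_congr_ae (g := fun s => s)]
    · simp; ring
    · refine Eventually.of_forall fun s hs => ?_
      rw [uIoc_of_le h.le] at hs
      rw [Real.sign_of_pos (by linarith [hs.1]), mul_one]
  · simp [h]
  · rw [Real.sign_of_neg (by linarith), intervalIntegral.integral_symm, intervalIntegral.integral_congr_ae (g := fun s => -s)]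
    · rw [intervalIntegral.integral_neg, integral_id]; ring
    · filter_upwards [measure_eq_zero_iff_ae_notMem.1 (measure_singleton (k:ℝ))] with s hne hs
      rw [uIoc_of_le h.le] at hs
      rw [Real.sign_of_neg (sub_neg.2 (lt_of_le_of_ne hs.2 hne)), mul_neg_one]
lemma LHyp.kruzkov {U : ℝ × ℝ → ℝ} {u : ℝ → ℝ → ℝ} (P : LHyp U u) (k : ℝ) (φ : ℝ → ℝ → ℝ)
    (h1 : ContDiff ℝ 1 (fun p : ℝ × ℝ => φ p.1 p.2))
    (h2 : HasCompactSupport (fun p : ℝ × ℝ => φ p.1 p.2)) (h0 : ∀ x t, 0 ≤ φ x t)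
    (h3 : ∀ x t, 0 ≤ x ∨ t ≤ 0 → φ x t = 0) :
    0 ≤ ∫ p : ℝ × ℝ, (|u p.1 p.2 - k| * deriv (fun s => φ p.1 s) p.2 +
        Real.sign (u p.1 p.2 - k) * (fq (u p.1 p.2) - fq k) *
          deriv (fun y => φ y p.2) p.1) := by
  obtain ⟨M, hM⟩ := P.bdd
  have hM0 : 0 ≤ M := (abs_nonneg _).trans (hM 0 0)
  have hmu : Measurable (fun p : ℝ × ℝ => u p.1 p.2) := P.meas
  set M' := M + |k| with hM'
  have hMM : M ≤ M' := by have := abs_nonneg k; linarith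
  set g : ℕ → ℝ → ℝ := fun n s => Kst (((n:ℝ)+1) * (s - k)) - Kst (-(((n:ℝ)+1) * (s - k))) with hg
  have hgd : ∀ n s, HasDerivAt (g n) (((n:ℝ)+1) * (kap (((n:ℝ)+1) * (s - k)) + kap (-(((n:ℝ)+1) * (s - k))))) s := by
    intro n s
    have l1 : HasDerivAt (fun s => ((n:ℝ)+1) * (s - k)) ((n:ℝ)+1) s := by
      simpa using ((hasDerivAt_id s).sub_const k).const_mul ((n:ℝ)+1)
    have := ((Kst_deriv _).comp s l1).sub ((Kst_deriv _).comp s l1.neg)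
    exact this.congr_deriv (by simp only [Pi.neg_apply]; ring)
  have hgc : ∀ n, Continuous (g n) := fun n => continuous_iff_continuousAt.2 fun s => (hgd n s).continuousAt
  have hg1 : ∀ n s, |g n s| ≤ 1 := fun n s => by
    have a1 := Kst_nonneg (((n:ℝ)+1) * (s - k)); have a2 := Kst_le (((n:ℝ)+1) * (s - k))
    have a3 := Kst_nonneg (-(((n:ℝ)+1) * (s - k))); have a4 := Kst_le (-(((n:ℝ)+1) * (s - k)))
    rw [abs_le]; constructor <;> simp only [hg] <;> linarith
  set cl : ℝ → ℝ := fun s => max (-M') (min M' s) with hcl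
  have hM'0 : 0 ≤ M' := hM0.trans hMM
  have clb : ∀ s, |cl s| ≤ M' := fun s => by
    rw [abs_le]; exact ⟨le_max_left _ _, max_le (by linarith) (min_le_left _ _)⟩
  have clc : Continuous cl := by fun_prop
  have cle : ∀ s, |s| ≤ M' → cl s = s := fun s hs => by
    rw [abs_le] at hs
    simp only [hcl]; rw [min_eq_right hs.2, max_eq_right hs.1]
  set η : ℕ → ℝ → ℝ := fun n b => ∫ s in k..b, g n s with hη
  set q : ℕ → ℝ → ℝ := fun n b => ∫ s in k..b, cl s * g n s with hq
  have key : ∀ n : ℕ, 0 ≤ ∫ p : ℝ × ℝ, (η n (u p.1 p.2) * deriv (fun s => φ p.1 s) p.2 +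
      q n (u p.1 p.2) * deriv (fun y => φ y p.2) p.1) := fun n =>
    kru_lim (gd := fun s => ((n:ℝ)+1) * (kap (((n:ℝ)+1) * (s - k)) + kap (-(((n:ℝ)+1) * (s - k)))))
      (q' := fun s => cl s * g n s) (Gd := ((n:ℝ)+1) * (6 + 6)) (Cq := M' * 1) P hM (hgd n)
      (fun s => mul_nonneg (by positivity) (add_nonneg (kap_nonneg _) (kap_nonneg _)))
      (fun s => by gcongr <;> exact kap_le _) (hg1 n)
      (fun s => intervalIntegral.integral_hasDerivAt_right ((hgc n).intervalIntegrable _ _)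
        ((hgc n).stronglyMeasurableAtFilter _ _) (hgc n).continuousAt)
      (fun s => intervalIntegral.integral_hasDerivAt_right ((clc.mul (hgc n)).intervalIntegrable _ _)
        ((clc.mul (hgc n)).stronglyMeasurableAtFilter _ _) (clc.mul (hgc n)).continuousAt)
      (fun s hs => by rw [cle s (hs.trans hMM)])
      (fun s => by rw [abs_mul]; exact mul_le_mul (clb s) (hg1 n s) (abs_nonneg _) hM'0) h1 h2 h0 h3
  have hηb : ∀ n b, |b| ≤ M → |η n b| ≤ M' := by
    intro n b hb
    have := intervalIntegral.norm_integral_le_of_norm_le_const (a := k) (b := b) (f := g n) (C := 1) (fun z _ => hg1 n z)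
    refine this.trans ?_
    rw [one_mul]
    exact (abs_sub _ _).trans (by linarith)
  have hqb : ∀ n b, |b| ≤ M → |q n b| ≤ M' * M' := by
    intro n b hb
    have := intervalIntegral.norm_integral_le_of_norm_le_const (a := k) (b := b) (f := fun s => cl s * g n s) (C := M')
      (fun z _ => by
        rw [norm_mul]
        exact (mul_le_mul (clb z) (hg1 n z) (abs_nonneg _) hM'0).trans (by rw [mul_one]))
    refine this.trans (mul_le_mul_of_nonneg_left ?_ hM'0)
    exact (abs_sub _ _).trans (by linarith)
  have cη : ∀ n, Continuous (η n) := fun n => intervalIntegral.continuous_primitive (fun a b => (hgc n).intervalIntegrable a b) k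
  have cq : ∀ n, Continuous (q n) := fun n => intervalIntegral.continuous_primitive (fun a b => (clc.mul (hgc n)).intervalIntegrable a b) k
  have lη : ∀ b, Tendsto (fun n => η n b) atTop (nhds |b - k|) := by
    intro b
    rw [← sgn_int]
    apply intervalIntegral.tendsto_integral_filter_of_dominated_convergence (fun _ => 1)
    · exact Eventually.of_forall fun n => (hgc n).aestronglyMeasurable
    · exact Eventually.of_forall fun n => Eventually.of_forall fun z _ => hg1 n z
    · exact intervalIntegrable_const
    · exact Eventually.of_forall fun s _ => sgnapprox_tendsto (s - k)
  have lq : ∀ b, |b| ≤ M → Tendsto (fun n => q n b) atTop (nhds (Real.sign (b - k) * (b ^ 2 / 2 - k ^ 2 / 2))) := by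
    intro b hb
    rw [← sgn_int2]
    apply intervalIntegral.tendsto_integral_filter_of_dominated_convergence (fun _ => M' * 1)
    · exact Eventually.of_forall fun n => (clc.mul (hgc n)).aestronglyMeasurable
    · refine Eventually.of_forall fun n => Eventually.of_forall fun z _ => ?_
      rw [norm_mul]; exact (mul_le_mul (clb z) (hg1 n z) (abs_nonneg _) hM'0)
    · exact intervalIntegrable_const
    · refine Eventually.of_forall fun s hs => ?_
      have hs' : |s| ≤ M' := by
        have h5 : s ∈ uIcc k b := uIoc_subset_uIcc hs
        have hk : k ∈ Icc (-M') M' := by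
          constructor <;> [linarith [neg_abs_le k]; linarith [le_abs_self k]]
        have hb' : b ∈ Icc (-M') M' := by rw [abs_le] at hb; constructor <;> linarith
        exact abs_le.2 (uIcc_subset_Icc hk hb' h5)
      have := (sgnapprox_tendsto (s - k)).const_mul s
      simp only [cle s hs']
      exact this
  refine ge_of_tendsto' (f := fun n : ℕ => ∫ p : ℝ × ℝ, (η n (u p.1 p.2) * deriv (fun s => φ p.1 s) p.2 +
      q n (u p.1 p.2) * deriv (fun y => φ y p.2) p.1)) (x := atTop) ?_ key
  refine tendsto_integral_of_dominated_convergence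
      (fun p => M' * ‖deriv (fun s => φ p.1 s) p.2‖ + (M' * M') * ‖deriv (fun y => φ y p.2) p.1‖) ?_ ?_ ?_ ?_
  · intro n
    exact ((((cη n).measurable.comp hmu).mul (tf_dt_cont h1).measurable).add
      (((cq n).measurable.comp hmu).mul (tf_dx_cont h1).measurable)).aestronglyMeasurable
  · exact (((tf_dt_cont h1).integrable_of_hasCompactSupport (tf_dt_supp h1 h2)).norm.const_mul _).add
        (((tf_dx_cont h1).integrable_of_hasCompactSupport (tf_dx_supp h1 h2)).norm.const_mul _)
  · intro n
    refine Eventually.of_forall fun p => ?_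
    refine (norm_add_le _ _).trans ?_
    rw [norm_mul, norm_mul]
    gcongr
    · exact hηb n _ (hM _ _)
    · exact hqb n _ (hM _ _)
  · refine Eventually.of_forall fun p => ?_
    exact ((lη _).mul_const _).add ((lq _ (hM _ _)).mul_const _)
end

section
lemma concave_sg {f : ℝ → ℝ} {S : Set ℝ} {x a : ℝ} (hf : ConcaveOn ℝ S f) (hx : x ∈ interior S)
    (ha : HasDerivWithinAt f a (Ioi x) x) {y : ℝ} (hy : y ∈ S) : f y ≤ f x + a * (y - x) := by
  have hxS := interior_subset hx
  rcases lt_trichotomy y x with h | h | h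
  · have hle : a ≤ (f x - f y) / (x - y) := by
      have ht := (hasDerivWithinAt_iff_tendsto_slope' (by simp)).1 ha
      refine le_of_tendsto ht ?_
      have : S ∈ nhdsWithin x (Ioi x) := mem_nhdsWithin_of_mem_nhds (mem_interior_iff_mem_nhds.1 hx)
      filter_upwards [this, self_mem_nhdsWithin] with z hz hzx
      rw [slope_def_field]
      exact hf.slope_anti_adjacent hy hz h hzx
    rw [le_div_iff₀ (by linarith)] at hle
    linarith
  · simp [h]
  · have := hf.slope_le_of_hasDerivWithinAt_Ioi hxS hy h ha
    rw [slope_def_field, div_le_iff₀ (by linarith)] at this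
    linarith
structure EHyp (V : ℝ → ℝ → ℝ) (u0 : ℝ → ℝ) (M N : ℝ) : Prop where
  lipx : ∀ t, 0 ≤ t → ∀ x y, |V x t - V y t| ≤ M * |x - y|
  lipt : ∀ s t, 0 ≤ s → 0 ≤ t → ∀ x, |V x s - V x t| ≤ N * |s - t|
  ccl : ∀ t, 0 < t → ConcaveOn ℝ (Iic 0) (fun x => V x t - x ^ 2 / (2 * t))
  ccr : ∀ t, 0 < t → ConcaveOn ℝ (Ici 0) (fun x => V x t - x ^ 2 / (2 * t))
  touch : ∀ᵐ p : ℝ × ℝ, 0 < p.2 → ∃ c : ℝ, IsLocalExtr (fun q : ℝ × ℝ => V q.1 q.2 - (c * q.1 - c ^ 2 / 2 * q.2)) p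
  iface : ∀ᵐ t : ℝ, 0 < t → ∃ a b, HasDerivWithinAt (fun x => V x t) a (Iio 0) 0 ∧
    HasDerivWithinAt (fun x => V x t) b (Ioi 0) 0 ∧ |b - 4| * (b + 4) / 2 ≤ |a - -4| * (a + -4) / 2
  meas0 : Measurable u0
  bdd0 : ∀ x, |u0 x| ≤ M
  der0 : ∀ᵐ x : ℝ, HasDerivAt (fun y => V y 0) (u0 x) x
  cc0 : ∀ᵐ x : ℝ, ∃ ε, 0 < ε ∧ ∀ t, 0 ≤ t → t ≤ ε → ConcaveOn ℝ (Icc (x - ε) (x + ε)) (fun y => V y t)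
def rd (V : ℝ → ℝ → ℝ) (x t : ℝ) : ℝ := derivWithin (fun y => V y t) (Ioi x) x
def eu (V : ℝ → ℝ → ℝ) (u0 : ℝ → ℝ) (x t : ℝ) : ℝ :=
  if 0 < t then (if x = 0 then 0 else rd V x t) else u0 x
variable {V : ℝ → ℝ → ℝ} {u0 : ℝ → ℝ} {M N : ℝ}
lemma sqdiv_hd (t x : ℝ) : HasDerivAt (fun y : ℝ => y ^ 2 / (2 * t)) (x / t) x := by
  have := (hasDerivAt_pow 2 x).div_const (2 * t)
  refine this.congr_deriv ?_
  rcases eq_or_ne t 0 with h | h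
  · simp [h]
  · field_simp; norm_num
lemma EHyp.rd_hd (E : EHyp V u0 M N) {x t : ℝ} (ht : 0 < t) (hx : x ≠ 0) :
    HasDerivWithinAt (fun y => V y t) (rd V x t) (Ioi x) x := by
  have h : DifferentiableWithinAt ℝ (fun y => V y t - y ^ 2 / (2 * t)) (Ioi x) x := by
    rcases lt_or_gt_of_ne hx with h | h
    · have := (E.ccl t ht).neg.differentiableWithinAt_Ioi_of_mem_interior (x := x) (by simpa using h)
      simpa using this.neg
    · have := (E.ccr t ht).neg.differentiableWithinAt_Ioi_of_mem_interior (x := x) (by simpa using h)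
      simpa using this.neg
  have h2 := h.add ((sqdiv_hd t x).differentiableAt.differentiableWithinAt)
  have e : ((fun y => V y t - y ^ 2 / (2 * t)) + fun y => y ^ 2 / (2 * t)) = fun y => V y t := by
    ext y; simp
  rw [e] at h2
  exact h2.hasDerivWithinAt
lemma eu_pos (V : ℝ → ℝ → ℝ) (u0 : ℝ → ℝ) {x t : ℝ} (ht : 0 < t) (hx : x ≠ 0) : eu V u0 x t = rd V x t := by
  simp [eu, ht, hx]
lemma EHyp.sg (E : EHyp V u0 M N) {x y t : ℝ} (ht : 0 < t) (h : (x < 0 ∧ y ≤ 0) ∨ (0 < x ∧ 0 ≤ y)) :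
    V y t ≤ V x t + eu V u0 x t * (y - x) + (y - x) ^ 2 / (2 * t) := by
  have hx : x ≠ 0 := by rcases h with h | h <;> [exact h.1.ne; exact h.1.ne']
  rw [eu_pos V u0 ht hx]
  have hd : HasDerivWithinAt (fun y => V y t - y ^ 2 / (2 * t)) (rd V x t - x / t) (Ioi x) x :=
    (E.rd_hd ht hx).sub (sqdiv_hd t x).hasDerivWithinAt
  have : V y t - y ^ 2 / (2 * t) ≤ V x t - x ^ 2 / (2 * t) + (rd V x t - x / t) * (y - x) := by
    rcases h with h | h
    · exact concave_sg (E.ccl t ht) (by simpa using h.1) hd h.2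
    · exact concave_sg (E.ccr t ht) (by simpa using h.1) hd h.2
  have e : (y - x) ^ 2 / (2 * t) = y ^ 2 / (2 * t) - x ^ 2 / (2 * t) - x / t * (y - x) := by
    field_simp; ring
  rw [e]; linarith
lemma EHyp.osl (E : EHyp V u0 M N) {x y t : ℝ} (ht : 0 < t) (hxy : y < x) (h : x < 0 ∨ 0 < y) :
    eu V u0 x t - eu V u0 y t ≤ (x - y) / t := by
  have h1 := E.sg (x := x) (y := y) ht (by rcases h with h | h; · left; constructor <;> linarith
                                           · right; constructor <;> linarith)
  have h2 := E.sg (x := y) (y := x) ht (by rcases h with h | h; · left; constructor <;> linarith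
                                           · right; constructor <;> linarith)
  have e : (y - x) ^ 2 / (2 * t) + (x - y) ^ 2 / (2 * t) = (x - y) * ((x - y) / t) := by field_simp; ring
  have : (x - y) * (eu V u0 x t - eu V u0 y t) ≤ (x - y) * ((x - y) / t) := by rw [← e]; linarith
  exact le_of_mul_le_mul_left this (by linarith)
lemma EHyp.M0 (E : EHyp V u0 M N) : 0 ≤ M := (abs_nonneg _).trans (E.bdd0 0)
lemma EHyp.bdd (E : EHyp V u0 M N) (x t : ℝ) : |eu V u0 x t| ≤ M := by
  unfold eu
  split_ifs with ht hx
  · simpa using E.M0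
  · have := (hasDerivWithinAt_iff_tendsto_slope' (by simp)).1 (E.rd_hd ht hx)
    refine le_of_tendsto this.abs ?_
    filter_upwards [self_mem_nhdsWithin] with z hz
    have hz' : x < z := hz
    rw [slope_def_field, abs_div, div_le_iff₀ (abs_pos.2 (by linarith))]
    exact E.lipx t ht.le z x
  · exact E.bdd0 x
lemma EHyp.lim_left (E : EHyp V u0 M N) {t : ℝ} (ht : 0 < t) (x : ℝ) :
    ∃ l, Tendsto (fun y => eu V u0 y t) (nhdsWithin x (Iio x)) (nhds l) := by
  obtain ⟨a, hax, ha⟩ : ∃ a, a < x ∧ (x ≤ 0 ∨ 0 < a) := by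
    rcases le_or_gt x 0 with h | h
    · exact ⟨x - 1, by linarith, Or.inl h⟩
    · exact ⟨x / 2, by linarith, Or.inr (by linarith)⟩
  have mono : MonotoneOn (fun y => y / t - eu V u0 y t) (Ioo a x) := by
    intro y hy z hz hyz
    rcases eq_or_lt_of_le hyz with h | h
    · simp [h]
    · have := E.osl ht h (by rcases ha with ha | ha; · left; linarith [hz.2]
                             · right; linarith [hy.1])
      simp only
      rw [sub_div] at this; linarith
  have := mono.tendsto_nhdsWithin_Ioo_left (nonempty_Ioo.2 hax) ⟨x / t + M, by
    rintro _ ⟨y, hy, rfl⟩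
    have h1 := E.bdd y t
    rw [abs_le] at h1
    have h2 : y / t ≤ x / t := by gcongr; exact hy.2.le
    simp only; linarith⟩
  refine ⟨x / t - _, ((((continuous_id.div_const t).tendsto x).mono_left nhdsWithin_le_nhds).sub this).congr fun y => ?_⟩
  simp
lemma EHyp.lim_right (E : EHyp V u0 M N) {t : ℝ} (ht : 0 < t) (x : ℝ) :
    ∃ l, Tendsto (fun y => eu V u0 y t) (nhdsWithin x (Ioi x)) (nhds l) := by
  obtain ⟨a, hax, ha⟩ : ∃ a, x < a ∧ (0 ≤ x ∨ a < 0) := by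
    rcases lt_or_ge x 0 with h | h
    · exact ⟨x / 2, by linarith, Or.inr (by linarith)⟩
    · exact ⟨x + 1, by linarith, Or.inl h⟩
  have mono : MonotoneOn (fun y => y / t - eu V u0 y t) (Ioo x a) := by
    intro y hy z hz hyz
    rcases eq_or_lt_of_le hyz with h | h
    · simp [h]
    · have := E.osl ht h (by rcases ha with ha | ha; · right; linarith [hy.1]
                             · left; linarith [hz.2])
      simp only
      rw [sub_div] at this; linarith
  have := mono.tendsto_nhdsWithin_Ioo_right (nonempty_Ioo.2 hax) ⟨x / t - M, by
    rintro _ ⟨y, hy, rfl⟩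
    have h1 := E.bdd y t
    rw [abs_le] at h1
    have h2 : x / t ≤ y / t := by gcongr; exact hy.1.le
    simp only; linarith⟩
  refine ⟨x / t - _, ((((continuous_id.div_const t).tendsto x).mono_left nhdsWithin_le_nhds).sub this).congr fun y => ?_⟩
  simp
lemma EHyp.trace_left (E : EHyp V u0 M N) {t a : ℝ} (ht : 0 < t)
    (ha : HasDerivWithinAt (fun x => V x t) a (Iio 0) 0) :
    Tendsto (fun y => eu V u0 y t) (nhdsWithin 0 (Iio 0)) (nhds a) := by
  obtain ⟨l, hl⟩ := E.lim_left (x := 0) ht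
  have hs := (hasDerivWithinAt_iff_tendsto_slope' (by simp)).1 ha
  have hid : Tendsto (fun y : ℝ => y) (nhdsWithin 0 (Iio 0)) (nhds 0) := nhdsWithin_le_nhds
  have hV : Tendsto (fun y : ℝ => V y t) (nhdsWithin 0 (Iio 0)) (nhds (V 0 t)) := ha.continuousWithinAt
  have h1 : a ≤ l := by
    have hs2 : Tendsto (fun y => slope (fun x => V x t) 0 y + y / (2 * t)) (nhdsWithin 0 (Iio 0)) (nhds a) := by
      have := hs.add (hid.div_const (2 * t)); simpa using this
    refine le_of_tendsto_of_tendsto hs2 hl ?_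
    filter_upwards [self_mem_nhdsWithin] with y hy
    have hy' : y < 0 := hy
    have := E.sg (x := y) (y := 0) ht (Or.inl ⟨hy', le_rfl⟩)
    rw [slope_def_field]
    have e : (0 - y) ^ 2 / (2 * t) = y * (y / (2 * t)) := by ring
    have : (V y t - V 0 t) / (y - 0) ≤ eu V u0 y t - y / (2 * t) := by
      rw [sub_zero, div_le_iff_of_neg hy']
      rw [e] at this; linarith
    linarith
  have h2 : l ≤ a := by
    have hz : ∀ z < 0, l - (-z / (2 * t)) ≤ slope (fun x => V x t) 0 z := by
      intro z hz
      have h3 : V z t ≤ V 0 t + l * (z - 0) + (z - 0) ^ 2 / (2 * t) := by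
        refine ge_of_tendsto ((hV.add (hl.mul (tendsto_const_nhds.sub hid))).add
          (((tendsto_const_nhds.sub hid).pow 2).div_const (2 * t))) ?_
        filter_upwards [self_mem_nhdsWithin] with y hy
        exact E.sg ht (Or.inl ⟨hy, hz.le⟩)
      rw [slope_def_field, sub_zero, le_div_iff_of_neg hz]
      have e : (z - 0) ^ 2 / (2 * t) = z * (z / (2 * t)) := by ring
      rw [e] at h3
      have e2 : -z / (2 * t) = -(z / (2 * t)) := by ring
      rw [e2]; linarith
    have hs2 : Tendsto (fun z => l - (-z / (2 * t))) (nhdsWithin 0 (Iio 0)) (nhds l) := by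
      have := (tendsto_const_nhds (x := l)).sub ((hid.neg).div_const (2 * t)); simpa using this
    refine le_of_tendsto_of_tendsto hs2 hs ?_
    filter_upwards [self_mem_nhdsWithin] with z hz' using hz z hz'
  rwa [le_antisymm h1 h2]
lemma EHyp.trace_right (E : EHyp V u0 M N) {t a : ℝ} (ht : 0 < t)
    (ha : HasDerivWithinAt (fun x => V x t) a (Ioi 0) 0) :
    Tendsto (fun y => eu V u0 y t) (nhdsWithin 0 (Ioi 0)) (nhds a) := by
  obtain ⟨l, hl⟩ := E.lim_right (x := 0) ht
  have hs := (hasDerivWithinAt_iff_tendsto_slope' (by simp)).1 ha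
  have hid : Tendsto (fun y : ℝ => y) (nhdsWithin 0 (Ioi 0)) (nhds 0) := nhdsWithin_le_nhds
  have hV : Tendsto (fun y : ℝ => V y t) (nhdsWithin 0 (Ioi 0)) (nhds (V 0 t)) := ha.continuousWithinAt
  have h1 : l ≤ a := by
    have hs2 : Tendsto (fun y => slope (fun x => V x t) 0 y + y / (2 * t)) (nhdsWithin 0 (Ioi 0)) (nhds a) := by
      have := hs.add (hid.div_const (2 * t)); simpa using this
    refine le_of_tendsto_of_tendsto hl hs2 ?_
    filter_upwards [self_mem_nhdsWithin] with y hy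
    have hy' : 0 < y := hy
    have := E.sg (x := y) (y := 0) ht (Or.inr ⟨hy', le_rfl⟩)
    rw [slope_def_field]
    have e : (0 - y) ^ 2 / (2 * t) = y * (y / (2 * t)) := by ring
    have : eu V u0 y t - y / (2 * t) ≤ (V y t - V 0 t) / (y - 0) := by
      rw [sub_zero, le_div_iff₀ hy']
      rw [e] at this; linarith
    linarith
  have h2 : a ≤ l := by
    have hz : ∀ z > 0, slope (fun x => V x t) 0 z ≤ l + z / (2 * t) := by
      intro z hz
      have h3 : V z t ≤ V 0 t + l * (z - 0) + (z - 0) ^ 2 / (2 * t) := by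
        refine ge_of_tendsto ((hV.add (hl.mul (tendsto_const_nhds.sub hid))).add
          (((tendsto_const_nhds.sub hid).pow 2).div_const (2 * t))) ?_
        filter_upwards [self_mem_nhdsWithin] with y hy
        exact E.sg ht (Or.inr ⟨hy, hz.le⟩)
      rw [slope_def_field, sub_zero, div_le_iff₀ hz]
      have e : (z - 0) ^ 2 / (2 * t) = z * (z / (2 * t)) := by ring
      rw [e] at h3
      linarith
    have hs2 : Tendsto (fun z => l + z / (2 * t)) (nhdsWithin 0 (Ioi 0)) (nhds l) := by
      have := (tendsto_const_nhds (x := l)).add (hid.div_const (2 * t)); simpa using this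
    refine le_of_tendsto_of_tendsto hs hs2 ?_
    filter_upwards [self_mem_nhdsWithin] with z hz' using hz z hz'
  rwa [le_antisymm h2 h1]
end

section
variable {V : ℝ → ℝ → ℝ} {u0 : ℝ → ℝ} {M N : ℝ}
def ut (V : ℝ → ℝ → ℝ) (p : ℝ × ℝ) : ℝ := V p.1 (max p.2 0)
lemma EHyp.N0 (E : EHyp V u0 M N) : 0 ≤ N := by
  have := (abs_nonneg _).trans (E.lipt 0 1 le_rfl zero_le_one 0)
  simpa using this
lemma EHyp.lip (E : EHyp V u0 M N) : LipschitzWith (Real.toNNReal (M + N)) (ut V) := by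
  refine LipschitzWith.of_dist_le_mul fun p q => ?_
  have hM := E.M0
  have hN := E.N0
  rw [Real.coe_toNNReal _ (by linarith), Real.dist_eq, Prod.dist_eq, Real.dist_eq, Real.dist_eq]
  have h1 := E.lipx (max p.2 0) (le_max_right _ _) p.1 q.1
  have h2 := E.lipt (max p.2 0) (max q.2 0) (le_max_right _ _) (le_max_right _ _) q.1
  have h3 : |max p.2 0 - max q.2 0| ≤ |p.2 - q.2| := abs_max_sub_max_le_abs _ _ _
  have e : ut V p - ut V q = (V p.1 (max p.2 0) - V q.1 (max p.2 0)) + (V q.1 (max p.2 0) - V q.1 (max q.2 0)) := by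
    simp [ut]
  rw [e]
  refine (abs_add_le _ _).trans ?_
  have := le_max_left (|p.1 - q.1|) (|p.2 - q.2|)
  have := le_max_right (|p.1 - q.1|) (|p.2 - q.2|)
  nlinarith
lemma EHyp.meas (E : EHyp V u0 M N) : Measurable (Function.uncurry (eu V u0)) := by
  have hc := E.lip.continuous
  refine measurable_of_tendsto_metrizable (f := fun (n : ℕ) (p : ℝ × ℝ) => if 0 < p.2 then (if p.1 = 0 then 0 else
    ((n:ℝ)+1) * (ut V (p.1 + 1 / ((n:ℝ)+1), p.2) - ut V p)) else u0 p.1) ?_ ?_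
  · intro n
    refine Measurable.ite (measurableSet_lt measurable_const measurable_snd) ?_ (E.meas0.comp measurable_fst)
    refine Measurable.ite (measurableSet_eq_fun measurable_fst measurable_const) measurable_const ?_
    exact (continuous_const.mul ((hc.comp (by fun_prop)).sub hc)).measurable
  · rw [tendsto_pi_nhds]
    rintro ⟨x, t⟩
    simp only [Function.uncurry, eu]
    split_ifs with ht hx
    · exact tendsto_const_nhds
    · have := (hasDerivWithinAt_iff_tendsto_slope' (by simp)).1 (E.rd_hd ht hx)
      have h2 : Tendsto (fun n : ℕ => x + 1 / ((n:ℝ)+1)) atTop (nhdsWithin x (Ioi x)) := by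
        apply tendsto_nhdsWithin_of_tendsto_nhds_of_eventually_within
        · simpa using (tendsto_const_nhds (x := x)).add (tendsto_one_div_add_atTop_nhds_zero_nat (𝕜 := ℝ))
        · refine Eventually.of_forall fun n => ?_
          have : 0 < 1 / ((n:ℝ) + 1) := by positivity
          show x < _
          linarith
      refine (this.comp h2).congr fun n => ?_
      simp only [Function.comp, slope_def_field, ut, max_eq_left ht.le, add_sub_cancel_left]
      rw [div_div_eq_mul_div, div_one, mul_comm]
    · exact tendsto_const_nhds
lemma EHyp.eu_eq (E : EHyp V u0 M N) {x t c : ℝ} (ht : 0 < t) (hx : x ≠ 0) (h : HasDerivAt (fun y => V y t) c x) :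
    eu V u0 x t = c := by
  rw [eu_pos V u0 ht hx]
  exact h.hasDerivWithinAt.derivWithin (uniqueDiffWithinAt_Ioi x)
lemma EHyp.lipx' (E : EHyp V u0 M N) {t : ℝ} (ht : 0 ≤ t) : LipschitzWith (Real.toNNReal M) (fun x => V x t) :=
  LipschitzWith.of_dist_le_mul fun x y => by
    rw [Real.coe_toNNReal _ E.M0]; exact E.lipx t ht x y
lemma EHyp.ae_x (E : EHyp V u0 M N) {t : ℝ} (ht : 0 < t) : ∀ᵐ x, HasDerivAt (fun y => V y t) (eu V u0 x t) x := by
  filter_upwards [(E.lipx' ht.le).ae_differentiableAt, measure_eq_zero_iff_ae_notMem.1 (measure_singleton (0:ℝ))] with x hx h0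
  have := hx.hasDerivAt
  rwa [E.eu_eq ht h0 this]
lemma EHyp.ftc (E : EHyp V u0 M N) {t : ℝ} (ht : 0 < t) (x y : ℝ) : V x t - V y t = ∫ s in y..x, eu V u0 s t := by
  have ac : AbsolutelyContinuousOnInterval (fun x => V x t) y x := (E.lipx' ht.le).lipschitzOnWith.absolutelyContinuousOnInterval
  rw [← ac.integral_deriv_eq_sub]
  apply intervalIntegral.integral_congr_ae
  filter_upwards [E.ae_x ht] with s hs _ using hs.deriv
lemma EHyp.pot (E : EHyp V u0 M N) : Pot (ut V) (eu V u0) := by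
  have key : ∀ᵐ p : ℝ × ℝ, 0 < p.2 → ∃ c : ℝ, HasFDerivAt (ut V) (c • ContinuousLinearMap.fst ℝ ℝ ℝ - (c ^ 2 / 2) • ContinuousLinearMap.snd ℝ ℝ ℝ) p := by
    filter_upwards [E.touch, E.lip.ae_differentiableAt] with p h1 h2 hp
    obtain ⟨c, hc⟩ := h1 hp
    refine ⟨c, ?_⟩
    set l : ℝ × ℝ →L[ℝ] ℝ := c • ContinuousLinearMap.fst ℝ ℝ ℝ - (c ^ 2 / 2) • ContinuousLinearMap.snd ℝ ℝ ℝ with hl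
    have h3 : IsLocalExtr (fun q => ut V q - l q) p := by
      have ee : (fun q : ℝ × ℝ => V q.1 q.2 - (c * q.1 - c ^ 2 / 2 * q.2)) =ᶠ[nhds p] (fun q => ut V q - l q) := by
        have : ∀ᶠ q : ℝ × ℝ in nhds p, 0 < q.2 := (continuous_snd.tendsto p).eventually (lt_mem_nhds hp)
        filter_upwards [this] with q hq
        simp [ut, hl, max_eq_left hq.le]
      exact hc.congr ee
    have h4 := h3.hasFDerivAt_eq_zero (h2.hasFDerivAt.sub l.hasFDerivAt)
    have h5 := h2.hasFDerivAt
    rwa [sub_eq_zero.1 h4] at h5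
  have e1 : ∀ p : ℝ × ℝ, 0 < p.2 → ∀ c : ℝ, HasFDerivAt (ut V) (c • ContinuousLinearMap.fst ℝ ℝ ℝ - (c ^ 2 / 2) • ContinuousLinearMap.snd ℝ ℝ ℝ) p →
      HasDerivAt (fun y => ut V (y, p.2)) c p.1 ∧ HasDerivAt (fun s => ut V (p.1, s)) (-(c ^ 2 / 2)) p.2 := by
    intro p hp c h
    constructor
    · have := h.comp_hasDerivAt p.1 ((hasDerivAt_id p.1).prodMk (hasDerivAt_const p.1 p.2))
      exact this.congr_deriv (by simp)
    · have := h.comp_hasDerivAt p.2 ((hasDerivAt_const p.2 p.1).prodMk (hasDerivAt_id p.2))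
      exact this.congr_deriv (by simp)
  have e2 : ∀ᵐ p : ℝ × ℝ, 0 < p.2 → HasDerivAt (fun y => ut V (y, p.2)) (eu V u0 p.1 p.2) p.1 ∧ HasDerivAt (fun s => ut V (p.1, s)) (-((eu V u0 p.1 p.2) ^ 2 / 2)) p.2 := by
    filter_upwards [key, ae_fst_ne 0] with p h1 h2 hp
    obtain ⟨c, hc⟩ := h1 hp
    have h3 := e1 p hp c hc
    have : eu V u0 p.1 p.2 = c := by
      apply E.eu_eq hp h2
      have := h3.1
      simpa only [ut, max_eq_left hp.le] using this
    rwa [this]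
  exact ⟨⟨_, E.lip⟩, E.meas, ⟨M, E.bdd⟩, e2.mono fun p h hp => (h hp).1, e2.mono fun p h hp => (h hp).2⟩
lemma EHyp.lhyp (E : EHyp V u0 M N) : LHyp (ut V) (eu V u0) where
  toPot := E.pot
  ftc t ht x y := by simp only [ut, max_eq_left ht.le]; exact E.ftc ht x y
  osl t ht x y hxy hx := E.osl ht hxy (Or.inl hx)
  ll t ht x _ := E.lim_left ht x
lemma EHyp.rhyp (E : EHyp V u0 M N) : LHyp (fun p => ut V (-p.1, p.2)) (fun x t => -eu V u0 (-x) t) where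
  lip := by
    refine ⟨_, E.lip.comp (LipschitzWith.of_dist_le_mul (K := 1) fun p q => ?_)⟩
    rw [Prod.dist_eq, Prod.dist_eq]; simp [dist_neg_neg]
  meas := by
    have := E.meas.comp (g := Function.uncurry (eu V u0)) (f := fun p : ℝ × ℝ => (-p.1, p.2)) (by fun_prop)
    exact this.neg
  bdd := ⟨M, fun x t => by rw [abs_neg]; exact E.bdd _ _⟩
  dx := by
    have qmp : Measure.QuasiMeasurePreserving (fun p : ℝ × ℝ => (-p.1, p.2)) volume volume :=
      ((Measure.measurePreserving_neg volume).prod (MeasurePreserving.id volume)).quasiMeasurePreserving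
    filter_upwards [qmp.ae E.pot.dx] with p h hp
    have h1 := (h hp)
    have := h1.scomp p.1 (hasDerivAt_neg p.1)
    exact this.congr_deriv (by simp)
  dt := by
    have qmp : Measure.QuasiMeasurePreserving (fun p : ℝ × ℝ => (-p.1, p.2)) volume volume :=
      ((Measure.measurePreserving_neg volume).prod (MeasurePreserving.id volume)).quasiMeasurePreserving
    filter_upwards [qmp.ae E.pot.dt] with p h hp
    have h1 := (h hp)
    rw [neg_sq]; exact h1
  ftc t ht x y := by
    simp only [ut, max_eq_left ht.le]
    rw [E.ftc ht, intervalIntegral.integral_neg, intervalIntegral.integral_comp_neg (f := fun x => eu V u0 x t), intervalIntegral.integral_symm]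
  osl t ht x y hxy hx := by
    have := E.osl (x := -y) (y := -x) ht (by linarith) (Or.inr (by linarith))
    have e : -y - -x = x - y := by ring
    rw [e] at this; linarith
  ll t ht x _ := by
    obtain ⟨l, hl⟩ := E.lim_right ht (-x)
    refine ⟨-l, (hl.comp ?_).neg⟩
    apply tendsto_nhdsWithin_of_tendsto_nhds_of_eventually_within
    · exact (continuous_neg.tendsto x).mono_left nhdsWithin_le_nhds
    · filter_upwards [self_mem_nhdsWithin] with y hy
      exact neg_lt_neg (show y < x from hy)
lemma sign_neg' (x : ℝ) : Real.sign (-x) = -Real.sign x := Real.sign_neg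
lemma EHyp.kr (E : EHyp V u0 M N) (k : ℝ) (φ : ℝ → ℝ → ℝ)
    (h1 : ContDiff ℝ 1 (fun p : ℝ × ℝ => φ p.1 p.2))
    (h2 : HasCompactSupport (fun p : ℝ × ℝ => φ p.1 p.2)) (h0 : ∀ x t, 0 ≤ φ x t)
    (h3 : ∀ x t, x ≤ 0 ∨ t ≤ 0 → φ x t = 0) :
    0 ≤ ∫ p : ℝ × ℝ, (|eu V u0 p.1 p.2 - k| * deriv (fun s => φ p.1 s) p.2 +
        Real.sign (eu V u0 p.1 p.2 - k) * (fq (eu V u0 p.1 p.2) - fq k) *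
          deriv (fun y => φ y p.2) p.1) := by
  have := E.rhyp.kruzkov (-k) (fun x t => φ (-x) t) (h1.comp (f := fun p : ℝ × ℝ => (-p.1, p.2)) (by fun_prop))
    (h2.comp_homeomorph ((Homeomorph.neg ℝ).prodCongr (Homeomorph.refl ℝ))) (fun x t => h0 _ _)
    (fun x t h => h3 _ _ (by simpa using h))
  have mp : MeasurePreserving (fun p : ℝ × ℝ => (-p.1, p.2)) volume volume :=
    ((Measure.measurePreserving_neg volume).prod (MeasurePreserving.id volume))
  have hemb : MeasurableEmbedding (fun p : ℝ × ℝ => (-p.1, p.2)) :=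
    (((Homeomorph.neg ℝ).prodCongr (Homeomorph.refl ℝ)).measurableEmbedding : _)
  rw [← mp.integral_comp hemb]
  refine this.trans_eq ?_
  congr 1; ext p
  have hd : deriv (fun y => φ (-y) p.2) p.1 = -deriv (fun y => φ y p.2) (-p.1) := deriv_comp_neg (f := fun y => φ y p.2) p.1
  simp only [hd]
  have e1 : -eu V u0 (-p.1) p.2 - -k = -(eu V u0 (-p.1) p.2 - k) := by ring
  rw [e1, abs_neg, sign_neg']
  simp only [fq]; ring
end

section
variable {V : ℝ → ℝ → ℝ} {u0 : ℝ → ℝ} {M N : ℝ}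
lemma tc_lim {l : Filter ℝ} {V : ℝ → ℝ → ℝ} {e : ℝ → ℝ} {x t0 D ε C : ℝ} (hD : HasDerivAt (fun y => V y t0) D x)
    (hV : ∀ y, Tendsto (fun t => V y t) l (nhds (V y t0))) (hε : 0 < ε)
    (h : ∀ᶠ t in l, ∀ δ, |δ| ≤ ε → V (x + δ) t ≤ V x t + e t * δ + C * δ ^ 2) :
    Tendsto e l (nhds D) := by
  rw [Metric.tendsto_nhds]
  intro η hη
  have hs := (hasDerivAt_iff_tendsto_slope_zero.1 hD)
  have hs2 : Tendsto (fun δ : ℝ => δ⁻¹ • (V (x + δ) t0 - V x t0) - C * δ) (nhdsWithin 0 {0}ᶜ) (nhds (D - C * 0)) := by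
    refine hs.sub (((continuous_const.mul continuous_id).tendsto (0:ℝ)).mono_left nhdsWithin_le_nhds)
  rw [mul_zero, sub_zero] at hs2
  have hb := (Metric.tendsto_nhds.1 hs2) η hη
  have hsm : ∀ᶠ δ : ℝ in nhdsWithin 0 {0}ᶜ, |δ| ≤ ε := by
    apply nhdsWithin_le_nhds
    filter_upwards [Metric.closedBall_mem_nhds (0:ℝ) hε] with δ hδ
    simpa [Real.dist_eq] using hδ
  have hboth := hb.and hsm
  have hp := (hboth.filter_mono (nhdsWithin_mono 0 (show Ioi (0:ℝ) ⊆ {0}ᶜ from fun z hz => (show (0:ℝ) < z from hz).ne'))).and self_mem_nhdsWithin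
  have hn := (hboth.filter_mono (nhdsWithin_mono 0 (show Iio (0:ℝ) ⊆ {0}ᶜ from fun z hz => (show z < (0:ℝ) from hz).ne))).and self_mem_nhdsWithin
  obtain ⟨d1, ⟨h1, h2⟩, h3⟩ := hp.exists
  obtain ⟨d2, ⟨h4, h5⟩, h6⟩ := hn.exists
  have lim : ∀ d, Tendsto (fun t => d⁻¹ • (V (x + d) t - V x t) - C * d) l (nhds (d⁻¹ • (V (x + d) t0 - V x t0) - C * d)) :=
    fun d => ((((hV _).sub (hV _)).const_smul _).sub tendsto_const_nhds)
  rw [Real.dist_eq, abs_lt] at h1 h4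
  have l1 := (lim d1).eventually (lt_mem_nhds (show D - η < _ by linarith [h1.1]))
  have l2 := (lim d2).eventually (gt_mem_nhds (show _ < D + η by linarith [h4.2]))
  have h3 : 0 < d1 := h3
  have h6 : d2 < 0 := h6
  filter_upwards [l1, l2, h] with t a1 a2 a3
  have b1 := a3 d1 h2
  have b2 := a3 d2 h5
  have c1 : d1⁻¹ • (V (x + d1) t - V x t) - C * d1 ≤ e t := by
    rw [smul_eq_mul, inv_mul_eq_div, sub_le_iff_le_add, div_le_iff₀ h3]; nlinarith
  have c2 : e t ≤ d2⁻¹ • (V (x + d2) t - V x t) - C * d2 := by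
    rw [smul_eq_mul, inv_mul_eq_div, le_sub_iff_add_le, le_div_iff_of_neg h6]; nlinarith
  rw [Real.dist_eq, abs_lt]; constructor <;> linarith
lemma EHyp.ptcont (E : EHyp V u0 M N) {t0 : ℝ} (ht : 0 ≤ t0) :
    ∀ᵐ x, Tendsto (fun t => eu V u0 x t) (nhdsWithin t0 (Ici 0)) (nhds (eu V u0 x t0)) := by
  have hV : ∀ y, Tendsto (fun t => V y t) (nhdsWithin t0 (Ici 0)) (nhds (V y t0)) := by
    intro y
    have : ContinuousOn (fun t => V y t) (Ici 0) := by
      have : LipschitzOnWith (Real.toNNReal N) (fun t => V y t) (Ici 0) :=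
        LipschitzOnWith.of_dist_le_mul fun s hs t ht => by
          rw [Real.coe_toNNReal _ E.N0]; exact E.lipt s t hs ht y
      exact this.continuousOn
    exact this t0 ht
  have hne := measure_eq_zero_iff_ae_notMem.1 (measure_singleton (α := ℝ) (μ := volume) (0:ℝ))
  rcases ht.eq_or_lt with h | h
  · subst h
    filter_upwards [E.der0, E.cc0, hne] with x h1 ⟨ε, hε, h2⟩ h0
    have e0 : eu V u0 x 0 = u0 x := by simp [eu]
    rw [e0]
    refine tc_lim (C := 0) (ε := ε) h1 hV hε ?_
    have hs : ∀ᶠ t : ℝ in nhdsWithin 0 (Ici 0), 0 ≤ t ∧ t ≤ ε := by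
      filter_upwards [self_mem_nhdsWithin, nhdsWithin_le_nhds (Iic_mem_nhds hε)] with t a b using ⟨a, b⟩
    filter_upwards [hs] with t ⟨a, b⟩ δ hδ
    rw [abs_le] at hδ
    have hd : HasDerivWithinAt (fun y => V y t) (eu V u0 x t) (Ioi x) x := by
      rcases a.eq_or_lt with hh | hh
      · rw [← hh, e0]; exact h1.hasDerivWithinAt
      · rw [eu_pos V u0 hh h0]; exact E.rd_hd hh h0
    have := concave_sg (h2 t a b) (x := x) (y := x + δ) (by rw [interior_Icc]; constructor <;> linarith) hd
      ⟨by linarith, by linarith⟩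
    simpa using this
  · filter_upwards [E.ae_x h, hne] with x h1 h0
    have h0' : x ≠ 0 := h0
    refine tc_lim (C := 1 / t0) (ε := |x|) h1 hV (abs_pos.2 h0) ?_
    filter_upwards [nhdsWithin_le_nhds (lt_mem_nhds (show t0 / 2 < t0 by linarith))] with t htt δ hδ
    have ht' : 0 < t := by linarith
    have := E.sg (x := x) (y := x + δ) ht' (by
      rcases lt_or_gt_of_ne h0' with hh | hh
      · left; rw [abs_of_neg hh, abs_le] at hδ; constructor <;> linarith
      · right; rw [abs_of_pos hh, abs_le] at hδ; constructor <;> linarith)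
    rw [add_sub_cancel_left] at this
    have h3 : δ ^ 2 / (2 * t) ≤ 1 / t0 * δ ^ 2 := by
      rw [one_div_mul_eq_div]
      exact div_le_div_of_nonneg_left (sq_nonneg _) h (by linarith)
    linarith
lemma EHyp.timeCont (E : EHyp V u0 M N) (r t0 : ℝ) (ht : 0 ≤ t0) :
    Tendsto (fun t => ∫ x in Icc (-r) r, |eu V u0 x t - eu V u0 x t0|) (nhdsWithin t0 (Ici 0)) (nhds 0) := by
  have hm : ∀ t, Measurable (fun x => eu V u0 x t) := fun t => E.meas.comp (measurable_id.prodMk measurable_const)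
  have : Tendsto (fun t => ∫ x in Icc (-r) r, |eu V u0 x t - eu V u0 x t0|) (nhdsWithin t0 (Ici 0)) (nhds (∫ x in Icc (-r) r, (0:ℝ))) := by
    refine tendsto_integral_filter_of_dominated_convergence (fun _ => 2 * M) ?_ ?_ ?_ ?_
    · exact Eventually.of_forall fun t => (((hm t).sub (hm t0)).abs).aestronglyMeasurable
    · refine Eventually.of_forall fun t => Eventually.of_forall fun x => ?_
      rw [Real.norm_eq_abs, abs_abs]
      have a := abs_le.1 (E.bdd x t)
      have b := abs_le.1 (E.bdd x t0)
      rw [abs_le]; constructor <;> linarith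
    · exact integrableOn_const (by simp)
    · refine ae_restrict_of_ae ?_
      filter_upwards [E.ptcont ht] with x hx
      have := (hx.sub_const (eu V u0 x t0)).abs
      simpa using this
  simpa using this
def Sk (k z : ℝ) : ℝ := |z - k| * (z + k) / 2
lemma sign_flux (k z : ℝ) : Real.sign (z - k) * (fq z - fq k) = Sk k z := by
  unfold fq Sk
  have : Real.sign (z - k) * (z - k) = |z - k| := by
    rcases lt_trichotomy (z - k) 0 with h | h | h
    · rw [Real.sign_of_neg h, abs_of_neg h]; ring
    · simp [h]
    · rw [Real.sign_of_pos h, abs_of_pos h]; ring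
  rw [← this]; ring
lemma Sk_cont (k : ℝ) : Continuous (Sk k) := by unfold Sk; fun_prop
lemma Sk_bd {k z M : ℝ} (h : |z| ≤ M) : |Sk k z| ≤ (M + |k|) ^ 2 := by
  unfold Sk
  rw [abs_div, abs_mul, abs_abs, abs_two]
  have h1 := abs_sub z k
  have h2 := abs_add_le z k
  have := abs_nonneg (z + k)
  have := abs_nonneg (z - k)
  have h3 : |z - k| * |z + k| ≤ (M + |k|) * (M + |k|) := mul_le_mul (by linarith) (by linarith) (by positivity) (by linarith)
  nlinarith [mul_nonneg (abs_nonneg (z-k)) (abs_nonneg (z+k))]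
lemma half_entropy {u : ℝ → ℝ → ℝ} (hm : Measurable (Function.uncurry u)) {M : ℝ} (hb : ∀ x t, |u x t| ≤ M)
    (k θ s c : ℝ) (tr : ℝ → ℝ) (φ : ℝ → ℝ → ℝ)
    (h1 : ContDiff ℝ 1 (fun p : ℝ × ℝ => φ p.1 p.2))
    (h2 : HasCompactSupport (fun p : ℝ × ℝ => φ p.1 p.2)) 
    (h3 : ∀ x t, t ≤ 0 → φ x t = 0)
    (htr : (c = 0 ∧ ∀ t, 0 < t → Tendsto (fun x => u x t) (nhdsWithin 0 (Iio 0)) (nhds (tr t))) ∨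
      (c = 1 ∧ ∀ t, 0 < t → Tendsto (fun x => u x t) (nhdsWithin 0 (Ioi 0)) (nhds (tr t))))
    (hI : ∀ n : ℕ, 0 ≤ ∫ p : ℝ × ℝ, (|u p.1 p.2 - k| * deriv (fun r => φ p.1 r * (θ + s * Kst (((n:ℝ)+1) * p.1 - c))) p.2 +
        Real.sign (u p.1 p.2 - k) * (fq (u p.1 p.2) - fq k) *
          deriv (fun y => φ y p.2 * (θ + s * Kst (((n:ℝ)+1) * y - c))) p.1)) :
    0 ≤ (∫ p : ℝ × ℝ, (|u p.1 p.2 - k| * deriv (fun r => φ p.1 r) p.2 + Sk k (u p.1 p.2) *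
          deriv (fun y => φ y p.2) p.1) * (θ + s * (if 0 < p.1 then 1 else 0))) + s * ∫ t, Sk k (tr t) * φ 0 t := by
  have hm' : Measurable (fun p : ℝ × ℝ => u p.1 p.2) := hm
  have hM0 : 0 ≤ M := (abs_nonneg _).trans (hb 0 0)
  set F : ℝ × ℝ → ℝ := fun p => |u p.1 p.2 - k| * deriv (fun r => φ p.1 r) p.2 + Sk k (u p.1 p.2) *
          deriv (fun y => φ y p.2) p.1 with hF
  set G : ℝ × ℝ → ℝ := fun p => Sk k (u p.1 p.2) * φ p.1 p.2 with hG
  have hS : Measurable (fun p : ℝ × ℝ => Sk k (u p.1 p.2)) := (Sk_cont k).measurable.comp hm'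
  have hFi : Integrable F := by
    refine (cs_integrable (M := M + |k|) (hm'.sub_const k).abs (fun p => ?_) (tf_dt_cont h1) (tf_dt_supp h1 h2)).add
      (cs_integrable (M := (M + |k|)^2) hS (fun p => Sk_bd (hb _ _)) (tf_dx_cont h1) (tf_dx_supp h1 h2))
    rw [abs_abs]; exact (abs_sub _ _).trans (by linarith [hb p.1 p.2])
  obtain ⟨C, hC0, hC⟩ := cs_bdd h1.continuous h2
  obtain ⟨R, hR0, hR⟩ := cs_box h2
  have hGC : ∀ p, |G p| ≤ (M + |k|)^2 * C := fun p => by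
    rw [hG, abs_mul]; exact mul_le_mul (Sk_bd (hb _ _)) (hC p) (abs_nonneg _) (by positivity)
  have hGm : Measurable G := hS.mul h1.continuous.measurable
  have wb : ∀ z, |θ + s * Kst z| ≤ |θ| + |s| := fun z => by
    refine (abs_add_le _ _).trans ?_
    rw [abs_mul, abs_of_nonneg (Kst_nonneg z)]
    nlinarith [abs_nonneg s, Kst_le z]
  have hwm : ∀ n : ℕ, Measurable (fun p : ℝ × ℝ => θ + s * Kst (((n:ℝ)+1) * p.1 - c)) := fun n => by
    have := Kst_contDiff.continuous
    exact (by fun_prop : Continuous (fun p : ℝ × ℝ => θ + s * Kst (((n:ℝ)+1) * p.1 - c))).measurable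
  have key : ∀ n : ℕ, 0 ≤ (∫ p, F p * (θ + s * Kst (((n:ℝ)+1) * p.1 - c))) + s * ∫ p : ℝ × ℝ, G p * (((n:ℝ) + 1) * kap (((n:ℝ) + 1) * (p.1 - 0) - c)) := by
    intro n
    rw [← integral_const_mul, ← integral_add]
    · refine (hI n).trans_eq (integral_congr_ae (Eventually.of_forall fun p => ?_))
      have d1 : deriv (fun r => φ p.1 r * (θ + s * Kst (((n:ℝ)+1) * p.1 - c))) p.2 = deriv (fun r => φ p.1 r) p.2 * (θ + s * Kst (((n:ℝ)+1) * p.1 - c)) :=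
        ((tf_hasDt h1 p.1 p.2).differentiableAt.hasDerivAt.mul_const _).deriv
      have d2 : deriv (fun y => φ y p.2 * (θ + s * Kst (((n:ℝ)+1) * y - c))) p.1 = deriv (fun y => φ y p.2) p.1 * (θ + s * Kst (((n:ℝ)+1) * p.1 - c))
           + φ p.1 p.2 * (s * (kap (((n:ℝ)+1) * p.1 - c) * ((n:ℝ)+1))) := by
        have l1 : HasDerivAt (fun y => ((n:ℝ)+1) * y - c) ((n:ℝ)+1) p.1 := by
          simpa using ((hasDerivAt_id p.1).const_mul ((n:ℝ)+1)).sub_const c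
        exact ((tf_hasDx h1 p.1 p.2).differentiableAt.hasDerivAt.mul ((((Kst_deriv _).comp p.1 l1).const_mul s).const_add θ)).deriv
      simp only [d1, d2, sign_flux, hF, hG, sub_zero]; ring
    · exact hFi.mul_bdd (hwm n).aestronglyMeasurable (Eventually.of_forall fun p => wb _)
    · refine Integrable.const_mul ?_ s
      have hkc := kap_cont
      have : Integrable (fun p : ℝ × ℝ => (Sk k (u p.1 p.2) * (((n:ℝ) + 1) * kap (((n:ℝ) + 1) * (p.1 - 0) - c))) * φ p.1 p.2) := by
        refine cs_integrable (M := (M + |k|)^2 * (((n:ℝ)+1) * 6)) (hS.mul (by fun_prop : Continuous _).measurable) (fun p => ?_) h1.continuous h2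
        rw [abs_mul]
        refine mul_le_mul (Sk_bd (hb _ _)) ?_ (abs_nonneg _) (by positivity)
        rw [abs_of_nonneg (mul_nonneg (by positivity) (kap_nonneg _))]
        exact mul_le_mul_of_nonneg_left (kap_le _) (by positivity)
      exact this.congr (Eventually.of_forall fun p => by simp only [hG]; ring)
  have lim1 : Tendsto (fun n : ℕ => ∫ p, F p * (θ + s * Kst (((n:ℝ)+1) * p.1 - c))) atTop (nhds (∫ p, F p * (θ + s * (if 0 < p.1 then 1 else 0)))) := by
    refine tendsto_integral_of_dominated_convergence (fun p => ‖F p‖ * (|θ| + |s|)) (fun n => ?_) (hFi.norm.mul_const _) (fun n => ?_) ?_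
    · exact (hFi.mul_bdd (hwm n).aestronglyMeasurable (Eventually.of_forall fun p => wb _)).aestronglyMeasurable
    · refine Eventually.of_forall fun p => ?_
      rw [norm_mul]; exact mul_le_mul_of_nonneg_left (wb _) (norm_nonneg _)
    · filter_upwards [ae_fst_ne 0] with p hp
      refine Tendsto.const_mul _ (Tendsto.const_add _ (Tendsto.const_mul _ ?_))
      have hc : c = 0 ∨ c = 1 := htr.imp And.left And.left
      have hc0 : 0 ≤ c ∧ c ≤ 1 := by rcases hc with h | h <;> rw [h] <;> norm_num
      have hn : Tendsto (fun n : ℕ => ((n:ℝ)+1)) atTop atTop := tendsto_natCast_atTop_atTop.atTop_add tendsto_const_nhds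
      refine tendsto_const_nhds.congr' ?_
      filter_upwards [hn.eventually_ge_atTop (1 / |p.1|)] with n hn
      have hpa := abs_pos.2 hp
      rw [div_le_iff₀ hpa] at hn
      split_ifs with h
      · rw [abs_of_pos h] at hn; rw [Kst_one (by linarith [hc0.2])]
      · have h' : p.1 < 0 := lt_of_le_of_ne (not_lt.1 h) hp
        rw [abs_of_neg h'] at hn; rw [Kst_zero (by linarith [hc0.1])]
  have lim2 := trace_lim G (fun t => Sk k (tr t) * φ 0 t) 0 c _ R hGm hGC (fun x t h => by simp only [hG]; have := hR x t (Or.inr h); simp only at this; rw [this, mul_zero]) (by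
    have gen : ∀ l : Filter ℝ, l ≤ nhds 0 → (∀ t, 0 < t → Tendsto (fun x => u x t) l (nhds (tr t))) → 
        ∀ᵐ t : ℝ, Tendsto (fun x => G (x, t)) l (nhds (Sk k (tr t) * φ 0 t)) := by
      intro l hl h
      refine Eventually.of_forall fun t => ?_
      rcases le_or_gt t 0 with ht | ht
      · simp only [hG, h3 _ t ht, mul_zero]; exact tendsto_const_nhds
      · refine (((Sk_cont k).tendsto _).comp (h t ht)).mul ?_
        have : Continuous (fun x => φ x t) := h1.continuous.comp (f := fun x : ℝ => (x, t)) (by fun_prop)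
        exact (this.tendsto 0).mono_left hl
    exact htr.imp (fun h => ⟨h.1, gen _ nhdsWithin_le_nhds h.2⟩) (fun h => ⟨h.1, gen _ nhdsWithin_le_nhds h.2⟩))
  exact ge_of_tendsto' (lim1.add (lim2.const_mul s)) key
end

section
variable {V : ℝ → ℝ → ℝ} {u0 : ℝ → ℝ} {M N : ℝ}
lemma sk_integrable {u : ℝ → ℝ → ℝ} (hm : Measurable (Function.uncurry u)) {M : ℝ} (hb : ∀ x t, |u x t| ≤ M) (k : ℝ) {φ : ℝ → ℝ → ℝ}
    (h1 : ContDiff ℝ 1 (fun p : ℝ × ℝ => φ p.1 p.2))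
    (h2 : HasCompactSupport (fun p : ℝ × ℝ => φ p.1 p.2)) :
    Integrable (fun p : ℝ × ℝ => |u p.1 p.2 - k| * deriv (fun r => φ p.1 r) p.2 + Sk k (u p.1 p.2) *
          deriv (fun y => φ y p.2) p.1) := by
  have hm' : Measurable (fun p : ℝ × ℝ => u p.1 p.2) := hm
  have hM0 : 0 ≤ M := (abs_nonneg _).trans (hb 0 0)
  refine (cs_integrable (M := M + |k|) (hm'.sub_const k).abs (fun p => ?_) (tf_dt_cont h1) (tf_dt_supp h1 h2)).add
      (cs_integrable (M := (M + |k|)^2) ((Sk_cont k).measurable.comp hm') (fun p => Sk_bd (hb _ _)) (tf_dx_cont h1) (tf_dx_supp h1 h2))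
  rw [abs_abs]; exact (abs_sub _ _).trans (by linarith [hb p.1 p.2])
lemma EHyp.iface_ent (E : EHyp V u0 M N) (um up : ℝ → ℝ)
    (hum : ∀ t, 0 < t → Tendsto (fun x => eu V u0 x t) (nhdsWithin 0 (Iio 0)) (nhds (um t)))
    (hup : ∀ t, 0 < t → Tendsto (fun x => eu V u0 x t) (nhdsWithin 0 (Ioi 0)) (nhds (up t)))
    (φ : ℝ → ℝ → ℝ) (h1 : ContDiff ℝ 1 (fun p : ℝ × ℝ => φ p.1 p.2))
    (h2 : HasCompactSupport (fun p : ℝ × ℝ => φ p.1 p.2)) (h0 : ∀ x t, 0 ≤ φ x t)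
    (h3 : ∀ x t, t ≤ 0 → φ x t = 0) :
    0 ≤ ∫ p : ℝ × ℝ, (|eu V u0 p.1 p.2 - cAB (-4) 4 p.1| * deriv (fun s => φ p.1 s) p.2 +
        Real.sign (eu V u0 p.1 p.2 - cAB (-4) 4 p.1) *
          (dflux fq fq p.1 (eu V u0 p.1 p.2) - dflux fq fq p.1 (cAB (-4) 4 p.1)) *
          deriv (fun y => φ y p.2) p.1) := by
  have hK := Kst_contDiff
  have hl := half_entropy E.meas E.bdd (-4) 1 (-1) 0 um φ h1 h2 h3 (Or.inl ⟨rfl, hum⟩) (fun n => by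
    refine E.lhyp.kruzkov (-4) (fun x t => φ x t * (1 + -1 * Kst (((n:ℝ)+1) * x - 0))) (h1.mul (by fun_prop)) h2.mul_right ?_ ?_
    · intro x t; refine mul_nonneg (h0 _ _) (by linarith [Kst_le (((n:ℝ)+1) * x - 0)])
    · rintro x t (h | h)
      · rw [Kst_one]
        · ring
        · rw [sub_zero]; positivity
      · rw [h3 x t h, zero_mul])
  have hr := half_entropy E.meas E.bdd 4 0 1 1 up φ h1 h2 h3 (Or.inr ⟨rfl, hup⟩) (fun n => by
    refine E.kr 4 (fun x t => φ x t * (0 + 1 * Kst (((n:ℝ)+1) * x - 1))) (h1.mul (by fun_prop)) h2.mul_right ?_ ?_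
    · intro x t; refine mul_nonneg (h0 _ _) (by linarith [Kst_nonneg (((n:ℝ)+1) * x - 1)])
    · rintro x t (h | h)
      · rw [Kst_zero]
        · ring
        · nlinarith [(Nat.cast_nonneg n : (0:ℝ) ≤ n)]
      · rw [h3 x t h, zero_mul])
  have htr : ∫ t, Sk 4 (up t) * φ 0 t ≤ ∫ t, Sk (-4) (um t) * φ 0 t := by
    have hM := E.M0
    obtain ⟨R, hR0, hR⟩ := cs_box h2
    have hφ : Integrable (fun t => φ 0 t) := by
      refine Continuous.integrable_of_hasCompactSupport (h1.continuous.comp (f := fun t : ℝ => ((0:ℝ), t)) (by fun_prop)) ?_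
      refine HasCompactSupport.intro (isCompact_Icc (a := -R) (b := R)) fun t ht => ?_
      have : R < |t| := by by_contra hh; exact ht (abs_le.1 (not_lt.1 hh))
      simpa using hR 0 t (Or.inr this)
    have mt : ∀ (l : Filter ℝ) [l.IsCountablyGenerated] [l.NeBot] (w : ℝ → ℝ) (k : ℝ), (∀ t, 0 < t → Tendsto (fun x => eu V u0 x t) l (nhds (w t))) →
        Integrable (fun t => Sk k (w t) * φ 0 t) := by
      intro l _ _ w k hw
      set w' : ℝ → ℝ := fun t => if 0 < t then w t else 0
      have hw'm : Measurable w' := by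
        refine measurable_of_tendsto_metrizable' l (f := fun x t => if 0 < t then eu V u0 x t else 0) (fun x => ?_) ?_
        · refine Measurable.ite measurableSet_Ioi (E.meas.comp (measurable_const.prodMk measurable_id)) measurable_const
        · rw [tendsto_pi_nhds]; intro t
          simp only [w']; split_ifs with h
          · exact hw t h
          · exact tendsto_const_nhds
      have hw'b : ∀ t, |w' t| ≤ M := by
        intro t; simp only [w']; split_ifs with h
        · exact le_of_tendsto (hw t h).abs (Eventually.of_forall fun x => E.bdd _ _)
        · simpa using hM
      have : Integrable (fun t => Sk k (w' t) * φ 0 t) :=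
        hφ.bdd_mul ((Sk_cont k).measurable.comp hw'm).aestronglyMeasurable (Eventually.of_forall fun t => Sk_bd (hw'b t))
      refine this.congr (Eventually.of_forall fun t => ?_)
      simp only [w']; split_ifs with h
      · rfl
      · rw [h3 0 t (not_lt.1 h)]; simp
    refine integral_mono_ae (mt _ up 4 hup) (mt _ um (-4) hum) ?_
    filter_upwards [E.iface] with t ht
    rcases le_or_gt t 0 with h | h
    · simp [h3 0 t h]
    · obtain ⟨a, b, ha, hb, hab⟩ := ht h
      rw [tendsto_nhds_unique (hum t h) (E.trace_left h ha), tendsto_nhds_unique (hup t h) (E.trace_right h hb)]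
      exact mul_le_mul_of_nonneg_right hab (h0 _ _)
  have hsum : ∫ p : ℝ × ℝ, (|eu V u0 p.1 p.2 - cAB (-4) 4 p.1| * deriv (fun s => φ p.1 s) p.2 +
        Real.sign (eu V u0 p.1 p.2 - cAB (-4) 4 p.1) *
          (dflux fq fq p.1 (eu V u0 p.1 p.2) - dflux fq fq p.1 (cAB (-4) 4 p.1)) *
          deriv (fun y => φ y p.2) p.1) = (∫ p : ℝ × ℝ, (|eu V u0 p.1 p.2 - -4| * deriv (fun r => φ p.1 r) p.2 + Sk (-4) (eu V u0 p.1 p.2) *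
          deriv (fun y => φ y p.2) p.1) * (1 + -1 * (if 0 < p.1 then 1 else 0))) + ∫ p : ℝ × ℝ, (|eu V u0 p.1 p.2 - 4| * deriv (fun r => φ p.1 r) p.2 + Sk 4 (eu V u0 p.1 p.2) *
          deriv (fun y => φ y p.2) p.1) * (0 + 1 * (if 0 < p.1 then 1 else 0)) := by
    have wm : ∀ a b : ℝ, AEStronglyMeasurable (fun p : ℝ × ℝ => a + b * (if 0 < p.1 then (1:ℝ) else 0)) volume := fun a b =>
      (measurable_const.add (measurable_const.mul (Measurable.ite (measurableSet_lt measurable_const measurable_fst) measurable_const measurable_const))).aestronglyMeasurable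
    rw [← integral_add]
    · refine integral_congr_ae (Eventually.of_forall fun p => ?_)
      simp only [dflux, ite_self, sign_flux, cAB]
      rcases le_or_gt p.1 0 with h | h
      · simp [h, not_lt.2 h]
      · simp [h, not_le.2 h]
    · exact (sk_integrable E.meas E.bdd (-4) h1 h2).mul_bdd (c := 1) (wm _ _) (Eventually.of_forall fun p => by split_ifs <;> norm_num)
    · exact (sk_integrable E.meas E.bdd 4 h1 h2).mul_bdd (c := 1) (wm _ _) (Eventually.of_forall fun p => by split_ifs <;> norm_num)
  rw [hsum]; linarith
def EHyp.sol (E : EHyp V u0 M N) : ABSol fq fq (-4) 4 u0 where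
  u := eu V u0
  meas := E.meas
  bdd := ⟨M, E.bdd⟩
  um x t := if h : 0 < t then (E.lim_left h x).choose else 0
  up x t := if h : 0 < t then (E.lim_right h x).choose else 0
  um_spec x t h := by simp only [dif_pos h]; exact (E.lim_left h x).choose_spec
  up_spec x t h := by simp only [dif_pos h]; exact (E.lim_right h x).choose_spec
  weak φ h1 h2 h3 := by simpa only [dflux, ite_self, fq] using E.pot.weak φ h1 h2 h3
  kruzkov_l := E.lhyp.kruzkov
  kruzkov_r := E.kr
  interfaceEntropy φ h1 h2 h0 h3 := E.iface_ent (fun t => if h : 0 < t then (E.lim_left h 0).choose else 0)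
    (fun t => if h : 0 < t then (E.lim_right h 0).choose else 0)
    (fun t h => by simp only [dif_pos h]; exact (E.lim_left h 0).choose_spec)
    (fun t h => by simp only [dif_pos h]; exact (E.lim_right h 0).choose_spec) φ h1 h2 h0 h3
  timeCont := E.timeCont
  init := by simp [eu]
end

section
lemma concave_sub_sq {S : Set ℝ} {f : ℝ → ℝ} (hf : ConcaveOn ℝ S f) {t : ℝ} (ht : 0 < t) :
    ConcaveOn ℝ S (fun x => f x - x ^ 2 / (2 * t)) := by
  refine hf.sub ⟨hf.1, ?_⟩
  intro x _ y _ a b ha hb hab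
  have hb' : b = 1 - a := by linarith
  subst hb'
  simp only [smul_eq_mul]
  have : (a * x + (1-a) * y) ^ 2 ≤ a * x ^ 2 + (1-a) * y ^ 2 := by nlinarith [mul_nonneg (mul_nonneg ha hb) (sq_nonneg (x - y))]
  calc _ ≤ (a * x ^ 2 + (1-a) * y ^ 2) / (2 * t) := by gcongr
    _ = _ := by ring
lemma concave_aff {S : Set ℝ} (hS : Convex ℝ S) (c d : ℝ) : ConcaveOn ℝ S (fun x => c * x + d) := by
  refine ⟨hS, ?_⟩
  intro x _ y _ a b ha hb hab
  have hb' : b = 1 - a := by linarith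
  subst hb'
  simp only [smul_eq_mul]
  apply le_of_eq; ring
lemma touch_of {V : ℝ → ℝ → ℝ} {p : ℝ × ℝ} (c : ℝ) (h : ∀ᶠ q : ℝ × ℝ in nhds p, V q.1 q.2 ≤ V p.1 p.2 + c * (q.1 - p.1) - c ^ 2 / 2 * (q.2 - p.2)) :
    IsLocalExtr (fun q : ℝ × ℝ => V q.1 q.2 - (c * q.1 - c ^ 2 / 2 * q.2)) p := by
  right
  filter_upwards [h] with q hq
  linarith
lemma touch_below {V : ℝ → ℝ → ℝ} {p : ℝ × ℝ} (c : ℝ) (h : ∀ᶠ q : ℝ × ℝ in nhds p, V p.1 p.2 + c * (q.1 - p.1) - c ^ 2 / 2 * (q.2 - p.2) ≤ V q.1 q.2) :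
    IsLocalExtr (fun q : ℝ × ℝ => V q.1 q.2 - (c * q.1 - c ^ 2 / 2 * q.2)) p := by
  left
  filter_upwards [h] with q hq
  linarith
lemma hd_aff {f : ℝ → ℝ} {x c d : ℝ} {S : Set ℝ} (hS : S ∈ nhds x) (h : ∀ y ∈ S, f y = c * y + d) : HasDerivAt f c x := by
  have : HasDerivAt (fun y => c * y + d) c x := by simpa using ((hasDerivAt_id x).const_mul c).add_const d
  exact this.congr_of_eventuallyEq (by filter_upwards [hS] with y hy using h y hy)
lemma hdw_aff {f : ℝ → ℝ} {x c d : ℝ} {S T : Set ℝ} (hS : S ∈ nhdsWithin x T) (h : ∀ y ∈ S, f y = c * y + d) (hx : f x = c * x + d) : HasDerivWithinAt f c T x := by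
  have : HasDerivAt (fun y => c * y + d) c x := by simpa using ((hasDerivAt_id x).const_mul c).add_const d
  exact this.hasDerivWithinAt.congr_of_eventuallyEq (by filter_upwards [hS] with y hy using h y hy) hx
lemma min3_a {a b c : ℝ} (h : a ≤ b) (h' : a ≤ c) : min (min a b) c = a := by rw [min_eq_left h, min_eq_left h']
lemma min3_b {a b c : ℝ} (h : b ≤ a) (h' : b ≤ c) : min (min a b) c = b := by rw [min_eq_right h, min_eq_left h']
lemma min3_c {a b c : ℝ} (h : c ≤ a) (h' : c ≤ b) : min (min a b) c = c := min_eq_right (le_min h h')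
def U1 (p x t : ℝ) : ℝ := min (min (8 + 4 * x - 8 * t) (4 * |x| - 8 * t)) (p * x + p ^ 2 * (1 - t) / 2 - 8)
lemma ae_ne (a : ℝ) : ∀ᵐ x : ℝ, x ≠ a := by simp [ae_iff, measure_singleton]
lemma U1_l {p x t : ℝ} (h : x ≤ 0) : U1 p x t = min (min (4 * x + (8 - 8 * t)) (-4 * x + (- 8 * t))) (p * x + (p ^ 2 * (1 - t) / 2 - 8)) := by
  unfold U1; rw [abs_of_nonpos h]; congr 1; congr 1 <;> ring; ring
lemma U1_r {p x t : ℝ} (h : 0 ≤ x) : U1 p x t = min (min (4 * x + (8 - 8 * t)) (4 * x + (- 8 * t))) (p * x + (p ^ 2 * (1 - t) / 2 - 8)) := by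
  unfold U1; rw [abs_of_nonneg h]; congr 1; congr 1 <;> ring; ring
lemma U1_ccl (p t : ℝ) : ConcaveOn ℝ (Iic 0) (fun x => U1 p x t) := by
  refine ConcaveOn.congr (f := fun x => _) ?_ (fun x hx => (U1_l hx).symm)
  exact ((concave_aff (convex_Iic 0) _ _).inf (concave_aff (convex_Iic 0) _ _)).inf (concave_aff (convex_Iic 0) _ _)
lemma U1_ccr (p t : ℝ) : ConcaveOn ℝ (Ici 0) (fun x => U1 p x t) := by
  refine ConcaveOn.congr (f := fun x => _) ?_ (fun x hx => (U1_r hx).symm)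
  exact ((concave_aff (convex_Ici 0) _ _).inf (concave_aff (convex_Ici 0) _ _)).inf (concave_aff (convex_Ici 0) _ _)
lemma U1_E {p : ℝ} (hp : p < -12) : EHyp (U1 p) (udat1 (-1) p) (-p) (p ^ 2 / 2) where
  lipx t ht x y := by
    have ha := abs_nonneg (x - y)
    refine (abs_min_sub_min_le_max _ _ _ _).trans (max_le ((abs_min_sub_min_le_max _ _ _ _).trans (max_le ?_ ?_)) ?_)
    · rw [show 8 + 4 * x - 8 * t - (8 + 4 * y - 8 * t) = 4 * (x - y) by ring, abs_mul]; norm_num; nlinarith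
    · rw [show 4 * |x| - 8 * t - (4 * |y| - 8 * t) = 4 * (|x| - |y|) by ring, abs_mul]; norm_num; nlinarith [abs_abs_sub_abs_le_abs_sub x y]
    · rw [show p * x + p ^ 2 * (1 - t) / 2 - 8 - (p * y + p ^ 2 * (1 - t) / 2 - 8) = p * (x - y) by ring, abs_mul, abs_of_neg (by linarith : p < 0)]
  lipt s t _ _ x := by
    have ha := abs_nonneg (s - t)
    have hp2 : 8 ≤ p ^ 2 / 2 := by nlinarith
    refine (abs_min_sub_min_le_max _ _ _ _).trans (max_le ((abs_min_sub_min_le_max _ _ _ _).trans (max_le ?_ ?_)) ?_)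
    · rw [show 8 + 4 * x - 8 * s - (8 + 4 * x - 8 * t) = -8 * (s - t) by ring, abs_mul]; norm_num; nlinarith
    · rw [show 4 * |x| - 8 * s - (4 * |x| - 8 * t) = -8 * (s - t) by ring, abs_mul]; norm_num; nlinarith
    · rw [show p * x + p ^ 2 * (1 - s) / 2 - 8 - (p * x + p ^ 2 * (1 - t) / 2 - 8) = -(p ^ 2 / 2) * (s - t) by ring, abs_mul, abs_neg, abs_of_nonneg (by positivity : 0 ≤ p ^ 2 / 2)]
  ccl t ht := concave_sub_sq (U1_ccl p t) ht
  ccr t ht := concave_sub_sq (U1_ccr p t) ht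
  touch := by
    filter_upwards [ae_fst_ne 0] with q0 h0 _
    obtain ⟨x, t⟩ := q0
    simp only at h0
    have t1 : ∀ y s, U1 p y s ≤ 8 + 4 * y - 8 * s := fun y s => (min_le_left _ _).trans (min_le_left _ _)
    have t2 : ∀ y s, U1 p y s ≤ 4 * |y| - 8 * s := fun y s => (min_le_left _ _).trans (min_le_right _ _)
    have t3 : ∀ y s, U1 p y s ≤ p * y + p ^ 2 * (1 - s) / 2 - 8 := fun y s => min_le_right _ _
    rcases min_choice (min (8 + 4 * x - 8 * t) (4 * |x| - 8 * t)) (p * x + p ^ 2 * (1 - t) / 2 - 8) with h | h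
    · rcases min_choice (8 + 4 * x - 8 * t) (4 * |x| - 8 * t) with h' | h'
      · have e : U1 p x t = 8 + 4 * x - 8 * t := h.trans h'
        exact ⟨4, touch_of 4 (Eventually.of_forall fun q => by have := t1 q.1 q.2; simp only [e]; linarith)⟩
      · have e : U1 p x t = 4 * |x| - 8 * t := h.trans h'
        rcases lt_or_gt_of_ne h0 with hx | hx
        · refine ⟨-4, touch_of (-4) ?_⟩
          filter_upwards [(continuous_fst.tendsto (x, t)).eventually (gt_mem_nhds hx)] with q hq
          have := t2 q.1 q.2
          rw [abs_of_neg hq] at this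
          simp only [e, abs_of_neg hx]; linarith
        · refine ⟨4, touch_of 4 ?_⟩
          filter_upwards [(continuous_fst.tendsto (x, t)).eventually (lt_mem_nhds hx)] with q hq
          have := t2 q.1 q.2
          rw [abs_of_pos hq] at this
          simp only [e, abs_of_pos hx]; linarith
    · have e : U1 p x t = _ := h
      exact ⟨p, touch_of p (Eventually.of_forall fun q => by have := t3 q.1 q.2; simp only [e]; linarith)⟩
  iface := by
    filter_upwards [ae_ne 1] with t ht1 ht
    rcases lt_or_gt_of_ne ht1 with h | h
    · have hp3 := mul_nonneg (show 0 ≤ p ^ 2 - 16 by nlinarith) (show 0 ≤ 1 - t by linarith)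
      refine ⟨-4, 4, hdw_aff (d := -8 * t) (S := Ioo (-1) 0) (Ioo_mem_nhdsLT (by norm_num)) ?_ ?_, hdw_aff (d := -8 * t) (S := Ioo 0 ((1-t))) (Ioo_mem_nhdsGT (by linarith)) ?_ ?_, by norm_num⟩
      · intro y hy
        rw [U1_l hy.2.le, min3_b] <;> nlinarith [hy.1, hy.2]
      · rw [U1_l le_rfl, min3_b] <;> nlinarith
      · intro y hy
        rw [U1_r hy.1.le, min3_b] <;> nlinarith [hy.1, hy.2, mul_nonneg (show 0 ≤ -p-12 by linarith) (show 0 ≤ 1-t-y by linarith [hy.2]), mul_nonneg (show 0 ≤ -p-12 by linarith) (show 0 ≤ 1-t by linarith), mul_nonneg (mul_nonneg (show 0 ≤ -p-12 by linarith) (show 0 ≤ -p-12 by linarith)) (show 0 ≤ 1-t by linarith)]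
      · rw [U1_r le_rfl, min3_b] <;> nlinarith
    · have hp2 : (t - 1) ≤ (p ^ 2 - 16) * (t - 1) / 2 := by
        nlinarith [mul_nonneg (show 0 ≤ p ^ 2 - 18 by nlinarith) (show 0 ≤ t - 1 by linarith)]
      refine ⟨p, p, hdw_aff (d := p ^ 2 * (1 - t) / 2 - 8) (S := Ioo ((t-1)/(p-4)) 0) (Ioo_mem_nhdsLT (div_neg_of_pos_of_neg (by linarith) (by linarith))) ?_ ?_, hdw_aff (d := p ^ 2 * (1 - t) / 2 - 8) (S := Ioi 0) self_mem_nhdsWithin ?_ ?_, ?_⟩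
      · intro y hy
        have h1 := hy.1
        rw [div_lt_iff_of_neg (by linarith)] at h1
        rw [U1_l hy.2.le, min3_c] <;> nlinarith [hy.2]
      · rw [U1_l le_rfl, min3_c] <;> nlinarith
      · intro y hy
        have hy : 0 < y := hy
        rw [U1_r hy.le, min3_c] <;> nlinarith
      · rw [U1_l le_rfl, min3_c] <;> nlinarith
      · rw [abs_of_neg (by linarith), abs_of_neg (by linarith)]; nlinarith
  meas0 := by
    unfold udat1
    exact Measurable.ite measurableSet_Iio measurable_const (Measurable.ite measurableSet_Iio measurable_const (Measurable.ite measurableSet_Iio measurable_const measurable_const))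
  bdd0 x := by unfold udat1; split_ifs <;> rw [abs_le] <;> constructor <;> linarith
  der0 := by
    filter_upwards [ae_ne (-1), ae_ne 0, ae_ne ((4 * (-1) - p) / 2)] with x h1 h2 h3
    unfold udat1
    split_ifs with a b c
    · refine hd_aff (d := 8) (S := Iio (-1)) (Iio_mem_nhds a) fun y hy => ?_
      have hy : y < -1 := hy
      rw [U1_l (by linarith), min3_a] <;> nlinarith
    · have a' : -1 < x := lt_of_le_of_ne (not_lt.1 a) (Ne.symm h1)
      refine hd_aff (d := 0) (S := Ioo (-1) 0) (Ioo_mem_nhds a' b) fun y hy => ?_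
      rw [U1_l hy.2.le, min3_b] <;> nlinarith [hy.1, hy.2]
    · have a' : 0 < x := lt_of_le_of_ne (not_lt.1 b) (Ne.symm h2)
      refine hd_aff (d := 0) (S := Ioo 0 ((4 * (-1) - p) / 2)) (Ioo_mem_nhds a' c) fun y hy => ?_
      have := hy.2
      rw [U1_r hy.1.le, min3_b] <;> nlinarith [hy.1, hy.2]
    · have a' : (4 * (-1) - p) / 2 < x := lt_of_le_of_ne (not_lt.1 c) (Ne.symm h3)
      refine hd_aff (d := p ^ 2 / 2 - 8) (S := Ioi ((4 * (-1) - p) / 2)) (Ioi_mem_nhds a') fun y hy => ?_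
      have hy : _ < y := hy
      rw [U1_r (by linarith), min3_c] <;> nlinarith
  cc0 := by
    filter_upwards [ae_ne 0] with x h0
    refine ⟨|x|, abs_pos.2 h0, fun t _ _ => ?_⟩
    rcases lt_or_gt_of_ne h0 with hx | hx
    · exact (U1_ccl p t).subset (fun y hy => by rw [abs_of_neg hx] at hy; have := hy.2; simp at this ⊢; linarith) (convex_Icc _ _)
    · exact (U1_ccr p t).subset (fun y hy => by rw [abs_of_pos hx] at hy; have := hy.1; simp at this ⊢; linarith) (convex_Icc _ _)
lemma U1_end {p : ℝ} (hp : p < -12) : ∀ᵐ x, (U1_E hp).sol.u x 1 = omega3 (-1) p x := by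
  filter_upwards [ae_ne (-1), ae_ne 0] with x h1 h2
  refine (U1_E hp).eu_eq one_pos h2 ?_
  unfold omega3
  split_ifs with a b
  · refine hd_aff (d := 0) (S := Iio (-1)) (Iio_mem_nhds (lt_of_le_of_ne a h1)) fun y hy => ?_
    have hy : y < -1 := hy
    rw [U1_l (by linarith), min3_a] <;> nlinarith
  · refine hd_aff (d := -8) (S := Ioo (-1) 0) (Ioo_mem_nhds (not_le.1 a) b) fun y hy => ?_
    rw [U1_l hy.2.le, min3_b] <;> nlinarith [hy.1, hy.2]
  · have a' : 0 < x := lt_of_le_of_ne (not_lt.1 b) (Ne.symm h2)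
    refine hd_aff (d := -8) (S := Ioi 0) (Ioi_mem_nhds a') fun y hy => ?_
    have hy : 0 < y := hy
    rw [U1_r hy.le, min3_c] <;> nlinarith
end

section
def Kf (a b X τ : ℝ) : ℝ := sInf ((fun c : ℝ => c * X + τ * c ^ 2 / 2) '' Icc a b)
lemma Kf_cpt (a b X τ : ℝ) : IsCompact ((fun c : ℝ => c * X + τ * c ^ 2 / 2) '' Icc a b) :=
  isCompact_Icc.image (by fun_prop)
lemma Kf_le {a b : ℝ} (X τ : ℝ) {c : ℝ} (h1 : a ≤ c) (h2 : c ≤ b) : Kf a b X τ ≤ c * X + τ * c ^ 2 / 2 :=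
  csInf_le (Kf_cpt a b X τ).bddBelow ⟨c, ⟨h1, h2⟩, rfl⟩
lemma Kf_ex {a b : ℝ} (hab : a ≤ b) (X τ : ℝ) : ∃ c, a ≤ c ∧ c ≤ b ∧ Kf a b X τ = c * X + τ * c ^ 2 / 2 := by
  obtain ⟨c, hc, h⟩ := (Kf_cpt a b X τ).sInf_mem ((nonempty_Icc.2 hab).image _)
  exact ⟨c, hc.1, hc.2, h.symm⟩
lemma Kf_ge {a b X τ m : ℝ} (hab : a ≤ b) (h : ∀ c, a ≤ c → c ≤ b → m ≤ c * X + τ * c ^ 2 / 2) : m ≤ Kf a b X τ := by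
  obtain ⟨c, h1, h2, h3⟩ := Kf_ex hab X τ
  rw [h3]; exact h c h1 h2
lemma Kf_eq {a b X τ : ℝ} (c : ℝ) (h1 : a ≤ c) (h2 : c ≤ b) (h : ∀ d, a ≤ d → d ≤ b → c * X + τ * c ^ 2 / 2 ≤ d * X + τ * d ^ 2 / 2) :
    Kf a b X τ = c * X + τ * c ^ 2 / 2 :=
  le_antisymm (Kf_le _ _ h1 h2) (Kf_ge (h1.trans h2) h)
lemma Kf_lip {a b m : ℝ} (hab : a ≤ b) (hm : ∀ c, a ≤ c → c ≤ b → |c| ≤ m) (X Y τ σ : ℝ) :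
    |Kf a b X τ - Kf a b Y σ| ≤ m * |X - Y| + m ^ 2 / 2 * |τ - σ| := by
  have key : ∀ X Y τ σ, Kf a b X τ - Kf a b Y σ ≤ m * |X - Y| + m ^ 2 / 2 * |τ - σ| := by
    intro X Y τ σ
    obtain ⟨c, h1, h2, h3⟩ := Kf_ex hab Y σ
    have h4 := Kf_le X τ h1 h2
    have h5 := hm c h1 h2
    have e1 : c * (X - Y) ≤ m * |X - Y| := by
      refine (le_abs_self _).trans ?_
      rw [abs_mul]; exact mul_le_mul_of_nonneg_right h5 (abs_nonneg _)
    have e2 : c ^ 2 / 2 * (τ - σ) ≤ m ^ 2 / 2 * |τ - σ| := by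
      have : c ^ 2 ≤ m ^ 2 := sq_le_sq' (by linarith [(abs_le.1 h5).1]) (abs_le.1 h5).2
      refine (le_abs_self _).trans ?_
      rw [abs_mul, abs_of_nonneg (by positivity)]
      exact mul_le_mul_of_nonneg_right (by linarith) (abs_nonneg _)
    rw [h3]; linarith
  rw [abs_le]
  constructor
  · have := key Y X σ τ
    rw [abs_sub_comm Y, abs_sub_comm σ] at this; linarith
  · exact key _ _ _ _
lemma Kf_concave {a b : ℝ} (hab : a ≤ b) (S : Set ℝ) (hS : Convex ℝ S) (s d τ : ℝ) :
    ConcaveOn ℝ S (fun x => Kf a b (s * x + d) τ) := by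
  refine ⟨hS, ?_⟩
  intro x _ y _ α β hα hβ h
  simp only [smul_eq_mul]
  obtain ⟨c, h1, h2, h3⟩ := Kf_ex hab (s * (α * x + β * y) + d) τ
  rw [h3]
  have a1 := mul_le_mul_of_nonneg_left (Kf_le (s * x + d) τ h1 h2) hα
  have a2 := mul_le_mul_of_nonneg_left (Kf_le (s * y + d) τ h1 h2) hβ
  have hb' : β = 1 - α := by linarith
  subst hb'
  linarith
lemma Ff_concave {a b : ℝ} (hab : a ≤ b) (S : Set ℝ) (hS : Convex ℝ S) (d : ℝ) {t : ℝ} (ht : 0 < t) :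
    ConcaveOn ℝ S (fun x => -Kf a b (-(x + d)) t - x ^ 2 / (2 * t)) := by
  refine ⟨hS, ?_⟩
  intro x _ y _ α β hα hβ h
  simp only [smul_eq_mul]
  obtain ⟨c, h1, h2, h3⟩ := Kf_ex hab (-(x + d)) t
  obtain ⟨e, h4, h5, h6⟩ := Kf_ex hab (-(y + d)) t
  rw [h3, h6]
  have hb' : β = 1 - α := by linarith
  subst hb'
  have := Kf_le (a := a) (b := b) (-(α * x + (1-α) * y + d)) t (c := α * c + (1-α) * e) (by nlinarith) (by nlinarith)
  have k : 0 ≤ α * (1-α) * ((x - y) - t * (c - e)) ^ 2 / (2 * t) := by positivity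
  have id : -((α * c + (1-α) * e) * (-(α * x + (1-α) * y + d)) + t * (α * c + (1-α) * e) ^ 2 / 2) - (α * x + (1-α) * y) ^ 2 / (2 * t)
     - (α * (-(c * (-(x + d)) + t * c ^ 2 / 2) - x ^ 2 / (2 * t)) + (1-α) * (-(e * (-(y + d)) + t * e ^ 2 / 2) - y ^ 2 / (2 * t)))
     = α * (1-α) * ((x - y) - t * (c - e)) ^ 2 / (2 * t) := by
    field_simp; ring
  linarith
def KL (x t : ℝ) : ℝ := Kf 0 4 (x + 1) (1 - t) - 8
def FL (x t : ℝ) : ℝ := -Kf 0 8 (-(x + 1)) t - 8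
def FR (x t : ℝ) : ℝ := -Kf (-8) (-4) (-(x + -1)) t - 8
def KR (p x t : ℝ) : ℝ := Kf p (-4) x (1 - t) - 12
def KR' (p x t : ℝ) : ℝ := KR p x t + 16 * max (1 / 4 - t) 0
def fstL (x t : ℝ) : ℝ := KL x t + FL x t + 8
def fstR (p x t : ℝ) : ℝ := KR p x t + FR x t + 4 * x + 4 + 8 * t
def U2 (p x t : ℝ) : ℝ := if x ≤ 0 then min (fstL x t) (KR' p x t) else min (fstR p x t) (KR' p x t)
variable {p x t : ℝ}
lemma KL_le0 : KL x t ≤ -8 := by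
  have := Kf_le (a := 0) (b := 4) (x + 1) (1 - t) (c := 0) le_rfl (by norm_num)
  unfold KL; linarith
lemma KL_le4 : KL x t ≤ 4 * x + 4 - 8 * t := by
  have := Kf_le (a := 0) (b := 4) (x + 1) (1 - t) (c := 4) (by norm_num) le_rfl
  unfold KL; linarith
lemma KL_eq0 (hx : -1 ≤ x) (ht : t ≤ 1) : KL x t = -8 := by
  unfold KL; rw [Kf_eq 0 le_rfl (by norm_num)]
  · ring
  · intro d hd _; have := mul_nonneg hd (show 0 ≤ x + 1 by linarith); have := mul_nonneg (show 0 ≤ 1 - t by linarith) (sq_nonneg d); linarith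
lemma FL_ge0 : -8 ≤ FL x t := by
  have := Kf_le (a := 0) (b := 8) (-(x + 1)) t (c := 0) le_rfl (by norm_num)
  unfold FL; linarith
lemma FL_ge {c : ℝ} (h0 : 0 ≤ c) (h8 : c ≤ 8) : c * (x + 1) - t * c ^ 2 / 2 - 8 ≤ FL x t := by
  have := Kf_le (a := 0) (b := 8) (-(x + 1)) t h0 h8
  unfold FL; linarith
lemma FL_eq0 (hx : x ≤ -1) (ht : 0 ≤ t) : FL x t = -8 := by
  unfold FL; rw [Kf_eq 0 le_rfl (by norm_num)]
  · ring
  · intro d hd _; have := mul_nonneg hd (show 0 ≤ -(x + 1) by linarith); have := mul_nonneg ht (sq_nonneg d); linarith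
lemma FL_eq8 (hx : 8 * t ≤ x + 1) (ht : 0 ≤ t) : FL x t = 8 * x + (- 32 * t) := by
  unfold FL; rw [Kf_eq 8 (by norm_num) le_rfl]
  · ring
  · intro d hd hd8
    nlinarith [mul_nonneg (show 0 ≤ 8 - d by linarith) (show 0 ≤ x + 1 - 8 * t by linarith), mul_nonneg ht (sq_nonneg (d - 8))]
lemma FL_eqq (h0 : 0 ≤ x + 1) (hx : x + 1 ≤ 8 * t) (ht : 0 < t) : FL x t = (x + 1) ^ 2 / (2 * t) - 8 := by
  unfold FL; rw [Kf_eq ((x + 1) / t) (by positivity) (by rw [div_le_iff₀ ht]; exact hx)]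
  · field_simp; ring
  · intro d hd hd8
    have : 0 ≤ t * (d - (x + 1) / t) ^ 2 / 2 := by positivity
    have e : t * (d - (x + 1) / t) ^ 2 / 2 = (d * -(x + 1) + t * d ^ 2 / 2) - ((x + 1) / t * -(x + 1) + t * ((x + 1) / t) ^ 2 / 2) := by field_simp; ring
    linarith
lemma FL_ub (hx : x ≤ 0) (h0 : 0 ≤ t) (ht : t ≤ 1/4) : FL x t ≤ -4 * x - 24 * t + 4 * x := by
  obtain ⟨c, h1, h2, h3⟩ := Kf_ex (a := 0) (b := 8) (by norm_num) (-(x + 1)) t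
  unfold FL; rw [h3]
  nlinarith [mul_nonneg h1 (show 0 ≤ -x by linarith), mul_nonneg (show 0 ≤ 1/4 - t by linarith) (show 0 ≤ 8 - c by linarith), mul_nonneg h0 (sq_nonneg (c - 4)), mul_nonneg h0 (show 0 ≤ 8 - c by linarith)]
lemma FR_ge4 : -4 * x - 4 - 8 * t ≤ FR x t := by
  have := Kf_le (a := -8) (b := -4) (-(x + -1)) t (c := -4) (by norm_num) le_rfl
  unfold FR; linarith
lemma FR_eq4 (hx : 1 ≤ x) (ht : 0 ≤ t) : FR x t = -4 * x - 4 - 8 * t := by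
  unfold FR; rw [Kf_eq (-4) (by norm_num) le_rfl]
  · ring
  · intro d hd hd'; nlinarith [mul_nonneg (show 0 ≤ -4 - d by linarith) (show 0 ≤ x - 1 by linarith), mul_nonneg ht (mul_nonneg (show 0 ≤ -4 - d by linarith) (show 0 ≤ 4 - d by linarith))]
lemma FR_eq8 (hx : 8 * t ≤ 1 - x) (ht : 0 ≤ t) : FR x t = -8 * x + (- 32 * t) := by
  unfold FR; rw [Kf_eq (-8) le_rfl (by norm_num)]
  · ring
  · intro d hd hd8
    nlinarith [mul_nonneg (show 0 ≤ d + 8 by linarith) (show 0 ≤ 1 - x - 8 * t by linarith), mul_nonneg ht (sq_nonneg (d + 8))]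
lemma FR_eqq (h0 : 4 * t ≤ 1 - x) (hx : 1 - x ≤ 8 * t) (ht : 0 < t) : FR x t = (x - 1) ^ 2 / (2 * t) - 8 := by
  unfold FR; rw [Kf_eq (-((1 - x) / t)) (by rw [neg_le_neg_iff, div_le_iff₀ ht]; exact hx) (by rw [neg_le_neg_iff, le_div_iff₀ ht]; exact h0)]
  · field_simp; ring
  · intro d hd hd8
    have : 0 ≤ t * (d + (1 - x) / t) ^ 2 / 2 := by positivity
    have e : t * (d + (1 - x) / t) ^ 2 / 2 = (d * -(x + -1) + t * d ^ 2 / 2) - (-((1 - x) / t) * -(x + -1) + t * (-((1 - x) / t)) ^ 2 / 2) := by field_simp; ring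
    linarith
lemma KR_le4 (hp : p < -12) : KR p x t ≤ -4 * x - 4 - 8 * t := by
  have := Kf_le (a := p) (b := -4) x (1 - t) (c := -4) (by linarith) le_rfl
  unfold KR; linarith
lemma KR_eq4 (hp : p < -12) (hx : x ≤ 4 * (1 - t)) (ht : t ≤ 1) : KR p x t = -4 * x + (- 4 - 8 * t) := by
  unfold KR; rw [Kf_eq (-4) (by linarith) le_rfl]
  · ring
  · intro d hd hd'; nlinarith [mul_nonneg (show 0 ≤ -4 - d by linarith) (show 0 ≤ 4 * (1 - t) - x by linarith), mul_nonneg (show 0 ≤ 1 - t by linarith) (sq_nonneg (d + 4))]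
lemma KR_eqp (hp : p < -12) (hx : -(1 - t) * (p - 4) ≤ 2 * x) (h1 : 1 ≤ t) : KR p x t = p * x + (p ^ 2 * (1 - t) / 2 - 12) := by
  unfold KR; rw [Kf_eq p le_rfl (by linarith)]
  · ring
  · intro d hd hd'
    nlinarith [mul_nonneg (show 0 ≤ d - p by linarith) (show 0 ≤ 2 * x + (1 - t) * (p - 4) by linarith), mul_nonneg (show 0 ≤ d - p by linarith) (mul_nonneg (show 0 ≤ t - 1 by linarith) (show 0 ≤ -4 - d by linarith))]
lemma KR_le_KR' : KR p x t ≤ KR' p x t := by unfold KR'; linarith [le_max_right (1/4 - t) 0]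
lemma KR'_eq (h : 1/4 ≤ t) : KR' p x t = KR p x t := by unfold KR'; rw [max_eq_right (by linarith)]; ring
lemma fstL_gt (hp : p < -12) (hx : x ≤ 0) (h0 : 0 ≤ t) (h : t ≤ 1/4) : fstL x t ≤ KR' p x t + 4 * x := by
  unfold KR' fstL; rw [max_eq_left (by linarith), KR_eq4 hp (by linarith) (by linarith)]
  linarith [FL_ub hx h0 h, KL_le0 (x := x) (t := t)]
lemma fstL_ge (hp : p < -12) (hx : -1 ≤ x) (h1 : 1 ≤ t) : KR p x t ≤ fstL x t := by
  unfold fstL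
  have := KR_le4 hp (x := x) (t := t)
  have := FL_ge0 (x := x) (t := t)
  have : KR p x t + 8 ≤ Kf 0 4 (x + 1) (1 - t) := Kf_ge (by norm_num) fun c h0 h4 => by
    nlinarith [mul_nonneg h0 (show 0 ≤ x + 1 by linarith), mul_nonneg (show 0 ≤ t - 1 by linarith) (mul_nonneg h0 (show 0 ≤ 4 - c by linarith)),
      mul_nonneg (show 0 ≤ t - 1 by linarith) (show 0 ≤ 4 - c by linarith)]
  unfold KL; linarith
lemma fstR_ge : KR p x t ≤ fstR p x t := by unfold fstR; linarith [FR_ge4 (x := x) (t := t)]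
lemma FR_ub (hx : 0 ≤ x) (h0 : 0 ≤ t) (ht : t ≤ 1/4) : FR x t ≤ -4 * x - 4 - 8 * t + 16 * (1/4 - t) := by
  obtain ⟨c, h1, h2, h3⟩ := Kf_ex (a := -8) (b := -4) (by norm_num) (-(x + -1)) t
  unfold FR; rw [h3]
  nlinarith [mul_nonneg (show 0 ≤ -4 - c by linarith) hx, mul_nonneg (show 0 ≤ 1/4 - t by linarith) (show 0 ≤ c + 8 by linarith), mul_nonneg h0 (sq_nonneg (c + 4))]
lemma fstR_le (hx : 0 ≤ x) (h0 : 0 ≤ t) (h : t ≤ 1/4) : fstR p x t ≤ KR' p x t := by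
  unfold KR' fstR; rw [max_eq_left (by linarith)]; linarith [FR_ub hx h0 h]
lemma fstR_eq (hp : p < -12) (hx : x ≤ 1) (h : t ≤ 1/4) : fstR p x t = FR x t := by
  unfold fstR; rw [KR_eq4 hp (by linarith) (by linarith)]; ring
lemma F0_eq (h0 : 0 ≤ t) (h : t ≤ 1/4) : FL 0 t = FR 0 t := by
  rcases le_or_gt t (1/8) with h' | h'
  · rw [FL_eq8 (by linarith) h0, FR_eq8 (by linarith) h0]; ring
  · rw [FL_eqq (by linarith) (by linarith) (by linarith), FR_eqq (by linarith) (by linarith) (by linarith)]; ring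
lemma U2_l (hx : x ≤ 0) : U2 p x t = min (fstL x t) (KR' p x t) := by simp [U2, hx]
lemma U2_0 (hp : p < -12) (h0 : 0 ≤ t) : min (fstL 0 t) (KR' p 0 t) = min (fstR p 0 t) (KR' p 0 t) := by
  rcases le_or_gt t (1/4) with h | h
  · rw [fstR_eq hp zero_le_one h, fstL, KL_eq0 (by norm_num) (by linarith), F0_eq h0 h]; congr 1; ring
  · rw [KR'_eq h.le, min_eq_right fstR_ge, min_eq_right]
    rcases le_or_gt 1 t with h1 | h1
    · exact fstL_ge hp (by norm_num) h1
    · rw [fstL, KL_eq0 (by norm_num) h1.le]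
      have a := KR_le4 hp (x := 0) (t := t)
      have b := FL_ge (x := 0) (t := t) (c := 1 / t) (by positivity) (by rw [div_le_iff₀ (by linarith)]; linarith)
      have e : 1 / t * (0 + 1) - t * (1 / t) ^ 2 / 2 - 8 - (-4 * 0 - 4 - 8 * t) = (1 - 4 * t) ^ 2 / (2 * t) := by field_simp; ring
      have : 0 ≤ (1 - 4 * t) ^ 2 / (2 * t) := by positivity
      linarith
lemma U2_r (hp : p < -12) (h0 : 0 ≤ t) (hx : 0 ≤ x) : U2 p x t = min (fstR p x t) (KR' p x t) := by
  rcases hx.eq_or_lt with h | h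
  · subst h; rw [U2_l le_rfl]; exact U2_0 hp h0
  · simp [U2, not_le.2 h]
lemma U2_r1 (hp : p < -12) (ht : 1/4 ≤ t) (hx : 0 ≤ x) : U2 p x t = KR p x t := by
  rw [U2_r hp (by linarith) hx, KR'_eq ht, min_eq_right fstR_ge]
lemma U2_r2 (hp : p < -12) (h0 : 0 ≤ t) (hx : 1 ≤ x) : U2 p x t = KR p x t := by
  rw [U2_r hp h0 (by linarith), fstR, FR_eq4 hx h0, min_eq_left] <;> linarith [KR_le_KR' (p := p) (x := x) (t := t)]
lemma U2_r3 (hp : p < -12) (h0 : 0 ≤ t) (ht : t ≤ 1/4) (hx : 0 ≤ x) (h1 : x ≤ 1) : U2 p x t = FR x t := by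
  rw [U2_r hp h0 hx, min_eq_left (fstR_le hx h0 ht), fstR_eq hp h1 ht]
lemma U2_l1 (h0 : 0 ≤ t) (hx : x ≤ -1) : U2 p x t = min (KL x t) (KR' p x t) := by
  rw [U2_l (by linarith), fstL, FL_eq0 hx h0]; congr 1; ring
lemma U2_l2 (hp : p < -12) (h0 : 0 ≤ t) (ht : t ≤ 1/4) (hx : x ≤ 0) : U2 p x t = fstL x t := by
  rw [U2_l hx, min_eq_left]; linarith [fstL_gt hp hx h0 ht]
lemma U2_l3 (hp : p < -12) (h0 : 0 ≤ t) (ht : t ≤ 1/4) (hx : x ≤ 0) (h1 : -1 ≤ x) : U2 p x t = FL x t := by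
  rw [U2_l2 hp h0 ht hx, fstL, KL_eq0 h1 (by linarith)]; ring
lemma U2_l4 (hp : p < -12) (ht : 1 ≤ t) (hx : x ≤ 0) (h1 : -1 ≤ x) : U2 p x t = KR p x t := by
  rw [U2_l hx, KR'_eq (by linarith), min_eq_right (fstL_ge hp h1 ht)]
end

section
variable {p x t : ℝ}
lemma lip_glue {f g : ℝ → ℝ} {M : ℝ} (h0 : f 0 = g 0) (hf : ∀ x y, x ≤ 0 → y ≤ 0 → |f x - f y| ≤ M * |x - y|)
    (hg : ∀ x y, 0 ≤ x → 0 ≤ y → |g x - g y| ≤ M * |x - y|) (x y : ℝ) :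
    |(if x ≤ 0 then f x else g x) - (if y ≤ 0 then f y else g y)| ≤ M * |x - y| := by
  have cross : ∀ x y, x ≤ 0 → 0 ≤ y → |f x - g y| ≤ M * |x - y| := by
    intro x y hx hy
    have a := hf x 0 hx le_rfl
    have b := hg 0 y le_rfl hy
    have e : f x - g y = (f x - f 0) + (g 0 - g y) := by rw [h0]; ring
    rw [e]
    refine (abs_add_le _ _).trans ((add_le_add a b).trans (le_of_eq ?_))
    rw [sub_zero, zero_sub, abs_neg, abs_of_nonpos hx, abs_of_nonneg hy, abs_of_nonpos (by linarith : x - y ≤ 0)]; ring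
  split_ifs with h1 h2 h2
  · exact hf _ _ h1 h2
  · exact cross _ _ h1 (by linarith)
  · rw [abs_sub_comm, abs_sub_comm x]; exact cross _ _ h2 (by linarith)
  · exact hg _ _ (by linarith) (by linarith)
lemma bd_KL (x y s t : ℝ) : |KL x s - KL y t| ≤ 4 * |x - y| + 8 * |s - t| := by
  have := Kf_lip (a := 0) (b := 4) (m := 4) (by norm_num) (fun c h1 h2 => abs_le.2 ⟨by linarith, h2⟩) (x + 1) (y + 1) (1 - s) (1 - t)
  rw [show x + 1 - (y + 1) = x - y by ring, show 1 - s - (1 - t) = -(s - t) by ring, abs_neg] at this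
  unfold KL; rw [sub_sub_sub_cancel_right]; linarith
lemma bd_FL (x y s t : ℝ) : |FL x s - FL y t| ≤ 8 * |x - y| + 32 * |s - t| := by
  have := Kf_lip (a := 0) (b := 8) (m := 8) (by norm_num) (fun c h1 h2 => abs_le.2 ⟨by linarith, h2⟩) (-(x + 1)) (-(y + 1)) s t
  rw [show -(x + 1) - -(y + 1) = -(x - y) by ring, abs_neg] at this
  unfold FL; rw [sub_sub_sub_cancel_right, neg_sub_neg, abs_sub_comm]; linarith
lemma bd_FR (x y s t : ℝ) : |FR x s - FR y t| ≤ 8 * |x - y| + 32 * |s - t| := by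
  have := Kf_lip (a := -8) (b := -4) (m := 8) (by norm_num) (fun c h1 h2 => abs_le.2 ⟨by linarith, by linarith⟩) (-(x + -1)) (-(y + -1)) s t
  rw [show -(x + -1) - -(y + -1) = -(x - y) by ring, abs_neg] at this
  unfold FR; rw [sub_sub_sub_cancel_right, neg_sub_neg, abs_sub_comm]; linarith
lemma bd_KR (hp : p < -12) (x y s t : ℝ) : |KR p x s - KR p y t| ≤ -p * |x - y| + p ^ 2 / 2 * |s - t| := by
  have := Kf_lip (a := p) (b := -4) (m := -p) (by linarith) (fun c h1 h2 => abs_le.2 ⟨by linarith, by linarith⟩) x y (1 - s) (1 - t)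
  rw [show 1 - s - (1 - t) = -(s - t) by ring, abs_neg, neg_sq] at this
  unfold KR; rw [sub_sub_sub_cancel_right]; exact this
lemma bd_KR' (hp : p < -12) (x y s t : ℝ) : |KR' p x s - KR' p y t| ≤ -p * |x - y| + (p ^ 2 / 2 + 16) * |s - t| := by
  unfold KR'
  have a := bd_KR hp x y s t
  have b := abs_max_sub_max_le_abs (1/4 - s) (1/4 - t) 0
  rw [show 1/4 - s - (1/4 - t) = -(s - t) by ring, abs_neg] at b
  rw [abs_le] at a b ⊢
  constructor <;> linarith
lemma bd_fstL (hp : p < -12) (x y s t : ℝ) : |fstL x s - fstL y t| ≤ (-p + 12) * |x - y| + (p ^ 2 / 2 + 40) * |s - t| := by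
  unfold fstL
  have a := bd_KL x y s t
  have b := bd_FL x y s t
  have := abs_nonneg (x - y)
  have := mul_nonneg (sq_nonneg p) (abs_nonneg (s - t))
  have := mul_nonneg (show 0 ≤ -p by linarith) (abs_nonneg (x - y))
  rw [abs_le] at a b ⊢
  constructor <;> linarith
lemma bd_fstR (hp : p < -12) (x y s t : ℝ) : |fstR p x s - fstR p y t| ≤ (-p + 12) * |x - y| + (p ^ 2 / 2 + 40) * |s - t| := by
  unfold fstR
  have a := bd_KR hp x y s t
  have b := bd_FR x y s t
  have := neg_abs_le (x - y)
  have := le_abs_self (x - y)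
  have := neg_abs_le (s - t)
  have := le_abs_self (s - t)
  rw [abs_le] at a b ⊢
  constructor <;> linarith
lemma U2_lipt (hp : p < -12) (x s t : ℝ) : |U2 p x s - U2 p x t| ≤ (p ^ 2 / 2 + 40) * |s - t| := by
  have c := bd_KR' hp x x s t
  have a := bd_fstL hp x x s t
  have b := bd_fstR hp x x s t
  have := abs_nonneg (s - t)
  simp only [sub_self, abs_zero, mul_zero, zero_add] at a b c
  unfold U2
  split_ifs
  · exact (abs_min_sub_min_le_max _ _ _ _).trans (max_le a (by linarith))
  · exact (abs_min_sub_min_le_max _ _ _ _).trans (max_le b (by linarith))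
lemma U2_lipx (hp : p < -12) (ht : 0 ≤ t) (x y : ℝ) : |U2 p x t - U2 p y t| ≤ (-p + 12) * |x - y| := by
  refine lip_glue (f := fun x => min (fstL x t) (KR' p x t)) (g := fun x => min (fstR p x t) (KR' p x t)) (U2_0 hp ht) ?_ ?_ x y
  · intro x y _ _
    have c := bd_KR' hp x y t t
    have a := bd_fstL hp x y t t
    have := abs_nonneg (x - y)
    simp only [sub_self, abs_zero, mul_zero, add_zero] at a c
    exact (abs_min_sub_min_le_max _ _ _ _).trans (max_le a (by linarith))
  · intro x y _ _
    have c := bd_KR' hp x y t t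
    have a := bd_fstR hp x y t t
    have := abs_nonneg (x - y)
    simp only [sub_self, abs_zero, mul_zero, add_zero] at a c
    exact (abs_min_sub_min_le_max _ _ _ _).trans (max_le a (by linarith))
lemma cc_KL (S : Set ℝ) (hS : Convex ℝ S) (t : ℝ) : ConcaveOn ℝ S (fun x => KL x t) := by
  have := (Kf_concave (a := 0) (b := 4) (by norm_num) S hS 1 1 (1 - t)).add_const (-8)
  exact this.congr fun x _ => by simp [KL]; ring
lemma cc_KR (hp : p < -12) (S : Set ℝ) (hS : Convex ℝ S) (t : ℝ) : ConcaveOn ℝ S (fun x => KR p x t) := by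
  have := (Kf_concave (a := p) (b := -4) (by linarith) S hS 1 0 (1 - t)).add_const (-12)
  exact this.congr fun x _ => by simp [KR]; ring
lemma cc_KR' (hp : p < -12) (S : Set ℝ) (hS : Convex ℝ S) (t : ℝ) : ConcaveOn ℝ S (fun x => KR' p x t) :=
  (cc_KR hp S hS t).add_const _
lemma cc_FL (S : Set ℝ) (hS : Convex ℝ S) (ht : 0 < t) : ConcaveOn ℝ S (fun x => FL x t - x ^ 2 / (2 * t)) := by
  have := (Ff_concave (a := 0) (b := 8) (by norm_num) S hS 1 ht).add_const (-8)
  exact this.congr fun x _ => by simp only [FL, Pi.add_apply]; ring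
lemma cc_FR (S : Set ℝ) (hS : Convex ℝ S) (ht : 0 < t) : ConcaveOn ℝ S (fun x => FR x t - x ^ 2 / (2 * t)) := by
  have := (Ff_concave (a := -8) (b := -4) (by norm_num) S hS (-1) ht).add_const (-8)
  exact this.congr fun x _ => by simp only [FR, Pi.add_apply]; ring
lemma U2_ccl (hp : p < -12) (ht : 0 < t) : ConcaveOn ℝ (Iic 0) (fun x => U2 p x t - x ^ 2 / (2 * t)) := by
  have h1 := ((cc_KL (Iic 0) (convex_Iic 0) t).add (cc_FL (Iic 0) (convex_Iic 0) ht)).add_const 8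
  have h2 := concave_sub_sq (cc_KR' hp (Iic 0) (convex_Iic 0) t) ht
  refine (h1.inf h2).congr fun x hx => ?_
  simp only [Pi.add_apply, Pi.inf_apply, U2_l (show x ≤ 0 from hx), fstL]
  rw [← min_sub_sub_right]; congr 1; ring
lemma U2_ccr (hp : p < -12) (ht : 0 < t) : ConcaveOn ℝ (Ici 0) (fun x => U2 p x t - x ^ 2 / (2 * t)) := by
  have h1 := ((cc_KR hp (Ici 0) (convex_Ici 0) t).add (cc_FR (Ici 0) (convex_Ici 0) ht)).add (concave_aff (convex_Ici 0) 4 (4 + 8 * t))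
  have h2 := concave_sub_sq (cc_KR' hp (Ici 0) (convex_Ici 0) t) ht
  refine (h1.inf h2).congr fun x hx => ?_
  simp only [Pi.add_apply, Pi.inf_apply, U2_r hp ht.le (show 0 ≤ x from hx), fstR]
  rw [← min_sub_sub_right]; congr 1; ring
lemma touch_KL (V : ℝ → ℝ → ℝ) (x t : ℝ) (h : ∀ᶠ q : ℝ × ℝ in nhds (x, t), V q.1 q.2 ≤ KL q.1 q.2) (he : V x t = KL x t) :
    ∃ c : ℝ, IsLocalExtr (fun q : ℝ × ℝ => V q.1 q.2 - (c * q.1 - c ^ 2 / 2 * q.2)) (x, t) := by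
  obtain ⟨c, h1, h2, h3⟩ := Kf_ex (a := 0) (b := 4) (by norm_num) (x + 1) (1 - t)
  refine ⟨c, touch_of c ?_⟩
  filter_upwards [h] with q hq
  have := Kf_le (q.1 + 1) (1 - q.2) h1 h2
  simp only [he]; unfold KL at hq ⊢; rw [h3]; linarith
lemma touch_KR (hp : p < -12) (V : ℝ → ℝ → ℝ) (x t : ℝ) (h : ∀ᶠ q : ℝ × ℝ in nhds (x, t), V q.1 q.2 ≤ KR p q.1 q.2) (he : V x t = KR p x t) :
    ∃ c : ℝ, IsLocalExtr (fun q : ℝ × ℝ => V q.1 q.2 - (c * q.1 - c ^ 2 / 2 * q.2)) (x, t) := by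
  obtain ⟨c, h1, h2, h3⟩ := Kf_ex (a := p) (b := -4) (by linarith) x (1 - t)
  refine ⟨c, touch_of c ?_⟩
  filter_upwards [h] with q hq
  have := Kf_le q.1 (1 - q.2) h1 h2
  simp only [he]; unfold KR at hq ⊢; rw [h3]; linarith
lemma touch_FL (V : ℝ → ℝ → ℝ) (x t : ℝ) (h : ∀ᶠ q : ℝ × ℝ in nhds (x, t), FL q.1 q.2 ≤ V q.1 q.2) (he : V x t = FL x t) :
    ∃ c : ℝ, IsLocalExtr (fun q : ℝ × ℝ => V q.1 q.2 - (c * q.1 - c ^ 2 / 2 * q.2)) (x, t) := by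
  obtain ⟨c, h1, h2, h3⟩ := Kf_ex (a := 0) (b := 8) (by norm_num) (-(x + 1)) t
  refine ⟨c, touch_below c ?_⟩
  filter_upwards [h] with q hq
  have := Kf_le (-(q.1 + 1)) q.2 h1 h2
  simp only [he]; unfold FL at hq ⊢; rw [h3]; linarith
lemma touch_FR (V : ℝ → ℝ → ℝ) (x t : ℝ) (h : ∀ᶠ q : ℝ × ℝ in nhds (x, t), FR q.1 q.2 ≤ V q.1 q.2) (he : V x t = FR x t) :
    ∃ c : ℝ, IsLocalExtr (fun q : ℝ × ℝ => V q.1 q.2 - (c * q.1 - c ^ 2 / 2 * q.2)) (x, t) := by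
  obtain ⟨c, h1, h2, h3⟩ := Kf_ex (a := -8) (b := -4) (by norm_num) (-(x + -1)) t
  refine ⟨c, touch_below c ?_⟩
  filter_upwards [h] with q hq
  have := Kf_le (-(q.1 + -1)) q.2 h1 h2
  simp only [he]; unfold FR at hq ⊢; rw [h3]; linarith
lemma box_nhds {a b c d : ℝ} (h1 : a < x) (h2 : x < b) (h3 : c < t) (h4 : t < d) :
    ∀ᶠ q : ℝ × ℝ in nhds (x, t), (a < q.1 ∧ q.1 < b) ∧ c < q.2 ∧ q.2 < d := by
  have := prod_mem_nhds (Ioo_mem_nhds h1 h2) (Ioo_mem_nhds h3 h4)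
  filter_upwards [this] with q hq using ⟨hq.1, hq.2⟩
lemma U2_touch (hp : p < -12) (ht : 0 < t) (h0 : x ≠ 0) (h1 : x ≠ -1) (h2 : x ≠ 1) (h3 : t ≠ 1/4) :
    ∃ c : ℝ, IsLocalExtr (fun q : ℝ × ℝ => U2 p q.1 q.2 - (c * q.1 - c ^ 2 / 2 * q.2)) (x, t) := by
  rcases lt_or_gt_of_ne h0 with hx | hx
  · rcases le_or_gt (KR' p x t) (fstL x t) with h | h
    · have ht4 : 1/4 < t := by
        by_contra hh
        linarith [fstL_gt hp hx.le ht.le (not_lt.1 hh)]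
      refine touch_KR hp _ x t ?_ ?_
      · filter_upwards [box_nhds (sub_one_lt x) hx ht4 (lt_add_one t)] with q hq
        rw [U2_l hq.1.2.le, KR'_eq hq.2.1.le]; exact min_le_right _ _
      · rw [U2_l hx.le, min_eq_right h, KR'_eq ht4.le]
    · rcases lt_or_gt_of_ne h1 with h1 | h1
      · refine touch_KL _ x t ?_ ?_
        · filter_upwards [box_nhds (sub_one_lt x) h1 ht (lt_add_one t)] with q hq
          rw [U2_l1 hq.2.1.le hq.1.2.le]; exact min_le_left _ _
        · rw [U2_l hx.le, min_eq_left h.le, fstL, FL_eq0 h1.le ht.le]; ring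
      · have ht1 : t < 1 := by
          by_contra hh
          have := fstL_ge hp h1.le (not_lt.1 hh)
          rw [KR'_eq (by linarith)] at h; linarith
        have hlt : ∀ᶠ q : ℝ × ℝ in nhds (x, t), fstL q.1 q.2 < KR' p q.1 q.2 := by
          have c1 : Continuous (fun q : ℝ × ℝ => fstL q.1 q.2) := by
            refine (LipschitzWith.of_dist_le_mul (K := Real.toNNReal ((-p + 12) + (p ^ 2 / 2 + 40))) fun a b => ?_).continuous
            rw [Real.coe_toNNReal _ (by nlinarith [sq_nonneg p]), Real.dist_eq, Prod.dist_eq, Real.dist_eq, Real.dist_eq]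
            have := bd_fstL hp a.1 b.1 a.2 b.2
            have := mul_le_mul_of_nonneg_left (le_max_left (|a.1 - b.1|) (|a.2 - b.2|)) (show 0 ≤ -p + 12 by linarith)
            have := mul_le_mul_of_nonneg_left (le_max_right (|a.1 - b.1|) (|a.2 - b.2|)) (show 0 ≤ p ^ 2 / 2 + 40 by positivity)
            linarith
          have c2 : Continuous (fun q : ℝ × ℝ => KR' p q.1 q.2) := by
            refine (LipschitzWith.of_dist_le_mul (K := Real.toNNReal ((-p) + (p ^ 2 / 2 + 16))) fun a b => ?_).continuous
            rw [Real.coe_toNNReal _ (by nlinarith [sq_nonneg p]), Real.dist_eq, Prod.dist_eq, Real.dist_eq, Real.dist_eq]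
            have := bd_KR' hp a.1 b.1 a.2 b.2
            have := mul_le_mul_of_nonneg_left (le_max_left (|a.1 - b.1|) (|a.2 - b.2|)) (show 0 ≤ -p by linarith)
            have := mul_le_mul_of_nonneg_left (le_max_right (|a.1 - b.1|) (|a.2 - b.2|)) (show 0 ≤ p ^ 2 / 2 + 16 by positivity)
            linarith
          exact (c1.tendsto (x, t)).eventually_lt (c2.tendsto (x, t)) h
        refine touch_FL _ x t ?_ ?_
        · filter_upwards [box_nhds h1 hx ht ht1, hlt] with q hq hq2
          rw [U2_l hq.1.2.le, min_eq_left hq2.le, fstL, KL_eq0 hq.1.1.le hq.2.2.le]; linarith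
        · rw [U2_l hx.le, min_eq_left h.le, fstL, KL_eq0 h1.le ht1.le]; linarith
  · rcases lt_or_gt_of_ne h3 with h4 | h4
    · rcases lt_or_gt_of_ne h2 with h2 | h2
      · refine touch_FR _ x t ?_ (U2_r3 hp ht.le h4.le hx.le h2.le)
        filter_upwards [box_nhds hx h2 ht h4] with q hq
        rw [U2_r3 hp hq.2.1.le hq.2.2.le hq.1.1.le hq.1.2.le]
      · refine touch_KR hp _ x t ?_ (U2_r2 hp ht.le h2.le)
        filter_upwards [box_nhds h2 (lt_add_one x) ht h4] with q hq
        rw [U2_r2 hp hq.2.1.le hq.1.1.le]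
    · refine touch_KR hp _ x t ?_ (U2_r1 hp h4.le hx.le)
      filter_upwards [box_nhds hx (lt_add_one x) h4 (lt_add_one t)] with q hq
      rw [U2_r1 hp hq.2.1.le hq.1.1.le]
end

section
variable {p x t : ℝ}
lemma hd_fun {f g : ℝ → ℝ} {S : Set ℝ} {c x : ℝ} (hS : S ∈ nhds x) (h : ∀ y ∈ S, f y = g y) (hg : HasDerivAt g c x) :
    HasDerivAt f c x :=
  hg.congr_of_eventuallyEq (Filter.mem_of_superset hS h)
lemma hdw_fun {f g : ℝ → ℝ} {S T : Set ℝ} {c x : ℝ} (hS : S ∈ nhdsWithin x T) (h : ∀ y ∈ S, f y = g y) (hx : f x = g x) (hg : HasDerivAt g c x) :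
    HasDerivWithinAt f c T x :=
  hg.hasDerivWithinAt.congr_of_eventuallyEq (Filter.mem_of_superset hS h) hx
lemma sq_hd (a b d x : ℝ) : HasDerivAt (fun y : ℝ => (y + a) ^ 2 / b + d) (2 * (x + a) / b) x := by
  have := (((hasDerivAt_id x).add_const a).pow 2).div_const b |>.add_const d
  refine this.congr_deriv ?_
  simp
lemma U2_l5 (hp : p < -12) (h4 : 1/4 ≤ t) (h1 : t ≤ 1) (hx : x ≤ 0) (hx' : -((1 - 4 * t) ^ 2 / 10) ≤ x) :
    U2 p x t = -4 * x + (- 4 - 8 * t) := by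
  have hb : (1 - 4 * t) ^ 2 ≤ 9 := by nlinarith
  have hx1 : -1 ≤ x := by linarith
  have e := KR_eq4 hp (x := x) (by linarith) h1
  rw [U2_l hx, KR'_eq h4, min_eq_right, e]
  rw [e, fstL, KL_eq0 hx1 h1]
  have t0 : 0 < t := by linarith
  have := FL_ge (x := x) (t := t) (c := 1 / t) (by positivity) (by rw [div_le_iff₀ t0]; linarith)
  have h2 : -4 * x + (-4 - 8 * t) ≤ 1 / t * (x + 1) - t * (1 / t) ^ 2 / 2 - 8 := by
    have e2 : 1 / t * (x + 1) - t * (1 / t) ^ 2 / 2 - 8 - (-4 * x + (-4 - 8 * t)) = (x * (1 + 4 * t) + (1 - 4 * t) ^ 2 / 2) / t := by field_simp; ring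
    have : 0 ≤ (x * (1 + 4 * t) + (1 - 4 * t) ^ 2 / 2) / t := by
      apply div_nonneg _ t0.le
      nlinarith
    linarith
  linarith
lemma U2_iface (hp : p < -12) (ht : 0 < t) (h8 : t ≠ 1/8) (h4 : t ≠ 1/4) (h1 : t ≠ 1) :
    ∃ a b, HasDerivWithinAt (fun x => U2 p x t) a (Iio 0) 0 ∧
    HasDerivWithinAt (fun x => U2 p x t) b (Ioi 0) 0 ∧ |b - 4| * (b + 4) / 2 ≤ |a - -4| * (a + -4) / 2 := by
  rcases lt_or_gt_of_ne h8 with h | h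
  · refine ⟨8, -8, hdw_aff (d := -32 * t) (S := Ioo (8 * t - 1) 0) (Ioo_mem_nhdsLT (by linarith)) ?_ ?_, hdw_aff (d := -32 * t) (S := Ioo 0 (1 - 8 * t)) (Ioo_mem_nhdsGT (by linarith)) ?_ ?_, by norm_num⟩
    · intro y hy; rw [U2_l3 hp ht.le (by linarith) hy.2.le (by linarith [hy.1]), FL_eq8 (by linarith [hy.1]) ht.le]
    · rw [U2_l3 hp ht.le (by linarith) le_rfl (by linarith), FL_eq8 (by linarith) ht.le]
    · intro y hy; rw [U2_r3 hp ht.le (by linarith) hy.1.le (by linarith [hy.2]), FR_eq8 (by linarith [hy.2]) ht.le]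
    · rw [U2_r3 hp ht.le (by linarith) le_rfl (by linarith), FR_eq8 (by linarith) ht.le]
  rcases lt_or_gt_of_ne h4 with h' | h'
  · refine ⟨_, _, hdw_fun (S := Ioo (-1) 0) (Ioo_mem_nhdsLT (by linarith)) ?_ ?_ (sq_hd 1 (2 * t) (-8) 0), hdw_fun (S := Ioo 0 (1 - 4 * t)) (Ioo_mem_nhdsGT (by linarith)) ?_ ?_ (sq_hd (-1) (2 * t) (-8) 0), ?_⟩
    · intro y hy; rw [U2_l3 hp ht.le (by linarith) hy.2.le (by linarith [hy.1]), FL_eqq (by linarith [hy.1]) (by linarith [hy.2]) ht]; ring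
    · rw [U2_l3 hp ht.le (by linarith) le_rfl (by linarith), FL_eqq (by linarith) (by linarith) ht]; ring
    · intro y hy; rw [U2_r3 hp ht.le (by linarith) hy.1.le (by linarith [hy.2]), FR_eqq (by linarith [hy.2]) (by linarith [hy.1]) ht]; ring
    · rw [U2_r3 hp ht.le (by linarith) le_rfl (by linarith), FR_eqq (by linarith) (by linarith) ht]; ring
    · have e1 : 2 * (0 + 1) / (2 * t) = 1 / t := by field_simp; norm_num
      have e2 : 2 * (0 + -1) / (2 * t) = - (1 / t) := by field_simp; norm_num
      rw [e1, e2]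
      have h4 : 4 ≤ 1 / t := by rw [le_div_iff₀ ht]; linarith
      rw [abs_of_neg (by linarith), abs_of_pos (by linarith)]
      nlinarith
  rcases lt_or_gt_of_ne h1 with g | g
  · refine ⟨-4, -4, hdw_aff (d := -4 - 8 * t) (S := Ioo (-((1 - 4 * t) ^ 2 / 10)) 0) (Ioo_mem_nhdsLT ?_) ?_ ?_, hdw_aff (d := -4 - 8 * t) (S := Ioo 0 (4 * (1 - t))) (Ioo_mem_nhdsGT (by linarith)) ?_ ?_, by norm_num⟩
    · nlinarith
    · intro y hy; rw [U2_l5 hp h'.le g.le hy.2.le hy.1.le]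
    · rw [U2_l5 hp h'.le g.le le_rfl (by nlinarith)]
    · intro y hy; rw [U2_r1 hp h'.le hy.1.le, KR_eq4 hp hy.2.le g.le]
    · rw [U2_r1 hp h'.le le_rfl, KR_eq4 hp (by linarith) g.le]
  · have hn : (t - 1) * (p - 4) < 0 := mul_neg_of_pos_of_neg (by linarith) (by linarith)
    refine ⟨p, p, hdw_aff (d := p ^ 2 * (1 - t) / 2 - 12) (S := Ioo (max (-1) ((t - 1) * (p - 4) / 2)) 0) (Ioo_mem_nhdsLT ?_) ?_ ?_, hdw_aff (d := p ^ 2 * (1 - t) / 2 - 12) (S := Ioi 0) self_mem_nhdsWithin ?_ ?_, ?_⟩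
    · exact max_lt (by norm_num) (by linarith)
    · intro y hy
      have h2 := max_lt_iff.1 hy.1
      rw [U2_l4 hp g.le hy.2.le h2.1.le, KR_eqp hp (by linarith [h2.2]) g.le]
    · rw [U2_l4 hp g.le le_rfl (by norm_num), KR_eqp hp (by linarith) g.le]
    · intro y hy
      have hy : 0 < y := hy
      rw [U2_r1 hp (by linarith) hy.le, KR_eqp hp (by linarith) g.le]
    · rw [U2_r1 hp (by linarith) le_rfl, KR_eqp hp (by linarith) g.le]
    · rw [abs_of_neg (by linarith), abs_of_neg (by linarith)]; nlinarith
lemma U2_der0 (hp : p < -12) (h5 : x ≠ -5) (h1 : x ≠ -1) (h0 : x ≠ 0) (h1' : x ≠ 1) (h4 : x ≠ 4) (hpp : x ≠ -p) :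
    HasDerivAt (fun y => U2 p y 0) (udat2 (-1) p x) x := by
  have lL : ∀ y, y ≤ -1 → U2 p y 0 = KL y 0 := fun y hy => by
    rw [U2_l2 hp le_rfl (by norm_num) (by linarith), fstL, FL_eq0 hy le_rfl]; ring
  unfold udat2
  split_ifs with a b c d e f
  · have a : x < -5 := by linarith
    refine (hd_aff (c := 4) (d := 4) (S := Iio (-5)) (Iio_mem_nhds a) fun y hy => ?_).congr_deriv (by ring)
    have hy : y < -5 := hy
    rw [lL y (by linarith), KL, Kf_eq 4 (by norm_num) le_rfl]
    · ring
    · intro d d1 d2; nlinarith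
  · have a : -5 < x := lt_of_le_of_ne (by linarith) (Ne.symm h5)
    have b : x < -1 := b
    refine (hd_fun (S := Ioo (-5) (-1)) (Ioo_mem_nhds a b) (fun y hy => ?_) (sq_hd 1 (-2) (-8) x)).congr_deriv (by ring)
    rw [lL y hy.2.le, KL, Kf_eq (-(y + 1)) (by linarith [hy.2]) (by linarith [hy.1])]
    · ring
    · intro d d1 d2; nlinarith [sq_nonneg (d + y + 1)]
  · have b : -1 < x := lt_of_le_of_ne (by linarith) (Ne.symm h1)
    refine (hd_aff (c := 8) (d := 0) (S := Ioo (-1) 0) (Ioo_mem_nhds b c) fun y hy => ?_).congr_deriv (by ring)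
    rw [U2_l3 hp le_rfl (by norm_num) hy.2.le hy.1.le, FL_eq8 (by linarith [hy.1]) le_rfl]; ring
  · have c : 0 < x := lt_of_le_of_ne (by linarith) (Ne.symm h0)
    have d : x < 1 := by linarith
    refine (hd_aff (c := -8) (d := 0) (S := Ioo 0 1) (Ioo_mem_nhds c d) fun y hy => ?_).congr_deriv (by ring)
    rw [U2_r3 hp le_rfl (by norm_num) hy.1.le hy.2.le, FR_eq8 (by linarith [hy.2]) le_rfl]; ring
  · have d : 1 < x := lt_of_le_of_ne (by linarith) (Ne.symm h1')
    have e : x < 4 := by linarith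
    refine (hd_aff (c := -4) (d := -4) (S := Ioo 1 4) (Ioo_mem_nhds d e) fun y hy => ?_).congr_deriv (by ring)
    rw [U2_r2 hp le_rfl hy.1.le, KR_eq4 hp (by linarith [hy.2]) (by norm_num)]; ring
  · have e : 4 < x := lt_of_le_of_ne (by linarith) (Ne.symm h4)
    refine (hd_fun (S := Ioo 4 (-p)) (Ioo_mem_nhds e f) (fun y hy => ?_) (sq_hd 0 (-2) (-12) x)).congr_deriv (by ring)
    rw [U2_r2 hp le_rfl (by linarith [hy.1]), KR, Kf_eq (-y) (by linarith [hy.2]) (by linarith [hy.1])]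
    · ring
    · intro d d1 d2; nlinarith [sq_nonneg (d + y)]
  · have f : -p < x := lt_of_le_of_ne (by linarith) (Ne.symm hpp)
    refine (hd_aff (c := p) (d := p ^ 2 / 2 - 12) (S := Ioi (-p)) (Ioi_mem_nhds f) fun y hy => ?_)
    have hy : -p < y := hy
    rw [U2_r2 hp le_rfl (by linarith), KR, Kf_eq p (by linarith) (by linarith)]
    · ring
    · intro d d1 d2; nlinarith
lemma U2_cc0 (hp : p < -12) (h1 : x ≠ -1) (h0 : x ≠ 0) (h1' : x ≠ 1) :
    ∃ ε, 0 < ε ∧ ∀ t, 0 ≤ t → t ≤ ε → ConcaveOn ℝ (Icc (x - ε) (x + ε)) (fun y => U2 p y t) := by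
  rcases lt_or_gt_of_ne h1 with h | h
  · refine ⟨-1 - x, by linarith, fun t t0 t1 => ?_⟩
    refine ((cc_KL _ (convex_Icc _ _) t).inf (cc_KR' hp _ (convex_Icc _ _) t)).congr fun y hy => ?_
    rw [U2_l1 t0 (by linarith [hy.2])]; rfl
  rcases lt_or_gt_of_ne h0 with g | g
  · have e1 := min_le_left ((x + 1) / 9) (min (-x) (1/9))
    have e2 := (min_le_right ((x + 1) / 9) (min (-x) (1/9))).trans (min_le_left _ _)
    have e3 := (min_le_right ((x + 1) / 9) (min (-x) (1/9))).trans (min_le_right _ _)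
    refine ⟨min ((x + 1) / 9) (min (-x) (1/9)), lt_min (by linarith) (lt_min (by linarith) (by norm_num)), fun t t0 t1 => ?_⟩
    refine (concave_aff (convex_Icc _ _) 8 (-32 * t)).congr fun y hy => ?_
    rw [U2_l3 hp t0 (by linarith) (by linarith [hy.2]) (by linarith [hy.1]), FL_eq8 (by linarith [hy.1]) t0]
  rcases lt_or_gt_of_ne h1' with k | k
  · have e1 := min_le_left ((1 - x) / 9) (min (x) (1/9))
    have e2 := (min_le_right ((1 - x) / 9) (min (x) (1/9))).trans (min_le_left _ _)
    have e3 := (min_le_right ((1 - x) / 9) (min (x) (1/9))).trans (min_le_right _ _)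
    refine ⟨min ((1 - x) / 9) (min x (1/9)), lt_min (by linarith) (lt_min (by linarith) (by norm_num)), fun t t0 t1 => ?_⟩
    refine (concave_aff (convex_Icc _ _) (-8) (-32 * t)).congr fun y hy => ?_
    rw [U2_r3 hp t0 (by linarith) (by linarith [hy.1]) (by linarith [hy.2]), FR_eq8 (by linarith [hy.2]) t0]
  · refine ⟨x - 1, by linarith, fun t t0 t1 => ?_⟩
    refine (cc_KR hp _ (convex_Icc _ _) t).congr fun y hy => ?_
    rw [U2_r2 hp t0 (by linarith [hy.1])]
lemma U2_E (hp : p < -12) : EHyp (U2 p) (udat2 (-1) p) (-p + 12) (p ^ 2 / 2 + 40) where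
  lipx t ht x y := U2_lipx hp ht x y
  lipt s t _ _ x := U2_lipt hp x s t
  ccl t ht := U2_ccl hp ht
  ccr t ht := U2_ccr hp ht
  touch := by
    filter_upwards [ae_fst_ne 0, ae_fst_ne (-1), ae_fst_ne 1, ae_snd_ne (1/4)] with q h0 h1 h2 h3 ht
    exact U2_touch hp ht h0 h1 h2 h3
  iface := by
    filter_upwards [ae_ne (1/8), ae_ne (1/4), ae_ne 1] with t h1 h2 h3 ht
    exact U2_iface hp ht h1 h2 h3
  meas0 := by
    unfold udat2
    refine Measurable.ite measurableSet_Iio measurable_const (Measurable.ite measurableSet_Iio (by fun_prop) (Measurable.ite measurableSet_Iio measurable_const (Measurable.ite measurableSet_Iio measurable_const (Measurable.ite measurableSet_Iio measurable_const (Measurable.ite measurableSet_Iio (by fun_prop) measurable_const)))))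
  bdd0 x := by unfold udat2; split_ifs <;> rw [abs_le] <;> constructor <;> linarith
  der0 := by
    filter_upwards [ae_ne (-5), ae_ne (-1), ae_ne 0, ae_ne 1, ae_ne 4, ae_ne (-p)] with x a b c d e f
    exact U2_der0 hp a b c d e f
  cc0 := by
    filter_upwards [ae_ne (-1), ae_ne 0, ae_ne 1] with x a b c
    exact U2_cc0 hp a b c
lemma U2_end (hp : p < -12) : ∀ᵐ x, (U2_E hp).sol.u x 1 = omega3 (-1) p x := by
  filter_upwards [ae_ne (-1), ae_ne 0] with x h1 h2
  refine (U2_E hp).eu_eq one_pos h2 ?_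
  unfold omega3
  split_ifs with a b
  · refine (hd_aff (c := 4) (d := -4) (S := Iio (-1)) (Iio_mem_nhds (lt_of_le_of_ne a h1)) fun y hy => ?_).congr_deriv (by ring)
    have hy : y < -1 := hy
    have e : KL y 1 = 4 * y - 4 := by
      rw [KL, Kf_eq 4 (by norm_num) le_rfl]
      · ring
      · intro d d1 d2; nlinarith
    rw [U2_l1 zero_le_one hy.le, KR'_eq (by norm_num), KR_eq4 hp (by linarith) le_rfl, e, min_eq_left (by linarith)]; ring
  · refine (hd_aff (c := -4) (d := -12) (S := Ioo (-1) 0) (Ioo_mem_nhds (not_le.1 a) b) fun y hy => ?_).congr_deriv (by ring)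
    rw [U2_l4 hp le_rfl hy.2.le hy.1.le, KR_eq4 hp (by linarith [hy.2]) le_rfl]; ring
  · have a' : 0 < x := lt_of_le_of_ne (not_lt.1 b) (Ne.symm h2)
    refine hd_aff (d := -12) (S := Ioi 0) (Ioi_mem_nhds a') fun y hy => ?_
    have hy : 0 < y := hy
    rw [U2_r1 hp (by norm_num) hy.le, KR_eqp hp (by linarith) le_rfl]; ring
end

section
lemma ker_lim (m : ℝ → ℝ) (s C : ℝ) (hm : Measurable m) (hC : ∀ τ, |m τ| ≤ C)
    (hl : Tendsto m (nhdsWithin s (Ioi s)) (nhds (m s))) :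
    Tendsto (fun n : ℕ => ∫ τ, m τ * (((n:ℝ) + 1) * kap (((n:ℝ) + 1) * (τ - s) - 1))) atTop (nhds (m s)) := by
  have h := trace_lim (fun p => m p.1 * (Icc (0:ℝ) 1).indicator (fun _ => (1:ℝ)) p.2) (fun t => m s * (Icc (0:ℝ) 1).indicator (fun _ => (1:ℝ)) t) s 1 C 1
    ((hm.comp measurable_fst).mul ((measurable_const.indicator measurableSet_Icc).comp measurable_snd)) (fun p => by
      have := abs_nonneg (m p.1)
      by_cases hp : p.2 ∈ Icc (0:ℝ) 1
      · simp [hp, hC]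
      · simp [hp]; exact this.trans (hC _)) (fun x t ht => by
      have : t ∉ Icc (0:ℝ) 1 := fun h => by rw [abs_of_nonneg h.1] at ht; linarith [h.2]
      simp [this]) (Or.inr ⟨rfl, Eventually.of_forall fun t => hl.mul_const _⟩)
  have e0 : ∫ t, (Icc (0:ℝ) 1).indicator (fun _ => (1:ℝ)) t = 1 := by
    rw [integral_indicator measurableSet_Icc]; simp
  rw [integral_const_mul, e0, mul_one] at h
  refine h.congr fun n => ?_
  have := integral_prod_mul (μ := volume) (ν := volume) (fun τ => m τ * (((n:ℝ) + 1) * kap (((n:ℝ) + 1) * (τ - s) - 1))) ((Icc (0:ℝ) 1).indicator (fun _ => (1:ℝ)))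
  rw [e0, mul_one] at this
  rw [← this]
  exact integral_congr_ae (Eventually.of_forall fun p => by ring)
variable {u0 : ℝ → ℝ}
lemma mom_lim (S : ABSol fq fq (-4) 4 u0) (η : ℝ → ℝ → ℝ) (hm : Measurable (Function.uncurry η)) {C : ℝ} (hC : ∀ x t, |η x t| ≤ C)
    (hη : ∀ x τ τ', |η x τ - η x τ'| ≤ |S.u x τ - S.u x τ'|) (α : ℝ → ℝ) (hα : Measurable α) {A r : ℝ} (hA : ∀ x, |α x| ≤ A)
    (hr : ∀ x, r < |x| → α x = 0) {s : ℝ} (hs : 0 ≤ s) :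
    Tendsto (fun τ => ∫ x, η x τ * α x) (nhdsWithin s (Ici 0)) (nhds (∫ x, η x s * α x)) := by
  obtain ⟨M, hM⟩ := S.bdd
  have hA0 : 0 ≤ A := (abs_nonneg _).trans (hA 0)
  have hC0 : 0 ≤ C := (abs_nonneg _).trans (hC 0 0)
  have hM0 : 0 ≤ M := (abs_nonneg _).trans (hM 0 0)
  have hi : ∀ τ, Integrable (fun x => η x τ * α x) := by
    intro τ
    rw [← integrableOn_iff_integrable_of_support_subset (s := Icc (-r) r)]
    · refine Measure.integrableOn_of_bounded (M := C * A) (by simp) ?_ ?_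
      · exact ((hm.comp (measurable_id.prodMk measurable_const)).mul hα).aestronglyMeasurable
      · refine Eventually.of_forall fun x => ?_
        rw [Real.norm_eq_abs, abs_mul]
        exact mul_le_mul (hC _ _) (hA _) (abs_nonneg _) hC0
    · intro x hx
      by_contra h
      refine hx ?_
      have : r < |x| := by by_contra hh; exact h (abs_le.1 (not_lt.1 hh))
      simp [hr x this]
  rw [tendsto_iff_norm_sub_tendsto_zero]
  have ht := (S.timeCont r s hs).const_mul A
  rw [mul_zero] at ht
  refine squeeze_zero (fun _ => norm_nonneg _) (fun τ => ?_) ht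
  rw [← integral_sub (hi τ) (hi s), ← integral_const_mul, ← integral_indicator measurableSet_Icc]
  refine (norm_integral_le_integral_norm _).trans (integral_mono_of_nonneg (Eventually.of_forall fun _ => norm_nonneg _) ?_ (Eventually.of_forall fun x => ?_))
  · rw [integrable_indicator_iff measurableSet_Icc]
    refine Measure.integrableOn_of_bounded (M := A * (2 * M)) (by simp) ?_ ?_
    · have hu : ∀ τ, Measurable (fun x => S.u x τ) := fun τ => S.meas.comp (measurable_id.prodMk measurable_const)
      exact (((hu τ).sub (hu s)).abs.const_mul A).aestronglyMeasurable
    · refine Eventually.of_forall fun x => ?_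
      rw [Real.norm_eq_abs, abs_mul, abs_of_nonneg hA0, abs_abs]
      refine mul_le_mul_of_nonneg_left ((abs_sub _ _).trans (by linarith [hM x τ, hM x s])) hA0
  · simp only
    rw [← sub_mul, Real.norm_eq_abs, abs_mul]
    by_cases hx : x ∈ Icc (-r) r
    · rw [indicator_of_mem hx, mul_comm]
      exact mul_le_mul (hA x) (hη x τ s) (abs_nonneg _) hA0
    · rw [indicator_of_notMem hx]
      have : r < |x| := by by_contra hh; exact hx (abs_le.1 (not_lt.1 hh))
      simp [hr x this]
lemma slab1 (S : ABSol fq fq (-4) 4 u0) (η Q : ℝ → ℝ → ℝ) (hm : Measurable (Function.uncurry η)) (hq : Measurable (Function.uncurry Q))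
    {C : ℝ} (hC : ∀ x t, |η x t| ≤ C) (hC' : ∀ x t, |Q x t| ≤ C)
    (hη : ∀ x τ τ', |η x τ - η x τ'| ≤ |S.u x τ - S.u x τ'|)
    (hI : ∀ φ : ℝ → ℝ → ℝ, ContDiff ℝ 1 (fun p : ℝ × ℝ => φ p.1 p.2) → HasCompactSupport (fun p : ℝ × ℝ => φ p.1 p.2) →
      (∀ x t, 0 ≤ φ x t) → (∀ x t, t ≤ 0 → φ x t = 0) →
      0 ≤ ∫ p : ℝ × ℝ, (η p.1 p.2 * deriv (fun s => φ p.1 s) p.2 + Q p.1 p.2 * deriv (fun y => φ y p.2) p.1))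
    (α α' : ℝ → ℝ) (hα : ContDiff ℝ 1 α) (hd : ∀ x, HasDerivAt α (α' x) x) (hα0 : ∀ x, 0 ≤ α x) {r : ℝ} (hr : ∀ x, r < |x| → α x = 0)
    {s t : ℝ} (hs : 0 ≤ s) (hst : s ≤ t) :
    (∫ x, η x t * α x) - (∫ x, η x s * α x) ≤ ∫ p : ℝ × ℝ, (Q p.1 p.2 * (Ioc s t).indicator (fun _ => (1:ℝ)) p.2) * α' p.1 := by
  have hcs : HasCompactSupport α := HasCompactSupport.intro (isCompact_Icc (a := -r) (b := r)) fun x hx => hr x (by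
    by_contra hh; exact hx (abs_le.1 (not_lt.1 hh)))
  have ed : deriv α = α' := funext fun x => (hd x).deriv
  have hαc : Continuous α := hα.continuous
  have hα'c : Continuous α' := by rw [← ed]; exact hα.continuous_deriv le_rfl
  have hcs' : HasCompactSupport α' := by rw [← ed]; exact hcs.deriv
  obtain ⟨A, hA⟩ := hcs.exists_bound_of_continuous hαc
  have hαi : Integrable α := hαc.integrable_of_hasCompactSupport hcs
  have hα'i : Integrable α' := hα'c.integrable_of_hasCompactSupport hcs'
  have hC0 : 0 ≤ C := (abs_nonneg _).trans (hC 0 0)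
  set m : ℝ → ℝ := fun τ => ∫ x, η x τ * α x with hmd
  have hmm : Measurable m := by
    have : StronglyMeasurable (fun q : ℝ × ℝ => η q.2 q.1 * α q.2) := by
      refine Measurable.stronglyMeasurable ?_
      exact (hm.comp (measurable_snd.prodMk measurable_fst)).mul (hαc.measurable.comp measurable_snd)
    exact (StronglyMeasurable.integral_prod_right (f := fun τ x => η x τ * α x) this).measurable
  have hmb : ∀ τ, |m τ| ≤ C * ∫ x, |α x| := by
    intro τ
    rw [← integral_const_mul]
    refine (norm_integral_le_integral_norm _).trans (integral_mono_of_nonneg (f := fun x => ‖η x τ * α x‖) (Eventually.of_forall fun _ => norm_nonneg _) (hαi.abs.const_mul C) (Eventually.of_forall fun x => ?_))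
    simp only [Real.norm_eq_abs, abs_mul]
    exact mul_le_mul_of_nonneg_right (hC _ _) (abs_nonneg _)
  have hml : ∀ σ, 0 ≤ σ → Tendsto m (nhdsWithin σ (Ioi σ)) (nhds (m σ)) := fun σ hσ =>
    (mom_lim S η hm hC hη α hαc.measurable hA hr hσ).mono_left (nhdsWithin_mono _ fun y hy => hσ.trans (le_of_lt hy))
  have L1 := ker_lim m s _ hmm hmb (hml s hs)
  have L2 := ker_lim m t _ hmm hmb (hml t (hs.trans hst))
  set B : ℕ → ℝ → ℝ := fun n τ => Kst (((n:ℝ) + 1) * (τ - s) - 1) - Kst (((n:ℝ) + 1) * (τ - t) - 1) with hB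
  have B0 : ∀ n τ, 0 ≤ B n τ := fun n τ => sub_nonneg.2 (Kst_mono (by
    have : (0:ℝ) ≤ (n:ℝ) + 1 := by positivity
    nlinarith))
  have B1 : ∀ n τ, |B n τ| ≤ 1 := fun n τ => by
    rw [abs_of_nonneg (B0 n τ)]; simp only [hB]
    linarith [Kst_le (((n:ℝ) + 1) * (τ - s) - 1), Kst_nonneg (((n:ℝ) + 1) * (τ - t) - 1)]
  have Bz : ∀ n τ, τ ≤ s → B n τ = 0 := fun n τ h => by
    have : (0:ℝ) ≤ (n:ℝ) + 1 := by positivity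
    simp only [hB]; rw [Kst_zero, Kst_zero, sub_zero] <;> nlinarith
  have Bz' : ∀ n τ, t + 1 ≤ τ → B n τ = 0 := fun n τ h => by
    have : (0:ℝ) ≤ (n:ℝ) := by positivity
    simp only [hB]; rw [Kst_one, Kst_one, sub_self] <;> nlinarith
  have Bc : ∀ n, Continuous (B n) := fun n => by
    have := Kst_contDiff.continuous
    simp only [hB]; fun_prop
  have L3 : Tendsto (fun n : ℕ => ∫ p : ℝ × ℝ, Q p.1 p.2 * α' p.1 * B n p.2) atTop
      (nhds (∫ p : ℝ × ℝ, (Q p.1 p.2 * (Ioc s t).indicator (fun _ => (1:ℝ)) p.2) * α' p.1)) := by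
    refine tendsto_integral_of_dominated_convergence (fun p => C * (|α' p.1| * (Icc s (t + 1)).indicator (fun _ => (1:ℝ)) p.2)) (fun n => ?_) ?_ (fun n => ?_) ?_
    · exact ((hq.mul (hα'c.measurable.comp measurable_fst)).mul ((Bc n).measurable.comp measurable_snd)).aestronglyMeasurable
    · refine Integrable.const_mul (Integrable.mul_prod hα'i.abs ?_) C
      rw [integrable_indicator_iff measurableSet_Icc]; simp
    · refine Eventually.of_forall fun p => ?_
      by_cases hp : p.2 ∈ Icc s (t + 1)
      · rw [indicator_of_mem hp, Real.norm_eq_abs, abs_mul, abs_mul, mul_assoc]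
        exact mul_le_mul (hC' _ _) (mul_le_mul_of_nonneg_left (B1 _ _) (abs_nonneg _)) (by positivity) hC0
      · rw [indicator_of_notMem hp]
        have : B n p.2 = 0 := by
          simp only [mem_Icc, not_and_or, not_le] at hp
          exact hp.elim (fun h => Bz _ _ h.le) (fun h => Bz' _ _ h.le)
        simp [this]
    · refine Eventually.of_forall fun p => ?_
      have key : ∀ σ : ℝ, Tendsto (fun n : ℕ => Kst (((n:ℝ) + 1) * (p.2 - σ) - 1)) atTop (nhds (if σ < p.2 then 1 else 0)) := by
        intro σ
        split_ifs with h
        · refine tendsto_const_nhds.congr' ?_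
          obtain ⟨N, hN⟩ := exists_nat_gt (1 / (p.2 - σ))
          filter_upwards [eventually_ge_atTop N] with n hn
          rw [Kst_one]
          have : (N:ℝ) ≤ n := by exact_mod_cast hn
          rw [div_lt_iff₀ (by linarith)] at hN
          nlinarith
        · refine tendsto_const_nhds.congr fun n => ?_
          rw [Kst_zero]
          have : (0:ℝ) ≤ (n:ℝ) := by positivity
          nlinarith
      have := ((key s).sub (key t)).const_mul (Q p.1 p.2 * α' p.1)
      convert this using 2
      by_cases h1 : s < p.2
      · by_cases h2 : t < p.2
        · simp [indicator, h1, h2, not_le.2 h2]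
        · simp [indicator, h1, h2, not_lt.1 h2]
      · simp [indicator, h1, not_lt.2 ((not_lt.1 h1).trans hst)]
  have key : ∀ n : ℕ, 0 ≤ (∫ τ, m τ * (((n:ℝ) + 1) * kap (((n:ℝ) + 1) * (τ - s) - 1))) - (∫ τ, m τ * (((n:ℝ) + 1) * kap (((n:ℝ) + 1) * (τ - t) - 1))) + ∫ p : ℝ × ℝ, Q p.1 p.2 * α' p.1 * B n p.2 := by
    intro n
    have hBd : ∀ τ, HasDerivAt (B n) (((n:ℝ) + 1) * kap (((n:ℝ) + 1) * (τ - s) - 1) - ((n:ℝ) + 1) * kap (((n:ℝ) + 1) * (τ - t) - 1)) τ := by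
      intro τ
      have d : ∀ σ, HasDerivAt (fun τ => Kst (((n:ℝ) + 1) * (τ - σ) - 1)) (((n:ℝ) + 1) * kap (((n:ℝ) + 1) * (τ - σ) - 1)) τ := by
        intro σ
        have := (Kst_deriv (((n:ℝ) + 1) * (τ - σ) - 1)).comp τ ((((hasDerivAt_id τ).sub_const σ).const_mul ((n:ℝ) + 1)).sub_const 1)
        refine this.congr_deriv ?_
        ring
      exact (d s).sub (d t)
    have h := hI (fun x τ => α x * B n τ) ?_ ?_ (fun x τ => mul_nonneg (hα0 x) (B0 n τ)) (fun x τ hτ => by rw [Bz n τ (hτ.trans hs), mul_zero])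
    · have e : ∀ p : ℝ × ℝ, η p.1 p.2 * deriv (fun s => α p.1 * B n s) p.2 + Q p.1 p.2 * deriv (fun y => α y * B n p.2) p.1 =
          η p.1 p.2 * α p.1 * (((n:ℝ) + 1) * kap (((n:ℝ) + 1) * (p.2 - s) - 1)) - η p.1 p.2 * α p.1 * (((n:ℝ) + 1) * kap (((n:ℝ) + 1) * (p.2 - t) - 1)) + Q p.1 p.2 * α' p.1 * B n p.2 := by
        intro p
        rw [((hBd p.2).const_mul (α p.1)).deriv, ((hd p.1).mul_const (B n p.2)).deriv]; ring
      simp only [e] at h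
      have i1 : ∀ σ, Integrable (fun p : ℝ × ℝ => η p.1 p.2 * α p.1 * (((n:ℝ) + 1) * kap (((n:ℝ) + 1) * (p.2 - σ) - 1))) := by
        intro σ
        have : Integrable (fun τ => ((n:ℝ) + 1) * kap (((n:ℝ) + 1) * (τ - σ) - 1)) := by
          have := ((kap_integrable.comp_sub_right 1).comp_mul_left' (R := (n:ℝ) + 1) (by positivity)).comp_sub_right σ
          exact this.const_mul _
        have := (Integrable.mul_prod hαi this).bdd_mul (c := C) (f := fun p : ℝ × ℝ => η p.1 p.2) hm.aestronglyMeasurable (Eventually.of_forall fun p => hC _ _)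
        exact this.congr (Eventually.of_forall fun p => by ring)
      have i2 : Integrable (fun p : ℝ × ℝ => Q p.1 p.2 * α' p.1 * B n p.2) := by
        have hBi : Integrable (B n) := (Bc n).integrable_of_hasCompactSupport (HasCompactSupport.intro (isCompact_Icc (a := s) (b := t + 1)) fun τ hτ => by
          simp only [mem_Icc, not_and_or, not_le] at hτ
          exact hτ.elim (fun h => Bz _ _ h.le) (fun h => Bz' _ _ h.le))
        have := (Integrable.mul_prod hα'i hBi).bdd_mul (c := C) (f := fun p : ℝ × ℝ => Q p.1 p.2) hq.aestronglyMeasurable (Eventually.of_forall fun p => hC' _ _)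
        exact this.congr (Eventually.of_forall fun p => by ring)
      have i3 : ∀ σ, ∫ p : ℝ × ℝ, η p.1 p.2 * α p.1 * (((n:ℝ) + 1) * kap (((n:ℝ) + 1) * (p.2 - σ) - 1)) = ∫ τ, m τ * (((n:ℝ) + 1) * kap (((n:ℝ) + 1) * (τ - σ) - 1)) := by
        intro σ
        rw [Measure.volume_eq_prod, integral_prod_symm _ (i1 σ)]
        congr 1; ext τ
        simp only [hmd]
        rw [← integral_mul_const]
      have i12 : Integrable (fun p : ℝ × ℝ => η p.1 p.2 * α p.1 * (((n:ℝ) + 1) * kap (((n:ℝ) + 1) * (p.2 - s) - 1)) - η p.1 p.2 * α p.1 * (((n:ℝ) + 1) * kap (((n:ℝ) + 1) * (p.2 - t) - 1))) := (i1 s).sub (i1 t)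
      rw [integral_add i12 i2, integral_sub (i1 s) (i1 t), i3, i3] at h
      exact h
    · refine ContDiff.mul (hα.comp contDiff_fst) ?_
      have := Kst_contDiff
      simp only [hB]
      exact ((this.comp (by fun_prop)).sub (this.comp (by fun_prop)))
    · refine HasCompactSupport.intro ((isCompact_Icc (a := -r) (b := r)).prod (isCompact_Icc (a := s) (b := t + 1))) fun p hp => ?_
      simp only [mem_prod, not_and_or] at hp
      rcases hp with hp | hp
      · rw [hr, zero_mul]
        by_contra hh; exact hp (abs_le.1 (not_lt.1 hh))
      · simp only [mem_Icc, not_and_or, not_le] at hp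
        rw [hp.elim (fun h => Bz n _ h.le) (fun h => Bz' n _ h.le), mul_zero]
  have := ge_of_tendsto' ((L1.sub L2).add L3) key
  linarith
end

section
variable {u0 : ℝ → ℝ}
lemma Kst_lim (x a c : ℝ) (hc0 : 0 ≤ c) (hx : x ≠ a) :
    Tendsto (fun n : ℕ => Kst (((n:ℝ) + 1) * (x - a) - c)) atTop (nhds (if a < x then 1 else 0)) := by
  split_ifs with h
  · refine tendsto_const_nhds.congr' ?_
    obtain ⟨N, hN⟩ := exists_nat_gt (c / (x - a))
    filter_upwards [eventually_ge_atTop N] with n hn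
    rw [Kst_one]
    have : (N:ℝ) ≤ n := by exact_mod_cast hn
    rw [div_lt_iff₀ (by linarith)] at hN
    nlinarith
  · refine tendsto_const_nhds.congr' ?_
    have h : x < a := lt_of_le_of_ne (not_lt.1 h) hx
    obtain ⟨N, hN⟩ := exists_nat_gt (1 / (a - x))
    filter_upwards [eventually_ge_atTop N] with n hn
    rw [Kst_zero]
    have : (N:ℝ) ≤ n := by exact_mod_cast hn
    rw [div_lt_iff₀ (by linarith)] at hN
    nlinarith
lemma slab2 (S : ABSol fq fq (-4) 4 u0) (η Q : ℝ → ℝ → ℝ) (hm : Measurable (Function.uncurry η)) (hq : Measurable (Function.uncurry Q))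
    {C : ℝ} (hC : ∀ x t, |η x t| ≤ C) (hC' : ∀ x t, |Q x t| ≤ C)
    (hη : ∀ x τ τ', |η x τ - η x τ'| ≤ |S.u x τ - S.u x τ'|)
    (hI : ∀ φ : ℝ → ℝ → ℝ, ContDiff ℝ 1 (fun p : ℝ × ℝ => φ p.1 p.2) → HasCompactSupport (fun p : ℝ × ℝ => φ p.1 p.2) →
      (∀ x t, 0 ≤ φ x t) → (∀ x t, t ≤ 0 → φ x t = 0) →
      0 ≤ ∫ p : ℝ × ℝ, (η p.1 p.2 * deriv (fun s => φ p.1 s) p.2 + Q p.1 p.2 * deriv (fun y => φ y p.2) p.1))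
    {a b c c' : ℝ} (hab : a ≤ b) (hc : c ≤ c') (Qa Qb : ℝ → ℝ)
    (ha : (c = 0 ∧ ∀ t, 0 < t → Tendsto (fun x => Q x t) (nhdsWithin a (Iio a)) (nhds (Qa t))) ∨
      (c = 1 ∧ ∀ t, 0 < t → Tendsto (fun x => Q x t) (nhdsWithin a (Ioi a)) (nhds (Qa t))))
    (hb : (c' = 0 ∧ ∀ t, 0 < t → Tendsto (fun x => Q x t) (nhdsWithin b (Iio b)) (nhds (Qb t))) ∨
      (c' = 1 ∧ ∀ t, 0 < t → Tendsto (fun x => Q x t) (nhdsWithin b (Ioi b)) (nhds (Qb t))))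
    {s t : ℝ} (hs : 0 ≤ s) (hst : s ≤ t) :
    (∫ x in a..b, η x t) - (∫ x in a..b, η x s) ≤ (∫ τ in s..t, Qa τ) - ∫ τ in s..t, Qb τ := by
  have hC0 : 0 ≤ C := (abs_nonneg _).trans (hC 0 0)
  have c0 : 0 ≤ c := by rcases ha with h | h <;> rw [h.1]; norm_num
  have c1 : c' ≤ 1 := by rcases hb with h | h <;> rw [h.1]; norm_num
  set α : ℕ → ℝ → ℝ := fun n x => Kst (((n:ℝ) + 1) * (x - a) - c) - Kst (((n:ℝ) + 1) * (x - b) - c') with hα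
  have α0 : ∀ n x, 0 ≤ α n x := fun n x => sub_nonneg.2 (Kst_mono (by
    have : (0:ℝ) ≤ (n:ℝ) + 1 := by positivity
    nlinarith))
  have α1 : ∀ n x, α n x ≤ 1 := fun n x => by
    simp only [hα]
    linarith [Kst_le (((n:ℝ) + 1) * (x - a) - c), Kst_nonneg (((n:ℝ) + 1) * (x - b) - c')]
  have αz : ∀ n x, x ∉ Icc (a - 1) (b + 1) → α n x = 0 := fun n x hx => by
    have : (0:ℝ) ≤ (n:ℝ) := by positivity
    simp only [mem_Icc, not_and_or, not_le] at hx
    simp only [hα]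
    rcases hx with hx | hx
    · rw [Kst_zero, Kst_zero, sub_zero] <;> nlinarith
    · rw [Kst_one, Kst_one, sub_self] <;> nlinarith
  have αc : ∀ n, ContDiff ℝ 1 (α n) := fun n => by
    have := Kst_contDiff
    simp only [hα]
    exact ((this.comp (by fun_prop)).sub (this.comp (by fun_prop)))
  have αd : ∀ (n : ℕ) x, HasDerivAt (α n) (((n:ℝ) + 1) * kap (((n:ℝ) + 1) * (x - a) - c) - ((n:ℝ) + 1) * kap (((n:ℝ) + 1) * (x - b) - c')) x := by
    intro n x
    have d : ∀ σ c, HasDerivAt (fun τ => Kst (((n:ℝ) + 1) * (τ - σ) - c)) (((n:ℝ) + 1) * kap (((n:ℝ) + 1) * (x - σ) - c)) x := by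
      intro σ c
      have := (Kst_deriv (((n:ℝ) + 1) * (x - σ) - c)).comp x ((((hasDerivAt_id x).sub_const σ).const_mul ((n:ℝ) + 1)).sub_const c)
      refine this.congr_deriv ?_
      ring
    exact (d a c).sub (d b c')
  have key := fun n => slab1 S η Q hm hq hC hC' hη hI (α n) _ (αc n) (αd n) (α0 n) (r := |a| + |b| + 1) (fun x hx => αz n x fun h => by
    have : |x| ≤ |a| + |b| + 1 := abs_le.2 ⟨by linarith [h.1, neg_abs_le a, abs_nonneg b], by linarith [h.2, le_abs_self b, abs_nonneg a]⟩
    linarith) hs hst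
  have L : ∀ σ, Tendsto (fun n => ∫ x, η x σ * α n x) atTop (nhds (∫ x in a..b, η x σ)) := by
    intro σ
    have hmσ : Measurable (fun x => η x σ) := hm.comp (measurable_id.prodMk measurable_const)
    rw [intervalIntegral.integral_of_le hab, ← integral_indicator measurableSet_Ioc]
    refine tendsto_integral_of_dominated_convergence ((Icc (a - 1) (b + 1)).indicator (fun _ => C)) (fun n => ?_) ?_ (fun n => ?_) ?_
    · exact (hmσ.mul (αc n).continuous.measurable).aestronglyMeasurable
    · rw [integrable_indicator_iff measurableSet_Icc]; simp
    · refine Eventually.of_forall fun x => ?_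
      by_cases hx : x ∈ Icc (a - 1) (b + 1)
      · rw [indicator_of_mem hx, Real.norm_eq_abs, abs_mul, abs_of_nonneg (α0 n x)]
        have := mul_le_mul (hC x σ) (α1 n x) (α0 n x) hC0
        linarith
      · rw [αz n x hx]; simp [indicator_of_notMem hx]
    · filter_upwards [ae_ne a, ae_ne b] with x h1 h2
      have := ((Kst_lim x a c c0 h1).sub (Kst_lim x b c' (c0.trans hc) h2)).const_mul (η x σ)
      convert this using 2
      by_cases h1 : a < x
      · by_cases h2 : b < x
        · simp [indicator, h1, h2, not_le.2 h2]
        · simp [indicator, h1, h2, not_lt.1 h2]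
      · simp [indicator, h1, not_lt.2 ((not_lt.1 h1).trans hab)]
  set G : ℝ × ℝ → ℝ := fun p => Q p.1 p.2 * (Ioc s t).indicator (fun _ => (1:ℝ)) p.2 with hG
  have Gm : Measurable G := hq.mul ((measurable_const.indicator measurableSet_Ioc).comp measurable_snd)
  have Gb : ∀ p, |G p| ≤ C := fun p => by
    by_cases hp : p.2 ∈ Ioc s t
    · simp only [hG, indicator_of_mem hp, mul_one]; exact hC' _ _
    · simp only [hG, indicator_of_notMem hp, mul_zero, abs_zero]; exact hC0
  have GT : ∀ x τ, t < |τ| → G (x, τ) = 0 := fun x τ hτ => by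
    have : τ ∉ Ioc s t := fun h => by rw [abs_of_nonneg (hs.trans h.1.le)] at hτ; linarith [h.2]
    simp [hG, this]
  have Gl : ∀ (l : Filter ℝ) (Qx : ℝ → ℝ), (∀ t, 0 < t → Tendsto (fun x => Q x t) l (nhds (Qx t))) → ∀ τ, Tendsto (fun x => G (x, τ)) l (nhds ((Ioc s t).indicator Qx τ)) := by
    intro l Qx h τ
    by_cases hp : τ ∈ Ioc s t
    · simp only [hG, indicator_of_mem hp, mul_one]; exact h τ (hs.trans_lt hp.1)
    · simp only [hG, indicator_of_notMem hp, mul_zero]; exact tendsto_const_nhds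
  have La := trace_lim G ((Ioc s t).indicator Qa) a c C t Gm Gb GT (ha.imp (fun h => ⟨h.1, Eventually.of_forall (Gl _ _ h.2)⟩) (fun h => ⟨h.1, Eventually.of_forall (Gl _ _ h.2)⟩))
  have Lb := trace_lim G ((Ioc s t).indicator Qb) b c' C t Gm Gb GT (hb.imp (fun h => ⟨h.1, Eventually.of_forall (Gl _ _ h.2)⟩) (fun h => ⟨h.1, Eventually.of_forall (Gl _ _ h.2)⟩))
  rw [integral_indicator measurableSet_Ioc, ← intervalIntegral.integral_of_le hst] at La Lb
  refine le_of_tendsto_of_tendsto' ((L t).sub (L s)) (La.sub Lb) fun n => (key n).trans (le_of_eq ?_)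
  have i : ∀ σ c, Integrable (fun p : ℝ × ℝ => G p * (((n:ℝ) + 1) * kap (((n:ℝ) + 1) * (p.1 - σ) - c))) := by
    intro σ c
    have h1 : Integrable (fun τ => ((n:ℝ) + 1) * kap (((n:ℝ) + 1) * (τ - σ) - c)) := by
      have := ((kap_integrable.comp_sub_right c).comp_mul_left' (R := (n:ℝ) + 1) (by positivity)).comp_sub_right σ
      exact this.const_mul _
    have h2 : Integrable ((Ioc s t).indicator (fun _ => (1:ℝ))) := by rw [integrable_indicator_iff measurableSet_Ioc]; simp
    have := (Integrable.mul_prod h1 h2).bdd_mul (c := C) (f := fun p : ℝ × ℝ => Q p.1 p.2) hq.aestronglyMeasurable (Eventually.of_forall fun p => hC' _ _)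
    exact this.congr (Eventually.of_forall fun p => by simp only [hG]; ring)
  rw [← integral_sub (i a c) (i b c')]
  congr 1; ext p; simp only [hG]; ring
lemma dflux_fq (x u : ℝ) : dflux fq fq x u = fq u := by unfold dflux; simp
lemma fq_cont : Continuous fq := by unfold fq; fun_prop
lemma flux_id (S : ABSol fq fq (-4) 4 u0) {a b s t : ℝ} (hab : a ≤ b) (hs : 0 ≤ s) (hst : s ≤ t) :
    (∫ x in a..b, S.u x t) - (∫ x in a..b, S.u x s) = (∫ τ in s..t, fq (S.um a τ)) - ∫ τ in s..t, fq (S.um b τ) := by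
  obtain ⟨M, hM⟩ := S.bdd
  have hM0 : 0 ≤ M := (abs_nonneg _).trans (hM 0 0)
  have hw := S.weak
  simp only [dflux_fq] at hw
  have hb : ∀ x t, |fq (S.u x t)| ≤ M + M ^ 2 := fun x t => by
    unfold fq; rw [abs_of_nonneg (by positivity)]; nlinarith [abs_le.1 (hM x t), sq_abs (S.u x t), abs_nonneg (S.u x t), hM x t]
  have hb1 : ∀ x t, |S.u x t| ≤ M + M ^ 2 := fun x t => by nlinarith [hM x t]
  have hq : Measurable (Function.uncurry fun x t => fq (S.u x t)) := fq_cont.measurable.comp S.meas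
  refine le_antisymm ?_ ?_
  · refine slab2 S S.u (fun x t => fq (S.u x t)) S.meas hq hb1 hb (fun _ _ _ => le_rfl) (fun φ h1 h2 h3 h4 => (hw φ h1 h2 h4).ge) hab (le_refl (0:ℝ)) _ _
      (Or.inl ⟨rfl, fun t ht => (fq_cont.tendsto _).comp (S.um_spec a t ht)⟩) (Or.inl ⟨rfl, fun t ht => (fq_cont.tendsto _).comp (S.um_spec b t ht)⟩) hs hst
  · have := slab2 S (fun x t => -S.u x t) (fun x t => -fq (S.u x t)) S.meas.neg hq.neg (C := M + M ^ 2) (fun x t => by rw [abs_neg]; exact hb1 x t) (fun x t => by rw [abs_neg]; exact hb x t)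
      (fun x τ τ' => by rw [abs_sub_comm]; exact le_of_eq (by congr 1; ring)) (fun φ h1 h2 h3 h4 => ?_) hab (le_refl (0:ℝ)) _ _
      (Or.inl ⟨rfl, fun t ht => ((fq_cont.tendsto _).comp (S.um_spec a t ht)).neg⟩) (Or.inl ⟨rfl, fun t ht => ((fq_cont.tendsto _).comp (S.um_spec b t ht)).neg⟩) hs hst
    · simp only [intervalIntegral.integral_neg] at this
      linarith
    · have := hw φ h1 h2 h4
      rw [← neg_zero, ← this, ← integral_neg]
      exact le_of_eq (by congr 1; ext p; ring)
lemma flux_iface (S : ABSol fq fq (-4) 4 u0) {s t : ℝ} (hs : 0 ≤ s) (hst : s ≤ t) :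
    (∫ τ in s..t, fq (S.um 0 τ)) = ∫ τ in s..t, fq (S.up 0 τ) := by
  obtain ⟨M, hM⟩ := S.bdd
  have hM0 : 0 ≤ M := (abs_nonneg _).trans (hM 0 0)
  have hw := S.weak
  simp only [dflux_fq] at hw
  have hb : ∀ x t, |fq (S.u x t)| ≤ M + M ^ 2 := fun x t => by
    unfold fq; rw [abs_of_nonneg (by positivity)]; nlinarith [abs_le.1 (hM x t), sq_abs (S.u x t), abs_nonneg (S.u x t), hM x t]
  have hb1 : ∀ x t, |S.u x t| ≤ M + M ^ 2 := fun x t => by nlinarith [hM x t]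
  have hq : Measurable (Function.uncurry fun x t => fq (S.u x t)) := fq_cont.measurable.comp S.meas
  have A := slab2 S S.u (fun x t => fq (S.u x t)) S.meas hq hb1 hb (fun _ _ _ => le_rfl) (fun φ h1 h2 h3 h4 => (hw φ h1 h2 h4).ge) (le_refl (0:ℝ)) (zero_le_one' ℝ) _ _
      (Or.inl ⟨rfl, fun t ht => (fq_cont.tendsto _).comp (S.um_spec 0 t ht)⟩) (Or.inr ⟨rfl, fun t ht => (fq_cont.tendsto _).comp (S.up_spec 0 t ht)⟩) hs hst
  have := slab2 S (fun x t => -S.u x t) (fun x t => -fq (S.u x t)) S.meas.neg hq.neg (C := M + M ^ 2) (fun x t => by rw [abs_neg]; exact hb1 x t) (fun x t => by rw [abs_neg]; exact hb x t)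
      (fun x τ τ' => by rw [abs_sub_comm]; exact le_of_eq (by congr 1; ring)) (fun φ h1 h2 h3 h4 => ?_) (le_refl (0:ℝ)) (zero_le_one' ℝ) _ _
      (Or.inl ⟨rfl, fun t ht => ((fq_cont.tendsto _).comp (S.um_spec 0 t ht)).neg⟩) (Or.inr ⟨rfl, fun t ht => ((fq_cont.tendsto _).comp (S.up_spec 0 t ht)).neg⟩) hs hst
  · simp only [intervalIntegral.integral_neg, intervalIntegral.integral_same] at this A
    linarith
  · have := hw φ h1 h2 h4
    rw [← neg_zero, ← this, ← integral_neg]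
    exact le_of_eq (by congr 1; ext p; ring)
lemma ent_iface (S : ABSol fq fq (-4) 4 u0) {s t : ℝ} (hs : 0 ≤ s) (hst : s ≤ t) :
    (∫ τ in s..t, Sk 4 (S.up 0 τ)) ≤ ∫ τ in s..t, Sk (-4) (S.um 0 τ) := by
  obtain ⟨M, hM⟩ := S.bdd
  have hM0 : 0 ≤ M := (abs_nonneg _).trans (hM 0 0)
  have hw := S.interfaceEntropy
  simp only [dflux_fq, sign_flux] at hw
  have hca : ∀ x, |cAB (-4) 4 x| = 4 := fun x => by unfold cAB; split_ifs <;> norm_num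
  have hcm : Measurable (cAB (-4) 4) := by unfold cAB; exact Measurable.ite measurableSet_Iic measurable_const measurable_const
  have hcm' : Measurable (fun p : ℝ × ℝ => cAB (-4) 4 p.1) := hcm.comp measurable_fst
  have hmu : Measurable (fun p : ℝ × ℝ => S.u p.1 p.2) := S.meas
  have hq : Measurable (Function.uncurry fun x t => Sk (cAB (-4) 4 x) (S.u x t)) := by
    unfold Sk
    exact (((hmu.sub hcm').abs).mul (hmu.add hcm')).div_const 2
  have A := slab2 S (fun x t => |S.u x t - cAB (-4) 4 x|) (fun x t => Sk (cAB (-4) 4 x) (S.u x t)) (C := (M + 4) + (M + 4) ^ 2) (hmu.sub hcm').abs hq ?_ ?_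
    (fun x τ τ' => ?_) hw (le_refl (0:ℝ)) (zero_le_one' ℝ) (fun τ => Sk (-4) (S.um 0 τ)) (fun τ => Sk 4 (S.up 0 τ)) (Or.inl ⟨rfl, fun t ht => ?_⟩) (Or.inr ⟨rfl, fun t ht => ?_⟩) hs hst
  · simp only [intervalIntegral.integral_same] at A; linarith
  · intro x t
    rw [abs_abs]
    refine (abs_sub _ _).trans ?_
    rw [hca]; nlinarith [hM x t]
  · intro x t
    have := Sk_bd (k := cAB (-4) 4 x) (hM x t)
    rw [hca] at this; linarith
  · refine (abs_abs_sub_abs_le_abs_sub _ _).trans (le_of_eq (by congr 1; ring))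
  · refine (((Sk_cont (-4)).tendsto _).comp (S.um_spec 0 t ht)).congr' ?_
    filter_upwards [self_mem_nhdsWithin] with x hx
    have : x ≤ 0 := le_of_lt hx
    simp [cAB, this]
  · refine (((Sk_cont 4).tendsto _).comp (S.up_spec 0 t ht)).congr' ?_
    filter_upwards [self_mem_nhdsWithin] with x hx
    have : ¬ x ≤ 0 := not_le.2 hx
    simp [cAB, this]
lemma ae_nonneg_of_int {G : ℝ → ℝ} (hG : Measurable G) {C : ℝ} (hC : ∀ t, |G t| ≤ C) (h : ∀ s t, 0 ≤ s → s ≤ t → 0 ≤ ∫ τ in s..t, G τ) :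
    ∀ᵐ t, 0 < t → 0 ≤ G t := by
  have hi : ∀ a b, IntervalIntegrable G volume a b := fun a b =>
    (intervalIntegrable_const (c := C)).mono_fun hG.aestronglyMeasurable (Eventually.of_forall fun x => by
      exact (hC x).trans (le_abs_self C))
  have hl : LocallyIntegrable G := by
    refine (locallyIntegrable_const C).mono hG.aestronglyMeasurable (Eventually.of_forall fun x => by
      exact (hC x).trans (le_abs_self C))
  filter_upwards [_root_.LocallyIntegrable.ae_hasDerivAt_integral hl] with t ht h0
  have hd := ht 0
  have := hd.hasDerivWithinAt (s := Ioi t)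
  rw [hasDerivWithinAt_iff_tendsto_slope' (by simp)] at this
  refine ge_of_tendsto this ?_
  filter_upwards [self_mem_nhdsWithin] with y hy
  have hy : t < y := hy
  rw [slope_def_field]
  refine div_nonneg ?_ (by linarith)
  rw [intervalIntegral.integral_interval_sub_left (hi _ _) (hi _ _)]
  exact h t y h0.le hy.le
end

section
variable {u0 : ℝ → ℝ}
lemma bint {f : ℝ → ℝ} {C : ℝ} (hf : Measurable f) (hC : ∀ x, |f x| ≤ C) (a b : ℝ) : IntervalIntegrable f volume a b :=
  (intervalIntegrable_const (c := C)).mono_fun hf.aestronglyMeasurable (Eventually.of_forall fun x => (hC x).trans (le_abs_self C))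
lemma bint_le {f : ℝ → ℝ} {C : ℝ} (hC : ∀ x, |f x| ≤ C) (a b : ℝ) : |∫ x in a..b, f x| ≤ C * |b - a| :=
  intervalIntegral.norm_integral_le_of_norm_le_const (f := f) fun x _ => hC x
def vv (S : ABSol fq fq (-4) 4 u0) (x t : ℝ) : ℝ := if 0 < t then S.um x t else 0
def vp (S : ABSol fq fq (-4) 4 u0) (x t : ℝ) : ℝ := if 0 < t then S.up x t else 0
def UU (S : ABSol fq fq (-4) 4 u0) (x t : ℝ) : ℝ := (∫ y in (0:ℝ)..x, S.u y t) - ∫ τ in (0:ℝ)..t, fq (vv S 0 τ)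
section
variable (S : ABSol fq fq (-4) 4 u0)
lemma mes_x (t : ℝ) : Measurable fun x => S.u x t := S.meas.comp (by fun_prop : Measurable fun x : ℝ => (x, t))
lemma seq_lt (x : ℝ) : Tendsto (fun n : ℕ => x - 1 / ((n:ℝ) + 1)) atTop (nhdsWithin x (Iio x)) := by
  refine tendsto_nhdsWithin_iff.2 ⟨?_, Eventually.of_forall fun n => ?_⟩
  · simpa using tendsto_const_nhds.sub (tendsto_one_div_add_atTop_nhds_zero_nat (𝕜 := ℝ)) (f := fun _ => x)
  · have : (0:ℝ) < 1 / ((n:ℝ) + 1) := by positivity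
    exact sub_lt_self x this
lemma seq_gt (x : ℝ) : Tendsto (fun n : ℕ => x + 1 / ((n:ℝ) + 1)) atTop (nhdsWithin x (Ioi x)) := by
  refine tendsto_nhdsWithin_iff.2 ⟨?_, Eventually.of_forall fun n => ?_⟩
  · simpa using tendsto_const_nhds.add (tendsto_one_div_add_atTop_nhds_zero_nat (𝕜 := ℝ)) (f := fun _ => x)
  · have : (0:ℝ) < 1 / ((n:ℝ) + 1) := by positivity
    exact lt_add_of_pos_right x this
lemma vv_meas : Measurable (Function.uncurry (vv S)) := by
  refine measurable_of_tendsto_metrizable (f := fun (n : ℕ) (p : ℝ × ℝ) => if 0 < p.2 then S.u (p.1 - 1 / ((n:ℝ) + 1)) p.2 else 0) (fun n => ?_) ?_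
  · exact Measurable.ite (measurableSet_lt measurable_const measurable_snd) (S.meas.comp (by fun_prop : Measurable fun p : ℝ × ℝ => (p.1 - 1 / ((n:ℝ) + 1), p.2))) measurable_const
  · rw [tendsto_pi_nhds]
    rintro ⟨x, t⟩
    by_cases h : 0 < t
    · simpa [vv, h, Function.uncurry, Function.comp_def] using (S.um_spec x t h).comp (seq_lt x)
    · simp [vv, h, Function.uncurry]
lemma vp_meas : Measurable (Function.uncurry (vp S)) := by
  refine measurable_of_tendsto_metrizable (f := fun (n : ℕ) (p : ℝ × ℝ) => if 0 < p.2 then S.u (p.1 + 1 / ((n:ℝ) + 1)) p.2 else 0) (fun n => ?_) ?_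
  · exact Measurable.ite (measurableSet_lt measurable_const measurable_snd) (S.meas.comp (by fun_prop : Measurable fun p : ℝ × ℝ => (p.1 + 1 / ((n:ℝ) + 1), p.2))) measurable_const
  · rw [tendsto_pi_nhds]
    rintro ⟨x, t⟩
    by_cases h : 0 < t
    · simpa [vp, h, Function.uncurry, Function.comp_def] using (S.up_spec x t h).comp (seq_gt x)
    · simp [vp, h, Function.uncurry]
variable {S} {M : ℝ}
lemma M_nn (hM : ∀ x t, |S.u x t| ≤ M) : 0 ≤ M := (abs_nonneg _).trans (hM 0 0)
lemma vv_bd (hM : ∀ x t, |S.u x t| ≤ M) (x t : ℝ) : |vv S x t| ≤ M := by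
  unfold vv
  split_ifs with h
  · exact le_of_tendsto (S.um_spec x t h).abs (Eventually.of_forall fun y => hM y t)
  · simpa using M_nn hM
lemma vp_bd (hM : ∀ x t, |S.u x t| ≤ M) (x t : ℝ) : |vp S x t| ≤ M := by
  unfold vp
  split_ifs with h
  · exact le_of_tendsto (S.up_spec x t h).abs (Eventually.of_forall fun y => hM y t)
  · simpa using M_nn hM
lemma fq_bd {z : ℝ} (h : |z| ≤ M) : |fq z| ≤ M ^ 2 / 2 := by
  unfold fq
  have := sq_abs z
  rw [abs_of_nonneg (by positivity)]
  nlinarith [abs_nonneg z]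
lemma mes_t (S : ABSol fq fq (-4) 4 u0) (x : ℝ) : Measurable fun t => vv S x t := (vv_meas S).comp (by fun_prop : Measurable fun t : ℝ => (x, t))
lemma vv_int (S : ABSol fq fq (-4) 4 u0) (G : ℝ → ℝ) (x : ℝ) {s t : ℝ} (hs : 0 ≤ s) (hst : s ≤ t) : ∫ τ in s..t, G (S.um x τ) = ∫ τ in s..t, G (vv S x τ) := by
  refine intervalIntegral.integral_congr_ae (Eventually.of_forall fun τ h => ?_)
  rw [uIoc_of_le hst] at h
  simp [vv, hs.trans_lt h.1]
lemma vp_int (S : ABSol fq fq (-4) 4 u0) (G : ℝ → ℝ) (x : ℝ) {s t : ℝ} (hs : 0 ≤ s) (hst : s ≤ t) : ∫ τ in s..t, G (S.up x τ) = ∫ τ in s..t, G (vp S x τ) := by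
  refine intervalIntegral.integral_congr_ae (Eventually.of_forall fun τ h => ?_)
  rw [uIoc_of_le hst] at h
  simp [vp, hs.trans_lt h.1]
lemma UU_x (hM : ∀ x t, |S.u x t| ≤ M) (x y t : ℝ) : UU S y t - UU S x t = ∫ z in x..y, S.u z t := by
  unfold UU
  rw [← intervalIntegral.integral_interval_sub_left (bint (mes_x S t) (fun x => hM x t) 0 y) (bint (mes_x S t) (fun x => hM x t) 0 x)]
  ring
lemma vvi (hM : ∀ x t, |S.u x t| ≤ M) (x a b : ℝ) : IntervalIntegrable (fun τ => fq (vv S x τ)) volume a b :=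
  bint (fq_cont.measurable.comp (mes_t S x)) (fun t => fq_bd (vv_bd hM x t)) a b
lemma UU_t (hM : ∀ x t, |S.u x t| ≤ M) (x : ℝ) {s t : ℝ} (hs : 0 ≤ s) (hst : s ≤ t) : UU S x t - UU S x s = - ∫ τ in s..t, fq (vv S x τ) := by
  unfold UU
  have h0 := intervalIntegral.integral_interval_sub_left (vvi hM 0 0 t) (vvi hM 0 0 s)
  rcases le_total 0 x with h | h
  · have := flux_id S h hs hst
    rw [vv_int S fq _ hs hst, vv_int S fq _ hs hst] at this
    linarith
  · have := flux_id S h hs hst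
    rw [vv_int S fq _ hs hst, vv_int S fq _ hs hst] at this
    rw [intervalIntegral.integral_symm x 0, intervalIntegral.integral_symm x 0]
    linarith
lemma UU_lx (hM : ∀ x t, |S.u x t| ≤ M) (x y t : ℝ) : |UU S y t - UU S x t| ≤ M * |y - x| := by
  rw [UU_x hM]
  exact bint_le (fun z => hM z t) _ _
lemma UU_lt (hM : ∀ x t, |S.u x t| ≤ M) (x : ℝ) {s t : ℝ} (hs : 0 ≤ s) (ht : 0 ≤ t) : |UU S x t - UU S x s| ≤ M ^ 2 / 2 * |t - s| := by
  rcases le_total s t with h | h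
  · rw [UU_t hM x hs h, abs_neg]
    exact bint_le (fun z => fq_bd (vv_bd hM x z)) _ _
  · rw [abs_sub_comm, UU_t hM x ht h, abs_neg, abs_sub_comm t s]
    exact bint_le (fun z => fq_bd (vv_bd hM x z)) _ _
lemma UU_cont (hM : ∀ x t, |S.u x t| ≤ M) : ContinuousOn (fun p : ℝ × ℝ => UU S p.1 p.2) {p | 0 ≤ p.2} := by
  rintro ⟨x, t⟩ h
  have h : 0 ≤ t := h
  rw [ContinuousWithinAt, tendsto_iff_dist_tendsto_zero]
  have hz : Tendsto (fun p : ℝ × ℝ => M * |p.1 - x| + M ^ 2 / 2 * |p.2 - t|) (nhdsWithin (x, t) {p | 0 ≤ p.2}) (nhds 0) := by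
    have : Continuous (fun p : ℝ × ℝ => M * |p.1 - x| + M ^ 2 / 2 * |p.2 - t|) := by fun_prop
    simpa using (this.tendsto (x, t)).mono_left nhdsWithin_le_nhds
  refine tendsto_of_tendsto_of_tendsto_of_le_of_le' tendsto_const_nhds hz (Eventually.of_forall fun _ => dist_nonneg) ?_
  filter_upwards [self_mem_nhdsWithin] with p hp
  rw [Real.dist_eq]
  have e : UU S p.1 p.2 - UU S x t = (UU S p.1 p.2 - UU S x p.2) + (UU S x p.2 - UU S x t) := by ring
  rw [e]
  exact (abs_add_le _ _).trans (add_le_add (UU_lx hM _ _ _) (UU_lt hM _ h hp))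
lemma iface (hM : ∀ x t, |S.u x t| ≤ M) : ∀ᵐ t, 0 < t → 8 ≤ fq (S.um 0 t) ∧ (8 < fq (S.um 0 t) → 4 < S.um 0 t ∨ S.up 0 t < -4) := by
  have m2 : Measurable fun t => vp S 0 t := (vp_meas S).comp (by fun_prop : Measurable fun t : ℝ => ((0:ℝ), t))
  have m1 := mes_t S 0
  have i1 : ∀ a b, IntervalIntegrable (fun τ => fq (vp S 0 τ)) volume a b := bint (fq_cont.measurable.comp m2) fun t => fq_bd (vp_bd hM 0 t)
  have i2 : ∀ a b, IntervalIntegrable (fun τ => Sk 4 (vp S 0 τ)) volume a b := bint ((Sk_cont 4).measurable.comp m2) fun t => Sk_bd (vp_bd hM 0 t)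
  have i3 : ∀ a b, IntervalIntegrable (fun τ => Sk (-4) (vv S 0 τ)) volume a b := bint ((Sk_cont (-4)).measurable.comp m1) fun t => Sk_bd (vv_bd hM 0 t)
  have A := ae_nonneg_of_int (G := fun t => fq (vv S 0 t) - fq (vp S 0 t)) ((fq_cont.measurable.comp m1).sub (fq_cont.measurable.comp m2))
    (fun t => (abs_sub _ _).trans (add_le_add (fq_bd (vv_bd hM 0 t)) (fq_bd (vp_bd hM 0 t)))) fun s t hs hst => by
      rw [intervalIntegral.integral_sub (vvi hM _ _ _) (i1 _ _), ← vv_int S fq _ hs hst, ← vp_int S fq _ hs hst, flux_iface S hs hst, sub_self]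
  have B := ae_nonneg_of_int (G := fun t => fq (vp S 0 t) - fq (vv S 0 t)) ((fq_cont.measurable.comp m2).sub (fq_cont.measurable.comp m1))
    (fun t => (abs_sub _ _).trans (add_le_add (fq_bd (vp_bd hM 0 t)) (fq_bd (vv_bd hM 0 t)))) fun s t hs hst => by
      rw [intervalIntegral.integral_sub (i1 _ _) (vvi hM _ _ _), ← vv_int S fq _ hs hst, ← vp_int S fq _ hs hst, flux_iface S hs hst, sub_self]
  have D := ae_nonneg_of_int (G := fun t => Sk (-4) (vv S 0 t) - Sk 4 (vp S 0 t)) (((Sk_cont (-4)).measurable.comp m1).sub ((Sk_cont 4).measurable.comp m2))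
    (fun t => (abs_sub _ _).trans (add_le_add (Sk_bd (vv_bd hM 0 t)) (Sk_bd (vp_bd hM 0 t)))) fun s t hs hst => by
      rw [intervalIntegral.integral_sub (i3 _ _) (i2 _ _), ← vv_int S (Sk (-4)) _ hs hst, ← vp_int S (Sk 4) _ hs hst]
      linarith [ent_iface S hs hst]
  filter_upwards [A, B, D] with t a b d h
  have a := a h
  have b := b h
  have d := d h
  simp only [vv, vp, h, if_true] at a b d
  generalize S.um 0 t = α at *
  generalize S.up 0 t = β at *
  have e : α ^ 2 = β ^ 2 := by unfold fq at a b; linarith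
  unfold Sk at d
  rw [sq_eq_sq_iff_eq_or_eq_neg] at e
  unfold fq
  rcases e with e | e
  · subst e
    rcases abs_cases (α - -4) with ⟨h1, h2⟩ | ⟨h1, h2⟩ <;> rcases abs_cases (α - 4) with ⟨h3, h4⟩ | ⟨h3, h4⟩ <;> rw [h1, h3] at d
    · refine ⟨by nlinarith, fun h => ?_⟩
      left; nlinarith
    · refine ⟨by nlinarith, fun h => ?_⟩
      exfalso; nlinarith
    · exfalso; linarith
    · refine ⟨by nlinarith, fun h => ?_⟩
      right; linarith
  · have e' : β = -α := by linarith
    subst e'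
    have h3 : |(-α) - 4| = |α - -4| := by rw [← abs_neg]; congr 1; ring
    rw [h3] at d
    rcases abs_cases (α - -4) with ⟨h1, h2⟩ | ⟨h1, h2⟩ <;> rw [h1] at d
    · rcases eq_or_lt_of_le h2 with h2 | h2
      · have : α = -4 := by linarith
        subst this; norm_num
      · have : 4 ≤ α := by nlinarith
        refine ⟨by nlinarith, fun h => Or.inl (by nlinarith)⟩
    · exfalso; nlinarith
end
end

section
variable {u0 : ℝ → ℝ} {S : ABSol fq fq (-4) 4 u0} {M ε x t : ℝ}
lemma le_inf_ae (x : ℝ) : nhdsWithin x (Iic x) ⊓ ae (volume : Measure ℝ) ≤ nhdsWithin x (Iio x) := by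
  intro s hs
  have h1 : insert x s ∈ nhdsWithin x (Iic x) := by
    rw [← Iio_insert, nhdsWithin_insert]
    exact mem_sup.2 ⟨by simp, mem_of_superset hs (subset_insert x s)⟩
  have h2 : ({x}ᶜ : Set ℝ) ∈ ae (volume : Measure ℝ) := compl_mem_ae_iff.2 (by simp)
  refine mem_of_superset (inter_mem_inf h1 h2) ?_
  rintro y ⟨h | h, h'⟩
  · exact absurd h h'
  · exact h
lemma vv_ae (hM : ∀ x t, |S.u x t| ≤ M) (ht : 0 < t) : ∀ᵐ x, S.u x t = vv S x t := by
  have hl : LocallyIntegrable (fun x => S.u x t) := by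
    refine (locallyIntegrable_const M).mono (mes_x S t).aestronglyMeasurable (Eventually.of_forall fun x => (hM x t).trans (le_abs_self M))
  filter_upwards [_root_.LocallyIntegrable.ae_hasDerivAt_integral hl] with x hx
  refine (uniqueDiffWithinAt_Iio x).eq_deriv _ (hx 0).hasDerivWithinAt ?_
  rw [vv, if_pos ht]
  exact (intervalIntegral.integral_hasDerivWithinAt_of_tendsto_ae_right (bint (mes_x S t) (fun x => hM x t) _ _) (s := Iic x) (t := Iic x)
    ((mes_x S t).stronglyMeasurable.stronglyMeasurableAtFilter) ((S.um_spec x t ht).mono_left (le_inf_ae x))).mono Iio_subset_Iic_self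
lemma vv_ae2 (hM : ∀ x t, |S.u x t| ≤ M) : ∀ᵐ p : ℝ × ℝ, 0 < p.2 → S.u p.1 p.2 = vv S p.1 p.2 := by
  have hms : MeasurableSet {p : ℝ × ℝ | 0 < p.2 → S.u p.1 p.2 = vv S p.1 p.2} := by
    have : {p : ℝ × ℝ | 0 < p.2 → S.u p.1 p.2 = vv S p.1 p.2} = {p : ℝ × ℝ | p.2 ≤ 0} ∪ {p | S.u p.1 p.2 = vv S p.1 p.2} := by
      ext p; simp only [mem_ofPred_eq, mem_union]; rw [imp_iff_not_or, not_lt]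
    rw [this]
    exact (measurableSet_le measurable_snd measurable_const).union (measurableSet_eq_fun S.meas (vv_meas S))
  have := (Measure.measurePreserving_swap (μ := (volume : Measure ℝ)) (ν := (volume : Measure ℝ)))
  have h2 : ∀ᵐ p : ℝ × ℝ, 0 < p.1 → S.u p.2 p.1 = vv S p.2 p.1 := by
    rw [Measure.volume_eq_prod, Measure.ae_prod_iff_ae_ae]
    · refine Eventually.of_forall fun t => ?_
      by_cases h : 0 < t
      · filter_upwards [vv_ae hM h] with x hx _ using hx
      · exact Eventually.of_forall fun x h' => absurd h' h
    · exact measurable_swap hms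
  exact (this.quasiMeasurePreserving.ae h2)
lemma vv_avg (ht : 0 < t) (G : ℝ → ℝ) (hG : Continuous G) {C : ℝ} (hC : ∀ x, |G (S.u x t)| ≤ C) (x : ℝ) :
    Tendsto (fun n : ℕ => (∫ y in (x - 1 / ((n:ℝ) + 1))..x, G (S.u y t)) / (1 / ((n:ℝ) + 1))) atTop (nhds (G (vv S x t))) := by
  have hm : Measurable fun x => G (S.u x t) := hG.measurable.comp (mes_x S t)
  have h := (intervalIntegral.integral_hasDerivWithinAt_of_tendsto_ae_right (bint hm hC 0 x) (s := Iic x) (t := Iic x)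
    (hm.stronglyMeasurable.stronglyMeasurableAtFilter) (((hG.tendsto _).comp (S.um_spec x t ht)).mono_left (le_inf_ae x))).mono Iio_subset_Iic_self
  rw [hasDerivWithinAt_iff_tendsto_slope' (by simp)] at h
  rw [vv, if_pos ht]
  refine (h.comp (seq_lt x)).congr fun n => ?_
  rw [Function.comp, slope_comm, slope_def_field, intervalIntegral.integral_interval_sub_left (bint hm hC _ _) (bint hm hC _ _)]
  congr 1; ring
lemma c1_part {f f1 f2 : ℝ → ℝ → ℝ} {O : Set (ℝ × ℝ)} (hO : IsOpen O) (h1 : ∀ q ∈ O, HasDerivAt (fun y => f y q.2) (f1 q.1 q.2) q.1)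
    (h2 : ∀ q ∈ O, HasDerivAt (fun y => f q.1 y) (f2 q.1 q.2) q.2) (c1 : ContinuousOn (fun q : ℝ × ℝ => f1 q.1 q.2) O)
    (c2 : ContinuousOn (fun q : ℝ × ℝ => f2 q.1 q.2) O) {p : ℝ × ℝ} (hp : p ∈ O) : ContDiffAt ℝ 1 (fun q : ℝ × ℝ => f q.1 q.2) p := by
  let T : ℝ → ℝ →L[ℝ] ℝ := fun a => ContinuousLinearMap.toSpanSingleton ℝ a
  have hT : Continuous T := by
    exact (ContinuousLinearMap.toSpanSingletonCLE (𝕜 := ℝ) (E := ℝ)).continuous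
  have hc : ∀ g : ℝ → ℝ → ℝ, ContinuousOn (fun q : ℝ × ℝ => g q.1 q.2) O → ContinuousOn (fun q : ℝ × ℝ => T (g q.1 q.2)) O := fun g hg => hT.comp_continuousOn hg
  rw [contDiffAt_one_iff]
  refine ⟨fun q => (T (f1 q.1 q.2)).coprod (T (f2 q.1 q.2)), O, hO.mem_nhds hp, ?_, fun q hq => ?_⟩
  · have : (fun q : ℝ × ℝ => (T (f1 q.1 q.2)).coprod (T (f2 q.1 q.2))) = fun q => (T (f1 q.1 q.2)).comp (ContinuousLinearMap.fst ℝ ℝ ℝ) + (T (f2 q.1 q.2)).comp (ContinuousLinearMap.snd ℝ ℝ ℝ) := by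
      ext q <;> simp
    rw [this]
    exact ((hc f1 c1).clm_comp continuousOn_const).add ((hc f2 c2).clm_comp continuousOn_const)
  · exact (hasStrictFDerivAt_uncurry_coprod (u := q) (f := f) (f₁ := fun x y => T (f1 x y)) (f₂ := fun x y => T (f2 x y))
      (by filter_upwards [hO.mem_nhds hq] with v hv using (h1 v hv).hasFDerivAt)
      (by filter_upwards [hO.mem_nhds hq] with v hv using (h2 v hv).hasFDerivAt)
      ((hc f1 c1).continuousAt (hO.mem_nhds hq)) ((hc f2 c2).continuousAt (hO.mem_nhds hq))).hasFDerivAt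
end

section
variable {u0 : ℝ → ℝ} {S : ABSol fq fq (-4) 4 u0} {M ε x t : ℝ}
def Fe (S : ABSol fq fq (-4) 4 u0) (ε x t : ℝ) : ℝ := (∫ y in (x-ε)..x, fq (S.u y t)) / ε
def Ue (S : ABSol fq fq (-4) 4 u0) (ε x t : ℝ) : ℝ := (∫ y in (x-ε)..x, UU S y t) / ε
lemma UU_cx (hM : ∀ x t, |S.u x t| ≤ M) (t : ℝ) : Continuous fun y => UU S y t :=
  (LipschitzWith.of_dist_le_mul (K := ⟨M, M_nn hM⟩) fun x y => UU_lx hM y x t).continuous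
lemma Ue_dx (hM : ∀ x t, |S.u x t| ≤ M) (x t : ℝ) : HasDerivAt (fun y => Ue S ε y t) ((UU S x t - UU S (x - ε) t) / ε) x := by
  have c := UU_cx hM t
  have h1 := (c.integral_hasStrictDerivAt 0 x).hasDerivAt
  have h2 := (c.integral_hasStrictDerivAt 0 (x - ε)).hasDerivAt.comp x ((hasDerivAt_id x).sub_const ε)
  refine (((h1.sub h2).div_const ε).congr_deriv (by simp)).congr_of_eventuallyEq (Eventually.of_forall fun y => ?_)
  show Ue S ε y t = ((∫ z in (0:ℝ)..y, UU S z t) - ∫ z in (0:ℝ)..(y - ε), UU S z t) / ε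
  rw [Ue, intervalIntegral.integral_interval_sub_left (c.intervalIntegrable _ _) (c.intervalIntegrable _ _)]
lemma fqi (hM : ∀ x t, |S.u x t| ≤ M) (t a b : ℝ) : IntervalIntegrable (fun y => fq (S.u y t)) volume a b :=
  bint (fq_cont.measurable.comp (mes_x S t)) (fun x => fq_bd (hM x t)) a b
lemma Fe_bd (hM : ∀ x t, |S.u x t| ≤ M) (hε : 0 < ε) (x t : ℝ) : |Fe S ε x t| ≤ M ^ 2 / 2 := by
  rw [Fe, abs_div, abs_of_pos hε, div_le_iff₀ hε]
  have := bint_le (fun y => fq_bd (hM y t)) (x - ε) x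
  rwa [sub_sub_cancel, abs_of_pos hε] at this
lemma Fe_cont (hM : ∀ x t, |S.u x t| ≤ M) (hε : 0 < ε) : ContinuousOn (fun q : ℝ × ℝ => Fe S ε q.1 q.2) {q | 0 < q.2} := by
  rintro ⟨x, t⟩ h
  have h : 0 < t := h
  set r := |x| + ε + 1
  have hz : Tendsto (fun p : ℝ × ℝ => (M * (∫ y in Icc (-r) r, |S.u y p.2 - S.u y t|) + M ^ 2 * |p.1 - x|) / ε) (nhdsWithin (x, t) {p | 0 < p.2}) (nhds 0) := by
    have h1 : Tendsto (fun p : ℝ × ℝ => ∫ y in Icc (-r) r, |S.u y p.2 - S.u y t|) (nhdsWithin (x, t) {p | 0 < p.2}) (nhds 0) := by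
      refine (S.timeCont r t h.le).comp (tendsto_nhdsWithin_iff.2 ⟨continuous_snd.continuousAt.mono_left nhdsWithin_le_nhds, ?_⟩)
      filter_upwards [self_mem_nhdsWithin] with p hp using le_of_lt hp
    have h2 : Tendsto (fun p : ℝ × ℝ => M ^ 2 * |p.1 - x|) (nhdsWithin (x, t) {p | 0 < p.2}) (nhds 0) := by
      have : Continuous (fun p : ℝ × ℝ => M ^ 2 * |p.1 - x|) := by fun_prop
      simpa using (this.tendsto (x, t)).mono_left nhdsWithin_le_nhds
    simpa using ((h1.const_mul M).add h2).div_const ε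
  rw [ContinuousWithinAt, tendsto_iff_dist_tendsto_zero]
  refine tendsto_of_tendsto_of_tendsto_of_le_of_le' tendsto_const_nhds hz (Eventually.of_forall fun _ => dist_nonneg) ?_
  refine Eventually.of_forall fun p => ?_
  obtain ⟨y, s⟩ := p
  have e : Fe S ε y s - Fe S ε x t = ((∫ z in (x-ε)..x, (fq (S.u z s) - fq (S.u z t))) + ((∫ z in x..y, fq (S.u z s)) - ∫ z in (x-ε)..(y-ε), fq (S.u z s))) / ε := by
    have a1 := intervalIntegral.integral_interval_sub_left (fqi hM s 0 y) (fqi hM s 0 x)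
    have a2 := intervalIntegral.integral_interval_sub_left (fqi hM s 0 (y-ε)) (fqi hM s 0 (x-ε))
    have a3 := intervalIntegral.integral_interval_sub_left (fqi hM s 0 y) (fqi hM s 0 (y-ε))
    have a4 := intervalIntegral.integral_interval_sub_left (fqi hM s 0 x) (fqi hM s 0 (x-ε))
    rw [intervalIntegral.integral_sub (fqi hM _ _ _) (fqi hM _ _ _), Fe, Fe, ← a1, ← a2, ← a3, ← a4]
    ring
  have mu : ∀ t, Measurable fun z => S.u z t := mes_x S
  have b1 : |∫ z in (x-ε)..x, (fq (S.u z s) - fq (S.u z t))| ≤ M * ∫ z in Icc (-r) r, |S.u z s - S.u z t| := by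
    rw [← integral_const_mul, intervalIntegral.integral_of_le (by linarith)]
    refine (abs_integral_le_integral_abs).trans ?_
    have hb : ∀ z, |S.u z s - S.u z t| ≤ 2 * M := fun z => (abs_sub _ _).trans (by linarith [hM z s, hM z t])
    have i1 : IntegrableOn (fun z => M * |S.u z s - S.u z t|) (Icc (-r) r) := by
      refine Measure.integrableOn_of_bounded (M := M * (2 * M)) (by simp) ((((mu s).sub (mu t)).abs.const_mul M).aestronglyMeasurable) (Eventually.of_forall fun z => ?_)
      rw [Real.norm_eq_abs, abs_mul, abs_abs, abs_of_nonneg (M_nn hM)]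
      exact mul_le_mul_of_nonneg_left (hb z) (M_nn hM)
    have sub : Ioc (x - ε) x ⊆ Icc (-r) r := fun z hz => ⟨by linarith [hz.1, neg_abs_le x], by linarith [hz.2, le_abs_self x]⟩
    refine (integral_mono_of_nonneg (Eventually.of_forall fun z => abs_nonneg _) (i1.mono_set sub) (Eventually.of_forall fun z => ?_)).trans
      (setIntegral_mono_set i1 (Eventually.of_forall fun z => mul_nonneg (M_nn hM) (abs_nonneg _)) (LE.le.eventuallyLE sub))
    show |fq (S.u z s) - fq (S.u z t)| ≤ M * |S.u z s - S.u z t|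
    have : fq (S.u z s) - fq (S.u z t) = (S.u z s + S.u z t) / 2 * (S.u z s - S.u z t) := by unfold fq; ring
    rw [this, abs_mul]
    refine mul_le_mul_of_nonneg_right ?_ (abs_nonneg _)
    rw [abs_le]
    constructor <;> linarith [abs_le.1 (hM z s), abs_le.1 (hM z t)]
  have b2 := bint_le (fun z => fq_bd (hM z s)) x y
  have b3 := bint_le (fun z => fq_bd (hM z s)) (x - ε) (y - ε)
  rw [sub_sub_sub_cancel_right] at b3
  rw [Real.dist_eq, e, abs_div, abs_of_pos hε]
  refine div_le_div_of_nonneg_right ((abs_add_le _ _).trans (add_le_add b1 ((abs_sub _ _).trans ?_))) hε.le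
  linarith
lemma Ue_dt (hM : ∀ x t, |S.u x t| ≤ M) (hε : 0 < ε) (ht : 0 < t) : HasDerivAt (fun s => Ue S ε x s) (- Fe S ε x t) t := by
  have cF : ContinuousOn (fun τ => Fe S ε x τ) (Ioi 0) := (Fe_cont hM hε).comp (f := fun τ => (x, τ)) (by fun_prop) fun τ h => h
  have key : ∀ a b, 0 < a → a ≤ b → Ue S ε x b - Ue S ε x a = - ∫ τ in a..b, Fe S ε x τ := by
    intro a b ha hab
    unfold Ue
    rw [← sub_div, ← intervalIntegral.integral_sub ((UU_cx hM b).intervalIntegrable _ _) ((UU_cx hM a).intervalIntegrable _ _)]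
    simp_rw [UU_t hM _ ha.le hab]
    rw [intervalIntegral.integral_neg, intervalIntegral_intervalIntegral_swap]
    · unfold Fe
      rw [intervalIntegral.integral_div, neg_div]
      congr 2
      refine intervalIntegral.integral_congr fun τ h => ?_
      rw [uIcc_of_le hab] at h
      refine intervalIntegral.integral_congr_ae ?_
      filter_upwards [vv_ae hM (ha.trans_le h.1)] with y hy _
      rw [hy]
    · refine Measure.integrableOn_of_bounded (M := M ^ 2 / 2) ?_ ((fq_cont.measurable.comp (vv_meas S)).aestronglyMeasurable) (Eventually.of_forall fun z => fq_bd (vv_bd hM z.1 z.2))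
      rw [Measure.volume_eq_prod, Measure.prod_prod]
      simp [uIoc, ENNReal.mul_eq_top]
  have hi : ∀ a b, 0 < a → 0 < b → IntervalIntegrable (fun τ => Fe S ε x τ) volume a b := fun a b ha hb =>
    (cF.mono fun τ h => (lt_min ha hb).trans_le h.1).intervalIntegrable
  have h1 : HasDerivAt (fun s => ∫ τ in t..s, Fe S ε x τ) (Fe S ε x t) t :=
    intervalIntegral.integral_hasDerivAt_right (hi t t ht ht) (cF.stronglyMeasurableAtFilter isOpen_Ioi t ht) (cF.continuousAt (Ioi_mem_nhds ht))
  refine (h1.neg.const_add (Ue S ε x t)).congr_of_eventuallyEq ?_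
  filter_upwards [Ioi_mem_nhds ht] with s hs
  have hs : 0 < s := hs
  show Ue S ε x s = Ue S ε x t + - ∫ τ in t..s, Fe S ε x τ
  rcases le_total t s with h | h
  · linarith [key t s ht h]
  · rw [intervalIntegral.integral_symm]; linarith [key s t hs h]
lemma Ue_c1 (hM : ∀ x t, |S.u x t| ≤ M) (hε : 0 < ε) {p : ℝ × ℝ} (hp : 0 < p.2) : ContDiffAt ℝ 1 (fun q : ℝ × ℝ => Ue S ε q.1 q.2) p := by
  refine c1_part (f1 := fun x t => (UU S x t - UU S (x - ε) t) / ε) (f2 := fun x t => - Fe S ε x t) (O := {q : ℝ × ℝ | 0 < q.2})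
    (isOpen_lt continuous_const continuous_snd) (fun q _ => Ue_dx hM q.1 q.2) (fun q hq => Ue_dt hM hε hq) ?_ (Fe_cont hM hε).neg hp
  refine ContinuousOn.div_const (((UU_cont hM).mono fun q hq => show (0:ℝ) ≤ q.2 from le_of_lt hq).sub ?_) ε
  exact (UU_cont hM).comp (f := fun q : ℝ × ℝ => (q.1 - ε, q.2)) (by fun_prop) fun q hq => show (0:ℝ) ≤ q.2 from le_of_lt hq
lemma Ue_near (hM : ∀ x t, |S.u x t| ≤ M) (hε : 0 < ε) (x t : ℝ) : |Ue S ε x t - UU S x t| ≤ M * ε := by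
  have c := UU_cx hM t
  have e : Ue S ε x t - UU S x t = (∫ y in (x-ε)..x, (UU S y t - UU S x t)) / ε := by
    rw [intervalIntegral.integral_sub (c.intervalIntegrable _ _) (by simp)]
    simp only [intervalIntegral.integral_const, Ue, sub_sub_cancel, smul_eq_mul]
    field_simp
  rw [e, abs_div, abs_of_pos hε, div_le_iff₀ hε]
  have := intervalIntegral.norm_integral_le_of_norm_le_const (a := x - ε) (b := x) (f := fun y => UU S y t - UU S x t) (C := M * ε) fun y hy => by
    rw [uIoc_of_le (by linarith)] at hy
    refine (UU_lx hM x y t).trans (mul_le_mul_of_nonneg_left ?_ (M_nn hM))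
    rw [abs_le]; constructor <;> linarith [hy.1, hy.2]
  rwa [sub_sub_cancel, abs_of_pos hε] at this
end

section
variable {u0 : ℝ → ℝ} {S : ABSol fq fq (-4) 4 u0} {M : ℝ}
lemma climb {f g : ℝ → ℝ} {s t η : ℝ} (hst : s ≤ t) (hf : ContinuousOn f (Icc s t))
    (hi : ∀ a b, s ≤ a → a ≤ b → b ≤ t → f b - f a = ∫ τ in a..b, g τ) (h0 : f s ≤ η)
    (hg : ∀ᵐ τ, τ ∈ Ioo s t → η < f τ → g τ = 0) : f t ≤ η := by
  set A := Icc s t ∩ f ⁻¹' Iic η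
  have hA : IsCompact A := isCompact_Icc.of_isClosed_subset (hf.preimage_isClosed_of_isClosed isClosed_Icc isClosed_Iic) inter_subset_left
  have hm := hA.sSup_mem ⟨s, ⟨le_refl s, hst⟩, h0⟩
  set a := sSup A
  have h1 := hi a t hm.1.1 hm.1.2 le_rfl
  have h2 : ∫ τ in a..t, g τ = 0 := by
    refine intervalIntegral.integral_zero_ae ?_
    have ht : ∀ᵐ τ : ℝ, τ ≠ t := ae_ne t
    filter_upwards [hg, ht] with τ h3 h3' h4
    rw [uIoc_of_le hm.1.2] at h4
    refine h3 ⟨hm.1.1.trans_lt h4.1, lt_of_le_of_ne h4.2 h3'⟩ ?_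
    by_contra h5
    exact absurd (le_csSup hA.bddAbove ⟨⟨hm.1.1.trans h4.1.le, h4.2⟩, not_lt.1 h5⟩) (not_le.2 h4.1)
  have h3 : f a ≤ η := hm.2
  linarith
def g2 (z : ℝ) : ℝ := (max z 0) ^ 2
lemma g2_d (z : ℝ) : HasDerivAt g2 (2 * max z 0) z := by
  rcases lt_trichotomy z 0 with h | h | h
  · rw [max_eq_right h.le, mul_zero]
    refine (hasDerivAt_const z (0:ℝ)).congr_of_eventuallyEq ?_
    filter_upwards [Iio_mem_nhds h] with y hy
    rw [g2, max_eq_right (le_of_lt hy)]; ring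
  · subst h
    rw [hasDerivAt_iff_isLittleO]
    simp only [g2, max_self, sub_zero, mul_zero, smul_zero, ne_eq, OfNat.ofNat_ne_zero, not_false_eq_true, zero_pow]
    refine Asymptotics.IsBigO.trans_isLittleO (g := fun x : ℝ => x ^ 2) (Asymptotics.IsBigO.of_bound 1 (Eventually.of_forall fun x => ?_)) (Asymptotics.isLittleO_pow_id one_lt_two)
    rw [one_mul, Real.norm_eq_abs, Real.norm_eq_abs, abs_of_nonneg (by positivity), abs_of_nonneg (by positivity)]
    rcases le_total x 0 with h | h
    · rw [max_eq_right h]; nlinarith [sq_nonneg x]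
    · rw [max_eq_left h]
  · rw [max_eq_left h.le]
    refine ((hasDerivAt_pow 2 z).congr_deriv (by simp)).congr_of_eventuallyEq ?_
    filter_upwards [Ioi_mem_nhds h] with y hy
    rw [g2, max_eq_left (le_of_lt hy)]
lemma g2_c1 : ContDiff ℝ 1 g2 := by
  rw [contDiff_one_iff_deriv]
  refine ⟨fun z => (g2_d z).differentiableAt, ?_⟩
  rw [show deriv g2 = fun z => 2 * max z 0 from funext fun z => (g2_d z).deriv]
  fun_prop
lemma g2_nn (z : ℝ) : 0 ≤ g2 z := by unfold g2; positivity
lemma g2_z {z : ℝ} (h : z ≤ 0) : g2 z = 0 := by rw [g2, max_eq_right h]; ring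
lemma g2_c : Continuous g2 := g2_c1.continuous
def Kr (S : ABSol fq fq (-4) 4 u0) (a b : ℝ) : Prop := ∀ (k : ℝ) (φ : ℝ → ℝ → ℝ), ContDiff ℝ 1 (fun p : ℝ × ℝ => φ p.1 p.2) →
    HasCompactSupport (fun p : ℝ × ℝ => φ p.1 p.2) → (∀ x t, 0 ≤ φ x t) → (∀ x t, x ≤ a ∨ b ≤ x ∨ t ≤ 0 → φ x t = 0) →
    0 ≤ ∫ p : ℝ × ℝ, (|S.u p.1 p.2 - k| * deriv (fun s => φ p.1 s) p.2 + Sk k (S.u p.1 p.2) * deriv (fun y => φ y p.2) p.1)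
lemma Kr_l (S : ABSol fq fq (-4) 4 u0) (a : ℝ) : Kr S a 0 := fun k φ h1 h2 h3 h4 => by
  have := S.kruzkov_l k φ h1 h2 h3 fun x t h => h4 x t (Or.inr h)
  simpa only [sign_flux] using this
lemma Kr_r (S : ABSol fq fq (-4) 4 u0) (b : ℝ) : Kr S 0 b := fun k φ h1 h2 h3 h4 => by
  have := S.kruzkov_r k φ h1 h2 h3 fun x t h => h4 x t (h.imp id Or.inr)
  simpa only [sign_flux] using this
def Ei (k rL : ℝ) (q : ℝ × ℝ × ℝ × ℝ × ℝ × ℝ × ℝ × ℝ) : ℝ :=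
  |q.1 - k| * (2 * max q.2.1 0 * (q.2.2.1 - k ^ 2 / 2) * g2 q.2.2.2.2.1 * q.2.2.2.2.2.1 + g2 q.2.1 * (2 * max q.2.2.2.2.1 0 * (-rL)) * q.2.2.2.2.2.1 + g2 q.2.1 * g2 q.2.2.2.2.1 * q.2.2.2.2.2.2.1)
  + Sk k q.1 * (2 * max q.2.1 0 * (k - q.2.2.2.1) * g2 q.2.2.2.2.1 * q.2.2.2.2.2.1 + g2 q.2.1 * (2 * max q.2.2.2.2.1 0 * (-2 * q.2.2.2.2.2.2.2)) * q.2.2.2.2.2.1)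
lemma Ei_cont (k rL : ℝ) : Continuous (Ei k rL) := by
  have := g2_c
  have := Sk_cont k
  unfold Ei
  fun_prop
lemma Ei_zero {k rL : ℝ} {w d F G z b b' y : ℝ} (h : z ≤ 0 ∨ (b = 0 ∧ b' = 0)) : Ei k rL (w, d, F, G, z, b, b', y) = 0 := by
  rcases h with h | ⟨h, h'⟩
  · simp [Ei, g2_z h, max_eq_right h]
  · simp [Ei, h, h']
lemma Ei_lim {k rL w d z b b' y : ℝ} (h : b' * g2 d * g2 z = 0) : Ei k rL (w, d, fq w, w, z, b, b', y) = g2 d * (2 * max z 0) * b * |w - k| * (-rL - (w + k) * y) := by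
  unfold Ei Sk fq
  simp only
  linear_combination |w - k| * h
end

section
variable {u0 : ℝ → ℝ} {S : ABSol fq fq (-4) 4 u0} {M : ℝ}
lemma AC1 (hM : ∀ x t, |S.u x t| ≤ M) {a b : ℝ} (hK : Kr S a b) {s x0 r k c η : ℝ} (hs : 0 ≤ s) (hr : 0 < r) (ha : a ≤ x0 - r) (hb : x0 + r ≤ b)
    (hbase : ∀ y, |y - x0| ≤ r → c + k * (y - x0) ≤ UU S y s) (hη : 0 < η) :
    ∀ᵐ p : ℝ × ℝ, s < p.2 → 0 < r ^ 2 - r * (M + |k| + 1) * (p.2 - s) - (p.1 - x0) ^ 2 →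
      η < c + k * (p.1 - x0) - k ^ 2 / 2 * (p.2 - s) - UU S p.1 p.2 → vv S p.1 p.2 = k := by
  have hM0 := M_nn hM
  set L := M + |k| + 1 with hL
  have hL0 : 0 < L := by positivity
  set δ := η / (M ^ 2 + 1) with hδ
  have hδ0 : 0 < δ := by positivity
  have hδη : M ^ 2 * δ ≤ η := by
    rw [hδ, mul_div_assoc', div_le_iff₀ (by positivity)]; nlinarith
  set Z : ℝ → ℝ → ℝ := fun x t => r ^ 2 - r * L * (t - s) - (x - x0) ^ 2 with hZ
  set A : ℝ → ℝ → ℝ := fun x t => c + k * (x - x0) - k ^ 2 / 2 * (t - s) - η with hA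
  set β : ℝ → ℝ := fun t => Kst ((t - s) / δ - 2) with hβ
  set β' : ℝ → ℝ := fun t => kap ((t - s) / δ - 2) * (1 / δ) with hβ'
  set e : ℕ → ℝ := fun n => 1 / ((n:ℝ) + 1) with he
  have e0 : ∀ n, 0 < e n := fun n => by simp only [he]; positivity
  have e1 : ∀ n, e n ≤ 1 := fun n => by
    simp only [he]; rw [div_le_one (by positivity)]; linarith [n.cast_nonneg (α := ℝ)]
  have bz : ∀ t, t ≤ s + δ → β t = 0 ∧ β' t = 0 := fun t ht => by
    have : (t - s) / δ - 2 ≤ -1 := by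
      have : (t - s) / δ ≤ 1 := by rw [div_le_one hδ0]; linarith
      linarith
    exact ⟨Kst_zero this, by simp [hβ', kap_zero (Or.inl this)]⟩
  have Zbox : ∀ x t, s < t → 0 < Z x t → |x - x0| ≤ r ∧ t ≤ s + r / L := fun x t ht hz => by
    simp only [hZ] at hz
    have h1 : 0 < r * L * (t - s) := by have := sub_pos.2 ht; positivity
    constructor
    · exact abs_le_of_sq_le_sq (by nlinarith) hr.le
    · have h2 : r * (L * (t - s)) < r * r := by nlinarith [sq_nonneg (x - x0)]
      have h3 := lt_of_mul_lt_mul_left h2 hr.le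
      have : t - s ≤ r / L := by rw [le_div_iff₀ hL0]; linarith
      linarith
  set Bx : Set (ℝ × ℝ) := Icc (x0 - r) (x0 + r) ×ˢ Icc s (s + r / L) with hBx
  have hBc : IsCompact Bx := isCompact_Icc.prod isCompact_Icc
  have out : ∀ p : ℝ × ℝ, p ∉ Bx → Z p.1 p.2 ≤ 0 ∨ (β p.2 = 0 ∧ β' p.2 = 0) := fun p hp => by
    by_contra h
    push Not at h
    have h1 : s < p.2 := by
      by_contra h'
      obtain ⟨h3, h4⟩ := bz p.2 (by linarith)
      exact h.2 h3 h4
    obtain ⟨h2, h3⟩ := Zbox p.1 p.2 h1 h.1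
    rw [abs_le] at h2
    exact hp ⟨⟨by linarith [h2.1], by linarith [h2.2]⟩, h1.le, h3⟩
  set φ : ℕ → ℝ → ℝ → ℝ := fun n x t => g2 (A x t - Ue S (e n) x t) * g2 (Z x t) * β t with hφ
  have φ0 : ∀ n x t, t ≤ s + δ → φ n x t = 0 := fun n x t h => by simp [hφ, (bz t h).1]
  have hβd : ∀ t, HasDerivAt β (β' t) t := fun t => by
    refine (Kst_deriv _).comp t ((((hasDerivAt_id t).sub_const s).div_const δ).sub_const 2)
  have dt : ∀ n x t, 0 < t → HasDerivAt (fun τ => φ n x τ) (2 * max (A x t - Ue S (e n) x t) 0 * (Fe S (e n) x t - k ^ 2 / 2) * g2 (Z x t) * β t + g2 (A x t - Ue S (e n) x t) * (2 * max (Z x t) 0 * (-(r * L))) * β t + g2 (A x t - Ue S (e n) x t) * g2 (Z x t) * β' t) t := by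
    intro n x t ht
    have h1 : HasDerivAt (fun τ => A x τ - Ue S (e n) x τ) (Fe S (e n) x t - k ^ 2 / 2) t := by
      have := (((((hasDerivAt_id t).sub_const s).const_mul (k ^ 2 / 2)).const_sub (c + k * (x - x0))).sub_const η).sub (Ue_dt (x := x) hM (e0 n) ht)
      exact this.congr_deriv (by ring)
    have h2 : HasDerivAt (fun τ => Z x τ) (-(r * L)) t := by
      have := ((((hasDerivAt_id t).sub_const s).const_mul (r * L)).const_sub (r ^ 2)).sub_const ((x - x0) ^ 2)
      exact this.congr_deriv (by ring)
    exact ((((g2_d _).comp t h1).mul ((g2_d _).comp t h2)).mul (hβd t)).congr_deriv (by simp only [Function.comp, Pi.mul_apply]; ring)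
  have dx : ∀ n x t, HasDerivAt (fun y => φ n y t) (2 * max (A x t - Ue S (e n) x t) 0 * (k - (UU S x t - UU S (x - e n) t) / e n) * g2 (Z x t) * β t + g2 (A x t - Ue S (e n) x t) * (2 * max (Z x t) 0 * (-2 * (x - x0))) * β t) x := by
    intro n x t
    have h1 : HasDerivAt (fun y => A y t - Ue S (e n) y t) (k - (UU S x t - UU S (x - e n) t) / e n) x := by
      have := ((((((hasDerivAt_id x).sub_const x0).const_mul k).const_add c).sub_const (k ^ 2 / 2 * (t - s))).sub_const η).sub (Ue_dx (ε := e n) hM x t)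
      exact this.congr_deriv (by ring)
    have h2 : HasDerivAt (fun y => Z y t) (-2 * (x - x0)) x := by
      have := (((hasDerivAt_id x).sub_const x0).pow 2).const_sub (r ^ 2 - r * L * (t - s))
      exact this.congr_deriv (by simp)
    exact ((((g2_d _).comp x h1).mul ((g2_d _).comp x h2)).mul_const (β t)).congr_deriv (by simp only [Function.comp, Pi.mul_apply]; ring)
  set Q : ℕ → ℝ × ℝ → ℝ × ℝ × ℝ × ℝ × ℝ × ℝ × ℝ × ℝ := fun n p =>
    (S.u p.1 p.2, A p.1 p.2 - Ue S (e n) p.1 p.2, Fe S (e n) p.1 p.2, (UU S p.1 p.2 - UU S (p.1 - e n) p.2) / e n, Z p.1 p.2, β p.2, β' p.2, p.1 - x0) with hQ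
  have hP : ∀ n p, |S.u p.1 p.2 - k| * deriv (fun s => φ n p.1 s) p.2 + Sk k (S.u p.1 p.2) * deriv (fun y => φ n y p.2) p.1 = Ei k (r * L) (Q n p) := by
    intro n p
    rcases lt_or_ge 0 p.2 with h | h
    · rw [(dt n p.1 p.2 h).deriv, (dx n p.1 p.2).deriv]; simp only [hQ, Ei]
    · have h1 : deriv (fun s => φ n p.1 s) p.2 = 0 := by
        refine ((hasDerivAt_const p.2 (0:ℝ)).congr_of_eventuallyEq ?_).deriv
        filter_upwards [Iio_mem_nhds (show p.2 < s + δ by linarith)] with t ht using φ0 n p.1 t (le_of_lt ht)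
      have h2 : (fun y => φ n y p.2) = fun _ => 0 := funext fun y => φ0 n y p.2 (by linarith)
      rw [h1, h2, hQ, Ei_zero (Or.inr (bz p.2 (by linarith)))]; simp
  have hφ1 : ∀ n, ContDiff ℝ 1 (fun p : ℝ × ℝ => φ n p.1 p.2) := by
    intro n
    rw [contDiff_iff_contDiffAt]
    intro p
    rcases lt_or_ge s p.2 with h | h
    · have a1 : ContDiffAt ℝ 1 (fun q : ℝ × ℝ => A q.1 q.2 - Ue S (e n) q.1 q.2) p := by
        refine ContDiffAt.sub ?_ (Ue_c1 hM (e0 n) (by linarith))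
        simp only [hA]; fun_prop
      have a2 : ContDiffAt ℝ 1 (fun q : ℝ × ℝ => Z q.1 q.2) p := by simp only [hZ]; fun_prop
      have a3 : ContDiffAt ℝ 1 (fun q : ℝ × ℝ => (q.2 - s) / δ - 2) p := by fun_prop
      exact ((g2_c1.contDiffAt.comp p a1).mul (g2_c1.contDiffAt.comp p a2)).mul (Kst_contDiff.contDiffAt.comp p a3)
    · refine (contDiffAt_const (c := (0:ℝ))).congr_of_eventuallyEq ?_
      filter_upwards [(isOpen_lt continuous_snd continuous_const).mem_nhds (show p.2 < s + δ by linarith)] with q hq using φ0 n q.1 q.2 (le_of_lt hq)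
  have hφz : ∀ n (p : ℝ × ℝ), p ∉ Bx → φ n p.1 p.2 = 0 := fun n p hp => by
    rcases out p hp with h | h
    · simp [hφ, g2_z h]
    · simp [hφ, h.1]
  have hpos : ∀ n, 0 ≤ ∫ p, Ei k (r * L) (Q n p) := by
    intro n
    have := hK k (φ n) (hφ1 n) (HasCompactSupport.intro hBc fun p hp => hφz n p hp)
      (fun x t => mul_nonneg (mul_nonneg (g2_nn _) (g2_nn _)) (Kst_nonneg _)) fun x t h => by
        rcases h with h | h | h
        · by_cases h' : (x, t) ∈ Bx
          · have h1 : x - x0 = -r := by linarith [h'.1.1]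
            rcases le_or_gt t s with h2 | h2
            · exact φ0 n x t (by linarith)
            · have : Z x t ≤ 0 := by
                simp only [hZ]; rw [h1]
                have : 0 < r * L * (t - s) := by have := sub_pos.2 h2; positivity
                nlinarith
              simp [hφ, g2_z this]
          · exact hφz n (x, t) h'
        · by_cases h' : (x, t) ∈ Bx
          · have h1 : x - x0 = r := by linarith [h'.1.2]
            rcases le_or_gt t s with h2 | h2
            · exact φ0 n x t (by linarith)
            · have : Z x t ≤ 0 := by
                simp only [hZ]; rw [h1]
                have : 0 < r * L * (t - s) := by have := sub_pos.2 h2; positivity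
                nlinarith
              simp [hφ, g2_z this]
          · exact hφz n (x, t) h'
        · exact φ0 n x t (by linarith)
    simpa only [hP] using this
  set Ql : ℝ × ℝ → ℝ × ℝ × ℝ × ℝ × ℝ × ℝ × ℝ × ℝ := fun p =>
    (vv S p.1 p.2, A p.1 p.2 - UU S p.1 p.2, fq (vv S p.1 p.2), vv S p.1 p.2, Z p.1 p.2, β p.2, β' p.2, p.1 - x0) with hQl
  have low : ∀ x t, s < t → t ≤ s + 2 * δ → |x - x0| ≤ r → A x t - UU S x t ≤ 0 := fun x t h1 h2 h3 => by
    have a1 := hbase x h3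
    have a2 := (abs_le.1 (UU_lt hM x hs (hs.trans h1.le))).1
    rw [abs_of_pos (sub_pos.2 h1)] at a2
    have a3 : M ^ 2 / 2 * (t - s) ≤ η := by nlinarith [sq_nonneg M]
    have a4 : 0 ≤ k ^ 2 / 2 * (t - s) := by have := sub_pos.2 h1; positivity
    simp only [hA]; linarith
  have hR : ∀ p, Ei k (r * L) (Ql p) = g2 (A p.1 p.2 - UU S p.1 p.2) * (2 * max (Z p.1 p.2) 0) * β p.2 * |vv S p.1 p.2 - k| * (-(r * L) - (vv S p.1 p.2 + k) * (p.1 - x0)) := by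
    intro p
    refine Ei_lim ?_
    by_cases h1 : β' p.2 = 0
    · rw [h1]; ring
    · by_cases h2 : Z p.1 p.2 ≤ 0
      · rw [g2_z h2]; ring
      · have h3 : s + δ < p.2 := by
          by_contra h; exact h1 (bz p.2 (not_lt.1 h)).2
        have h4 : p.2 ≤ s + 2 * δ := by
          by_contra h
          refine h1 ?_
          have : 0 ≤ (p.2 - s) / δ - 2 := by
            have : 2 ≤ (p.2 - s) / δ := by rw [le_div_iff₀ hδ0]; linarith
            linarith
          simp [hβ', kap_zero (Or.inr this)]
        rw [g2_z (low p.1 p.2 (by linarith) h4 (Zbox p.1 p.2 (by linarith) (not_le.1 h2)).1)]; ring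
  have hneg : ∀ x t, s < t → 0 < Z x t → -(r * L) - (vv S x t + k) * (x - x0) ≤ -r := fun x t h1 h2 => by
    have h3 := (Zbox x t h1 h2).1
    have h4 : |(vv S x t + k) * (x - x0)| ≤ (M + |k|) * r := by
      rw [abs_mul]
      exact mul_le_mul ((abs_add_le _ _).trans (by linarith [vv_bd hM x t])) h3 (abs_nonneg _) (by positivity)
    have := (abs_le.1 h4).1
    simp only [hL]; nlinarith
  have hR0 : ∀ p, Ei k (r * L) (Ql p) ≤ 0 := by
    intro p
    by_cases h : Z p.1 p.2 ≤ 0 ∨ (β p.2 = 0 ∧ β' p.2 = 0)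
    · rw [hQl, Ei_zero h]
    · rw [hR]
      push Not at h
      have h1 : s < p.2 := by
        by_contra h'
        obtain ⟨h3, h4⟩ := bz p.2 (by linarith)
        exact h.2 h3 h4
      have := hneg p.1 p.2 h1 h.1
      have h5 : 0 ≤ β p.2 := Kst_nonneg _
      have h6 := g2_nn (A p.1 p.2 - UU S p.1 p.2)
      refine mul_nonpos_of_nonneg_of_nonpos (by positivity) (by linarith)
  obtain ⟨K0, hK0⟩ := hBc.exists_bound_of_continuousOn ((UU_cont hM).mono fun p (hp : p ∈ Bx) => show (0:ℝ) ≤ p.2 from hs.trans hp.2.1)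
  have kc := kap_cont
  have Kc := Kst_contDiff.continuous
  have hcc : Continuous fun p : ℝ × ℝ => (A p.1 p.2, Z p.1 p.2, β p.2, β' p.2, p.1 - x0) := by
    simp only [hA, hZ, hβ, hβ']; fun_prop
  obtain ⟨K1, hK1⟩ := hBc.exists_bound_of_continuousOn hcc.continuousOn
  simp only [norm_prod_le_iff, Real.norm_eq_abs] at hK0 hK1
  set K := |K0| + |K1| + M + M ^ 2 / 2 with hKd
  have hKK : ∀ n, ∀ p ∈ Bx, ‖Q n p‖ ≤ K := by
    intro n p hp
    obtain ⟨b1, b2, b3, b4, b5⟩ := hK1 p hp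
    have b0 := hK0 p hp
    have hk0 := le_abs_self K0
    have hk1 := le_abs_self K1
    have hq : 0 ≤ M ^ 2 / 2 := by positivity
    have k0 := abs_nonneg K0
    have k1 := abs_nonneg K1
    simp only [hQ, norm_prod_le_iff, Real.norm_eq_abs]
    refine ⟨?_, ?_, ?_, ?_, ?_, ?_, ?_, ?_⟩
    · linarith [hM p.1 p.2]
    · have h1 := Ue_near hM (e0 n) p.1 p.2
      have h2 : M * e n ≤ M := by nlinarith [e1 n]
      rw [abs_le] at *
      constructor <;> linarith [b1.1, b1.2, b0.1, b0.2, h1.1, h1.2]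
    · linarith [Fe_bd hM (e0 n) p.1 p.2]
    · rw [abs_div, abs_of_pos (e0 n)]
      have h1 := UU_lx hM (p.1 - e n) p.1 p.2
      rw [sub_sub_cancel, abs_of_pos (e0 n)] at h1
      have h2 := (div_le_iff₀ (e0 n)).2 h1
      linarith
    all_goals linarith
  obtain ⟨C, hC⟩ := (isCompact_closedBall (0 : ℝ × ℝ × ℝ × ℝ × ℝ × ℝ × ℝ × ℝ) K).exists_bound_of_continuousOn (Ei_cont k (r * L)).continuousOn
  have hbd : ∀ n p, ‖Ei k (r * L) (Q n p)‖ ≤ Bx.indicator (fun _ => C) p := by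
    intro n p
    by_cases hp : p ∈ Bx
    · rw [indicator_of_mem hp]
      exact hC _ (mem_closedBall_zero_iff.2 (hKK n p hp))
    · rw [indicator_of_notMem hp]
      simp only [hQ]; rw [Ei_zero (out p hp)]; simp
  have hbi : Integrable (Bx.indicator fun _ => C) := (integrable_indicator_iff hBc.measurableSet).2 (continuousOn_const.integrableOn_compact hBc)
  have hme : ∀ n, AEStronglyMeasurable (fun p => Ei k (r * L) (Q n p)) volume := by
    intro n
    have h := ((((S.meas.sub_const k).abs.mul (tf_dt_cont (hφ1 n)).measurable)).add (((Sk_cont k).measurable.comp S.meas).mul (tf_dx_cont (hφ1 n)).measurable))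
    refine (h.aestronglyMeasurable).congr (Eventually.of_forall fun p => ?_)
    exact hP n p
  have hlim : ∀ᵐ p : ℝ × ℝ, Tendsto (fun n => Ei k (r * L) (Q n p)) atTop (nhds (Ei k (r * L) (Ql p))) := by
    filter_upwards [vv_ae2 hM] with p hp
    rcases le_or_gt p.2 0 with h | h
    · have hz := bz p.2 (by linarith)
      simp only [hQ, hQl]
      rw [Ei_zero (Or.inr hz)]
      simp only [Ei_zero (Or.inr hz)]
      exact tendsto_const_nhds
    · refine ((Ei_cont k (r * L)).tendsto _).comp ?_
      simp only [hQ, hQl, hp h]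
      have et : Tendsto e atTop (nhds 0) := tendsto_one_div_add_atTop_nhds_zero_nat (𝕜 := ℝ)
      have l1 : Tendsto (fun n => Ue S (e n) p.1 p.2) atTop (nhds (UU S p.1 p.2)) := by
        rw [tendsto_iff_dist_tendsto_zero]
        refine tendsto_of_tendsto_of_tendsto_of_le_of_le tendsto_const_nhds (by simpa using et.const_mul M) (fun _ => dist_nonneg) fun n => Ue_near hM (e0 n) p.1 p.2
      have l2 : Tendsto (fun n => Fe S (e n) p.1 p.2) atTop (nhds (fq (vv S p.1 p.2))) :=
        vv_avg h fq fq_cont (fun x => fq_bd (hM x p.2)) p.1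
      have l3 : Tendsto (fun n => (UU S p.1 p.2 - UU S (p.1 - e n) p.2) / e n) atTop (nhds (vv S p.1 p.2)) := by
        refine (vv_avg h (fun z => z) continuous_id (fun x => hM x p.2) p.1).congr fun n => ?_
        rw [UU_x hM]
      exact tendsto_const_nhds.prodMk_nhds ((tendsto_const_nhds.sub l1).prodMk_nhds (l2.prodMk_nhds (l3.prodMk_nhds tendsto_const_nhds)))
  have hconv := tendsto_integral_of_dominated_convergence _ hme hbi (fun n => Eventually.of_forall (hbd n)) hlim
  have hI := ge_of_tendsto' hconv hpos
  have hint : Integrable fun p => Ei k (r * L) (Ql p) := by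
    refine hbi.mono' (aestronglyMeasurable_of_tendsto_ae _ hme hlim) ?_
    filter_upwards [hlim] with p hp using le_of_tendsto' hp.norm fun n => hbd n p
  have hz : (fun p => -Ei k (r * L) (Ql p)) =ᵐ[volume] 0 :=
    (integral_eq_zero_iff_of_nonneg (f := fun p => -Ei k (r * L) (Ql p)) (fun p => by have := hR0 p; show (0:ℝ) ≤ -Ei _ _ _; linarith) hint.neg).1 (by
      rw [integral_neg]; have : ∫ p, Ei k (r * L) (Ql p) ≤ 0 := integral_nonpos hR0; linarith)
  filter_upwards [hz] with p hp h1 h2 h3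
  have hp : -Ei k (r * L) (Ql p) = 0 := hp
  rw [hR, neg_eq_zero] at hp
  have h4 : s + 2 * δ < p.2 := by
    by_contra h
    have := low p.1 p.2 h1 (not_lt.1 h) (Zbox p.1 p.2 h1 h2).1
    simp only [hA] at this; linarith
  have h5 : β p.2 = 1 := Kst_one (by
    have : 2 ≤ (p.2 - s) / δ := by rw [le_div_iff₀ hδ0]; linarith
    linarith)
  have h6 := hneg p.1 p.2 h1 h2
  have h7 : 0 < A p.1 p.2 - UU S p.1 p.2 := by simp only [hA]; linarith
  have h8 : 0 < Z p.1 p.2 := h2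
  rw [h5, g2, max_eq_left h7.le, max_eq_left h8.le] at hp
  rcases mul_eq_zero.1 hp with h | h
  · rcases mul_eq_zero.1 h with h | h
    · exact absurd h (by positivity)
    · exact sub_eq_zero.1 (abs_eq_zero.1 h)
  · linarith
end

section
variable {u0 : ℝ → ℝ} {S : ABSol fq fq (-4) 4 u0} {M : ℝ}
lemma UU_ct (hM : ∀ x t, |S.u x t| ≤ M) (x : ℝ) : ContinuousOn (fun t => UU S x t) (Ici 0) :=
  (UU_cont hM).comp (f := fun t => (x, t)) (by fun_prop) fun t ht => ht
lemma AC2 (hM : ∀ x t, |S.u x t| ≤ M) {a b : ℝ} (hK : Kr S a b) {s x0 r k c : ℝ} (hs : 0 ≤ s) (hr : 0 < r) (ha : a ≤ x0 - r) (hb : x0 + r ≤ b)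
    (hbase : ∀ y, |y - x0| ≤ r → c + k * (y - x0) ≤ UU S y s) :
    c - k ^ 2 / 2 * (r / (M + |k| + 1)) ≤ UU S x0 (s + r / (M + |k| + 1)) := by
  have hM0 := M_nn hM
  set L := M + |k| + 1 with hL
  have hL0 : 0 < L := by positivity
  refine le_of_forall_pos_le_add fun η hη => ?_
  have h1 : ∀ᵐ x : ℝ, ∀ᵐ t : ℝ, s < t → 0 < r ^ 2 - r * L * (t - s) - (x - x0) ^ 2 →
      η < c + k * (x - x0) - k ^ 2 / 2 * (t - s) - UU S x t → vv S x t = k := by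
    have := AC1 hM hK hs hr ha hb hbase hη
    rw [Measure.volume_eq_prod] at this
    exact Measure.ae_ae_of_ae_prod this
  have h2 : ∀ t, s ≤ t → t < s + r / L → c - k ^ 2 / 2 * (t - s) - UU S x0 t ≤ η := by
    intro t hst ht
    have hd : r * L * (t - s) < r ^ 2 := by
      have : L * (t - s) < r := by rw [mul_comm, ← lt_div_iff₀ hL0]; linarith
      nlinarith
    have h3 : ∀ᵐ x : ℝ, 0 < r ^ 2 - r * L * (t - s) - (x - x0) ^ 2 →
        c + k * (x - x0) - k ^ 2 / 2 * (t - s) - UU S x t ≤ η := by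
      filter_upwards [h1] with x hx hz
      have hrx : |x - x0| ≤ r := by
        apply abs_le_of_sq_le_sq _ hr.le
        nlinarith [mul_nonneg (mul_pos hr hL0).le (sub_nonneg.2 hst)]
      refine climb (s := s) (f := fun τ => c + k * (x - x0) - k ^ 2 / 2 * (τ - s) - UU S x τ) (g := fun τ => fq (vv S x τ) - k ^ 2 / 2) hst ?_ ?_ ?_ ?_
      · exact ContinuousOn.sub (by fun_prop) ((UU_ct hM x).mono fun τ hτ => hs.trans hτ.1)
      · intro a' b' h1 h2 h3
        have := UU_t hM x (hs.trans h1) h2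
        rw [intervalIntegral.integral_sub (vvi hM x a' b') (by simp), intervalIntegral.integral_const, smul_eq_mul]
        linarith
      · have := hbase x hrx
        simp only [sub_self, mul_zero, sub_zero]; linarith
      · filter_upwards [hx] with τ h hτ hη'
        rw [h hτ.1 (by nlinarith [mul_pos hr hL0, hτ.2]) hη', fq]; ring
    have ho : IsOpen {x : ℝ | 0 < r ^ 2 - r * L * (t - s) - (x - x0) ^ 2} := isOpen_lt continuous_const (by fun_prop)
    have hde := Measure.dense_of_ae h3
    have hcl : IsClosed {x : ℝ | c + k * (x - x0) - k ^ 2 / 2 * (t - s) - UU S x t ≤ η} :=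
      isClosed_le (by have := UU_cx hM t; fun_prop) continuous_const
    have hx0 : x0 ∈ closure {x : ℝ | c + k * (x - x0) - k ^ 2 / 2 * (t - s) - UU S x t ≤ η} := by
      refine closure_mono ?_ (hde.open_subset_closure_inter ho (show 0 < r ^ 2 - r * L * (t - s) - (x0 - x0) ^ 2 by simp; linarith))
      exact fun x hx => hx.2 hx.1
    have := hcl.closure_subset hx0
    have h : c + k * (x0 - x0) - k ^ 2 / 2 * (t - s) - UU S x0 t ≤ η := this
    simpa using h
  have hrl : 0 < r / L := by positivity
  have h4 : s + r / L ∈ closure (Ico s (s + r / L)) := by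
    rw [closure_Ico (by linarith)]; exact ⟨by linarith, le_rfl⟩
  have h5 : ContinuousOn (fun t => c - k ^ 2 / 2 * (t - s) - UU S x0 t) (Ici 0) := ContinuousOn.sub (by fun_prop) (UU_ct hM x0)
  have h6 := ContinuousWithinAt.closure_le (f := fun t => c - k ^ 2 / 2 * (t - s) - UU S x0 t) (g := fun _ => η) h4
    ((h5 _ (show (0:ℝ) ≤ _ by linarith)).mono fun t ht => hs.trans ht.1) continuousWithinAt_const fun t ht => h2 t ht.1 ht.2
  have h7 : s + r / L - s = r / L := by ring
  simp only [h7] at h6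
  linarith
end

section
variable {u0 : ℝ → ℝ} {S : ABSol fq fq (-4) 4 u0} {M : ℝ}
lemma LO1 (hM : ∀ x t, |S.u x t| ≤ M) {α β T T' x0 c ε : ℝ} (hK : Kr S α β) (hT : 0 ≤ T') (hT' : T' < T) (h0 : α < x0) (h1 : x0 < β) (hε : 0 < ε)
    (hi : ∀ y, α ≤ y → y ≤ β → c - (y - x0) ^ 2 / (2 * T) ≤ UU S y 0)
    (hα : ∀ s, 0 ≤ s → s < T → c - (α - x0) ^ 2 / (2 * (T - s)) ≤ UU S α s)
    (hβ : ∀ s, 0 ≤ s → s < T → c - (β - x0) ^ 2 / (2 * (T - s)) ≤ UU S β s) : c - ε * T' ≤ UU S x0 T' := by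
  have hM0 := M_nn hM
  set F : ℝ × ℝ → ℝ := fun p => UU S p.1 p.2 - (c - (p.1 - x0) ^ 2 / (2 * (T - p.2))) + ε * p.2 with hF
  have hc : ContinuousOn F (Icc α β ×ˢ Icc 0 T') := by
    refine ((((UU_cont hM).mono fun p hp => hp.2.1).sub (continuousOn_const.sub (ContinuousOn.div (by fun_prop) (by fun_prop) fun p hp => ?_))).add (by fun_prop))
    have := hp.2.2; nlinarith
  obtain ⟨⟨x1, t1⟩, ⟨⟨ha, hb⟩, hc1, hd⟩, hmin⟩ := (isCompact_Icc.prod isCompact_Icc).exists_isMinOn (⟨(x0, T'), ⟨⟨h0.le, h1.le⟩, hT, le_rfl⟩⟩ : (Icc α β ×ˢ Icc 0 T').Nonempty) hc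
  simp only at ha hb hc1 hd
  have hmin : ∀ x t, α ≤ x → x ≤ β → 0 ≤ t → t ≤ T' → F (x1, t1) ≤ F (x, t) := fun x t h1 h2 h3 h4 => hmin (⟨⟨h1, h2⟩, h3, h4⟩ : (x, t) ∈ Icc α β ×ˢ Icc 0 T')
  by_contra hneg
  push Not at hneg
  have hm : F (x1, t1) < 0 := by
    refine (hmin x0 T' h0.le h1.le hT le_rfl).trans_lt ?_
    simp only [hF, sub_self]; norm_num; linarith
  have hm' : UU S x1 t1 - (c - (x1 - x0) ^ 2 / (2 * (T - t1))) + ε * t1 < 0 := hm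
  have e1 : 0 < t1 := by
    refine hc1.lt_of_ne fun h => ?_
    subst h
    have := hi x1 ha hb
    simp only [sub_zero, mul_zero] at hm'; linarith
  have e2 : α < x1 := by
    refine ha.lt_of_ne fun h => ?_
    subst h
    have := hα t1 hc1 (by linarith)
    nlinarith
  have e3 : x1 < β := by
    refine hb.lt_of_ne fun h => ?_
    subst h
    have := hβ t1 hc1 (by linarith)
    nlinarith
  have hD : 0 < T - t1 := by linarith
  set K := |x1 - x0| / (T - t1) with hKd
  have hK0 : 0 ≤ K := by positivity
  set L0 := M + K + 1 with hL0
  have hL00 : 0 < L0 := by positivity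
  obtain ⟨ρ, hρ, h1ρ, h2ρ, h3ρ, h4ρ⟩ : ∃ ρ > 0, ρ ≤ t1 ∧ L0 * ρ ≤ x1 - α ∧ L0 * ρ ≤ β - x1 ∧ L0 ^ 2 * ρ < 2 * (T - t1) * ε := by
    have ev : ∀ᶠ ρ : ℝ in nhdsWithin 0 (Ioi 0), 0 < ρ ∧ ρ < t1 ∧ L0 * ρ < x1 - α ∧ L0 * ρ < β - x1 ∧ L0 ^ 2 * ρ < 2 * (T - t1) * ε := by
      refine (eventually_mem_nhdsWithin.mono fun _ h => h).and (nhdsWithin_le_nhds ?_)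
      have c1 : ∀ (a b : ℝ), 0 < b → ∀ᶠ ρ : ℝ in nhds 0, a * ρ < b := fun a b hb =>
        (show Continuous fun ρ : ℝ => a * ρ by fun_prop).continuousAt.eventually_lt continuousAt_const (by simpa using hb)
      filter_upwards [c1 1 t1 e1, c1 L0 _ (sub_pos.2 e2), c1 L0 _ (sub_pos.2 e3), c1 (L0 ^ 2) (2 * (T - t1) * ε) (by positivity)] with ρ a b c d using ⟨by linarith, b, c, d⟩
    obtain ⟨ρ, h1, h2, h3, h4, h5⟩ := ev.exists
    exact ⟨ρ, h1, h2.le, h3.le, h4.le, h5⟩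
  set s := t1 - ρ with hs
  have hDs : 0 < T - s := by linarith
  set k := -(x1 - x0) / (T - s) with hk
  have hkK : |k| ≤ K := by
    rw [hk, hKd, abs_div, abs_neg, abs_of_pos hDs]
    gcongr; linarith
  set L := M + |k| + 1 with hL
  have hLp : 0 < L := by positivity
  have hLL : L ≤ L0 := by linarith
  have hr : L * ρ ≤ L0 * ρ := by gcongr
  have key := AC2 hM hK (s := s) (x0 := x1) (r := L * ρ) (k := k) (c := c - (x1 - x0) ^ 2 / (2 * (T - s)) - (L * ρ) ^ 2 / (2 * (T - t1)) - ε * s + F (x1, t1))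
    (by linarith) (by positivity) (by linarith) (by linarith) (by
      intro y hy
      have hy' := abs_le.1 hy
      have h := hmin y s (by linarith) (by linarith) (by linarith) (by linarith)
      have h' : F (x1, t1) ≤ UU S y s - (c - (y - x0) ^ 2 / (2 * (T - s))) + ε * s := h
      have q1 : (y - x0) ^ 2 / (2 * (T - s)) = (x1 - x0) ^ 2 / (2 * (T - s)) - k * (y - x1) + (y - x1) ^ 2 / (2 * (T - s)) := by
        rw [hk]; field_simp; ring
      have q2 : (y - x1) ^ 2 / (2 * (T - s)) ≤ (L * ρ) ^ 2 / (2 * (T - t1)) := by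
        apply div_le_div₀ (by positivity) (sq_le_sq' hy'.1 hy'.2) (by positivity) (by linarith)
      linarith)
  rw [show L * ρ / (M + |k| + 1) = ρ by rw [← hL]; field_simp, show s + ρ = t1 by rw [hs]; ring] at key
  have hF1 : F (x1, t1) = UU S x1 t1 - (c - (x1 - x0) ^ 2 / (2 * (T - t1))) + ε * t1 := rfl
  have q3 : (x1 - x0) ^ 2 / (2 * (T - s)) + k ^ 2 / 2 * ρ ≤ (x1 - x0) ^ 2 / (2 * (T - t1)) := by
    have : (x1 - x0) ^ 2 / (2 * (T - s)) + k ^ 2 / 2 * ρ = (x1 - x0) ^ 2 / 2 * ((T - s + ρ) / (T - s) ^ 2) := by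
      rw [hk]; field_simp
    rw [this, show (x1 - x0) ^ 2 / (2 * (T - t1)) = (x1 - x0) ^ 2 / 2 * (1 / (T - t1)) by field_simp]
    refine mul_le_mul_of_nonneg_left ?_ (by positivity)
    rw [div_le_div_iff₀ (by positivity) hD]
    have : T - t1 = T - s - ρ := by rw [hs]; ring
    rw [this]; nlinarith
  have q4 : (L * ρ) ^ 2 / (2 * (T - t1)) < ε * ρ := by
    rw [div_lt_iff₀ (by positivity)]
    have : L ^ 2 ≤ L0 ^ 2 := by gcongr
    nlinarith [mul_le_mul_of_nonneg_right this hρ.le]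
  have : ε * s = ε * t1 - ε * ρ := by rw [hs]; ring
  linarith
lemma LO (hM : ∀ x t, |S.u x t| ≤ M) {α β T x0 c : ℝ} (hK : Kr S α β) (hT : 0 < T) (h0 : α < x0) (h1 : x0 < β)
    (hi : ∀ y, α ≤ y → y ≤ β → c - (y - x0) ^ 2 / (2 * T) ≤ UU S y 0)
    (hα : ∀ s, 0 ≤ s → s < T → c - (α - x0) ^ 2 / (2 * (T - s)) ≤ UU S α s)
    (hβ : ∀ s, 0 ≤ s → s < T → c - (β - x0) ^ 2 / (2 * (T - s)) ≤ UU S β s) : c ≤ UU S x0 T := by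
  refine le_of_forall_pos_le_add fun η hη => ?_
  have h4 : T ∈ closure (Ico 0 T) := by
    rw [closure_Ico (by linarith)]; exact ⟨by linarith, le_rfl⟩
  have h5 := (UU_ct hM x0) T (show (0:ℝ) ≤ _ by linarith)
  refine ContinuousWithinAt.closure_le (f := fun _ => c) (g := fun t => UU S x0 t + η) h4
    continuousWithinAt_const ((h5.mono fun t ht => ht.1).add continuousWithinAt_const) fun t ht => ?_
  have := LO1 hM hK ht.1 ht.2 h0 h1 (ε := η / T) (by positivity) hi hα hβ
  have : η / T * t ≤ η := by
    rw [div_mul_eq_mul_div, div_le_iff₀ hT]; nlinarith [ht.2]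
  linarith
end

section
variable {u0 : ℝ → ℝ} {S : ABSol fq fq (-4) 4 u0} {M : ℝ}
lemma line_up (hM : ∀ x t, |S.u x t| ≤ M) (x : ℝ) : UU S (x + 4) 1 ≤ UU S x 0 + 8 := by
  have hM0 := M_nn hM
  have key : ∀ ε, 0 < ε → ε < 1 → UU S (x + 4) 1 ≤ UU S x 0 + 8 + (M * ε + M * ε + M * (4 * ε) + M ^ 2 / 2 * ε) := by
    intro ε hε hε1
    set g : ℝ → ℝ := fun t => Ue S ε (x + 4 * t) t - 8 * t with hg
    have hd : ∀ t, 0 < t → HasDerivAt g ((4 * ((UU S (x + 4 * t) t - UU S (x + 4 * t - ε) t) / ε) - Fe S ε (x + 4 * t) t) - 8) t := by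
      intro t ht
      have h1 := ((Ue_c1 hM hε (p := (x + 4 * t, t)) ht).differentiableAt (by norm_num)).hasFDerivAt
      have h2 : HasDerivAt (fun s : ℝ => (x + 4 * s, s)) ((4:ℝ), (1:ℝ)) t := by
        refine HasDerivAt.prodMk ?_ (hasDerivAt_id t)
        simpa using ((hasDerivAt_id t).const_mul (4:ℝ)).const_add x
      have h3 := h1.comp_hasDerivAt (f := fun s : ℝ => (x + 4 * s, s)) t h2
      refine (h3.sub ((hasDerivAt_id t).const_mul 8)).congr_deriv ?_
      have a1 := h1.comp_hasDerivAt (f := fun y => (y, t)) (x + 4 * t) ((hasDerivAt_id (x + 4 * t)).prodMk (hasDerivAt_const (x + 4 * t) t))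
      have a2 := h1.comp_hasDerivAt (f := fun s => (x + 4 * t, s)) t ((hasDerivAt_const t (x + 4 * t)).prodMk (hasDerivAt_id t))
      have b1 := a1.unique (Ue_dx hM (x + 4 * t) t)
      have b2 := a2.unique (Ue_dt (x := x + 4 * t) hM hε ht)
      have : ((4:ℝ), (1:ℝ)) = (4:ℝ) • ((1:ℝ), (0:ℝ)) + ((0:ℝ), (1:ℝ)) := by ext <;> simp
      rw [this, map_add, map_smul, b1, b2, smul_eq_mul]; ring
    have hanti : AntitoneOn g (Icc ε 1) := by
      refine antitoneOn_of_deriv_nonpos (convex_Icc _ _) (fun t ht => (hd t (hε.trans_le ht.1)).continuousAt.continuousWithinAt)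
        (fun t ht => (hd t ?_).differentiableAt.differentiableWithinAt) fun t ht => ?_
      · rw [interior_Icc] at ht; exact hε.trans ht.1
      · rw [interior_Icc] at ht
        rw [(hd t (hε.trans ht.1)).deriv, UU_x hM, Fe, mul_div_assoc', ← sub_div, ← intervalIntegral.integral_const_mul,
          ← intervalIntegral.integral_sub ((bint (mes_x S t) (fun x => hM x t) _ _).const_mul 4) (fqi hM t _ _), sub_nonpos, div_le_iff₀ hε]
        have := intervalIntegral.integral_mono_on (a := x + 4 * t - ε) (b := x + 4 * t) (μ := volume) (g := fun _ => (8:ℝ)) (by linarith) (((bint (mes_x S t) (fun x => hM x t) _ _).const_mul 4).sub (fqi hM t _ _)) (by simp)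
          (fun y _ => by simp only [fq]; nlinarith [sq_nonneg (S.u y t - 4)])
        simpa [mul_comm] using this
    have h := hanti ⟨le_rfl, hε1.le⟩ ⟨hε1.le, le_rfl⟩ hε1.le
    simp only [hg, mul_one] at h
    have n1 := (abs_le.1 (Ue_near hM hε (x + 4) 1)).1
    have n2 := (abs_le.1 (Ue_near hM hε (x + 4 * ε) ε)).2
    have n3 := (abs_le.1 (UU_lx hM x (x + 4 * ε) ε)).2
    have n4 := (abs_le.1 (UU_lt hM x le_rfl hε.le)).2
    rw [show x + 4 * ε - x = 4 * ε by ring, abs_of_pos (by linarith)] at n3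
    rw [sub_zero, abs_of_pos hε] at n4
    linarith
  have hlim : Tendsto (fun ε => UU S x 0 + 8 + (M * ε + M * ε + M * (4 * ε) + M ^ 2 / 2 * ε)) (nhdsWithin 0 (Ioi 0)) (nhds (UU S x 0 + 8)) := by
    have : Continuous (fun ε => UU S x 0 + 8 + (M * ε + M * ε + M * (4 * ε) + M ^ 2 / 2 * ε)) := by fun_prop
    exact (this.tendsto' 0 _ (by simp)).mono_left nhdsWithin_le_nhds
  refine ge_of_tendsto hlim ?_
  filter_upwards [Ioo_mem_nhdsGT (zero_lt_one' ℝ)] with ε hε using key ε hε.1 hε.2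
end

section
lemma seg {u : ℝ → ℝ} (hu : ∀ a b, IntervalIntegrable u volume a b) {a b : ℝ} (α β : ℝ) (hab : a ≤ b) (h : ∀ z, a < z → z < b → u z = α + β * z) :
    (∫ z in (0:ℝ)..b, u z) - (∫ z in (0:ℝ)..a, u z) = α * (b - a) + β * (b ^ 2 - a ^ 2) / 2 := by
  rw [intervalIntegral.integral_interval_sub_left (hu _ _) (hu _ _)]
  have : ∫ z in a..b, u z = ∫ z in a..b, (α + β * z) := by
    refine intervalIntegral.integral_congr_ae ?_
    filter_upwards [ae_ne b] with z hz hz'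
    rw [uIoc_of_le hab] at hz'
    exact h z hz'.1 (hz'.2.lt_of_ne hz)
  rw [this, intervalIntegral.integral_add (by simp) (Continuous.intervalIntegrable (by fun_prop) _ _), intervalIntegral.integral_const_mul]
  simp [integral_id]; ring
lemma u1_int {p : ℝ} (hp : p < -12) (a b : ℝ) : IntervalIntegrable (udat1 (-1) p) volume a b := bint (U1_E hp).meas0 (U1_E hp).bdd0 a b
lemma u2_int {p : ℝ} (hp : p < -12) (a b : ℝ) : IntervalIntegrable (udat2 (-1) p) volume a b := bint (U2_E hp).meas0 (U2_E hp).bdd0 a b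
lemma prim1 {p : ℝ} (hp : p < -12) (y : ℝ) : (y ≤ -5 → ∫ z in (0:ℝ)..y, udat1 (-1) p z = 4 * y + 8) ∧
    (y ≤ 4 → -4 * |y| + 8 * min |y| 1 ≤ ∫ z in (0:ℝ)..y, udat1 (-1) p z) ∧
    (4 ≤ y → -8 - y ^ 2 / 2 ≤ ∫ z in (0:ℝ)..y, udat1 (-1) p z) ∧
    (y ≤ 0 → -4 ≤ (∫ z in (0:ℝ)..y, udat1 (-1) p z) + (y + 3 / 4) ^ 2 / 2) := by
  have h0 : ∫ z in (0:ℝ)..0, udat1 (-1) p z = 0 := by simp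
  have g1 : ∀ y, -1 ≤ y → y ≤ 0 → ∫ z in (0:ℝ)..y, udat1 (-1) p z = -4 * y := fun y a b => by
    have := seg (u1_int hp) (-4) 0 b fun z h1 h2 => by unfold udat1; split_ifs <;> linarith
    linarith
  have g2 : ∀ y, y ≤ -1 → ∫ z in (0:ℝ)..y, udat1 (-1) p z = 4 * y + 8 := fun y a => by
    have := seg (u1_int hp) 4 0 a fun z h1 h2 => by unfold udat1; split_ifs <;> linarith
    linarith [g1 (-1) le_rfl (by norm_num)]
  have g3 : ∀ y, 0 ≤ y → y ≤ (-4 - p) / 2 → ∫ z in (0:ℝ)..y, udat1 (-1) p z = 4 * y := fun y a b => by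
    have := seg (u1_int hp) 4 0 a fun z h1 h2 => by unfold udat1; split_ifs <;> linarith
    linarith
  have g4 : ∀ y, (-4 - p) / 2 ≤ y → ∫ z in (0:ℝ)..y, udat1 (-1) p z = 4 * ((-4 - p) / 2) + p * (y - (-4 - p) / 2) := fun y a => by
    have := seg (u1_int hp) p 0 a fun z h1 h2 => by unfold udat1; split_ifs <;> linarith
    linarith [g3 ((-4 - p) / 2) (by linarith) le_rfl]
  refine ⟨fun h => g2 y (by linarith), fun h => ?_, fun h => ?_, fun h => ?_⟩
  · rcases le_total y 0 with a | a
    · rw [abs_of_nonpos a]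
      rcases le_total y (-1) with b | b
      · rw [g2 y b]; linarith [min_le_right (-y) 1]
      · rw [g1 y b a]; linarith [min_le_left (-y) 1]
    · rw [abs_of_nonneg a, g3 y a (by linarith)]; linarith [min_le_left y 1]
  · rcases le_total y ((-4 - p) / 2) with b | b
    · rw [g3 y (by linarith) b]; nlinarith
    · rw [g4 y b]; nlinarith [sq_nonneg (y + p)]
  · rcases le_total y (-1) with b | b
    · rw [g2 y b]; nlinarith [sq_nonneg (y + 19 / 4)]
    · rw [g1 y b h]; nlinarith [sq_nonneg (y + 3 / 4)]
lemma prim2 {p : ℝ} (hp : p < -12) (y : ℝ) : (y ≤ -5 → ∫ z in (0:ℝ)..y, udat2 (-1) p z = 4 * y + 4) ∧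
    (y ≤ 4 → -4 * |y| - 4 * min |y| 1 ≤ ∫ z in (0:ℝ)..y, udat2 (-1) p z) ∧
    (4 ≤ y → -12 - y ^ 2 / 2 ≤ ∫ z in (0:ℝ)..y, udat2 (-1) p z) ∧
    (y ≤ 0 → -8 ≤ (∫ z in (0:ℝ)..y, udat2 (-1) p z) + (y + 3 / 4) ^ 2 / 2) := by
  have h0 : ∫ z in (0:ℝ)..0, udat2 (-1) p z = 0 := by simp
  have g1 : ∀ y, -1 ≤ y → y ≤ 0 → ∫ z in (0:ℝ)..y, udat2 (-1) p z = 8 * y := fun y a b => by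
    have := seg (u2_int hp) 8 0 b fun z h1 h2 => by unfold udat2; split_ifs <;> linarith
    linarith
  have g2 : ∀ y, -5 ≤ y → y ≤ -1 → ∫ z in (0:ℝ)..y, udat2 (-1) p z = -8 - (y + 1) ^ 2 / 2 := fun y b a => by
    have := seg (u2_int hp) (-1) (-1) a fun z h1 h2 => by unfold udat2; split_ifs <;> linarith
    linarith [g1 (-1) le_rfl (by norm_num)]
  have g3 : ∀ y, y ≤ -5 → ∫ z in (0:ℝ)..y, udat2 (-1) p z = 4 * y + 4 := fun y a => by
    have := seg (u2_int hp) 4 0 a fun z h1 h2 => by unfold udat2; split_ifs <;> linarith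
    linarith [g2 (-5) le_rfl (by norm_num)]
  have g4 : ∀ y, 0 ≤ y → y ≤ 1 → ∫ z in (0:ℝ)..y, udat2 (-1) p z = -8 * y := fun y a b => by
    have := seg (u2_int hp) (-8) 0 a fun z h1 h2 => by unfold udat2; split_ifs <;> linarith
    linarith
  have g5 : ∀ y, 1 ≤ y → y ≤ 4 → ∫ z in (0:ℝ)..y, udat2 (-1) p z = -4 - 4 * y := fun y a b => by
    have := seg (u2_int hp) (-4) 0 a fun z h1 h2 => by unfold udat2; split_ifs <;> linarith
    linarith [g4 1 (by norm_num) le_rfl]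
  have g6 : ∀ y, 4 ≤ y → y ≤ -p → ∫ z in (0:ℝ)..y, udat2 (-1) p z = -12 - y ^ 2 / 2 := fun y a b => by
    have := seg (u2_int hp) 0 (-1) a fun z h1 h2 => by unfold udat2; split_ifs <;> linarith
    linarith [g5 4 (by norm_num) le_rfl]
  have g7 : ∀ y, -p ≤ y → ∫ z in (0:ℝ)..y, udat2 (-1) p z = -12 - p ^ 2 / 2 + p * (y + p) := fun y a => by
    have := seg (u2_int hp) p 0 a fun z h1 h2 => by unfold udat2; split_ifs <;> linarith
    linarith [g6 (-p) (by linarith) le_rfl]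
  refine ⟨g3 y, fun h => ?_, fun h => ?_, fun h => ?_⟩
  · rcases le_total y 0 with a | a
    · rw [abs_of_nonpos a]
      rcases le_total y (-1) with b | b
      · rw [min_eq_right (by linarith)]
        rcases le_total y (-5) with c | c
        · rw [g3 y c]; linarith
        · rw [g2 y c b]; nlinarith
      · rw [g1 y b a, min_eq_left (by linarith)]; linarith
    · rw [abs_of_nonneg a]
      rcases le_total y 1 with b | b
      · rw [g4 y a b, min_eq_left b]; linarith
      · rw [g5 y b h, min_eq_right b]; linarith
  · rcases le_total y (-p) with b | b
    · rw [g6 y h b]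
    · rw [g7 y b]; nlinarith [sq_nonneg (y + p)]
  · rcases le_total y (-1) with b | b
    · rcases le_total y (-5) with c | c
      · rw [g3 y c]; nlinarith [sq_nonneg (y + 19 / 4)]
      · rw [g2 y c b]; nlinarith
    · rw [g1 y b h]; nlinarith [sq_nonneg (y + 3 / 4)]
lemma prim0 {p l σ : ℝ} (hp : p < -12) (hl : 0 < l) (hl1 : l < 1) (hσ1 : σ ≤ 4 * (1 - l)) (hσ2 : σ ≤ 8 * l) {P : ℝ → ℝ}
    (hP : ∀ y, P y = l * (∫ z in (0:ℝ)..y, udat1 (-1) p z) + (1 - l) * ∫ z in (0:ℝ)..y, udat2 (-1) p z) (y : ℝ) :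
    (y ≤ -5 → P y = 4 * y + 4 + 4 * l) ∧ (y ≤ 4 → -4 * |y| - 4 * (1 - l) + σ ≤ P y) ∧
    (4 ≤ y → -12 + 4 * l - y ^ 2 / 2 ≤ P y) ∧ (y ≤ 0 → -8 + 4 * l ≤ P y + (y + 3 / 4) ^ 2 / 2) := by
  obtain ⟨a1, a2, a3, a4⟩ := prim1 hp y
  obtain ⟨b1, b2, b3, b4⟩ := prim2 hp y
  have hl2 : 0 ≤ 1 - l := by linarith
  refine ⟨fun h => ?_, fun h => ?_, fun h => ?_, fun h => ?_⟩
  · rw [hP, a1 h, b1 h]; ring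
  all_goals rw [hP]
  · have m0 : 0 ≤ min |y| 1 := le_min (abs_nonneg y) zero_le_one
    have m1 := min_le_right |y| 1
    nlinarith [mul_le_mul_of_nonneg_left (a2 h) hl.le, mul_le_mul_of_nonneg_left (b2 h) hl2]
  · nlinarith [mul_le_mul_of_nonneg_left (a3 h) hl.le, mul_le_mul_of_nonneg_left (b3 h) hl2]
  · nlinarith [mul_le_mul_of_nonneg_left (a4 h) hl.le, mul_le_mul_of_nonneg_left (b4 h) hl2]
end

section
variable {u0 : ℝ → ℝ} {S : ABSol fq fq (-4) 4 u0} {M : ℝ}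
lemma UU00 : UU S 0 0 = 0 := by simp [UU]
lemma far (hM : ∀ x t, |S.u x t| ≤ M) {t : ℝ} (ht : 0 < t) (c : ℝ) : ∃ b > 1, ∀ y x s, |y| = b → |x| ≤ 1 → 0 ≤ s → s < t →
    c - (y - x) ^ 2 / (2 * (t - s)) ≤ UU S y s := by
  have hM0 := M_nn hM
  set K := 2 * t * (|c| + M ^ 2 / 2 * t + M) with hK
  have hK0 : 0 ≤ K := by positivity
  set m := 1 + K + 2 * t * M with hm
  have hm1 : 1 ≤ m := by have : 0 ≤ 2 * t * M := by positivity
                         linarith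
  refine ⟨m + 1, by linarith, fun y x s hy hx hs hst => ?_⟩
  have n1 := (abs_le.1 (UU_lx hM 0 y s)).1
  have n2 := (abs_le.1 (UU_lt hM 0 le_rfl hs)).1
  rw [UU00, sub_zero, sub_zero, abs_of_nonneg hs] at n2
  rw [sub_zero, hy] at n1
  have n3 : M ^ 2 / 2 * s ≤ M ^ 2 / 2 * t := by gcongr
  have n4 : m ^ 2 ≤ (y - x) ^ 2 := by
    rw [← sq_abs (y - x)]
    have := abs_sub_abs_le_abs_sub y x
    exact pow_le_pow_left₀ (by linarith) (by linarith) 2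
  have n5 : m ^ 2 / (2 * t) ≤ (y - x) ^ 2 / (2 * (t - s)) := div_le_div₀ (sq_nonneg _) n4 (by linarith) (by linarith)
  have n6 : |c| + M ^ 2 / 2 * t + M * (m + 1) ≤ m ^ 2 / (2 * t) := by
    rw [le_div_iff₀ (by positivity)]
    have : m ^ 2 = m + m * K + 2 * t * M * m := by rw [hm]; ring
    rw [this]; nlinarith
  linarith [le_abs_self c]
lemma z_mono (hM : ∀ x t, |S.u x t| ≤ M) {s t : ℝ} (hs : 0 ≤ s) (hst : s ≤ t) : UU S 0 t ≤ UU S 0 s - 8 * (t - s) := by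
  have h := UU_t hM 0 hs hst
  have h2 : ∫ τ in s..t, (8:ℝ) ≤ ∫ τ in s..t, fq (vv S 0 τ) := by
    refine intervalIntegral.integral_mono_ae_restrict hst (by simp) (vvi hM 0 s t) ?_
    refine (ae_restrict_iff' measurableSet_Icc).2 ?_
    filter_upwards [iface hM, ae_ne 0] with τ h h0 hτ
    have : 0 < τ := lt_of_le_of_ne (hs.trans hτ.1) (Ne.symm h0)
    simp only [vv, this, if_true]
    exact (h this).1
  simp only [intervalIntegral.integral_const, smul_eq_mul] at h2
  linarith
lemma near0 (hM : ∀ x t, |S.u x t| ≤ M) {t μ : ℝ} (ht : 0 < t) (hμ : 0 < μ) (hi : ∀ y, UU S 0 t + μ ≤ UU S y 0 + y ^ 2 / (2 * t)) :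
    ∃ δ > 0, ∀ x, x ≠ 0 → |x| < δ → UU S 0 t ≤ UU S x t := by
  obtain ⟨b, hb, hf⟩ := far hM ht (UU S 0 t)
  refine ⟨min 1 (μ * t / b), by positivity, fun x hx0 hx => ?_⟩
  have h1 : |x| < 1 := hx.trans_le (min_le_left _ _)
  have h2 : |x| * b < μ * t := by
    rw [← lt_div_iff₀ (by linarith)]; exact hx.trans_le (min_le_right _ _)
  have hI : ∀ y, |y| ≤ b → UU S 0 t - (y - x) ^ 2 / (2 * t) ≤ UU S y 0 := by
    intro y hy
    have := hi y
    have h3 : y ^ 2 / (2 * t) ≤ (y - x) ^ 2 / (2 * t) + μ := by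
      rw [div_add' _ _ _ (by positivity)]
      gcongr
      have : y * x ≤ |x| * b := by
        rw [mul_comm |x|]
        refine (le_abs_self _).trans ?_
        rw [abs_mul]; gcongr
      nlinarith [sq_nonneg x]
    linarith
  have hz : ∀ s, 0 ≤ s → s < t → UU S 0 t - (0 - x) ^ 2 / (2 * (t - s)) ≤ UU S 0 s := fun s hs hst => by
    have := z_mono hM hs hst.le
    have : 0 ≤ (0 - x) ^ 2 / (2 * (t - s)) := div_nonneg (sq_nonneg _) (by linarith)
    linarith
  obtain ⟨h3, h4⟩ := abs_lt.1 h1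
  rcases lt_or_gt_of_ne hx0 with h | h
  · refine LO hM (Kr_l S (-b)) ht (by linarith) h (fun y a1 a2 => hI y (abs_le.2 ⟨a1, by linarith⟩)) (fun s => hf (-b) x s (by rw [abs_neg, abs_of_pos (by linarith)]) h1.le) hz
  · refine LO hM (Kr_r S b) ht h (by linarith) (fun y a1 a2 => hI y (abs_le.2 ⟨by linarith, a2⟩)) hz (fun s => hf b x s (abs_of_pos (by linarith)) h1.le)
lemma stage1 (hM : ∀ x t, |S.u x t| ≤ M) {C T : ℝ} (hC : C ≤ 0)
    (hi : ∀ y t, 0 < t → t ≤ T → C - 8 * t ≤ UU S y 0 + y ^ 2 / (2 * t)) {t : ℝ} (ht : 0 ≤ t) (htT : t ≤ T) : C - 8 * t ≤ UU S 0 t := by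
  have key := climb (s := 0) (t := t) (η := 0) (f := fun τ => C - 8 * τ - UU S 0 τ) (g := fun τ => fq (vv S 0 τ) - 8) ht
    (ContinuousOn.sub (by fun_prop) ((UU_ct hM 0).mono fun τ hτ => hτ.1)) (fun a b h1 h2 h3 => by
      have := UU_t hM 0 h1 h2
      rw [intervalIntegral.integral_sub (vvi hM 0 a b) (by simp), intervalIntegral.integral_const, smul_eq_mul]
      linarith) (by simp only [UU00]; linarith) (by
      filter_upwards [iface hM] with τ h hτ hz
      obtain ⟨δ, hδ, hn⟩ := near0 hM hτ.1 hz (fun y => by linarith [hi y τ hτ.1 (hτ.2.le.trans htT)])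
      obtain ⟨h8, h9⟩ := h hτ.1
      have e : vv S 0 τ = S.um 0 τ := by simp [vv, hτ.1]
      rw [e]
      by_contra hne
      rcases h9 (lt_of_le_of_ne h8 fun h => hne (by linarith)) with h | h
      · have ev := (S.um_spec 0 τ hτ.1).eventually (lt_mem_nhds h)
        obtain ⟨x, hx, hx'⟩ := mem_nhdsLT_iff_exists_Ioo_subset.1 ev
        have hx : x < 0 := hx
        set w := max x (-δ) / 2
        have hm : max x (-δ) < 0 := max_lt hx (by linarith)
        have hw : w < 0 := by simp only [w]; linarith
        have hw1 : max x (-δ) < w := by simp only [w]; linarith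
        have h1 := hn w hw.ne (by rw [abs_of_neg hw]; linarith [le_max_right x (-δ)])
        have h2 := UU_x hM w 0 τ
        have h3 := intervalIntegral.integral_mono_on_of_le_Ioo (a := w) (b := 0) (μ := volume) (f := fun _ => (4:ℝ)) hw.le (by simp) (bint (mes_x S τ) (fun x => hM x τ) _ _) fun y hy =>
          (le_of_lt (hx' ⟨(le_max_left x (-δ)).trans_lt (hw1.trans hy.1), hy.2⟩) : (4:ℝ) ≤ S.u y τ)
        simp only [intervalIntegral.integral_const, smul_eq_mul] at h3
        linarith
      · have ev := (S.up_spec 0 τ hτ.1).eventually (gt_mem_nhds h)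
        obtain ⟨x, hx, hx'⟩ := mem_nhdsGT_iff_exists_Ioo_subset.1 ev
        have hx : 0 < x := hx
        set w := min x δ / 2
        have hm : 0 < min x δ := lt_min hx hδ
        have hw : 0 < w := by simp only [w]; linarith
        have hw1 : w < min x δ := by simp only [w]; linarith
        have h1 := hn w hw.ne' (by rw [abs_of_pos hw]; linarith [min_le_right x δ])
        have h2 := UU_x hM 0 w τ
        have h3 := intervalIntegral.integral_mono_on_of_le_Ioo (a := 0) (b := w) (μ := volume) (g := fun _ => (-4:ℝ)) hw.le (bint (mes_x S τ) (fun x => hM x τ) _ _) (by simp) fun y hy =>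
          (le_of_lt (hx' ⟨hy.1, (hy.2.trans hw1).trans_le (min_le_left x δ)⟩) : S.u y τ ≤ (-4:ℝ))
        simp only [intervalIntegral.integral_const, smul_eq_mul] at h3
        linarith)
  linarith
end

section
lemma no_mix {p l : ℝ} (hp : p < -12) (hl : 0 < l) (hl1 : l < 1)
    (S : ABSol fq fq (-4) 4 (fun x => l * udat1 (-1) p x + (1 - l) * udat2 (-1) p x)) (hω : ∀ᵐ x, S.u x 1 = omega3 (-1) p x) : False := by
  obtain ⟨M, hM⟩ := S.bdd
  set σ := min (min (4 * (1 - l)) (8 * l)) (1 / 8) with hσ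
  have s0 : 0 < σ := by simp only [hσ, lt_min_iff]; refine ⟨⟨?_, ?_⟩, ?_⟩ <;> linarith
  have s1 : σ ≤ 4 * (1 - l) := (min_le_left _ _).trans (min_le_left _ _)
  have s2 : σ ≤ 8 * l := (min_le_left _ _).trans (min_le_right _ _)
  have s3 : σ ≤ 1 / 8 := min_le_right _ _
  have hP : ∀ y, UU S y 0 = l * (∫ z in (0:ℝ)..y, udat1 (-1) p z) + (1 - l) * ∫ z in (0:ℝ)..y, udat2 (-1) p z := by
    intro y
    have h := UU_x hM 0 y 0
    rw [UU00, sub_zero] at h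
    rw [h, intervalIntegral.integral_congr_ae (S.init.mono fun x hx _ => hx), intervalIntegral.integral_add ((u1_int hp _ _).const_mul _) ((u2_int hp _ _).const_mul _),
      intervalIntegral.integral_const_mul, intervalIntegral.integral_const_mul]
  have F := prim0 hp hl hl1 s1 s2 hP
  have oi : ∀ v a b, a ≤ b → (∀ z, a < z → z < b → omega3 (-1) p z = v) → UU S b 1 - UU S a 1 = v * (b - a) := by
    intro v a b hab h
    rw [UU_x hM, mul_comm, ← smul_eq_mul, ← intervalIntegral.integral_const]
    refine intervalIntegral.integral_congr_ae ?_
    filter_upwards [ae_ne b, hω] with z hz h1 hz'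
    rw [uIoc_of_le hab] at hz'
    rw [h1, h z hz'.1 (hz'.2.lt_of_ne hz)]
  set W := UU S 0 1 with hW
  have o1 := oi 4 (-5) (-1) (by norm_num) fun z h1 h2 => by unfold omega3; split_ifs <;> linarith
  have o2 : ∀ a, -1 ≤ a → a ≤ 0 → UU S 0 1 - UU S a 1 = -4 * (0 - a) := fun a h h' => oi (-4) a 0 h' fun z h1 h2 => by
    unfold omega3; split_ifs <;> linarith
  have hW0 : W ≤ -12 + 4 * l := by
    have h1 := line_up hM (-9)
    rw [show (-9:ℝ) + 4 = -5 by norm_num, (F (-9)).1 (by norm_num)] at h1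
    linarith [o2 (-1) le_rfl (by norm_num)]
  have hZ : UU S (-(3 / 4)) 1 = W + 3 := by linarith [o2 (-(3 / 4)) (by norm_num) (by norm_num)]
  have st1 : ∀ t, 0 ≤ t → t ≤ 7 / 8 → W + 8 + σ - 8 * t ≤ UU S 0 t := by
    intro t h1 h2
    refine stage1 hM (T := 7 / 8) (by linarith) (fun y t h0 h1 => ?_) h1 h2
    obtain ⟨-, f2, f3, -⟩ := F y
    rcases le_total y 4 with h | h
    · have := f2 h
      have : 4 * |y| - 8 * t ≤ y ^ 2 / (2 * t) := by
        rw [le_div_iff₀ (by linarith), ← sq_abs]; nlinarith [sq_nonneg (|y| - 4 * t)]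
      linarith
    · have := f3 h
      have : 8 + σ - 8 * t + y ^ 2 / 2 ≤ y ^ 2 / (2 * t) := by
        rw [le_div_iff₀ (by linarith)]
        have h3 : 16 * (1 - t) ≤ y ^ 2 * (1 - t) := by gcongr <;> nlinarith
        nlinarith
      linarith
  obtain ⟨b, hb, hf⟩ := far hM one_pos (W + 3 + σ)
  have := LO hM (Kr_l S (-b)) one_pos (x0 := -(3 / 4)) (c := W + 3 + σ) (by linarith) (by norm_num) (fun y h1 h2 => by
    have := (F y).2.2.2 h2
    rw [sub_neg_eq_add, mul_one]; linarith) (fun s => hf (-b) _ s (by rw [abs_neg, abs_of_pos (by linarith)]) (by rw [abs_neg, abs_of_pos] <;> norm_num))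
    (fun s h1 h2 => by
      have e : 3 + σ - (0 - -(3 / 4)) ^ 2 / (2 * (1 - s)) ≤ 8 * (1 - s) + if s ≤ 7 / 8 then σ else 0 := by
        rw [sub_le_iff_le_add, ← sub_le_iff_le_add', le_div_iff₀ (by linarith)]
        split_ifs with h
        · nlinarith [sq_nonneg (16 * (1 - s) - 3)]
        · nlinarith [sq_nonneg (16 * (1 - s) - 3)]
      split_ifs at e with h
      · linarith [st1 s h1 h]
      · linarith [z_mono hM h1 h2.le])
  linarith
end

section
lemma dat_scale {c : ℝ} (hc : 0 < c) (L p x : ℝ) : udat1 (c * L) (c * p) (c * x) = c * udat1 L p x ∧ udat2 (c * L) (c * p) (c * x) = c * udat2 L p x ∧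
    omega3 (c * L) (c * p) (c * x) = c * omega3 L p x := by
  have h : ∀ a b, (c * a < c * b) = (a < b) := fun a b => by rw [mul_lt_mul_iff_right₀ hc]
  have h' : ∀ a b, (c * a ≤ c * b) = (a ≤ b) := fun a b => by rw [mul_le_mul_iff_right₀ hc]
  have h0 : (c * x < 0) = (x < 0) := by have := h x 0; rwa [mul_zero] at this
  have e : ∀ a, a * (c * L) = c * (a * L) := fun a => by ring
  have e2 : (c * (4 * L) - c * p) / 2 = c * ((4 * L - p) / 2) := by ring
  unfold udat1 udat2 omega3
  simp only [e, e2, ← mul_neg, h, h', h0]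
  refine ⟨?_, ?_, ?_⟩ <;> split_ifs <;> ring
lemma scl {c L p : ℝ} {u0 : ℝ → ℝ} (hc : 0 < c) (s : ABSol fq fq (4 * (c * L)) (-4 * (c * L)) u0) (hs : ∀ᵐ x, s.u x 1 = omega3 (c * L) (c * p) x) :
    ∃ s : ABSol fq fq (4 * L) (-4 * L) (fun x => u0 (c * x) / c), ∀ᵐ x, s.u x 1 = omega3 L p x := by
  have h : ∃ s : ABSol fq fq (4 * (c * L) / c) (-4 * (c * L) / c) (fun x => u0 (c * x) / c), ∀ᵐ x, s.u x 1 = omega3 L p x := by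
    refine ⟨scaleSol hc s, ?_⟩
    filter_upwards [scale_ae hc.ne' hs] with x hx
    show s.u (c * x) 1 / c = _
    rw [hx, (dat_scale hc L p x).2.2]; field_simp
  rwa [show 4 * (c * L) / c = 4 * L by field_simp, show -4 * (c * L) / c = -4 * L by field_simp] at h
lemma mem_of {L0 p : ℝ} (hL0 : L0 < 0) {u : ℝ → ℝ → ℝ → ℝ} {M : ℝ} (hu : ∀ c, 0 < c → ∀ L p x, u (c * L) (c * p) (c * x) = c * u L p x)
    (hm : Measurable (u (-1) (p / -L0))) (hb : ∀ x, |u (-1) (p / -L0) x| ≤ M) (s : ABSol fq fq (-4) 4 (u (-1) (p / -L0)))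
    (hs : ∀ᵐ x, s.u x 1 = omega3 (-1) (p / -L0) x) : u L0 p ∈ InitialSet 1 fq fq (4 * L0) (-4 * L0) (omega3 L0 p) := by
  have hne := hL0.ne
  have hc : 0 < (-L0)⁻¹ := by rw [inv_pos]; linarith
  have e1 : (-L0)⁻¹ * L0 = -1 := by field_simp
  have e2 : (-L0)⁻¹ * p = p / -L0 := by field_simp
  have e : u L0 p = fun x => u (-1) (p / -L0) ((-L0)⁻¹ * x) / (-L0)⁻¹ := by
    funext x
    rw [← e1, ← e2, hu _ hc]; field_simp
  have h : ∃ s : ABSol fq fq (4 * ((-L0)⁻¹ * L0)) (-4 * ((-L0)⁻¹ * L0)) (u (-1) (p / -L0)), ∀ᵐ x, s.u x 1 = omega3 ((-L0)⁻¹ * L0) ((-L0)⁻¹ * p) x := by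
    rw [e1, e2, show (4:ℝ) * -1 = -4 by norm_num, show (-4:ℝ) * -1 = 4 by norm_num]; exact ⟨s, hs⟩
  obtain ⟨s', hs'⟩ := h
  have h2 := scl hc s' hs'
  rw [← e] at h2
  refine ⟨⟨?_, M / (-L0)⁻¹, Eventually.of_forall fun x => ?_⟩, h2⟩
  · rw [e]; exact (hm.comp (measurable_const_mul _)).div_const _
  · rw [e, abs_div, abs_of_pos hc]; gcongr; exact hb _
end

theorem initial_set_not_convex_example
    (L0 p : ℝ) (hL0 : L0 < 0) (hp : p < 12 * L0) :
    Attainable 1 fq fq (4 * L0) (-4 * L0) (omega3 L0 p) ∧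
    udat1 L0 p ∈ InitialSet 1 fq fq (4 * L0) (-4 * L0) (omega3 L0 p) ∧
    udat2 L0 p ∈ InitialSet 1 fq fq (4 * L0) (-4 * L0) (omega3 L0 p) ∧
    (∀ lam : ℝ, lam ∈ Ioo (0:ℝ) 1 →
      (fun x => lam * udat1 L0 p x + (1 - lam) * udat2 L0 p x) ∉
        InitialSet 1 fq fq (4 * L0) (-4 * L0) (omega3 L0 p)) ∧
    ¬ Convex ℝ (InitialSet 1 fq fq (4 * L0) (-4 * L0) (omega3 L0 p)) := by
  have hne := hL0.ne
  have hl : 0 < -L0 := by linarith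
  have hp' : p / -L0 < -12 := by rw [div_lt_iff₀ hl]; linarith
  have m1 : udat1 L0 p ∈ InitialSet 1 fq fq (4 * L0) (-4 * L0) (omega3 L0 p) :=
    mem_of hL0 (fun c hc L p x => (dat_scale hc L p x).1) (U1_E hp').meas0 (U1_E hp').bdd0 (U1_E hp').sol (U1_end hp')
  have m2 : udat2 L0 p ∈ InitialSet 1 fq fq (4 * L0) (-4 * L0) (omega3 L0 p) :=
    mem_of hL0 (fun c hc L p x => (dat_scale hc L p x).2.1) (U2_E hp').meas0 (U2_E hp').bdd0 (U2_E hp').sol (U2_end hp')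
  have m3 : ∀ lam : ℝ, lam ∈ Ioo (0:ℝ) 1 →
      (fun x => lam * udat1 L0 p x + (1 - lam) * udat2 L0 p x) ∉
        InitialSet 1 fq fq (4 * L0) (-4 * L0) (omega3 L0 p) := by
    rintro l ⟨h0, h1⟩ ⟨-, h⟩
    have e1 : -L0 * (-1) = L0 := by ring
    have e2 : -L0 * (p / -L0) = p := by field_simp
    rw [← e1, ← e2] at h
    obtain ⟨s, hs⟩ := h
    have h3 := scl hl s hs
    have : (fun x => (l * udat1 (-L0 * (-1)) (-L0 * (p / -L0)) (-L0 * x) + (1 - l) * udat2 (-L0 * (-1)) (-L0 * (p / -L0)) (-L0 * x)) / -L0) =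
        fun x => l * udat1 (-1) (p / -L0) x + (1 - l) * udat2 (-1) (p / -L0) x := by
      funext x
      rw [(dat_scale hl _ _ x).1, (dat_scale hl _ _ x).2.1]; field_simp; ring
    rw [this, show (4:ℝ) * -1 = -4 by norm_num, show (-4:ℝ) * -1 = 4 by norm_num] at h3
    obtain ⟨s, hs⟩ := h3
    exact no_mix hp' h0 h1 s hs
  refine ⟨⟨_, m1⟩, m1, m2, m3, fun hc => m3 (1 / 2) ⟨by norm_num, by norm_num⟩ ?_⟩
  convert hc m1 m2 (a := 1 / 2) (b := 1 / 2) (by norm_num) (by norm_num) (by norm_num) using 1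
  funext x
  simp only [Pi.add_apply, Pi.smul_apply, smul_eq_mul]; norm_num
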